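/- Let n ≥ 2 be an integer, α ∈ (0,n), β > 0 and A > 0, and assume α > β. Then there exists a mass m_* = m_*(n,α,β,A) > 0 such that: if 0 < m < m_*, then the ball B[m] is an L¹-local minimizer at mass m of E_{α,β,A}; and if m > m_*, then B[m] is not an L¹-local minimizer at mass m of E_{α,β,A}. -/

import Mathlib

open MeasureTheory Metric Filter ENNReal

noncomputable section

/-- The Lebesgue density of `E` at `x` equals `d`. -/
def HasDensity {n : ℕ} (E : Set (EuclideanSpace ℝ (Fin n)))
    (x : EuclideanSpace ℝ (Fin n)) (d : ℝ) : Prop :=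
  Filter.Tendsto
    (fun r : ℝ => (volume (E ∩ Metric.ball x r)).toReal / (volume (Metric.ball x r)).toReal)
    (nhdsWithin 0 (Set.Ioi 0)) (nhds d)

/-- The essential boundary of `E`: points where `E` has neither density 0 nor density 1. -/
def essBoundary {n : ℕ} (E : Set (EuclideanSpace ℝ (Fin n))) :
    Set (EuclideanSpace ℝ (Fin n)) :=
  {x | ¬ HasDensity E x 0 ∧ ¬ HasDensity E x 1}

/-- The perimeter of `E`: the `(n-1)`-dimensional Hausdorff measure of the essential
boundary of `E`. -/
def perimeter {n : ℕ} (E : Set (EuclideanSpace ℝ (Fin n))) : ℝ≥0∞ :=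
  μH[(n : ℝ) - 1] (essBoundary E)

/-- The Riesz energy `V_α(E) = ∫_{E×E} |x-y|^(α-n) dx dy`. -/
def rieszEnergy {n : ℕ} (α : ℝ) (E : Set (EuclideanSpace ℝ (Fin n))) : ℝ≥0∞ :=
  ∫⁻ x in E, ∫⁻ y in E, ENNReal.ofReal (‖x - y‖ ^ (α - (n : ℝ)))

/-- The potential energy `U_{β,A}(E) = A ∫_E |x|^β dx`. -/
def potEnergy {n : ℕ} (β A : ℝ) (E : Set (EuclideanSpace ℝ (Fin n))) : ℝ≥0∞ :=
  ∫⁻ x in E, ENNReal.ofReal (A * ‖x‖ ^ β)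

/-- The total energy `E_{α,β,A} = P + V_α + U_{β,A}`. -/
def totalEnergy {n : ℕ} (α β A : ℝ) (E : Set (EuclideanSpace ℝ (Fin n))) : ℝ≥0∞ :=
  perimeter E + rieszEnergy α E + potEnergy β A E

/-- `E` is a minimizer of `E_{α,β,A}` at mass `m`. -/
def IsMinimizer {n : ℕ} (α β A m : ℝ) (E : Set (EuclideanSpace ℝ (Fin n))) : Prop :=
  MeasurableSet E ∧ volume E = ENNReal.ofReal m ∧
    ∀ F : Set (EuclideanSpace ℝ (Fin n)), MeasurableSet F → volume F = ENNReal.ofReal m →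
      totalEnergy α β A E ≤ totalEnergy α β A F

/-- The unit ball of `ℝⁿ` centered at the origin. -/
def unitBall (n : ℕ) : Set (EuclideanSpace ℝ (Fin n)) := Metric.ball 0 1

/-- `B[m]`: the open ball centered at `0` with volume `m`. -/
def ballOfVolume (n : ℕ) (m : ℝ) : Set (EuclideanSpace ℝ (Fin n)) :=
  Metric.ball 0 ((m / (volume (unitBall n)).toReal) ^ (1 / (n : ℝ)))

/-- `E` is an `L¹`-local minimizer of `E_{α,β,A}` at mass `m`: there is `ε > 0` such that
`E` minimizes the energy among sets of the same mass within symmetric difference `< ε`. -/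
def IsL1LocalMin {n : ℕ} (α β A m : ℝ) (E : Set (EuclideanSpace ℝ (Fin n))) : Prop :=
  MeasurableSet E ∧ volume E = ENNReal.ofReal m ∧
    ∃ ε : ℝ, 0 < ε ∧ ∀ F : Set (EuclideanSpace ℝ (Fin n)), MeasurableSet F →
      volume F = ENNReal.ofReal m → volume (symmDiff E F) < ENNReal.ofReal ε →
        totalEnergy α β A E ≤ totalEnergy α β A F

/-- Euclidean space of dimension `k`. -/
abbrev Eu (k : ℕ) := EuclideanSpace ℝ (Fin k)

/-- Normalizing constant of the Hausdorff measure. -/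
def hc (k : ℕ) : NNReal := Measure.addHaarScalarFactor (volume : Measure (Eu k)) μH[(k:ℝ)]

lemma hc_vol (k : ℕ) : (volume : Measure (Eu k)) = (hc k : ℝ≥0∞) • (μH[(k:ℝ)] : Measure (Eu k)) := by
  have := Measure.isAddLeftInvariant_eq_smul (volume : Measure (Eu k)) (μH[(k:ℝ)] : Measure (Eu k))
  rw [this]; rfl

lemma hc_pos (k : ℕ) : 0 < hc k := Measure.addHaarScalarFactor_pos_of_isAddHaarMeasure _ _

lemma hc_vol_apply (k : ℕ) (s : Set (Eu k)) : volume s = (hc k : ℝ≥0∞) * μH[(k:ℝ)] s := by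
  conv_lhs => rw [hc_vol k]
  simp

/-- Orthogonal splitting along a unit vector. -/
lemma exists_split {k : ℕ} (e : Eu (k+1)) (he : ‖e‖ = 1) :
    ∃ J : (Eu k × ℝ) ≃L[ℝ] Eu (k+1), MeasurePreserving J volume volume ∧
      (∀ p, ‖J p‖^2 = ‖p.1‖^2 + p.2^2) ∧ J (0, 1) = e := by
  have hd : Module.finrank ℝ (WithLp 2 (Eu k × ℝ)) = Module.finrank ℝ (Eu (k+1)) := by
    rw [(WithLp.linearEquiv 2 ℝ (Eu k × ℝ)).finrank_eq]; simp
  let b := (stdOrthonormalBasis ℝ (WithLp 2 (Eu k × ℝ))).reindex (finCongr (by rw [hd]; simp) : _ ≃ Fin (k+1))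
  let L := b.repr
  let u : WithLp 2 (Eu k × ℝ) := WithLp.toLp 2 (0, 1)
  have hu : ‖L u‖ = ‖e‖ := by
    rw [LinearIsometryEquiv.norm_map, he]
    simp [u]
  let L2 := L.trans (Submodule.reflection (Submodule.span ℝ {(L u - e)})ᗮ)
  refine ⟨(WithLp.prodContinuousLinearEquiv 2 ℝ (Eu k) ℝ).symm.trans L2.toContinuousLinearEquiv, ?_, ?_, ?_⟩
  · exact L2.measurePreserving.comp (WithLp.volume_preserving_toLp (Eu k) ℝ)
  · intro p
    have : ‖L2 (WithLp.toLp 2 p)‖ = ‖WithLp.toLp 2 p‖ := L2.norm_map _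
    change ‖L2 (WithLp.toLp 2 p)‖^2 = _
    rw [this, WithLp.prod_norm_sq_eq_of_L2]
    simp
  · change (Submodule.reflection (Submodule.span ℝ {(L u - e)})ᗮ) (L u) = e
    exact Submodule.reflection_sub hu

/-- The unit sphere. -/
abbrev Sp (k : ℕ) := sphere (0 : Eu (k+1)) 1

/-- Surface measure on the unit sphere. -/
abbrev sig (k : ℕ) : Measure (Sp k) := (volume : Measure (Eu (k+1))).toSphere

/-- Polar coordinates. -/
lemma lintegral_polar {k : ℕ} (g : Eu (k+1) → ℝ≥0∞) (hg : Measurable g) :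
    ∫⁻ x, g x = ∫⁻ θ : Sp k, (∫⁻ r in Set.Ioi (0:ℝ),
      ENNReal.ofReal (r^k) * g (r • (θ : Eu (k+1)))) ∂(sig k) := by
  have h1 : ∫⁻ x, g x = ∫⁻ x in ({0}ᶜ : Set (Eu (k+1))), g x := by
    rw [restrict_compl_singleton]
  have h2 := (Measure.measurePreserving_homeomorphUnitSphereProd
    (volume : Measure (Eu (k+1))))
  rw [h1, ← lintegral_subtype_comap (measurableSet_singleton _).compl]
  have h3 := h2.symm (homeomorphUnitSphereProd (Eu (k+1))).toMeasurableEquiv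
  have h4 := h3.lintegral_comp_emb (MeasurableEquiv.measurableEmbedding _)
    (fun x : ({0}ᶜ : Set (Eu (k+1))) => g x)
  rw [← h4]
  have hd : Module.finrank ℝ (Eu (k+1)) - 1 = k := by simp
  rw [hd]
  have hm : Measurable (fun p : Sp k × Set.Ioi (0:ℝ) => g ((p.2:ℝ) • (p.1 : Eu (k+1)))) := by
    apply hg.comp; fun_prop
  have h5 : ∀ p : Sp k × Set.Ioi (0:ℝ),
    g ((homeomorphUnitSphereProd (Eu (k+1))).toMeasurableEquiv.symm p : ({0}ᶜ : Set (Eu (k+1))))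
      = g ((p.2:ℝ) • (p.1 : Eu (k+1))) := fun p => rfl
  simp_rw [h5]
  rw [lintegral_prod _ hm.aemeasurable]
  refine lintegral_congr fun θ => ?_
  rw [Measure.volumeIoiPow]
  have h6 : Measurable (fun y : Set.Ioi (0:ℝ) => g ((y:ℝ) • (θ : Eu (k+1)))) :=
    hm.comp measurable_prodMk_left
  refine (lintegral_withDensity_eq_lintegral_mul _ (by fun_prop) h6).trans ?_
  rw [← lintegral_subtype_comap measurableSet_Ioi]
  rfl

lemma sig_univ (k : ℕ) : sig k Set.univ = ((k+1 : ℕ) : ℝ≥0∞) * volume (ball (0 : Eu (k+1)) 1) := by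
  rw [Measure.toSphere_apply_univ]; simp

/-- volume of the unit ball, as a real number -/
def om (k : ℕ) : ℝ := (volume (ball (0 : Eu k) 1)).toReal

lemma om_pos (k : ℕ) : 0 < om k :=
  ENNReal.toReal_pos (measure_ball_pos _ _ one_pos).ne' measure_ball_lt_top.ne

lemma vol_unit (k : ℕ) : volume (ball (0 : Eu k) 1) = ENNReal.ofReal (om k) :=
  (ENNReal.ofReal_toReal measure_ball_lt_top.ne).symm

lemma vol_ball (k : ℕ) (x : Eu k) {r : ℝ} (hr : 0 < r) :
    volume (ball x r) = ENNReal.ofReal (om k * r^k) := by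
  rw [Measure.addHaar_ball_of_pos _ x hr, vol_unit, ← ENNReal.ofReal_mul (by positivity)]
  simp [mul_comm]

lemma vol_closedBall (k : ℕ) (x : Eu k) {r : ℝ} (hr : 0 < r) :
    volume (closedBall x r) = ENNReal.ofReal (om k * r^k) := by
  rw [Measure.addHaar_closedBall _ x hr.le, vol_unit, ← ENNReal.ofReal_mul (by positivity)]
  simp [mul_comm]

lemma hasDensity_compl {n : ℕ} {F : Set (Eu n)} (hF : MeasurableSet F) (x : Eu n) (d : ℝ) :
    HasDensity Fᶜ x d ↔ HasDensity F x (1 - d) := by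
  have key : ∀ r : ℝ, 0 < r →
    (volume (Fᶜ ∩ ball x r)).toReal / (volume (ball x r)).toReal
      = 1 - (volume (F ∩ ball x r)).toReal / (volume (ball x r)).toReal := by
    intro r hr
    have h1 : (volume (ball x r)).toReal = (volume (F ∩ ball x r)).toReal
        + (volume (Fᶜ ∩ ball x r)).toReal := by
      rw [← ENNReal.toReal_add]
      · congr 1
        rw [Set.inter_comm F, Set.inter_comm Fᶜ, ← measure_inter_add_sdiff (ball x r) hF]; rfl
      · exact (measure_mono_top Set.inter_subset_right).mt measure_ball_lt_top.ne
      · exact (measure_mono_top Set.inter_subset_right).mt measure_ball_lt_top.ne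
    have h2 : 0 < (volume (ball x r)).toReal :=
      ENNReal.toReal_pos (measure_ball_pos _ _ hr).ne' measure_ball_lt_top.ne
    rw [eq_sub_iff_add_eq, ← add_div, add_comm, ← h1, div_self h2.ne']
  unfold HasDensity
  rw [tendsto_congr' (f₁ := fun r : ℝ => (volume (Fᶜ ∩ ball x r)).toReal / (volume (ball x r)).toReal)
    (f₂ := fun r => 1 - (volume (F ∩ ball x r)).toReal / (volume (ball x r)).toReal)
    (by filter_upwards [self_mem_nhdsWithin] with r hr using key r hr)]
  constructor
  · intro h
    have := (tendsto_const_nhds (x := (1:ℝ))).sub h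
    simpa using this
  · intro h
    have := (tendsto_const_nhds (x := (1:ℝ))).sub h
    simpa using this

lemma essBoundary_compl {n : ℕ} {F : Set (Eu n)} (hF : MeasurableSet F) :
    essBoundary Fᶜ = essBoundary F := by
  ext x
  simp only [essBoundary, Set.mem_ofPred_eq, hasDensity_compl hF]
  norm_num
  tauto

lemma ae_density {k : ℕ} {F : Set (Eu (k+1))} (hF : MeasurableSet F) :
    ∀ᵐ x, (x ∈ F → HasDensity F x 1) ∧ (x ∉ F → HasDensity F x 0) := by
  filter_upwards [Besicovitch.ae_tendsto_measure_inter_div_of_measurableSet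
    (volume : Measure (Eu (k+1))) hF] with x hx
  have key : Tendsto (fun r => (volume (F ∩ ball x r)).toReal / (volume (ball x r)).toReal)
      (nhdsWithin 0 (Set.Ioi 0)) (nhds ((F.indicator 1 x : ℝ≥0∞).toReal)) := by
    have := (ENNReal.tendsto_toReal (a := (F.indicator 1 x : ℝ≥0∞)) (by
      by_cases h : x ∈ F <;> simp [h])).comp hx
    refine this.congr fun r => ?_
    simp only [Function.comp_apply, ENNReal.toReal_div]
    have h1 : (ball x r : Set (Eu (k+1))) =ᵐ[volume] closedBall x r := by
      refine ae_eq_of_subset_of_measure_ge ball_subset_closedBall ?_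
        measurableSet_ball.nullMeasurableSet measure_closedBall_lt_top.ne
      rw [Measure.addHaar_closedBall_eq_addHaar_ball]
    rw [measure_congr h1, measure_congr ((ae_eq_refl F).inter h1)]
  constructor
  · intro h; simpa [h, HasDensity] using key
  · intro h; simpa [h, HasDensity] using key

/-- Quantitative density sets. -/
def Gs {k : ℕ} (c : ℝ) (F : Set (Eu (k+1))) (j : ℕ) : Set (Eu (k+1)) :=
  {x | ∀ r : ℝ, 0 < r → r < 1/((j:ℝ)+1) → volume (ball x r \ F) ≤ ENNReal.ofReal (c * r^(k+1))}

lemma isClosed_Gs {k : ℕ} (c : ℝ) (F : Set (Eu (k+1))) (j : ℕ) : IsClosed (Gs c F j) := by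
  refine isClosed_of_closure_subset fun x hx => ?_
  intro r hr hrj
  have h1 : Tendsto (fun s : ℝ => ENNReal.ofReal (c * s^(k+1))) (nhdsWithin r (Set.Ioi r))
      (nhds (ENNReal.ofReal (c * r^(k+1)))) := by
    apply ENNReal.tendsto_ofReal
    have : Continuous (fun s : ℝ => c * s^(k+1)) := by fun_prop
    exact (this.tendsto r).mono_left nhdsWithin_le_nhds
  refine ge_of_tendsto h1 ?_
  filter_upwards [Ioo_mem_nhdsGT hrj] with s hs
  obtain ⟨y, hy, hxy⟩ := Metric.mem_closure_iff.1 hx (s - r) (by linarith [hs.1])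
  refine (measure_mono ?_).trans (hy s (by linarith [hs.1]) hs.2)
  refine Set.sdiff_subset_sdiff_left ?_
  intro z hz
  rw [mem_ball] at *
  linarith [dist_triangle z x y]

lemma density_one_mem_Gs {k : ℕ} {c : ℝ} (hc : 0 < c) {F : Set (Eu (k+1))} (hF : MeasurableSet F)
    {x : Eu (k+1)} (hx : HasDensity F x 1) : ∃ j, x ∈ Gs c F j := by
  have h0 : HasDensity Fᶜ x 0 := by rw [hasDensity_compl hF]; simpa using hx
  have h1 : ∀ᶠ r in nhdsWithin (0:ℝ) (Set.Ioi 0),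
      (volume (Fᶜ ∩ ball x r)).toReal / (volume (ball x r)).toReal < c / om (k+1) :=
    h0.eventually_lt_const (by have := om_pos (k+1); positivity)
  rw [eventually_nhdsWithin_iff, Metric.eventually_nhds_iff] at h1
  obtain ⟨ε, hε, h1⟩ := h1
  obtain ⟨j, hj⟩ := exists_nat_one_div_lt hε
  refine ⟨j, fun r hr hrj => ?_⟩
  have h2 := h1 (y := r) (by simp [abs_of_pos hr]; linarith [hj, hrj]) hr
  have hv : (volume (ball x r)).toReal = om (k+1) * r^(k+1) := by
    rw [vol_ball _ _ hr, ENNReal.toReal_ofReal (by have := om_pos (k+1); positivity)]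
  have ho := om_pos (k+1)
  rw [hv, div_lt_div_iff₀ (by positivity) ho] at h2
  have h3 : (volume (Fᶜ ∩ ball x r)).toReal ≤ c * r^(k+1) := by
    by_contra h
    push Not at h
    nlinarith
  have h4 : ball x r \ F = Fᶜ ∩ ball x r := by rw [Set.inter_comm]; rfl
  rw [h4]
  exact (ENNReal.le_ofReal_iff_toReal_le
    ((measure_mono_top Set.inter_subset_right).mt measure_ball_lt_top.ne) (by positivity)).2 h3

lemma Gs_not_density_zero {k : ℕ} {c : ℝ} (hc : 0 < c) (hc2 : c < om (k+1)) {F : Set (Eu (k+1))}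
    (hF : MeasurableSet F)
    {x : Eu (k+1)} {j : ℕ} (hx : x ∈ Gs c F j) : ¬ HasDensity F x 0 := by
  intro h
  have h0 : HasDensity Fᶜ x 1 := by rw [hasDensity_compl hF]; simpa using h
  have ho := om_pos (k+1)
  have h1 : ∀ᶠ r in nhdsWithin (0:ℝ) (Set.Ioi 0), c / om (k+1) <
      (volume (Fᶜ ∩ ball x r)).toReal / (volume (ball x r)).toReal :=
    h0.eventually_const_lt (by rwa [div_lt_one ho])
  obtain ⟨r, h1, hr⟩ := (h1.and (Ioo_mem_nhdsGT (show (0:ℝ) < 1/((j:ℝ)+1) by positivity))).exists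
  have h2 := hx r hr.1 hr.2
  have hv : (volume (ball x r)).toReal = om (k+1) * r^(k+1) := by
    rw [vol_ball _ _ hr.1, ENNReal.toReal_ofReal (by have := hr.1; positivity)]
  have h4 : ball x r \ F = Fᶜ ∩ ball x r := by rw [Set.inter_comm]; rfl
  have hr1 := hr.1
  rw [h4] at h2
  have h3 := ENNReal.toReal_le_of_le_ofReal (by positivity) h2
  rw [hv, div_lt_div_iff₀ ho (by positivity)] at h1
  nlinarith

lemma null_lemma {k : ℕ} (J : (Eu k × ℝ) ≃L[ℝ] Eu (k+1)) (hJ : MeasurePreserving J volume volume)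
    (hn : ∀ p, ‖J p‖^2 = ‖p.1‖^2 + p.2^2)
    {c : ℝ} (hc : 0 < c) (hc2 : c * 5^(k+1) < om k / 2) {F : Set (Eu (k+1))} (hF : MeasurableSet F)
    (j : ℕ) {δ : ℝ} (hδ : 0 < δ) :
    volume {y : Eu k | ∃ t, J (y,t) ∈ Gs c F j ∧ ∀ s, 0 < s → s < δ → HasDensity F (J (y,t+s)) 0} = 0 := by
  set τ := δ/2 with hτ
  have hτ0 : 0 < τ := by positivity
  let N : ℤ → Set (Eu k) := fun m => {y : Eu k | ∃ t, (m * τ ≤ t ∧ t < (m+1) * τ) ∧ J (y,t) ∈ Gs c F j ∧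
    ∀ s, 0 < s → s < δ → HasDensity F (J (y,t+s)) 0}
  refine measure_mono_null (t := ⋃ m, N m) ?_ (measure_iUnion_null fun m => ?_)
  · rintro y ⟨t, h1, h2⟩
    refine Set.mem_iUnion.2 ⟨⌊t/τ⌋, t, ⟨?_, ?_⟩, h1, h2⟩
    · have := Int.floor_le (t/τ); rwa [le_div_iff₀ hτ0] at this
    · have := Int.lt_floor_add_one (t/τ); rwa [div_lt_iff₀ hτ0] at this
  · by_contra hne
    have h1 := Besicovitch.ae_tendsto_measure_inter_div (volume : Measure (Eu k)) (N m)
    have hne' : (volume.restrict (N m)) ≠ 0 := by simpa [Measure.restrict_eq_zero] using hne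
    have : (ae (volume.restrict (N m))).NeBot := ae_neBot.2 hne'
    obtain ⟨b, hb⟩ := h1.exists
    have hb2 := hb.eventually_const_lt (show (2⁻¹ : ℝ≥0∞) < 1 by simp)
    have hj : (0:ℝ) < 1/((j:ℝ)+1) := by positivity
    obtain ⟨r, hr, hr0⟩ := (hb2.and (Ioo_mem_nhdsGT (show (0:ℝ) < min (δ/4) (1/((j:ℝ)+1)/5) by positivity))).exists
    have hr1 : 0 < r := hr0.1
    have hr2 : r < δ/4 := hr0.2.trans_le (min_le_left _ _)
    have hr3 : 5 * r < 1/((j:ℝ)+1) := by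
      have := hr0.2.trans_le (min_le_right _ _); linarith
    have hom := om_pos k
    have hQ : ENNReal.ofReal (om k * r^k / 2) < volume (N m ∩ closedBall b r) := by
      rw [vol_closedBall _ _ hr1] at hr
      have h := ENNReal.mul_lt_of_lt_div hr
      refine lt_of_eq_of_lt ?_ h
      rw [div_eq_mul_inv, mul_comm, ENNReal.ofReal_mul (by positivity)]
      congr 1
      rw [ENNReal.ofReal_inv_of_pos (by norm_num)]; simp
    set Q := N m ∩ closedBall b r with hQdef
    let T : Set ℝ := {t | (m * τ ≤ t ∧ t < (m+1) * τ) ∧ ∃ y ∈ closedBall b r, J (y,t) ∈ Gs c F j ∧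
      ∀ s, 0 < s → s < δ → HasDensity F (J (y,t+s)) 0}
    have hTne : T.Nonempty := by
      have : Q.Nonempty := by
        rw [Set.nonempty_iff_ne_empty]; intro h; rw [h] at hQ; simp at hQ
      obtain ⟨y, ⟨t, ht, h1, h2⟩, hyb⟩ := this
      exact ⟨t, ht, y, hyb, h1, h2⟩
    have hTb : BddAbove T := ⟨(m+1)*τ, fun t ht => ht.1.2.le⟩
    obtain ⟨t0, ht0, hlt⟩ := exists_lt_of_lt_csSup hTne (show sSup T - r < sSup T by linarith)
    obtain ⟨⟨ht01, ht02⟩, y0, hy0, hG, -⟩ := ht0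
    have hnull : volume ({x | HasDensity F x 0} ∩ F) = 0 := by
      have h := ae_density hF
      rw [ae_iff] at h
      refine measure_mono_null ?_ h
      rintro x ⟨hx0, hxF⟩ hcon
      exact one_ne_zero (tendsto_nhds_unique (hcon.1 hxF) hx0)
    have hsub : J '' (Q ×ˢ Set.Ioo (t0+r) (t0+2*r)) ⊆ (ball (J (y0,t0)) (5*r) \ F) ∪ ({x | HasDensity F x 0} ∩ F) := by
      rintro _ ⟨⟨y, s⟩, ⟨⟨⟨t, ht, h1, h2⟩, hyb⟩, hs⟩, rfl⟩
      have htT : t ≤ sSup T := le_csSup hTb ⟨ht, y, hyb, h1, h2⟩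
      have hs1 := hs.1
      have hs2 := hs.2
      simp only at hs1 hs2 hyb
      have h0 : HasDensity F (J (y,s)) 0 := by
        have := h2 (s - t) (by linarith) (by
          have : (m+1) * τ = m * τ + τ := by ring
          linarith [ht.1])
        simpa using this
      have hball : J (y,s) ∈ ball (J (y0,t0)) (5*r) := by
        rw [mem_ball, dist_eq_norm, ← map_sub]
        refine abs_lt_of_sq_lt_sq' ?_ (by positivity) |>.2
        rw [hn]
        simp only [Prod.mk_sub_mk]
        have e1 : ‖y - y0‖ ≤ 2 * r := by
          rw [← dist_eq_norm]
          have := dist_triangle_right y y0 b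
          rw [mem_closedBall] at hyb hy0; linarith
        have e2 : ‖y - y0‖^2 ≤ (2*r)^2 := by gcongr
        nlinarith
      by_cases hxF : J (y,s) ∈ F
      · exact Or.inr ⟨h0, hxF⟩
      · exact Or.inl ⟨hball, hxF⟩
    have hm1 := (measure_mono hsub).trans (measure_union_le (μ := volume) _ _)
    rw [hnull, add_zero] at hm1
    have hm2 := hm1.trans (hG (5*r) (by positivity) hr3)
    have himg : volume (J '' (Q ×ˢ Set.Ioo (t0+r) (t0+2*r))) = volume Q * ENNReal.ofReal r := by
      have : J '' (Q ×ˢ Set.Ioo (t0+r) (t0+2*r)) = J.symm ⁻¹' (Q ×ˢ Set.Ioo (t0+r) (t0+2*r)) := by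
        ext x; constructor
        · rintro ⟨p, hp, rfl⟩; simpa using hp
        · intro h; exact ⟨J.symm x, h, by simp⟩
      have hJs : MeasurePreserving J.symm volume volume :=
        hJ.symm J.toHomeomorph.toMeasurableEquiv
      rw [this, hJs.measure_preimage_emb J.symm.toHomeomorph.measurableEmbedding,
        Measure.volume_eq_prod, Measure.prod_prod, Real.volume_Ioo]
      congr 2; ring
    rw [himg] at hm2
    have hm3 : ENNReal.ofReal (om k * r^k / 2) * ENNReal.ofReal r ≤ ENNReal.ofReal (c * (5*r)^(k+1)) :=
      le_trans (by gcongr) hm2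
    rw [← ENNReal.ofReal_mul (by positivity), ENNReal.ofReal_le_ofReal_iff (by positivity)] at hm3
    have : c * (5*r)^(k+1) < om k * r^k/2 * r := by
      have e : c * (5*r)^(k+1) = (c * 5^(k+1)) * (r^k * r) := by rw [mul_pow, pow_succ r]; ring
      rw [e]
      have : om k * r^k/2 * r = om k / 2 * (r^k * r) := by ring
      rw [this]
      gcongr
    linarith

/-- auxiliary one-sided step for the Baire argument -/
lemma baire_step {a b : ℝ} {A0 A1 : Set ℝ} (hcov : Set.Icc a b ⊆ A0 ∪ A1)
    {C : Set ℝ} (hdis : ∀ t ∈ C, t ∉ A0) {Z U : Set ℝ} (hU : IsOpen U)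
    (hZ : Z = closure (A1 ∩ Set.Icc a b) ∩ closure (A0 ∩ Set.Icc a b))
    (hUc : U.OrdConnected)
    (hne : (Z ∩ U).Nonempty) (hZC : Z ∩ U ⊆ C) :
    ∃ p ∈ C, ∃ δ > 0, (∀ s, 0 < s → s < δ → p + s ∈ A0) ∨ (∀ s, 0 < s → s < δ → p - s ∈ A0) := by
  obtain ⟨p, hpZ, hpU⟩ := hne
  have hp0 : p ∈ closure (A0 ∩ Set.Icc a b) := by rw [hZ] at hpZ; exact hpZ.2
  have hp1 : p ∈ closure (A1 ∩ Set.Icc a b) := by rw [hZ] at hpZ; exact hpZ.1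
  obtain ⟨q, hqU, hqA, hqI⟩ := mem_closure_iff.1 hp0 U hU hpU
  have hq1 : q ∉ closure (A1 ∩ Set.Icc a b) := by
    intro h
    have : q ∈ Z := by rw [hZ]; exact ⟨h, subset_closure ⟨hqA, hqI⟩⟩
    exact hdis q (hZC ⟨this, hqU⟩) hqA
  have hcl : closure (A1 ∩ Set.Icc a b) ⊆ Set.Icc a b :=
    closure_minimal Set.inter_subset_right isClosed_Icc
  have hpI := hcl hp1
  set K := closure (A1 ∩ Set.Icc a b) with hK
  have hKc : IsClosed K := isClosed_closure
  have hA0 : ∀ t ∈ Set.Icc a b, t ∉ K → t ∈ A0 := by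
    intro t ht htK
    rcases hcov ht with h | h
    · exact h
    · exact absurd (subset_closure (show t ∈ A1 ∩ Set.Icc a b from ⟨h, ht⟩)) htK
  rcases lt_trichotomy p q with hpq | hpq | hpq
  · -- rightmost point of K in [p,q]
    have hcomp : IsCompact (K ∩ Set.Icc p q) := isCompact_Icc.inter_left hKc
    have hne : (K ∩ Set.Icc p q).Nonempty := ⟨p, hp1, le_rfl, hpq.le⟩
    obtain ⟨p', ⟨hp'K, hp'1, hp'2⟩, hmax⟩ := hcomp.exists_isGreatest hne
    have hp'q : p' < q := lt_of_le_of_ne hp'2 (fun h => hq1 (h ▸ hp'K))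
    have hA : ∀ s, p' < s → s ≤ q → s ∈ A0 := by
      intro s hs1 hs2
      refine hA0 s ⟨hpI.1.trans (hp'1.trans hs1.le), hs2.trans hqI.2⟩ fun hsK => ?_
      exact absurd (hmax ⟨hsK, hp'1.trans hs1.le, hs2⟩) (not_le.2 hs1)
    have hp'Z : p' ∈ Z := by
      rw [hZ]; refine ⟨hp'K, ?_⟩
      have : p' ∈ closure (Set.Ioo p' q) := by rw [closure_Ioo hp'q.ne]; exact ⟨le_rfl, hp'q.le⟩
      refine closure_mono ?_ this
      intro s hs
      exact ⟨hA s hs.1 hs.2.le, hpI.1.trans (hp'1.trans hs.1.le), hs.2.le.trans hqI.2⟩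
    refine ⟨p', hZC ⟨hp'Z, hUc.out hpU hqU ⟨hp'1, hp'2⟩⟩, q - p', by linarith, Or.inl ?_⟩
    intro s hs1 hs2
    exact hA _ (by linarith) (by linarith)
  · exact absurd (hpq ▸ hp1) hq1
  · have hcomp : IsCompact (K ∩ Set.Icc q p) := isCompact_Icc.inter_left hKc
    have hne : (K ∩ Set.Icc q p).Nonempty := ⟨p, hp1, hpq.le, le_rfl⟩
    obtain ⟨p', ⟨hp'K, hp'1, hp'2⟩, hmin⟩ := hcomp.exists_isLeast hne
    have hp'q : q < p' := lt_of_le_of_ne hp'1 (fun h => hq1 (h ▸ hp'K))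
    have hA : ∀ s, s < p' → q ≤ s → s ∈ A0 := by
      intro s hs1 hs2
      refine hA0 s ⟨hqI.1.trans hs2, hs1.le.trans (hp'2.trans hpI.2)⟩ fun hsK => ?_
      exact absurd (hmin ⟨hsK, hs2, hs1.le.trans hp'2⟩) (not_le.2 hs1)
    have hp'Z : p' ∈ Z := by
      rw [hZ]; refine ⟨hp'K, ?_⟩
      have : p' ∈ closure (Set.Ioo q p') := by rw [closure_Ioo hp'q.ne]; exact ⟨hp'q.le, le_rfl⟩
      refine closure_mono ?_ this
      intro s hs
      exact ⟨hA s hs.2 hs.1.le, hqI.1.trans hs.1.le, hs.2.le.trans (hp'2.trans hpI.2)⟩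
    refine ⟨p', hZC ⟨hp'Z, hUc.out hqU hpU ⟨hp'1, hp'2⟩⟩, p' - q, by linarith, Or.inr ?_⟩
    intro s hs1 hs2
    exact hA _ (by linarith) (by linarith)

lemma baire_line {a b : ℝ} {A0 A1 : Set ℝ} (hcov : Set.Icc a b ⊆ A0 ∪ A1)
    {C0 C1 : ℕ → Set ℝ} (hc0 : ∀ j, IsClosed (C0 j)) (hc1 : ∀ j, IsClosed (C1 j))
    (h0 : ∀ t ∈ A0, ∃ j, t ∈ C0 j) (h1 : ∀ t ∈ A1, ∃ j, t ∈ C1 j)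
    (hd0 : ∀ j, ∀ t ∈ C0 j, t ∉ A1) (hd1 : ∀ j, ∀ t ∈ C1 j, t ∉ A0)
    (hn0 : (A0 ∩ Set.Icc a b).Nonempty) (hn1 : (A1 ∩ Set.Icc a b).Nonempty) :
    ∃ j p δ, 0 < δ ∧ ((p ∈ C1 j ∧ ((∀ s, 0 < s → s < δ → p + s ∈ A0) ∨ (∀ s, 0 < s → s < δ → p - s ∈ A0)))
      ∨ (p ∈ C0 j ∧ ((∀ s, 0 < s → s < δ → p + s ∈ A1) ∨ (∀ s, 0 < s → s < δ → p - s ∈ A1)))) := by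
  set Z := closure (A1 ∩ Set.Icc a b) ∩ closure (A0 ∩ Set.Icc a b) with hZ
  have hZI : Z ⊆ Set.Icc a b := fun t ht =>
    closure_minimal Set.inter_subset_right isClosed_Icc ht.1
  have hZc : IsClosed Z := isClosed_closure.inter isClosed_closure
  have hZne : Z.Nonempty := by
    have hpre : IsPreconnected (Set.Icc a b) := isPreconnected_Icc
    have := (isPreconnected_closed_iff.1 hpre) (closure (A1 ∩ Set.Icc a b)) (closure (A0 ∩ Set.Icc a b))
      isClosed_closure isClosed_closure
      (by intro t ht
          rcases hcov ht with h | h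
          · exact Or.inr (subset_closure ⟨h, ht⟩)
          · exact Or.inl (subset_closure ⟨h, ht⟩))
      (by obtain ⟨t, ht⟩ := hn1; exact ⟨t, ht.2, subset_closure ht⟩)
      (by obtain ⟨t, ht⟩ := hn0; exact ⟨t, ht.2, subset_closure ht⟩)
    obtain ⟨t, -, ht⟩ := this
    exact ⟨t, ht⟩
  have : Nonempty Z := hZne.to_subtype
  have : CompleteSpace Z := hZc.completeSpace_coe
  let f : ℕ ⊕ ℕ → Set Z := fun i => Sum.elim (fun j => Subtype.val ⁻¹' (C0 j)) (fun j => Subtype.val ⁻¹' (C1 j)) i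
  obtain ⟨i, hi⟩ := nonempty_interior_of_iUnion_of_closed (f := f)
    (by rintro (j | j)
        · exact (hc0 j).preimage continuous_subtype_val
        · exact (hc1 j).preimage continuous_subtype_val)
    (by
      rw [Set.eq_univ_iff_forall]
      rintro ⟨t, ht⟩
      rcases hcov (hZI ht) with h | h
      · obtain ⟨j, hj⟩ := h0 t h
        exact Set.mem_iUnion.2 ⟨Sum.inl j, hj⟩
      · obtain ⟨j, hj⟩ := h1 t h
        exact Set.mem_iUnion.2 ⟨Sum.inr j, hj⟩)
  obtain ⟨⟨p, hpZ⟩, hp⟩ := hi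
  rw [mem_interior_iff_mem_nhds, Metric.mem_nhds_iff] at hp
  obtain ⟨ε, hε, hball⟩ := hp
  have hUc : (ball p ε).OrdConnected := by rw [Real.ball_eq_Ioo]; exact Set.ordConnected_Ioo
  have hne : (Z ∩ ball p ε).Nonempty := ⟨p, hpZ, mem_ball_self hε⟩
  rcases i with j | j
  · have hsub : Z ∩ ball p ε ⊆ C0 j := fun t ht => hball (show (⟨t, ht.1⟩ : Z) ∈ ball _ ε from ht.2)
    obtain ⟨q, hq, δ, hδ, h⟩ := baire_step (A0 := A1) (A1 := A0) (Set.union_comm A0 A1 ▸ hcov) (hd0 j)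
      (Z := Z) isOpen_ball (by rw [hZ, Set.inter_comm]) hUc hne hsub
    exact ⟨j, q, δ, hδ, Or.inr ⟨hq, h⟩⟩
  · have hsub : Z ∩ ball p ε ⊆ C1 j := fun t ht => hball (show (⟨t, ht.1⟩ : Z) ∈ ball _ ε from ht.2)
    obtain ⟨q, hq, δ, hδ, h⟩ := baire_step hcov (hd1 j) isOpen_ball hZ hUc hne hsub
    exact ⟨j, q, δ, hδ, Or.inl ⟨hq, h⟩⟩

lemma flip_split {k : ℕ} (J : (Eu k × ℝ) ≃L[ℝ] Eu (k+1)) (hJ : MeasurePreserving J volume volume)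
    (hn : ∀ p, ‖J p‖^2 = ‖p.1‖^2 + p.2^2) :
    ∃ J' : (Eu k × ℝ) ≃L[ℝ] Eu (k+1), MeasurePreserving J' volume volume ∧
      (∀ p, ‖J' p‖^2 = ‖p.1‖^2 + p.2^2) ∧ ∀ y t, J' (y,t) = J (y,-t) := by
  refine ⟨((ContinuousLinearEquiv.refl ℝ (Eu k)).prodCongr (ContinuousLinearEquiv.neg ℝ)).trans J, ?_, ?_, ?_⟩
  · refine hJ.comp ?_
    exact (MeasurePreserving.id (volume : Measure (Eu k))).prod (Measure.measurePreserving_neg (volume : Measure ℝ))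
  · intro p;
    change ‖J (p.1, -p.2)‖^2 = _
    rw [hn]; simp
  · intro y t; rfl

lemma line_lemma {k : ℕ} (J : (Eu k × ℝ) ≃L[ℝ] Eu (k+1)) (hJ : MeasurePreserving J volume volume)
    (hn : ∀ p, ‖J p‖^2 = ‖p.1‖^2 + p.2^2) {F : Set (Eu (k+1))} (hF : MeasurableSet F) :
    ∀ᵐ y : Eu k, ∀ a b, HasDensity F (J (y,a)) 1 → HasDensity F (J (y,b)) 0 →
      ∃ t ∈ Set.uIcc a b, J (y,t) ∈ essBoundary F := by
  obtain ⟨J', hJ', hn', hJJ⟩ := flip_split J hJ hn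
  obtain ⟨c, hc0, hc1, hc2⟩ : ∃ c : ℝ, 0 < c ∧ c * 5^(k+1) < om k/2 ∧ c < om (k+1) := by
    have h1 := om_pos k
    have h2 := om_pos (k+1)
    refine ⟨min (om k / 4 / 5^(k+1)) (om (k+1)/2), by positivity, ?_, ?_⟩
    · calc _ ≤ om k / 4 / 5^(k+1) * 5^(k+1) := by gcongr; exact min_le_left _ _
        _ = om k / 4 := by field_simp
        _ < _ := by linarith
    · exact (min_le_right _ _).trans_lt (by linarith)
  have hFc := hF.compl
  have e1 : ∀ᵐ y : Eu k, ∀ j i : ℕ, ¬ ∃ t, J (y,t) ∈ Gs c F j ∧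
      ∀ s, 0 < s → s < 1/((i:ℝ)+1) → HasDensity F (J (y,t+s)) 0 := by
    rw [ae_all_iff]; intro j; rw [ae_all_iff]; intro i
    rw [ae_iff]; simp only [not_not]
    exact null_lemma J hJ hn hc0 hc1 hF j (by positivity)
  have e2 : ∀ᵐ y : Eu k, ∀ j i : ℕ, ¬ ∃ t, J (y,t) ∈ Gs c Fᶜ j ∧
      ∀ s, 0 < s → s < 1/((i:ℝ)+1) → HasDensity Fᶜ (J (y,t+s)) 0 := by
    rw [ae_all_iff]; intro j; rw [ae_all_iff]; intro i
    rw [ae_iff]; simp only [not_not]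
    exact null_lemma J hJ hn hc0 hc1 hFc j (by positivity)
  have e3 : ∀ᵐ y : Eu k, ∀ j i : ℕ, ¬ ∃ t, J' (y,t) ∈ Gs c F j ∧
      ∀ s, 0 < s → s < 1/((i:ℝ)+1) → HasDensity F (J' (y,t+s)) 0 := by
    rw [ae_all_iff]; intro j; rw [ae_all_iff]; intro i
    rw [ae_iff]; simp only [not_not]
    exact null_lemma J' hJ' hn' hc0 hc1 hF j (by positivity)
  have e4 : ∀ᵐ y : Eu k, ∀ j i : ℕ, ¬ ∃ t, J' (y,t) ∈ Gs c Fᶜ j ∧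
      ∀ s, 0 < s → s < 1/((i:ℝ)+1) → HasDensity Fᶜ (J' (y,t+s)) 0 := by
    rw [ae_all_iff]; intro j; rw [ae_all_iff]; intro i
    rw [ae_iff]; simp only [not_not]
    exact null_lemma J' hJ' hn' hc0 hc1 hFc j (by positivity)
  filter_upwards [e1, e2, e3, e4] with y e1 e2 e3 e4
  intro a b ha hb
  by_contra hcon
  push Not at hcon
  have hcy : Continuous fun t : ℝ => J (y,t) := by fun_prop
  have hz : ∀ x, HasDensity F x 0 ↔ HasDensity Fᶜ x 1 := fun x => by
    rw [hasDensity_compl hF]; norm_num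
  have ho : ∀ x, HasDensity F x 1 ↔ HasDensity Fᶜ x 0 := fun x => by
    rw [hasDensity_compl hF]; norm_num
  obtain ⟨j, p, δ, hδ, h⟩ := baire_line (a := min a b) (b := max a b)
    (A0 := {t | HasDensity F (J (y,t)) 0}) (A1 := {t | HasDensity F (J (y,t)) 1})
    (C0 := fun j => {t | J (y,t) ∈ Gs c Fᶜ j}) (C1 := fun j => {t | J (y,t) ∈ Gs c F j})
    (by
      intro t ht
      have := hcon t ht
      simp only [essBoundary, Set.mem_ofPred_eq, not_and_or, not_not] at this
      exact this)
    (fun j => (isClosed_Gs c Fᶜ j).preimage hcy) (fun j => (isClosed_Gs c F j).preimage hcy)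
    (fun t ht => density_one_mem_Gs hc0 hFc ((hz _).1 ht))
    (fun t ht => density_one_mem_Gs hc0 hF ht)
    (fun j t ht h => Gs_not_density_zero hc0 hc2 hFc ht ((ho _).1 h))
    (fun j t ht h => Gs_not_density_zero hc0 hc2 hF ht h)
    ⟨b, hb, by simp, by simp⟩ ⟨a, ha, by simp, by simp⟩
  obtain ⟨i, hi⟩ := exists_nat_one_div_lt hδ
  rcases h with ⟨hp, h | h⟩ | ⟨hp, h | h⟩
  · exact e1 j i ⟨p, hp, fun s hs1 hs2 => h s hs1 (hs2.trans hi)⟩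
  · refine e3 j i ⟨-p, by rw [hJJ]; simpa using hp, fun s hs1 hs2 => ?_⟩
    rw [hJJ]
    have := h s hs1 (hs2.trans hi)
    have e : -(-p + s) = p - s := by ring
    rw [e]; exact this
  · exact e2 j i ⟨p, hp, fun s hs1 hs2 => (ho _).1 (h s hs1 (hs2.trans hi))⟩
  · refine e4 j i ⟨-p, by rw [hJJ]; simpa using hp, fun s hs1 hs2 => ?_⟩
    rw [hJJ]
    have := h s hs1 (hs2.trans hi)
    have e : -(-p + s) = p - s := by ring
    rw [e]; exact (ho _).1 this

/-- The Hausdorff measure restricted to the essential boundary. -/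
def bdM {k : ℕ} (F : Set (Eu (k+1))) : Measure (Eu (k+1)) := (μH[(k:ℝ)]).restrict (essBoundary F)

lemma perimeter_eq {k : ℕ} (F : Set (Eu (k+1))) : perimeter F = bdM F Set.univ := by
  unfold perimeter bdM
  rw [Measure.restrict_apply_univ]
  push_cast; simp

open Classical in
lemma shift_bound {k : ℕ} {F : Set (Eu (k+1))} (hF : MeasurableSet F) {e : Eu (k+1)} (he : ‖e‖ = 1)
    {Ψ : Eu (k+1) → ℝ} {L : NNReal} (hL : LipschitzWith L Ψ)
    {h d : ℝ} (hh : 0 < h) (hd : 0 < d) :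
    ∫⁻ x, (if (x ∈ F ↔ x - h • e ∈ F) then 0 else ENNReal.ofReal (Ψ x)) ≤
      ENNReal.ofReal (h + 2*d) * hc k * ∫⁻ x, ENNReal.ofReal (Ψ x + L * (h + 2*d)) ∂(bdM F) := by
  obtain ⟨J, hJ, hn, hJe⟩ := exists_split e he
  have hJs : MeasurePreserving J.symm volume volume := hJ.symm J.toHomeomorph.toMeasurableEquiv
  have hn1 : ∀ p, ‖p.1‖ ≤ ‖J p‖ := fun p =>
    abs_le_of_sq_le_sq' (by rw [hn]; nlinarith [sq_nonneg p.2]) (norm_nonneg _) |>.2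
  have hn2 : ∀ p, |p.2| ≤ ‖J p‖ := fun p => by
    rw [← abs_norm (J p)]
    exact sq_le_sq.1 (by rw [hn]; nlinarith [sq_nonneg ‖p.1‖])
  let c : ℕ → Eu (k+1) := TopologicalSpace.denseSeq _
  let D : ℕ → Set (Eu (k+1)) := disjointed fun i => ball (c i) d
  have hDm : ∀ i, MeasurableSet (D i) := MeasurableSet.disjointed fun i => measurableSet_ball
  have hDb : ∀ i, D i ⊆ ball (c i) d := disjointed_subset _
  have hDU : ⋃ i, D i = Set.univ := by
    rw [iUnion_disjointed, Set.eq_univ_iff_forall]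
    intro x
    obtain ⟨i, hi⟩ := (TopologicalSpace.denseRange_denseSeq (Eu (k+1))).exists_dist_lt x hd
    exact Set.mem_iUnion.2 ⟨i, hi⟩
  set M := essBoundary F with hM
  let Q : ℕ → Set (Eu k) := fun i => (fun x => (J.symm x).1) '' (M ∩ D i)
  let B : ℕ → Set (Eu (k+1)) := fun i => J.symm ⁻¹' (toMeasurable volume (Q i) ×ˢ
    Set.Icc ((J.symm (c i)).2 - d) ((J.symm (c i)).2 + h + d))
  let T : ℕ → Set (Eu (k+1)) := fun i => B i ∩ closedBall (c i) (h+d)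
  have hBm : ∀ i, MeasurableSet (B i) := fun i =>
    J.symm.continuous.measurable ((measurableSet_toMeasurable _ _).prod measurableSet_Icc)
  have hTm : ∀ i, MeasurableSet (T i) := fun i => (hBm i).inter measurableSet_closedBall
  have hvol : ∀ i, volume (T i) ≤ ENNReal.ofReal (h+2*d) * hc k * bdM F (D i) := by
    intro i
    have h1 : volume (B i) = volume (Q i) * ENNReal.ofReal (h+2*d) := by
      rw [hJs.measure_preimage_emb J.symm.toHomeomorph.measurableEmbedding,
        Measure.volume_eq_prod, Measure.prod_prod, Real.volume_Icc, measure_toMeasurable]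
      congr 2; ring
    have hlip : LipschitzWith 1 (fun x => (J.symm x).1) := by
      refine LipschitzWith.of_dist_le_mul fun x y => ?_
      rw [dist_eq_norm, dist_eq_norm, ← Prod.fst_sub, ← map_sub]
      have := hn1 (J.symm (x - y))
      simpa using this
    have h2 : volume (Q i) ≤ hc k * bdM F (D i) := by
      rw [hc_vol_apply]
      gcongr
      have := hlip.hausdorffMeasure_image_le (d := (k:ℝ)) (by positivity) (M ∩ D i)
      rw [bdM, Measure.restrict_apply (hDm i), Set.inter_comm (D i)]
      simpa using this
    calc volume (T i) ≤ volume (B i) := measure_mono Set.inter_subset_left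
      _ = volume (Q i) * ENNReal.ofReal (h+2*d) := h1
      _ ≤ (hc k * bdM F (D i)) * ENNReal.ofReal (h+2*d) := by gcongr
      _ = _ := by ring
  have hcover : ∀ᵐ x : Eu (k+1), ¬ (x ∈ F ↔ x - h • e ∈ F) → ∃ i, x ∈ T i := by
    have a1 := ae_density hF
    have a2 : ∀ᵐ x : Eu (k+1), (x - h • e ∈ F → HasDensity F (x - h • e) 1) ∧
        (x - h • e ∉ F → HasDensity F (x - h • e) 0) :=
      (measurePreserving_sub_right (volume : Measure (Eu (k+1))) (h • e)).quasiMeasurePreserving.ae a1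
    have a3 : ∀ᵐ x : Eu (k+1), ∀ a b, HasDensity F (J ((J.symm x).1,a)) 1 →
        HasDensity F (J ((J.symm x).1,b)) 0 →
      ∃ t ∈ Set.uIcc a b, J ((J.symm x).1,t) ∈ essBoundary F :=
      (Measure.quasiMeasurePreserving_fst.comp hJs.quasiMeasurePreserving).ae (line_lemma J hJ hn hF)
    filter_upwards [a1, a2, a3] with x a1 a2 a3 hx
    set y := (J.symm x).1 with hy
    set t := (J.symm x).2 with ht
    have hxJ : J (y,t) = x := by simp [hy, ht]
    have hJadd : ∀ s, J (y, s) = x + (s - t) • e := by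
      intro s
      rw [← hxJ, ← hJe, ← map_smul, ← map_add]; simp
    have hxh : J (y, t - h) = x - h • e := by rw [hJadd]; simp [sub_eq_add_neg]
    obtain ⟨t', ht', htM⟩ : ∃ t' ∈ Set.Icc (t-h) t, J (y,t') ∈ M := by
      have hu : Set.uIcc (t-h) t = Set.Icc (t-h) t := Set.uIcc_of_le (by linarith)
      by_cases hxF : x ∈ F
      · have hx2 : x - h • e ∉ F := fun hh => hx (by simp [hxF, hh])
        have := a3 t (t-h) (by rw [hxJ]; exact a1.1 hxF) (by rw [hxh]; exact a2.2 hx2)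
        rwa [Set.uIcc_comm, hu] at this
      · have hx2 : x - h • e ∈ F := by by_contra hh; exact hx (by simp [hxF, hh])
        have := a3 (t-h) t (by rw [hxh]; exact a2.1 hx2) (by rw [hxJ]; exact a1.2 hxF)
        rwa [hu] at this
    obtain ⟨i, hi⟩ : ∃ i, J (y,t') ∈ D i := by
      have : J (y,t') ∈ ⋃ i, D i := by rw [hDU]; trivial
      exact Set.mem_iUnion.1 this
    have hib : ‖J (y,t') - c i‖ < d := by
      have := hDb i hi; rwa [mem_ball, dist_eq_norm] at this
    have hti : |t' - (J.symm (c i)).2| < d := by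
      refine lt_of_le_of_lt ?_ hib
      have := hn2 ((y,t') - J.symm (c i))
      simpa using this
    rw [abs_lt] at hti
    refine ⟨i, ⟨subset_toMeasurable _ _ ⟨J (y,t'), ⟨htM, hi⟩, by simp [hy]⟩, ?_, ?_⟩, ?_⟩
    · change _ ≤ t; linarith [ht'.2]
    · change t ≤ _; linarith [ht'.1]
    · rw [mem_closedBall, dist_eq_norm]
      have e1 : x - c i = (J (y,t') - c i) + (t - t') • e := by
        rw [hJadd]; module
      rw [e1]
      refine (norm_add_le _ _).trans ?_
      rw [norm_smul, he, Real.norm_eq_abs, abs_of_nonneg (by linarith [ht'.2])]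
      linarith [ht'.1]
  have hLc : ∀ x y, Ψ x ≤ Ψ y + L * dist x y := fun x y => by
    have := hL.dist_le_mul x y
    rw [Real.dist_eq] at this
    linarith [le_abs_self (Ψ x - Ψ y)]
  calc ∫⁻ x, (if (x ∈ F ↔ x - h • e ∈ F) then 0 else ENNReal.ofReal (Ψ x))
      ≤ ∫⁻ x, ∑' i, (T i).indicator (fun x => ENNReal.ofReal (Ψ x)) x := by
        refine lintegral_mono_ae ?_
        filter_upwards [hcover] with x hx
        split_ifs with h1
        · exact zero_le
        · obtain ⟨i, hi⟩ := hx h1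
          refine le_trans ?_ (ENNReal.le_tsum i)
          rw [Set.indicator_of_mem hi]
    _ = ∑' i, ∫⁻ x in T i, ENNReal.ofReal (Ψ x) := by
        rw [lintegral_tsum]
        · congr 1; ext i; rw [lintegral_indicator (hTm i)]
        · intro i
          exact ((hL.continuous.measurable.ennreal_ofReal).indicator (hTm i)).aemeasurable
    _ ≤ ∑' i, ENNReal.ofReal (h + 2*d) * hc k * ∫⁻ x in D i, ENNReal.ofReal (Ψ x + L * (h + 2*d)) ∂(bdM F) := by
        refine ENNReal.tsum_le_tsum fun i => ?_
        calc ∫⁻ x in T i, ENNReal.ofReal (Ψ x) ≤ ∫⁻ x in T i, ENNReal.ofReal (Ψ (c i) + L * (h + d)) := by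
              refine setLIntegral_mono' (hTm i) fun x hx => ?_
              apply ENNReal.ofReal_le_ofReal
              have h1 := hLc x (c i)
              have h2 : dist x (c i) ≤ h + d := hx.2
              have : (L:ℝ) * dist x (c i) ≤ L * (h+d) := by gcongr
              linarith
          _ = ENNReal.ofReal (Ψ (c i) + L * (h + d)) * volume (T i) := by rw [setLIntegral_const]
          _ ≤ ENNReal.ofReal (Ψ (c i) + L * (h + d)) * (ENNReal.ofReal (h+2*d) * hc k * bdM F (D i)) := by
              gcongr; exact hvol i
          _ = ENNReal.ofReal (h+2*d) * hc k * ∫⁻ x in D i, ENNReal.ofReal (Ψ (c i) + L * (h + d)) ∂(bdM F) := by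
              rw [setLIntegral_const]; ring
          _ ≤ _ := by
              refine mul_le_mul' le_rfl ?_
              refine setLIntegral_mono' (hDm i) fun x hx => ?_
              apply ENNReal.ofReal_le_ofReal
              have h1 := hLc (c i) x
              have h2 : dist (c i) x ≤ d := by rw [dist_comm]; exact (hDb i hx).le
              have : (L:ℝ) * dist (c i) x ≤ L * d := by gcongr
              linarith
    _ = _ := by
        rw [ENNReal.tsum_mul_left]
        congr 1
        rw [← lintegral_iUnion hDm (disjoint_disjointed _), hDU, Measure.restrict_univ]

/-- Mollification of the indicator of `F`. -/
def moll {k : ℕ} (ρ : Eu (k+1) → ℝ) (F : Set (Eu (k+1))) (z : Eu (k+1)) : ℝ :=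
  ∫ x, ρ (z - x) * F.indicator 1 x

open Classical in
lemma moll_grad {k : ℕ} {F : Set (Eu (k+1))} (hF : MeasurableSet F) (hP : perimeter F ≠ ⊤)
    {ρ : Eu (k+1) → ℝ} (hρ : Continuous ρ) (hρc : HasCompactSupport ρ) (hρ0 : ∀ x, 0 ≤ ρ x)
    {L : NNReal} (hL : LipschitzWith L ρ) (z : Eu (k+1)) (hd : DifferentiableAt ℝ (moll ρ F) z) :
    ‖fderiv ℝ (moll ρ F) z‖ₑ ≤ hc k * ∫⁻ x, ENNReal.ofReal (ρ (z - x)) ∂(bdM F) := by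
  have hfin : IsFiniteMeasure (bdM F) := ⟨by rw [← perimeter_eq]; exact hP.lt_top⟩
  have hcc : ∀ w : Eu (k+1), Continuous fun x => ρ (w - x) := fun w => by fun_prop
  have hcs : ∀ w : Eu (k+1), HasCompactSupport fun x => ρ (w - x) := fun w =>
    hρc.comp_homeomorph (Homeomorph.subLeft w)
  have hintg : ∀ w : Eu (k+1), Integrable (fun x => ρ (w - x)) :=
    fun w => (hcc w).integrable_of_hasCompactSupport (hcs w)
  have hintb : ∀ w : Eu (k+1), Integrable (fun x => ρ (w - x)) (bdM F) :=
    fun w => (hcc w).integrable_of_hasCompactSupport (hcs w)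
  have hintF : ∀ w : Eu (k+1), Integrable (fun x => ρ (w - x) * F.indicator 1 x) := by
    intro w
    have := (hintg w).indicator hF
    refine this.congr (Eventually.of_forall fun x => ?_)
    by_cases hx : x ∈ F <;> simp [hx]
  set G : ℝ := ∫ x, ρ (z - x) ∂(bdM F) with hG
  set p : ℝ := (bdM F).real Set.univ with hp
  have hGe : ∫⁻ x, ENNReal.ofReal (ρ (z - x)) ∂(bdM F) = ENNReal.ofReal G := by
    rw [hG, ofReal_integral_eq_lintegral_ofReal (hintb z) (Eventually.of_forall fun x => hρ0 _)]
  have hG0 : 0 ≤ G := integral_nonneg fun x => hρ0 _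
  have key : ∀ e : Eu (k+1), ‖e‖ = 1 → ∀ h : ℝ, 0 < h →
      |moll ρ F (z - h • e) - moll ρ F z| ≤ (h + 2*h^2) * hc k * (G + L * (h + 2*h^2) * p) := by
    intro e he h hh
    have hΨ : LipschitzWith L (fun x => ρ (z - x)) := by
      have := hL.comp (LipschitzWith.of_dist_le_mul (K := 1) (f := fun x : Eu (k+1) => z - x)
        (fun x y => by rw [dist_sub_left]; simp))
      rw [mul_one] at this
      exact this
    have h1 := shift_bound hF he hΨ hh (d := h^2) (by positivity)
    have h2 : moll ρ F (z - h • e) = ∫ x, ρ (z - x) * F.indicator 1 (x - h • e) := by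
      unfold moll
      rw [← integral_sub_right_eq_self (fun x => ρ (z - h • e - x) * F.indicator 1 x) (h • e)]
      congr 1; ext x; congr 2; abel
    have h2i : Integrable (fun x => ρ (z - x) * F.indicator 1 (x - h • e)) := by
      have := (hintF (z - h • e)).comp_sub_right (h • e)
      refine this.congr (Eventually.of_forall fun x => ?_)
      simp only []; congr 2; abel
    have h3 : moll ρ F (z - h • e) - moll ρ F z
        = ∫ x, ρ (z - x) * (F.indicator 1 (x - h • e) - F.indicator 1 x) := by
      rw [h2]; unfold moll
      rw [← integral_sub h2i (hintF z)]
      congr 1; ext x; ring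
    have h4 : ‖moll ρ F (z - h • e) - moll ρ F z‖ₑ ≤
        ∫⁻ x, (if (x ∈ F ↔ x - h • e ∈ F) then 0 else ENNReal.ofReal (ρ (z - x))) := by
      rw [h3]
      refine (enorm_integral_le_lintegral_enorm _).trans (lintegral_mono fun x => ?_)
      simp only []
      by_cases a : x ∈ F <;> by_cases b : x - h • e ∈ F <;>
        simp [a, b, Real.enorm_of_nonneg (hρ0 _)]
    have h5 : ∫⁻ x, ENNReal.ofReal (ρ (z - x) + L * (h + 2*h^2)) ∂(bdM F)
        = ENNReal.ofReal (G + L * (h + 2*h^2) * p) := by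
      rw [← ofReal_integral_eq_lintegral_ofReal]
      · rw [integral_add (hintb z) (integrable_const _), integral_const]
        congr 2; rw [smul_eq_mul]; ring
      · exact (hintb z).add (integrable_const _)
      · exact Eventually.of_forall fun x => add_nonneg (hρ0 _) (by positivity)
    have h6 := h4.trans h1
    rw [h5, Real.enorm_eq_ofReal_abs, ← ENNReal.ofReal_coe_nnreal (p := hc k),
      ← ENNReal.ofReal_mul (by positivity), ← ENNReal.ofReal_mul (by positivity)] at h6
    rwa [ENNReal.ofReal_le_ofReal_iff] at h6
    have : 0 ≤ p := measureReal_nonneg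
    positivity
  have hbd : ∀ e : Eu (k+1), ‖e‖ = 1 → ‖fderiv ℝ (moll ρ F) z e‖ ≤ hc k * G := by
    intro e he
    have h1 : HasDerivAt (fun h : ℝ => moll ρ F (z - h • e)) (-(fderiv ℝ (moll ρ F) z e)) 0 := by
      have h0 : HasDerivAt (fun h : ℝ => z - h • e) (-e) 0 := by
        have := ((hasDerivAt_id (0:ℝ)).smul_const e).const_sub z
        simpa using this
      have hd' : HasFDerivAt (moll ρ F) (fderiv ℝ (moll ρ F) z) (z - (0:ℝ) • e) := by
        simpa using hd.hasFDerivAt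
      have := hd'.comp_hasDerivAt (0:ℝ) h0
      rw [map_neg] at this
      exact this
    have h2 := h1.tendsto_slope_zero_right
    have h3 := h2.norm
    rw [norm_neg] at h3
    have h4 : Tendsto (fun h : ℝ => (1 + 2*h) * hc k * (G + L * (h + 2*h^2) * p))
        (nhdsWithin 0 (Set.Ioi 0)) (nhds (hc k * G)) := by
      have : Continuous (fun h : ℝ => (1 + 2*h) * hc k * (G + L * (h + 2*h^2) * p)) := by fun_prop
      have := this.tendsto 0
      simp only [mul_zero, add_zero, one_mul] at this
      norm_num at this
      exact this.mono_left nhdsWithin_le_nhds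
    refine le_of_tendsto_of_tendsto h3 h4 ?_
    filter_upwards [self_mem_nhdsWithin] with h hh
    have hh : 0 < h := hh
    have := key e he h hh
    simp only [zero_add, zero_smul, sub_zero, smul_eq_mul, norm_mul, norm_inv, Real.norm_eq_abs,
      abs_of_pos hh]
    rw [inv_mul_le_iff₀ hh]
    refine this.trans (le_of_eq ?_)
    ring
  have hle : ‖fderiv ℝ (moll ρ F) z‖ ≤ hc k * G :=
    ContinuousLinearMap.opNorm_le_of_unit_norm (by positivity) hbd
  rw [hGe, ← ENNReal.ofReal_coe_nnreal (p := hc k), ← ENNReal.ofReal_mul (by positivity),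
    ← ofReal_norm]
  exact ENNReal.ofReal_le_ofReal hle

lemma moll_eq {k : ℕ} (ρ : Eu (k+1) → ℝ) (F : Set (Eu (k+1))) :
    moll ρ F = convolution ρ (F.indicator 1) (ContinuousLinearMap.lsmul ℝ ℝ) volume := by
  ext z
  rw [convolution_eq_swap]
  rfl

lemma exists_smooth_aux {k : ℕ} {F : Set (Eu (k+1))} (hF : MeasurableSet F) (hP : perimeter F ≠ ⊤)
    (hV : volume F ≠ ⊤) {η : ℝ} (hη : 0 < η) :
    ∃ f : Eu (k+1) → ℝ, ContDiff ℝ 1 f ∧ (∀ x, 0 ≤ f x) ∧ (∀ x, f x ≤ 1) ∧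
      ∫⁻ x, ‖fderiv ℝ f x‖ₑ ≤ hc k * perimeter F ∧ ∫⁻ x, ENNReal.ofReal (f x) = volume F ∧
      ∫⁻ x, ‖f x - F.indicator 1 x‖ₑ ≤ ENNReal.ofReal η := by
  let φ : ℕ → ContDiffBump (0 : Eu (k+1)) := fun i =>
    ⟨1/((i:ℝ)+1), 2/((i:ℝ)+1), by positivity, by gcongr; norm_num⟩
  let ρ : ℕ → Eu (k+1) → ℝ := fun i => (φ i).normed volume
  have hρ0 : ∀ i x, 0 ≤ ρ i x := fun i x => (φ i).nonneg_normed x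
  have hρcs : ∀ i, HasCompactSupport (ρ i) := fun i => (φ i).hasCompactSupport_normed
  have hρd : ∀ i, ContDiff ℝ 1 (ρ i) := fun i => (φ i).contDiff_normed
  have hρi : ∀ i, Integrable (ρ i) := fun i => (hρd i).continuous.integrable_of_hasCompactSupport (hρcs i)
  have hρ1 : ∀ i, ∫⁻ x, ENNReal.ofReal (ρ i x) = 1 := by
    intro i
    rw [← ofReal_integral_eq_lintegral_ofReal (hρi i) (Eventually.of_forall (hρ0 i)),
      (φ i).integral_normed, ENNReal.ofReal_one]
  have hindm : Measurable (F.indicator (1 : Eu (k+1) → ℝ)) := measurable_one.indicator hF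
  have hindi : Integrable (F.indicator (1 : Eu (k+1) → ℝ)) := by
    rw [integrable_indicator_iff hF]
    exact integrableOn_const hV
  have hcd : ∀ i, ContDiff ℝ 1 (moll (ρ i) F) := by
    intro i
    rw [moll_eq]
    exact (hρcs i).contDiff_convolution_left _ (hρd i) hindi.locallyIntegrable
  have hintF : ∀ i (w : Eu (k+1)), Integrable (fun x => ρ i (w - x) * F.indicator 1 x) := by
    intro i w
    have := ((hρi i).comp_sub_left w).indicator hF
    refine this.congr (Eventually.of_forall fun x => ?_)
    by_cases hx : x ∈ F <;> simp [hx]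
  have hind0 : ∀ x, 0 ≤ F.indicator (1 : Eu (k+1) → ℝ) x := fun x => Set.indicator_nonneg (by simp) _
  have hind1 : ∀ x, F.indicator (1 : Eu (k+1) → ℝ) x ≤ 1 := fun x =>
    Set.indicator_le_self' (f := 1) (fun _ _ => zero_le_one) x
  have hf0 : ∀ i z, 0 ≤ moll (ρ i) F z := fun i z => integral_nonneg fun x => mul_nonneg (hρ0 _ _) (hind0 x)
  have hf1 : ∀ i z, moll (ρ i) F z ≤ 1 := by
    intro i z
    calc moll (ρ i) F z ≤ ∫ x, ρ i (z - x) := by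
          refine integral_mono (hintF i z) ((hρi i).comp_sub_left z) fun x => ?_
          exact mul_le_of_le_one_right (hρ0 _ _) (hind1 x)
      _ = 1 := by rw [integral_sub_left_eq_self (ρ i) volume z, (φ i).integral_normed]
  have hmass : ∀ i, ∫⁻ x, ENNReal.ofReal (moll (ρ i) F x) = volume F := by
    intro i
    calc ∫⁻ z, ENNReal.ofReal (moll (ρ i) F z)
        = ∫⁻ z, ∫⁻ x, ENNReal.ofReal (ρ i (z - x)) * ENNReal.ofReal (F.indicator 1 x) := by
          congr 1; ext z
          unfold moll
          rw [ofReal_integral_eq_lintegral_ofReal (hintF i z)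
            (Eventually.of_forall fun x => mul_nonneg (hρ0 _ _) (hind0 x))]
          congr 1; ext x; rw [ENNReal.ofReal_mul (hρ0 _ _)]
      _ = ∫⁻ x, ∫⁻ z, ENNReal.ofReal (ρ i (z - x)) * ENNReal.ofReal (F.indicator 1 x) := by
          rw [lintegral_lintegral_swap]
          exact (((hρd i).continuous.measurable.comp (measurable_fst.sub measurable_snd)).ennreal_ofReal.mul
            (hindm.comp measurable_snd).ennreal_ofReal).aemeasurable
      _ = ∫⁻ x, ENNReal.ofReal (F.indicator 1 x) := by
          congr 1; ext x
          have hmx : Measurable fun z => ENNReal.ofReal (ρ i (z - x)) :=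
            ((hρd i).continuous.measurable.comp (measurable_id.sub_const x)).ennreal_ofReal
          rw [lintegral_mul_const _ hmx,
            lintegral_sub_right_eq_self (fun z => ENNReal.ofReal (ρ i z)) x, hρ1, one_mul]
      _ = volume F := by
          have : (fun x => ENNReal.ofReal (F.indicator 1 x)) = F.indicator (1 : Eu (k+1) → ℝ≥0∞) := by
            ext x; by_cases hx : x ∈ F <;> simp [hx]
          rw [this, lintegral_indicator_one hF]
  have hgrad : ∀ i, ∫⁻ x, ‖fderiv ℝ (moll (ρ i) F) x‖ₑ ≤ hc k * perimeter F := by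
    intro i
    have hfin : IsFiniteMeasure (bdM F) := ⟨by rw [← perimeter_eq]; exact hP.lt_top⟩
    obtain ⟨L, hL⟩ := (hρd i).lipschitzWith_of_hasCompactSupport (hρcs i) one_ne_zero
    have hm : Measurable fun p : Eu (k+1) × Eu (k+1) => ENNReal.ofReal (ρ i (p.1 - p.2)) :=
      ((hρd i).continuous.measurable.comp (measurable_fst.sub measurable_snd)).ennreal_ofReal
    calc ∫⁻ x, ‖fderiv ℝ (moll (ρ i) F) x‖ₑ
        ≤ ∫⁻ z, hc k * ∫⁻ x, ENNReal.ofReal (ρ i (z - x)) ∂(bdM F) := by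
          refine lintegral_mono fun z => ?_
          exact moll_grad hF hP (hρd i).continuous (hρcs i) (hρ0 i) hL z
            ((hcd i).differentiable one_ne_zero z)
      _ = hc k * ∫⁻ x, (∫⁻ z, ENNReal.ofReal (ρ i (z - x))) ∂(bdM F) := by
          rw [lintegral_const_mul _ hm.lintegral_prod_right']
          rw [lintegral_lintegral_swap hm.aemeasurable]
      _ = hc k * perimeter F := by
          have : ∀ x, ∫⁻ z, ENNReal.ofReal (ρ i (z - x)) = 1 := fun x => by
            rw [lintegral_sub_right_eq_self (fun z => ENNReal.ofReal (ρ i z)) x, hρ1]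
          simp only [this, lintegral_const, one_mul, perimeter_eq]
  have hae := ContDiffBump.ae_convolution_tendsto_right_of_locallyIntegrable (φ := φ) (l := atTop) (K := 2)
    (μ := volume) (g := F.indicator (1 : Eu (k+1) → ℝ)) ?_ ?_ hindi.locallyIntegrable
  rotate_left
  · have := (tendsto_one_div_add_atTop_nhds_zero_nat (𝕜 := ℝ)).const_mul 2
    simpa [φ, mul_one_div, div_eq_mul_inv] using this
  · refine Eventually.of_forall fun i => le_of_eq ?_
    simp only [φ]; ring
  have hlim : Tendsto (fun i => ∫⁻ x, ENNReal.ofReal (F.indicator 1 x - moll (ρ i) F x)) atTop (nhds 0) := by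
    have h0 : (0:ℝ≥0∞) = ∫⁻ x : Eu (k+1), 0 := by simp
    rw [h0]
    refine tendsto_lintegral_of_dominated_convergence (fun x => ENNReal.ofReal (F.indicator 1 x)) ?_ ?_ ?_ ?_
    · intro i; exact (hindm.sub (hcd i).continuous.measurable).ennreal_ofReal
    · intro i; refine Eventually.of_forall fun x => ENNReal.ofReal_le_ofReal ?_
      linarith [hf0 i x]
    · exact (hindi.lintegral_lt_top).ne
    · filter_upwards [hae] with x hx
      have : Tendsto (fun i => ENNReal.ofReal (F.indicator 1 x - moll (ρ i) F x)) atTop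
          (nhds (ENNReal.ofReal (F.indicator 1 x - F.indicator 1 x))) := by
        refine (ENNReal.continuous_ofReal.tendsto _).comp (Tendsto.sub tendsto_const_nhds ?_)
        simp only [moll_eq]; exact hx
      simpa using this
  obtain ⟨i, hi⟩ := (hlim.eventually (eventually_le_nhds (b := ENNReal.ofReal (η/2)) (by positivity))).exists
  refine ⟨moll (ρ i) F, hcd i, hf0 i, hf1 i, hgrad i, hmass i, ?_⟩
  have e1 : ∫⁻ x, ENNReal.ofReal (moll (ρ i) F x - F.indicator 1 x)
      = ∫⁻ x, ENNReal.ofReal (F.indicator 1 x - moll (ρ i) F x) := by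
    have hm1 : Measurable (fun x => ENNReal.ofReal (F.indicator 1 x : ℝ)) := hindm.ennreal_ofReal
    have hm2 : Measurable (fun x => ENNReal.ofReal (moll (ρ i) F x)) := (hcd i).continuous.measurable.ennreal_ofReal
    have hF1 : ∫⁻ x, ENNReal.ofReal (F.indicator 1 x) = volume F := by
      have : (fun x => ENNReal.ofReal (F.indicator 1 x)) = F.indicator (1 : Eu (k+1) → ℝ≥0∞) := by
        ext x; by_cases hx : x ∈ F <;> simp [hx]
      rw [this, lintegral_indicator_one hF]
    have := calc
      (∫⁻ x, ENNReal.ofReal (moll (ρ i) F x - F.indicator 1 x)) + volume F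
        = ∫⁻ x, (ENNReal.ofReal (moll (ρ i) F x - F.indicator 1 x) + ENNReal.ofReal (F.indicator 1 x)) := by
          rw [lintegral_add_right _ hm1, hF1]
      _ = ∫⁻ x, (ENNReal.ofReal (F.indicator 1 x - moll (ρ i) F x) + ENNReal.ofReal (moll (ρ i) F x)) := by
          congr 1; ext x
          rcases le_total (moll (ρ i) F x) (F.indicator 1 x) with h | h
          · rw [ENNReal.ofReal_of_nonpos (by linarith), zero_add, ← ENNReal.ofReal_add (by linarith) (hf0 i x)]
            congr 1; ring
          · rw [ENNReal.ofReal_of_nonpos (p := F.indicator 1 x - _) (by linarith), zero_add, ← ENNReal.ofReal_add (by linarith) (hind0 x)]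
            congr 1; ring
      _ = (∫⁻ x, ENNReal.ofReal (F.indicator 1 x - moll (ρ i) F x)) + volume F := by
          rw [lintegral_add_right _ hm2, hmass i]
    exact (ENNReal.add_left_inj hV).1 this
  calc ∫⁻ x, ‖moll (ρ i) F x - F.indicator 1 x‖ₑ
      = ∫⁻ x, (ENNReal.ofReal (moll (ρ i) F x - F.indicator 1 x) + ENNReal.ofReal (F.indicator 1 x - moll (ρ i) F x)) := by
        congr 1; ext x
        rw [Real.enorm_eq_ofReal_abs]
        rcases le_total (moll (ρ i) F x) (F.indicator 1 x) with h | h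
        · rw [ENNReal.ofReal_of_nonpos (p := moll (ρ i) F x - _) (by linarith), zero_add, abs_of_nonpos (by linarith)]
          congr 1; ring
        · rw [ENNReal.ofReal_of_nonpos (p := F.indicator 1 x - _) (by linarith), add_zero, abs_of_nonneg (by linarith)]
    _ ≤ ENNReal.ofReal (η/2) + ENNReal.ofReal (η/2) := by
        have hmm : Measurable fun x => ENNReal.ofReal (moll (ρ i) F x - F.indicator 1 x) :=
          ((hcd i).continuous.measurable.sub hindm).ennreal_ofReal
        rw [lintegral_add_left hmm, e1]
        gcongr
    _ = ENNReal.ofReal η := by rw [← ENNReal.ofReal_add (by positivity) (by positivity)]; congr 1; ring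


lemma exists_smooth {k : ℕ} {F : Set (Eu (k+1))} (hF : MeasurableSet F) (hP : perimeter F ≠ ⊤)
    (hV : volume F ≠ ⊤) {η : ℝ} (hη : 0 < η) :
    ∃ f : Eu (k+1) → ℝ, ContDiff ℝ 1 f ∧ HasCompactSupport f ∧ (∀ x, 0 ≤ f x) ∧ (∀ x, f x ≤ 1) ∧
      ∫⁻ x, ‖fderiv ℝ f x‖ₑ ≤ hc k * perimeter F + ENNReal.ofReal η ∧
      ∫⁻ x, ‖f x - F.indicator 1 x‖ₑ ≤ ENNReal.ofReal η := by
  obtain ⟨f, hf, hf0, hf1, hg, hm, hl⟩ := exists_smooth_aux hF hP hV (half_pos hη)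
  let χ : ContDiffBump (0 : Eu (k+1)) := ⟨1, 2, by norm_num, by norm_num⟩
  have hχd : ContDiff ℝ 1 χ := χ.contDiff
  obtain ⟨L, hL⟩ := hχd.lipschitzWith_of_hasCompactSupport χ.hasCompactSupport one_ne_zero
  have hχi : ∀ i : ℕ, ContDiff ℝ 1 (fun x : Eu (k+1) => χ ((1/((i:ℝ)+1)) • x)) := fun i => by fun_prop
  have hpos : ∀ i : ℕ, 0 < 1/((i:ℝ)+1) := fun i => by positivity
  have hLi : ∀ (i : ℕ) x, ‖fderiv ℝ (fun x : Eu (k+1) => χ ((1/((i:ℝ)+1)) • x)) x‖ₑ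
      ≤ ENNReal.ofReal (L * (1/((i:ℝ)+1))) := by
    intro i x
    have : LipschitzWith (L * ⟨1/((i:ℝ)+1), (hpos i).le⟩) (fun x : Eu (k+1) => χ ((1/((i:ℝ)+1)) • x)) := by
      refine hL.comp (LipschitzWith.of_dist_le_mul fun x y => ?_)
      rw [dist_smul₀, Real.norm_of_nonneg (hpos i).le]; rfl
    have h2 := norm_fderiv_le_of_lipschitz ℝ (x₀ := x) this
    rw [← ofReal_norm]
    exact ENNReal.ofReal_le_ofReal h2
  have hcont1 : Tendsto (fun i : ℕ => ENNReal.ofReal (L * (1/((i:ℝ)+1))) * volume F) atTop (nhds 0) := by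
    have h1 := (tendsto_one_div_add_atTop_nhds_zero_nat (𝕜 := ℝ)).const_mul (L:ℝ)
    have h2 := ENNReal.Tendsto.mul_const ((ENNReal.continuous_ofReal.tendsto _).comp h1) (Or.inr hV)
    simpa using h2
  have hcont2 : Tendsto (fun i : ℕ => ∫⁻ x, ‖χ ((1/((i:ℝ)+1)) • x) * f x - f x‖ₑ) atTop (nhds 0) := by
    have h0 : (0:ℝ≥0∞) = ∫⁻ x : Eu (k+1), 0 := by simp
    rw [h0]
    refine tendsto_lintegral_of_dominated_convergence (fun x => ENNReal.ofReal (f x)) ?_ ?_ ?_ ?_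
    · intro i
      exact (((hχi i).continuous.mul hf.continuous).sub hf.continuous).measurable.enorm
    · intro i; refine Eventually.of_forall fun x => ?_
      simp only []
      rw [Real.enorm_eq_ofReal_abs]
      refine ENNReal.ofReal_le_ofReal ?_
      have a := χ.nonneg (x := (1/((i:ℝ)+1)) • x)
      have b := χ.le_one (x := (1/((i:ℝ)+1)) • x)
      rw [abs_le]; constructor <;> nlinarith [hf0 x]
    · rw [hm]; exact hV
    · refine Eventually.of_forall fun x => ?_
      have h1 := ((tendsto_one_div_add_atTop_nhds_zero_nat (𝕜 := ℝ)).smul_const x)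
      have h2 := (χ.continuous.tendsto _).comp h1
      have h3 := ((h2.mul_const (f x)).sub_const (f x)).enorm
      have h4 : χ ((0:ℝ) • x) = 1 := χ.one_of_mem_closedBall (by simp [χ])
      rw [h4] at h3
      simpa using h3
  obtain ⟨i, hi1, hi2⟩ := ((hcont1.eventually (eventually_le_nhds (b := ENNReal.ofReal η) (by positivity))).and
    (hcont2.eventually (eventually_le_nhds (b := ENNReal.ofReal (η/2)) (by positivity)))).exists
  refine ⟨fun x => χ ((1/((i:ℝ)+1)) • x) * f x, (hχi i).mul hf, ?_, ?_, ?_, ?_, ?_⟩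
  · have h1 : HasCompactSupport (fun x : Eu (k+1) => χ ((1/((i:ℝ)+1)) • x)) :=
      χ.hasCompactSupport.comp_homeomorph (Homeomorph.smulOfNeZero _ (hpos i).ne')
    exact h1.mul_right
  · exact fun x => mul_nonneg χ.nonneg (hf0 x)
  · exact fun x => mul_le_one₀ χ.le_one (hf0 x) (hf1 x)
  · calc ∫⁻ x, ‖fderiv ℝ (fun x => χ ((1/((i:ℝ)+1)) • x) * f x) x‖ₑ
        ≤ ∫⁻ x, (‖fderiv ℝ f x‖ₑ + ENNReal.ofReal (L * (1/((i:ℝ)+1))) * ENNReal.ofReal (f x)) := by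
          refine lintegral_mono fun x => ?_
          have := fderiv_fun_mul ((hχi i).differentiable one_ne_zero x) (hf.differentiable one_ne_zero x)
          simp only [this]
          refine (enorm_add_le (_ : Eu (k+1) →L[ℝ] ℝ) _).trans ?_
          rw [enorm_smul, enorm_smul, mul_comm (ENNReal.ofReal _)]
          rw [Real.enorm_of_nonneg χ.nonneg, Real.enorm_of_nonneg (hf0 x)]
          gcongr
          · refine mul_le_of_le_one_left zero_le ?_
            exact ENNReal.ofReal_le_one.2 χ.le_one
          · exact hLi i x
      _ = (∫⁻ x, ‖fderiv ℝ f x‖ₑ) + ENNReal.ofReal (L * (1/((i:ℝ)+1))) * volume F := by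
          rw [lintegral_add_left (hf.continuous_fderiv one_ne_zero).measurable.enorm,
            lintegral_const_mul _ hf.continuous.measurable.ennreal_ofReal, hm]
      _ ≤ _ := by gcongr
  · calc ∫⁻ x, ‖χ ((1/((i:ℝ)+1)) • x) * f x - F.indicator 1 x‖ₑ
        ≤ ∫⁻ x, (‖χ ((1/((i:ℝ)+1)) • x) * f x - f x‖ₑ + ‖f x - F.indicator 1 x‖ₑ) := by
          refine lintegral_mono fun x => ?_
          refine le_trans (le_of_eq ?_) (enorm_add_le _ _)
          congr 1; ring
      _ ≤ ENNReal.ofReal (η/2) + ENNReal.ofReal (η/2) := by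
          rw [lintegral_add_left]
          · gcongr
          · exact (((hχi i).continuous.mul hf.continuous).sub hf.continuous).measurable.enorm
      _ = ENNReal.ofReal η := by rw [← ENNReal.ofReal_add (by positivity) (by positivity)]; congr 1; ring

/-- One-dimensional Brunn-Minkowski inequality. -/
lemma bm_one {A B C : Set ℝ} (hA : MeasurableSet A) (hB : MeasurableSet B)
    (hAn : A.Nonempty) (hBn : B.Nonempty) (h : ∀ x ∈ A, ∀ y ∈ B, x + y ∈ C) :
    volume A + volume B ≤ volume C := by
  have hcomp : ∀ K₁ ⊆ A, IsCompact K₁ → ∀ K₂ ⊆ B, IsCompact K₂ → volume K₁ + volume K₂ ≤ volume C := by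
    intro K₁ h₁ c₁ K₂ h₂ c₂
    rcases K₁.eq_empty_or_nonempty with rfl | n₁
    · obtain ⟨x, hx⟩ := hAn
      rw [measure_empty, zero_add, ← measure_preimage_add volume (-x)  K₂]
      refine measure_mono fun y hy => ?_
      have := h x hx _ (h₂ hy)
      simpa using this
    rcases K₂.eq_empty_or_nonempty with rfl | n₂
    · obtain ⟨x, hx⟩ := hBn
      rw [measure_empty, add_zero, ← measure_preimage_add volume (-x)  K₁]
      refine measure_mono fun y hy => ?_
      have := h _ (h₁ hy) x hx
      simpa using this
    obtain ⟨M, hM, hM'⟩ := c₁.exists_isGreatest n₁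
    obtain ⟨m, hm, hm'⟩ := c₂.exists_isLeast n₂
    have e1 : volume K₁ = volume ((fun x => -m + x) ⁻¹' K₁) := (measure_preimage_add volume (-m) K₁).symm
    have e2 : volume K₂ = volume ((fun x => -M + x) ⁻¹' K₂) := (measure_preimage_add volume (-M) K₂).symm
    rw [e1, e2, ← measure_union₀]
    · refine measure_mono ?_
      rintro y (hy | hy)
      · have := h _ (h₁ hy) m (h₂ hm); simpa using this
      · have := h M (h₁ hM) _ (h₂ hy); simpa using this
    · exact ((measurable_const_add (-M)) c₂.measurableSet).nullMeasurableSet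
    · refine measure_mono_null (t := {M + m}) ?_ (by simp)
      rintro y ⟨hy1, hy2⟩
      have a := hM' hy1
      have b := hm' hy2
      simp only [Set.mem_singleton_iff]
      apply le_antisymm <;> linarith
  rw [hA.measure_eq_iSup_isCompact, hB.measure_eq_iSup_isCompact]
  simp only [iSup_and']
  exact ENNReal.biSup_add_biSup_le' ⟨∅, by simp⟩ ⟨∅, by simp⟩
    fun K₁ h₁ K₂ h₂ => hcomp K₁ h₁.1 h₁.2 K₂ h₂.1 h₂.2

open Classical in
/-- Core of the one-dimensional Prekopa-Leindler inequality. -/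
lemma pl_core {a b : ℝ} (ha : 0 < a) (hb : 0 < b)
    {u v w : ℝ → ℝ} (hu : Measurable u) (hv : Measurable v) (hw : Measurable w)
    (hu0 : ∀ x, 0 ≤ u x) (hv0 : ∀ x, 0 ≤ v x) (hw0 : ∀ x, 0 ≤ w x) (hu1 : ∀ x, u x ≤ 1) (hv1 : ∀ x, v x ≤ 1)
    (hun : ∀ t < 1, ∃ x, t < u x) (hvn : ∀ t < 1, ∃ x, t < v x)
    (h : ∀ t, 0 < t → ∀ x y, t < u x → t < v y → t < w (a * x + b * y)) :
    ENNReal.ofReal a * (∫⁻ x, ENNReal.ofReal (u x)) + ENNReal.ofReal b * (∫⁻ x, ENNReal.ofReal (v x))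
      ≤ ∫⁻ x, ENNReal.ofReal (w x) := by
  rw [lintegral_eq_lintegral_meas_lt volume (Eventually.of_forall hu0) hu.aemeasurable,
    lintegral_eq_lintegral_meas_lt volume (Eventually.of_forall hv0) hv.aemeasurable,
    lintegral_eq_lintegral_meas_lt volume (Eventually.of_forall hw0) hw.aemeasurable]
  have mu : ∀ f : ℝ → ℝ, Measurable fun t : ℝ => volume {x | t < f x} := fun f =>
    Antitone.measurable fun s t hst => measure_mono fun x hx => lt_of_le_of_lt hst hx
  rw [← lintegral_const_mul _ (mu u), ← lintegral_const_mul _ (mu v), ← lintegral_add_left ((mu u).const_mul _)]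
  refine setLIntegral_mono' measurableSet_Ioi fun t ht => ?_
  have ht : 0 < t := ht
  have sc : ∀ (c : ℝ), 0 < c → ∀ S : Set ℝ, volume ((fun x => c⁻¹ * x) ⁻¹' S) = ENNReal.ofReal c * volume S := by
    intro c hc S
    rw [Real.volume_preimage_mul_left (inv_ne_zero hc.ne'), inv_inv, abs_of_pos hc]
  by_cases h1 : t < 1
  · rw [← sc a ha, ← sc b hb]
    refine bm_one ((measurable_const_mul _) (measurableSet_lt measurable_const hu))
      ((measurable_const_mul _) (measurableSet_lt measurable_const hv)) ?_ ?_ ?_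
    · obtain ⟨x, hx⟩ := hun t h1
      exact ⟨a * x, by simpa [ha.ne'] using hx⟩
    · obtain ⟨x, hx⟩ := hvn t h1
      exact ⟨b * x, by simpa [hb.ne'] using hx⟩
    · intro x hx y hy
      have := h t ht _ _ hx hy
      simpa [ha.ne', hb.ne'] using this
  · have e1 : {x | t < u x} = ∅ := by ext x; simpa using (hu1 x).trans (not_lt.1 h1)
    have e2 : {x | t < v x} = ∅ := by ext x; simpa using (hv1 x).trans (not_lt.1 h1)
    rw [e1, e2]; simp


lemma ennreal_amgm {a b : ℝ} (ha : 0 < a) (hb : 0 < b) (hab : a + b = 1) (p q : ℝ≥0∞) :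
    p ^ a * q ^ b ≤ ENNReal.ofReal a * p + ENNReal.ofReal b * q := by
  by_cases hp : p = ⊤
  · rw [hp, ENNReal.mul_top (by simpa using ha)]; simp
  by_cases hq : q = ⊤
  · rw [hq, ENNReal.mul_top (by simpa using hb)]; simp
  lift p to NNReal using hp
  lift q to NNReal using hq
  rw [← ENNReal.ofReal_coe_nnreal (p := p), ← ENNReal.ofReal_coe_nnreal (p := q),
    ENNReal.ofReal_rpow_of_nonneg p.coe_nonneg ha.le, ENNReal.ofReal_rpow_of_nonneg q.coe_nonneg hb.le,
    ← ENNReal.ofReal_mul (by positivity), ← ENNReal.ofReal_mul ha.le, ← ENNReal.ofReal_mul hb.le,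
    ← ENNReal.ofReal_add (by positivity) (by positivity)]
  exact ENNReal.ofReal_le_ofReal (Real.geom_mean_le_arith_mean2_weighted ha.le hb.le p.2 q.2 hab)

lemma sup_near {f : ℝ → ℝ≥0∞} (hS0 : (⨆ x, f x) ≠ 0) (hSN : (⨆ x, f x) ≠ ⊤) (t : ℝ) (ht : t < 1) :
    ∃ x, t < (f x / (⨆ x, f x)).toReal := by
  rcases lt_or_ge t 0 with h0 | h0
  · exact ⟨0, h0.trans_le toReal_nonneg⟩
  set S := ⨆ x, f x
  have : ENNReal.ofReal t * S < S := by
    conv_rhs => rw [← one_mul S]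
    exact ENNReal.mul_lt_mul_left hS0 hSN (by simpa using ht)
  obtain ⟨x, hx⟩ := lt_iSup_iff.1 this
  have hfS : f x / S ≤ 1 := ENNReal.div_le_of_le_mul (by rw [one_mul]; exact le_iSup f x)
  refine ⟨x, ?_⟩
  rw [← ENNReal.ofReal_lt_iff_lt_toReal h0 (hfS.trans_lt one_lt_top).ne,
    ENNReal.lt_div_iff_mul_lt (Or.inl hS0) (Or.inl hSN)]
  exact hx

/-- One-dimensional Prekopa-Leindler, bounded case. -/
lemma pl_one_bdd {a b : ℝ} (ha : 0 < a) (hb : 0 < b) (hab : a + b = 1)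
    {f g h : ℝ → ℝ≥0∞} (hf : Measurable f) (hg : Measurable g) (hh : Measurable h)
    {N : NNReal} (hfN : ∀ x, f x ≤ N) (hgN : ∀ x, g x ≤ N)
    (H : ∀ x y, f x ^ a * g y ^ b ≤ h (a * x + b * y)) :
    (∫⁻ x, f x) ^ a * (∫⁻ x, g x) ^ b ≤ ∫⁻ x, h x := by
  set S := ⨆ x, f x with hS
  set T := ⨆ x, g x with hT
  have hSN : S ≠ ⊤ := ((iSup_le hfN).trans_lt ENNReal.coe_lt_top).ne
  have hTN : T ≠ ⊤ := ((iSup_le hgN).trans_lt ENNReal.coe_lt_top).ne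
  by_cases hS0 : S = 0
  · have : ∀ x, f x = 0 := fun x => le_antisymm ((le_iSup f x).trans hS0.le) zero_le
    simp [this, ENNReal.zero_rpow_of_pos ha]
  by_cases hT0 : T = 0
  · have : ∀ x, g x = 0 := fun x => le_antisymm ((le_iSup g x).trans hT0.le) zero_le
    simp [this, ENNReal.zero_rpow_of_pos hb]
  set Z := S ^ a * T ^ b with hZ
  have hZ0 : Z ≠ 0 := by
    simp [hZ, hS0, hT0, hSN, hTN]
  have hZt : Z ≠ ⊤ := ENNReal.mul_ne_top (ENNReal.rpow_ne_top_of_nonneg ha.le hSN) (ENNReal.rpow_ne_top_of_nonneg hb.le hTN)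
  let u : ℝ → ℝ := fun x => (f x / S).toReal
  let v : ℝ → ℝ := fun x => (g x / T).toReal
  let w : ℝ → ℝ := fun x => (min (h x / Z) 1).toReal
  have hfS : ∀ x, f x / S ≤ 1 := fun x => ENNReal.div_le_of_le_mul (by rw [one_mul]; exact le_iSup f x)
  have hgT : ∀ x, g x / T ≤ 1 := fun x => ENNReal.div_le_of_le_mul (by rw [one_mul]; exact le_iSup g x)
  have hfS' : ∀ x, f x / S ≠ ⊤ := fun x => ((hfS x).trans_lt one_lt_top).ne
  have hgT' : ∀ x, g x / T ≠ ⊤ := fun x => ((hgT x).trans_lt one_lt_top).ne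
  have hw' : ∀ x, min (h x / Z) 1 ≠ ⊤ := fun x => ((min_le_right _ _).trans_lt one_lt_top).ne
  have key := pl_core ha hb (u := u) (v := v) (w := w) (hf.div_const _).ennreal_toReal (hg.div_const _).ennreal_toReal
    ((hh.div_const _).min measurable_const).ennreal_toReal (fun _ => toReal_nonneg) (fun _ => toReal_nonneg)
    (fun _ => toReal_nonneg) (fun x => ENNReal.toReal_le_of_le_ofReal zero_le_one (by simpa using hfS x))
    (fun x => ENNReal.toReal_le_of_le_ofReal zero_le_one (by simpa using hgT x)) ?_ ?_ ?_
  · have e1 : ∫⁻ x, ENNReal.ofReal (u x) = (∫⁻ x, f x) / S := by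
      simp only [u, ENNReal.ofReal_toReal (hfS' _)]
      simp only [div_eq_mul_inv]
      rw [lintegral_mul_const _ hf]
    have e2 : ∫⁻ x, ENNReal.ofReal (v x) = (∫⁻ x, g x) / T := by
      simp only [v, ENNReal.ofReal_toReal (hgT' _)]
      simp only [div_eq_mul_inv]
      rw [lintegral_mul_const _ hg]
    have e3 : ∫⁻ x, ENNReal.ofReal (w x) ≤ (∫⁻ x, h x) / Z := by
      simp only [w, ENNReal.ofReal_toReal (hw' _)]
      rw [div_eq_mul_inv, ← lintegral_mul_const _ hh]
      exact lintegral_mono fun x => by rw [← div_eq_mul_inv]; exact min_le_left _ _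
    rw [e1, e2] at key
    have k2 := (ennreal_amgm ha hb hab _ _).trans (key.trans e3)
    rw [ENNReal.div_rpow_of_nonneg _ _ ha.le, ENNReal.div_rpow_of_nonneg _ _ hb.le] at k2
    have e4 : (∫⁻ x, f x) ^ a / S ^ a * ((∫⁻ x, g x) ^ b / T ^ b) = ((∫⁻ x, f x) ^ a * (∫⁻ x, g x) ^ b) / Z := by
      rw [hZ, div_eq_mul_inv, div_eq_mul_inv, div_eq_mul_inv, ENNReal.mul_inv]
      · ring
      · left; simp [hS0, hSN]
      · left; simp [ENNReal.rpow_eq_top_iff, hS0, hSN]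
    rw [e4] at k2
    rwa [ENNReal.div_le_iff hZ0 hZt, ENNReal.div_mul_cancel hZ0 hZt] at k2
  · exact fun t ht => sup_near hS0 hSN t ht
  · exact fun t ht => sup_near hT0 hTN t ht
  · intro t ht x y hx hy
    have hx' : ENNReal.ofReal t * S < f x := by
      rwa [← ENNReal.ofReal_lt_iff_lt_toReal ht.le (hfS' x), ENNReal.lt_div_iff_mul_lt (Or.inl hS0) (Or.inl hSN)] at hx
    have hy' : ENNReal.ofReal t * T < g y := by
      rwa [← ENNReal.ofReal_lt_iff_lt_toReal ht.le (hgT' y), ENNReal.lt_div_iff_mul_lt (Or.inl hT0) (Or.inl hTN)] at hy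
    have ht1 : ENNReal.ofReal t < 1 := by
      rw [← ENNReal.ofReal_lt_iff_lt_toReal ht.le (hfS' x)] at hx
      exact hx.trans_le (hfS x)
    rw [← ENNReal.ofReal_lt_iff_lt_toReal ht.le (hw' _)]
    refine lt_min ?_ ht1
    rw [ENNReal.lt_div_iff_mul_lt (Or.inl hZ0) (Or.inl hZt)]
    refine lt_of_lt_of_le ?_ (H x y)
    have e5 : ENNReal.ofReal t * Z = (ENNReal.ofReal t * S) ^ a * (ENNReal.ofReal t * T) ^ b := by
      rw [ENNReal.mul_rpow_of_nonneg _ _ ha.le, ENNReal.mul_rpow_of_nonneg _ _ hb.le, hZ]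
      have : ENNReal.ofReal t = ENNReal.ofReal t ^ a * ENNReal.ofReal t ^ b := by
        rw [← ENNReal.rpow_add _ _ (by simpa using ht) ENNReal.ofReal_ne_top, hab, ENNReal.rpow_one]
      conv_lhs => rw [this]
      ring
    rw [e5]
    exact ENNReal.mul_lt_mul (ENNReal.rpow_lt_rpow hx' ha) (ENNReal.rpow_lt_rpow hy' hb)

/-- One-dimensional Prekopa-Leindler. -/
lemma pl_one {a b : ℝ} (ha : 0 < a) (hb : 0 < b) (hab : a + b = 1)
    {f g h : ℝ → ℝ≥0∞} (hf : Measurable f) (hg : Measurable g) (hh : Measurable h)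
    (H : ∀ x y, f x ^ a * g y ^ b ≤ h (a * x + b * y)) :
    (∫⁻ x, f x) ^ a * (∫⁻ x, g x) ^ b ≤ ∫⁻ x, h x := by
  have conv : ∀ f : ℝ → ℝ≥0∞, Measurable f →
      Tendsto (fun N : ℕ => ∫⁻ x, min (f x) N) atTop (nhds (∫⁻ x, f x)) := by
    intro f hf
    refine lintegral_tendsto_of_tendsto_of_monotone (fun N => (hf.min measurable_const).aemeasurable) ?_ ?_
    · refine Eventually.of_forall fun x N M hNM => ?_
      exact min_le_min le_rfl (by exact_mod_cast hNM)
    · refine Eventually.of_forall fun x => ?_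
      have := (tendsto_const_nhds (x := f x) (f := atTop)).min ENNReal.tendsto_nat_nhds_top
      simpa using this
  have hc : ∀ p : ℝ, 0 < p → Continuous fun z : ℝ≥0∞ => z ^ p := fun p hp => ENNReal.continuous_rpow_const
  have bd : ∀ N : ℕ, (∫⁻ x, min (f x) N) ^ a * (∫⁻ x, min (g x) N) ^ b ≤ ∫⁻ x, h x := by
    intro N
    refine pl_one_bdd ha hb hab (hf.min measurable_const) (hg.min measurable_const) hh (N := N)
      (fun x => ?_) (fun x => ?_) fun x y => ?_
    · simp
    · simp
    · refine le_trans ?_ (H x y)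
      gcongr <;> exact min_le_left _ _
  -- limit in both factors; use a product-free argument through `liminf`
  by_cases h0 : (∫⁻ x, f x) = 0
  · rw [h0, ENNReal.zero_rpow_of_pos ha, zero_mul]; exact zero_le
  by_cases h1 : (∫⁻ x, g x) = 0
  · rw [h1, ENNReal.zero_rpow_of_pos hb, mul_zero]; exact zero_le
  have t1 := ((hc a ha).tendsto _).comp (conv f hf)
  have t2 := ((hc b hb).tendsto _).comp (conv g hg)
  have hne : ∀ (z : ℝ≥0∞) (p : ℝ), 0 < p → z ≠ 0 → z ^ p ≠ 0 := by
    intro z p hp hz hzp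
    rw [ENNReal.rpow_eq_zero_iff] at hzp
    rcases hzp with ⟨h, _⟩ | ⟨_, h⟩
    · exact hz h
    · linarith
  have t3 := ENNReal.Tendsto.mul t1 (Or.inl (hne _ _ ha h0)) t2 (Or.inl (hne _ _ hb h1))
  exact le_of_tendsto t3 (Eventually.of_forall bd)

/-- Prekopa-Leindler in `Fin n → ℝ`. -/
lemma pl_pi {a b : ℝ} (ha : 0 < a) (hb : 0 < b) (hab : a + b = 1) : ∀ (n : ℕ)
    {f g h : (Fin n → ℝ) → ℝ≥0∞} (_ : Measurable f) (_ : Measurable g) (_ : Measurable h)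
    (_ : ∀ x y, f x ^ a * g y ^ b ≤ h (a • x + b • y)),
    (∫⁻ x, f x) ^ a * (∫⁻ x, g x) ^ b ≤ ∫⁻ x, h x
  | 0, f, g, h, hf, hg, hh, H => by
    have e : ∀ f : (Fin 0 → ℝ) → ℝ≥0∞, ∫⁻ x, f x = f default := fun f => by
      rw [lintegral_unique]; simp [volume_pi]; exact congrArg f (Subsingleton.elim _ _)
    rw [e, e, e]
    refine (H default default).trans (le_of_eq ?_)
    congr 1; exact Subsingleton.elim _ _
  | n+1, f, g, h, hf, hg, hh, H => by
    let Φ := (MeasurableEquiv.piFinSuccAbove (fun _ : Fin (n+1) => ℝ) 0)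
    have hΦ := (volume_preserving_piFinSuccAbove (fun _ : Fin (n+1) => ℝ) 0).symm
    have e : ∀ f : (Fin (n+1) → ℝ) → ℝ≥0∞, Measurable f →
        ∫⁻ x, f x = ∫⁻ s : ℝ, ∫⁻ z : Fin n → ℝ, f (Φ.symm (s, z)) := by
      intro f hf
      have hm' : Measurable fun p : ℝ × (Fin n → ℝ) => f (Φ.symm p) := hf.comp Φ.symm.measurable
      rw [← hΦ.lintegral_comp hf]
      exact lintegral_prod _ hm'.aemeasurable
    rw [e f hf, e g hg, e h hh]
    have hm : ∀ f : (Fin (n+1) → ℝ) → ℝ≥0∞, Measurable f →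
        Measurable fun s : ℝ => ∫⁻ z : Fin n → ℝ, f (Φ.symm (s, z)) := fun f hf =>
      (hf.comp Φ.symm.measurable).lintegral_prod_right'
    refine pl_one ha hb hab (hm f hf) (hm g hg) (hm h hh) fun s t => ?_
    have hs : ∀ f : (Fin (n+1) → ℝ) → ℝ≥0∞, Measurable f → ∀ s : ℝ,
        Measurable fun z : Fin n → ℝ => f (Φ.symm (s, z)) := fun f hf s =>
      (hf.comp Φ.symm.measurable).comp measurable_prodMk_left
    refine pl_pi ha hb hab n (hs f hf s) (hs g hg t) (hs h hh _) fun x y => ?_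
    refine (H _ _).trans (le_of_eq ?_)
    congr 1
    ext i
    refine Fin.cases ?_ (fun j => ?_) i <;> simp [Φ, MeasurableEquiv.piFinSuccAbove]


lemma pl_eu {a b : ℝ} (ha : 0 < a) (hb : 0 < b) (hab : a + b = 1) {n : ℕ}
    {A B C : Set (Eu n)} (hA : MeasurableSet A) (hB : MeasurableSet B) (hC : MeasurableSet C)
    (H : ∀ x ∈ A, ∀ y ∈ B, a • x + b • y ∈ C) :
    volume A ^ a * volume B ^ b ≤ volume C := by
  have hΦ := PiLp.volume_preserving_toLp (Fin n)
  have key : ∀ A : Set (Eu n), MeasurableSet A →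
      volume A = ∫⁻ x : Fin n → ℝ, A.indicator 1 (WithLp.toLp 2 x) := by
    intro A hA
    rw [hΦ.lintegral_comp (measurable_one.indicator hA), lintegral_indicator_one hA]
  have hm : ∀ A : Set (Eu n), MeasurableSet A →
      Measurable fun x : Fin n → ℝ => A.indicator (1 : Eu n → ℝ≥0∞) (WithLp.toLp 2 x) := by
    intro A hA
    exact (measurable_one.indicator hA).comp hΦ.measurable
  rw [key A hA, key B hB, key C hC]
  refine pl_pi ha hb hab n (hm A hA) (hm B hB) (hm C hC) fun x y => ?_
  by_cases h1 : WithLp.toLp 2 x ∈ A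
  · by_cases h2 : WithLp.toLp 2 y ∈ B
    · have h3 : (WithLp.toLp 2 (a • x + b • y) : Eu n) ∈ C := H _ h1 _ h2
      rw [Set.indicator_of_mem h1, Set.indicator_of_mem h2, Set.indicator_of_mem h3]; simp
    · simp [h2, hb]
  · simp [h1, ha]

/-- Brunn–Minkowski for a ball. -/
lemma bm_ball {n : ℕ} (hn : n ≠ 0) {r h : ℝ} (hr : 0 < r) (hh : 0 < h) {A C : Set (Eu n)}
    (hA : MeasurableSet A) (hC : MeasurableSet C) (hv : volume A = ENNReal.ofReal (om n * r ^ n))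
    (H : ∀ x ∈ A, ∀ y, ‖y‖ < h → x + y ∈ C) :
    ENNReal.ofReal (om n * (r + h) ^ n) ≤ volume C := by
  have hrh : 0 < r + h := by positivity
  set A' : Set (Eu n) := (fun x => (r / (r + h)) • x) ⁻¹' A with hA'
  have hA'm : MeasurableSet A' := (measurable_const_smul _) hA
  have hvA' : volume A' = ENNReal.ofReal (om n * (r + h) ^ n) := by
    rw [hA', Measure.addHaar_preimage_smul _ (by positivity), hv, ← ENNReal.ofReal_mul (by positivity)]
    congr 1
    rw [finrank_euclideanSpace_fin, abs_of_pos (by positivity)]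
    rw [inv_mul_eq_iff_eq_mul₀ (by positivity), div_pow]
    field_simp
  have := pl_eu (a := r / (r + h)) (b := h / (r + h)) (by positivity) (by positivity)
    (by field_simp) hA'm (B := ball 0 (r + h)) measurableSet_ball hC (by
      intro x hx y hy
      refine H _ hx _ ?_
      rw [norm_smul, Real.norm_of_nonneg (by positivity)]
      rw [mem_ball_zero_iff] at hy
      calc h / (r + h) * ‖y‖ < h / (r + h) * (r + h) := by gcongr
        _ = h := by field_simp)
  rw [hvA', vol_ball _ _ hrh, ← ENNReal.rpow_add_of_nonneg _ _ (by positivity) (by positivity), ← add_div, div_self hrh.ne',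
    ENNReal.rpow_one] at this
  exact this

lemma pow_succ_bound {k : ℕ} {r h : ℝ} (hr : 0 ≤ r) (hh : 0 ≤ h) :
    r ^ (k+1) + (k+1) * h * r ^ k ≤ (r + h) ^ (k+1) := by
  induction k with
  | zero => simp
  | succ k ih =>
    have e : (r + h) ^ (k+1+1) = (r+h)^(k+1) * r + (r + h)^(k+1) * h := by ring
    have h1 : r ^ (k+1) ≤ (r + h) ^ (k+1) := by gcongr; linarith
    rw [e]
    calc r ^ (k+1+1) + ((k+1:ℕ)+1) * h * r ^ (k+1)
        = (r ^ (k+1) + (k+1) * h * r ^ k) * r + r^(k+1) * h := by push_cast; ring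
      _ ≤ _ := by gcongr

/-- smooth functions: oscillation on small balls. -/
lemma smooth_osc {n : ℕ} {f : Eu n → ℝ} (hf : ContDiff ℝ 1 f) (hc : HasCompactSupport f) {ε : ℝ}
    (hε : 0 < ε) : ∃ h, 0 < h ∧ h ≤ 1 ∧ ∀ x y, ‖y - x‖ < h → f y ≤ f x + h * (‖fderiv ℝ f x‖ + ε) := by
  have hcont : Continuous (fderiv ℝ f) := hf.continuous_fderiv (by norm_num)
  have huc : UniformContinuous (fderiv ℝ f) := hcont.uniformContinuous_of_tendsto_cocompact (hc.fderiv ℝ).is_zero_at_infty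
  obtain ⟨δ, hδ, H⟩ := Metric.uniformContinuous_iff.1 huc ε hε
  refine ⟨min δ 1, by positivity, min_le_right _ _, fun x y hxy => ?_⟩
  have := (convex_ball x (min δ 1)).norm_image_sub_le_of_norm_fderiv_le (f := f) (𝕜 := ℝ)
    (C := ‖fderiv ℝ f x‖ + ε) (x := x) (y := y)
    (fun z _ => (hf.differentiable (by norm_num)) z) (fun z hz => by
      have h1 := H (lt_of_lt_of_le (mem_ball.1 hz) (min_le_left _ _))
      rw [dist_eq_norm] at h1
      calc ‖fderiv ℝ f z‖ = ‖fderiv ℝ f x + (fderiv ℝ f z - fderiv ℝ f x)‖ := by congr 1; abel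
        _ ≤ _ := norm_add_le _ _
        _ ≤ _ := by linarith) (mem_ball_self (by positivity)) (by rwa [mem_ball, dist_eq_norm])
  have h2 : f y - f x ≤ (‖fderiv ℝ f x‖ + ε) * min δ 1 := by
    refine (le_abs_self _).trans (this.trans ?_)
    gcongr
  linarith [h2]

lemma isoper_aux {k : ℕ} {f : Eu (k+1) → ℝ} (hf : ContDiff ℝ 1 f) (hc : HasCompactSupport f)
    (hf0 : ∀ x, 0 ≤ f x) (hf1 : ∀ x, f x ≤ 1) {F : Set (Eu (k+1))} (hF : MeasurableSet F)
    (hv : volume F = ENNReal.ofReal (om (k+1))) {s : ℝ} (hs : 0 < s) (hs1 : s < 1) (hsω : s < om (k+1))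
    (hN : ∫⁻ x, ‖f x - F.indicator 1 x‖ₑ ≤ ENNReal.ofReal (s^2)) :
    ENNReal.ofReal ((k+1) * om (k+1) * (1 - s / om (k+1)) * (1 - s)) ≤ ∫⁻ x, ‖fderiv ℝ f x‖ₑ := by
  have hω := om_pos (k+1)
  set ω := om (k+1) with hωd
  set c := 1 - s / ω with hcdef
  have hc0 : 0 < c := by rw [hcdef, sub_pos, div_lt_one hω]; exact hsω
  have hcont := hf.continuous
  -- level set lower bounds
  have lev : ∀ t, 0 < t → t < 1 - s → ENNReal.ofReal (ω * c) ≤ volume {x | t < f x} := by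
    intro t ht ht1
    have hM : volume {x | ENNReal.ofReal s ≤ ‖f x - F.indicator 1 x‖ₑ} ≤ ENNReal.ofReal s := by
      have hm : Measurable fun x => ‖f x - F.indicator 1 x‖ₑ :=
        (hcont.measurable.sub (measurable_one.indicator hF)).enorm
      have := (mul_meas_ge_le_lintegral₀ (μ := volume) hm.aemeasurable (ENNReal.ofReal s)).trans hN
      rw [pow_two, ENNReal.ofReal_mul hs.le] at this
      exact (ENNReal.mul_le_mul_iff_right (by simpa using hs) (by simp)).1 this
    have hsub : F ⊆ {x | t < f x} ∪ {x | ENNReal.ofReal s ≤ ‖f x - F.indicator 1 x‖ₑ} := by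
      intro x hx
      by_cases h : t < f x
      · exact Or.inl h
      · refine Or.inr ?_
        rw [Set.mem_ofPred_eq, Set.indicator_of_mem hx, Real.enorm_eq_ofReal_abs]
        apply ENNReal.ofReal_le_ofReal
        rw [abs_sub_comm]
        refine le_trans ?_ (le_abs_self _)
        simp only [Pi.one_apply]; linarith [not_lt.1 h]
    have h1 := (measure_mono hsub).trans (measure_union_le _ _) |>.trans (add_le_add_right hM _)
    rw [hv, ← tsub_le_iff_right, ← ENNReal.ofReal_sub _ hs.le] at h1
    have e : ω * c = ω - s := by rw [hcdef]; field_simp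
    rwa [e]
  have hK : volume (cthickening 1 (tsupport f)) < ⊤ := (hc.isCompact.cthickening (r := 1)).measure_lt_top
  set K1 := cthickening 1 (tsupport f) with hK1
  have hKm : MeasurableSet K1 := isClosed_cthickening.measurableSet
  have hfK : ∀ x, f x ≠ 0 → x ∈ K1 := fun x hx => self_subset_cthickening _ (subset_tsupport f hx)
  have hfint : ∫⁻ x, ENNReal.ofReal (f x) ≠ ⊤ := by
    have : ∫⁻ x, ENNReal.ofReal (f x) ≤ ∫⁻ x, K1.indicator 1 x := by
      refine lintegral_mono fun x => ?_
      by_cases hx : f x = 0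
      · simp [hx]
      · rw [Set.indicator_of_mem (hfK x hx)]; simpa using hf1 x
    rw [lintegral_indicator_one hKm] at this
    exact (this.trans_lt hK).ne
  -- main inequality for each ε
  have main : ∀ ε : ℝ, 0 < ε → ENNReal.ofReal ((k+1) * ω * c * (1 - s)) ≤
      (∫⁻ x, ‖fderiv ℝ f x‖ₑ) + ENNReal.ofReal ε * volume K1 := by
    intro ε hε
    obtain ⟨h, hh, hh1, H⟩ := smooth_osc hf hc hε
    have hfd : Continuous (fderiv ℝ f) := hf.continuous_fderiv (by norm_num)
    set G : Eu (k+1) → ℝ := fun x => f x + K1.indicator (fun x => h * (‖fderiv ℝ f x‖ + ε)) x with hG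
    have hGm : Measurable G := hcont.measurable.add
      (Measurable.indicator (by fun_prop) hKm)
    have hG0 : ∀ x, 0 ≤ K1.indicator (fun x => h * (‖fderiv ℝ f x‖ + ε)) x := fun x =>
      Set.indicator_nonneg (fun x _ => by positivity) x
    have hthick : ∀ t, 0 < t → ∀ x ∈ {x | t < f x}, ∀ y, ‖y‖ < h → x + y ∈ {x | t < G x} := by
      intro t ht x hx y hy
      have hx' : t < f x := hx
      have : x + y ∈ K1 := by
        rw [hK1]
        refine mem_cthickening_of_dist_le _ x _ _ (subset_tsupport f ?_) ?_
        · exact (ht.trans hx').ne'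
        · rw [dist_eq_norm]; simpa using hy.le.trans hh1
      have h2 := H (x + y) x (by simpa using hy)
      change t < G (x + y)
      simp only [hG, Set.indicator_of_mem this]
      linarith
    have hpt : ∀ t ∈ Set.Ioi (0:ℝ), volume {x | t < f x} +
        (Set.Ioo 0 (1-s)).indicator (fun _ => ENNReal.ofReal ((k+1) * ω * c * h)) t ≤ volume {x | t < G x} := by
      intro t ht
      have ht : 0 < t := ht
      by_cases htm : t ∈ Set.Ioo 0 (1 - s)
      · rw [Set.indicator_of_mem htm]
        have hl := lev t ht htm.2
        have hfin : volume {x | t < f x} ≠ ⊤ := by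
          refine ((measure_mono (fun x hx => hfK x ?_)).trans_lt hK).ne
          exact (ht.trans hx).ne'
        set v := (volume {x | t < f x}).toReal with hvdef
        have hvv : volume {x | t < f x} = ENNReal.ofReal v := (ENNReal.ofReal_toReal hfin).symm
        have hcv : ω * c ≤ v := by
          rw [hvv] at hl
          exact (ENNReal.ofReal_le_ofReal_iff ENNReal.toReal_nonneg).1 hl
        have hv0 : 0 < v := (by positivity : 0 < ω * c).trans_le hcv
        set r := (v / ω) ^ (1 / ((k+1 : ℕ) : ℝ)) with hr
        have hr0 : 0 < r := by positivity
        have hrn : r ^ (k+1) = v / ω := by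
          rw [hr, ← Real.rpow_natCast, ← Real.rpow_mul (by positivity)]
          rw [one_div_mul_cancel (by positivity), Real.rpow_one]
        have hrk : c ≤ r ^ k := by
          rcases le_total r 1 with h1 | h1
          · calc c ≤ v / ω := by rw [le_div_iff₀ hω]; linarith
              _ = r ^ (k+1) := hrn.symm
              _ ≤ r ^ k := pow_le_pow_of_le_one hr0.le h1 (by omega)
          · exact le_trans (by rw [hcdef]; have : 0 < s / ω := by positivity
                               linarith) (one_le_pow₀ h1)
        have hbm := bm_ball (n := k+1) (by omega) hr0 hh (A := {x | t < f x}) (C := {x | t < G x})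
          (hcont.measurable measurableSet_Ioi) (hGm measurableSet_Ioi) (by
            rw [hvv, hrn]; congr 1; rw [← hωd, mul_div_cancel₀ _ hω.ne']) (hthick t ht)
        refine le_trans ?_ hbm
        rw [hvv, ← ENNReal.ofReal_add hv0.le (by positivity)]
        apply ENNReal.ofReal_le_ofReal
        have := pow_succ_bound (k := k) hr0.le hh.le
        have e : v = ω * r ^ (k+1) := by rw [hrn, mul_div_cancel₀ _ hω.ne']
        calc v + (k+1) * ω * c * h ≤ v + (k+1) * ω * r ^ k * h := by gcongr
          _ = ω * (r ^ (k+1) + (k+1) * h * r ^ k) := by rw [e]; ring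
          _ ≤ _ := by gcongr
      · rw [Set.indicator_of_notMem htm, add_zero]
        refine measure_mono fun x hx => ?_
        have hx' : t < f x := hx
        exact lt_of_lt_of_le hx' (by simp only [hG]; linarith [hG0 x])
    have L1 := lintegral_eq_lintegral_meas_lt (μ := volume) (f := f) (Eventually.of_forall hf0) hcont.aemeasurable
    have L2 := lintegral_eq_lintegral_meas_lt (μ := volume) (f := G)
      (Eventually.of_forall fun x => add_nonneg (hf0 x) (hG0 x)) hGm.aemeasurable
    have hintg := setLIntegral_mono' (μ := volume) measurableSet_Ioi hpt
    have hmi : Measurable ((Set.Ioo 0 (1-s)).indicator (fun _ : ℝ => ENNReal.ofReal ((k+1) * ω * c * h))) :=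
      measurable_const.indicator measurableSet_Ioo
    rw [lintegral_add_right _ hmi, ← L1, ← L2] at hintg
    have hI : ∫⁻ t in Set.Ioi (0:ℝ), (Set.Ioo 0 (1-s)).indicator (fun _ => ENNReal.ofReal ((k+1) * ω * c * h)) t
        = ENNReal.ofReal h * ENNReal.ofReal ((k+1) * ω * c * (1 - s)) := by
      rw [lintegral_indicator_const measurableSet_Ioo, Measure.restrict_apply measurableSet_Ioo,
        Set.inter_eq_left.2 Set.Ioo_subset_Ioi_self, Real.volume_Ioo, ← ENNReal.ofReal_mul (by positivity),
        ← ENNReal.ofReal_mul hh.le]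
      congr 1; ring
    have hGI : ∫⁻ x, ENNReal.ofReal (G x) ≤ (∫⁻ x, ENNReal.ofReal (f x)) +
        ENNReal.ofReal h * ((∫⁻ x, ‖fderiv ℝ f x‖ₑ) + ENNReal.ofReal ε * volume K1) := by
      have hmc : Measurable fun x => ‖fderiv ℝ f x‖ₑ := hfd.enorm.measurable
      calc ∫⁻ x, ENNReal.ofReal (G x) ≤ ∫⁻ x, (ENNReal.ofReal (f x) + ENNReal.ofReal h *
            (‖fderiv ℝ f x‖ₑ + K1.indicator (fun _ => ENNReal.ofReal ε) x)) := by
            refine lintegral_mono fun x => ?_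
            simp only [hG]
            rw [ENNReal.ofReal_add (hf0 x) (hG0 x)]
            gcongr
            by_cases hx : x ∈ K1
            · rw [Set.indicator_of_mem hx, Set.indicator_of_mem hx, ENNReal.ofReal_mul hh.le,
                ENNReal.ofReal_add (norm_nonneg _) hε.le, ofReal_norm]
            · simp [hx]
        _ = _ := by
            rw [lintegral_add_left hcont.measurable.ennreal_ofReal, lintegral_const_mul' _ _ (by simp),
              lintegral_add_left hmc, lintegral_indicator_const hKm]
    rw [hI] at hintg
    have h3 := (ENNReal.add_le_add_iff_left hfint).1 (hintg.trans hGI)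
    exact (ENNReal.mul_le_mul_iff_right (by simpa using hh) (by simp)).1 h3
  refine ENNReal.le_of_forall_pos_le_add fun ε hε hfin => ?_
  by_cases hz : (volume K1).toReal = 0
  · have h0 : volume K1 = 0 := by
      rcases (ENNReal.toReal_eq_zero_iff _).1 hz with h | h
      · exact h
      · exact absurd h hK.ne
    have := main 1 one_pos
    rw [h0, mul_zero, add_zero] at this
    exact this.trans le_self_add
  · have hz' : 0 < (volume K1).toReal := lt_of_le_of_ne ENNReal.toReal_nonneg (Ne.symm hz)
    have := main (ε / (volume K1).toReal) (by positivity)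
    have e : ENNReal.ofReal (ε / (volume K1).toReal) * volume K1 = ENNReal.ofReal ε := by
      conv_lhs => rw [← ENNReal.ofReal_toReal hK.ne]
      rw [ENNReal.toReal_ofReal ENNReal.toReal_nonneg, ← ENNReal.ofReal_mul (by positivity), div_mul_cancel₀ _ hz]
    rw [e] at this
    simpa using this

lemma isoper {k : ℕ} {F : Set (Eu (k+1))} (hF : MeasurableSet F)
    (hv : volume F = ENNReal.ofReal (om (k+1))) :
    ENNReal.ofReal ((k+1) * om (k+1)) ≤ hc k * perimeter F := by
  have hω := om_pos (k+1)
  by_cases hP : perimeter F = ⊤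
  · rw [hP, ENNReal.mul_top (by simpa using (hc_pos k).ne')]; exact le_top
  have ht1 : Tendsto (fun s : ℝ => ENNReal.ofReal ((k+1) * om (k+1) * (1 - s / om (k+1)) * (1 - s)))
      (nhdsWithin 0 (Set.Ioi 0)) (nhds (ENNReal.ofReal ((k+1) * om (k+1)))) := by
    have : Continuous (fun s : ℝ => ENNReal.ofReal ((k+1) * om (k+1) * (1 - s / om (k+1)) * (1 - s))) :=
      ENNReal.continuous_ofReal.comp (by fun_prop)
    have h := (this.tendsto 0).mono_left (nhdsWithin_le_nhds (s := Set.Ioi 0))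
    simpa using h
  have ht2 : Tendsto (fun s : ℝ => hc k * perimeter F + ENNReal.ofReal (s^2))
      (nhdsWithin 0 (Set.Ioi 0)) (nhds (hc k * perimeter F)) := by
    have : Continuous (fun s : ℝ => hc k * perimeter F + ENNReal.ofReal (s^2)) :=
      continuous_const.add (ENNReal.continuous_ofReal.comp (by fun_prop))
    have h := (this.tendsto 0).mono_left (nhdsWithin_le_nhds (s := Set.Ioi 0))
    simpa using h
  refine le_of_tendsto_of_tendsto ht1 ht2 ?_
  have hev : ∀ᶠ s : ℝ in nhdsWithin 0 (Set.Ioi 0), s ∈ Set.Ioo 0 (min 1 (om (k+1))) :=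
    Ioo_mem_nhdsGT (by positivity)
  filter_upwards [hev] with s hs
  obtain ⟨f, h1, h2, h3, h4, h5, h6⟩ := exists_smooth hF hP (by rw [hv]; simp) (η := s^2) (by have := hs.1; positivity)
  exact (isoper_aux h1 h2 h3 h4 hF hv hs.1 (hs.2.trans_le (min_le_left _ _)) (hs.2.trans_le (min_le_right _ _)) h6).trans h5

lemma norm_polar_sq {n : ℕ} {θ φ : Eu n} (h1 : ‖θ‖ = 1) (h2 : ‖φ‖ = 1) (a b : ℝ) :
    ‖a • θ - b • φ‖ ^ 2 = (a - b) ^ 2 + a * b * ‖θ - φ‖ ^ 2 := by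
  rw [norm_sub_sq_real, norm_sub_sq_real, norm_smul, norm_smul, h1, h2, inner_smul_left, inner_smul_right]
  simp only [Real.norm_eq_abs, mul_one, sq_abs, conj_trivial]
  ring

lemma lintegral_pow_Ioc (k : ℕ) {b : ℝ} (hb : 0 ≤ b) :
    ∫⁻ r in Set.Ioc (0:ℝ) b, ENNReal.ofReal (r ^ k) = ENNReal.ofReal (b ^ (k+1) / (k+1)) := by
  rw [← ofReal_integral_eq_lintegral_ofReal]
  · rw [← intervalIntegral.integral_of_le hb, integral_pow]; simp
  · exact ((continuous_pow k).integrableOn_Icc).mono_set Set.Ioc_subset_Icc_self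
  · exact (ae_restrict_iff' measurableSet_Ioc).2 (Eventually.of_forall fun r hr => pow_nonneg hr.1.le _)

lemma cap_piece {k : ℕ} (e : Sp k) {d : ℝ} (hd0 : 0 < d) (hd : d ≤ 1) {D : Set (Sp k)} (hD : MeasurableSet D)
    (hDb : D ⊆ ball e d) : ∃ (Q : Set (Eu k)) (ψ : Eu k → Sp k), LipschitzWith 1 ψ ∧ D ⊆ ψ '' Q ∧
      Set.MapsTo ψ Q D ∧ ENNReal.ofReal ((1 - d^2/2)^(k+1)) * volume Q ≤ sig k D := by
  obtain ⟨J, hJm, hJn, hJe⟩ := exists_split (e : Eu (k+1)) (by simp)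
  have hL1 : ∀ q, 1 ≤ ‖J (q, 1)‖ := fun q => by
    have := hJn (q, 1); simp only [one_pow] at this
    nlinarith [norm_nonneg (J (q,1)), sq_nonneg ‖q‖]
  have hL0 : ∀ q, ‖J (q, 1)‖ ≠ 0 := fun q => by linarith [hL1 q]
  let ψ : Eu k → Sp k := fun q => ⟨‖J (q, 1)‖⁻¹ • J (q, 1), by
    rw [mem_sphere_zero_iff_norm, norm_smul, norm_inv, norm_norm, inv_mul_cancel₀ (hL0 q)]⟩
  have hψv : ∀ q, (ψ q : Eu (k+1)) = ‖J (q, 1)‖⁻¹ • J (q, 1) := fun q => rfl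
  have hψ1 : ∀ q, ‖J (q, 1)‖ • (ψ q : Eu (k+1)) = J (q, 1) := fun q => by
    rw [hψv, smul_inv_smul₀ (hL0 q)]
  have hsp : ∀ θ : Sp k, ‖(θ : Eu (k+1))‖ = 1 := fun θ => by simp
  have hψL : LipschitzWith 1 ψ := by
    refine LipschitzWith.of_dist_le_mul fun q q' => ?_
    simp only [NNReal.coe_one, one_mul]
    rw [Subtype.dist_eq, dist_eq_norm, dist_eq_norm]
    have h1 := norm_polar_sq (hsp (ψ q)) (hsp (ψ q')) ‖J (q, 1)‖ ‖J (q', 1)‖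
    rw [hψ1, hψ1, ← map_sub, hJn] at h1
    simp only [Prod.mk_sub_mk, sub_self] at h1
    have h2 : 1 ≤ ‖J (q, 1)‖ * ‖J (q', 1)‖ := one_le_mul_of_one_le_of_one_le (hL1 q) (hL1 q')
    refine le_of_sq_le_sq ?_ (norm_nonneg _)
    nlinarith [sq_nonneg (‖J (q, 1)‖ - ‖J (q', 1)‖), sq_nonneg ‖(ψ q : Eu (k+1)) - ψ q'‖]
  have hc0 : 0 < 1 - d^2/2 := by nlinarith
  -- last coordinate
  have hlast : ∀ (θ : Sp k) (p : Eu k × ℝ), J p = θ → ‖(θ : Eu (k+1)) - e‖^2 = 2 - 2 * p.2 := by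
    intro θ p hp
    have h1 := hJn p
    have h2 := hJn (p - (0, 1))
    rw [map_sub, hJe, hp] at h2
    rw [hp, hsp] at h1
    rw [h2]; simp only [Prod.fst_sub, Prod.snd_sub, sub_zero]; nlinarith
  have hdist : ∀ θ ∈ D, ‖(θ : Eu (k+1)) - e‖^2 ≤ d^2 := fun θ hθ => by
    have := hDb hθ
    rw [mem_ball, Subtype.dist_eq, dist_eq_norm] at this
    gcongr
  refine ⟨ψ ⁻¹' D, ψ, hψL, ?_, Set.mapsTo_preimage _ _, ?_⟩
  · intro θ hθ
    obtain ⟨p, hp⟩ := J.surjective (θ : Eu (k+1))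
    have h1 := hlast θ p hp
    have h2 := hdist θ hθ
    have hp2 : 0 < p.2 := by nlinarith
    have hψe : ψ (p.2⁻¹ • p.1) = θ := by
      have e1 : ((p.2⁻¹ • p.1, 1) : Eu k × ℝ) = p.2⁻¹ • p := by
        ext1 <;> simp [hp2.ne']
      apply Subtype.ext
      rw [hψv, e1, map_smul, hp, norm_smul, hsp, mul_one, norm_inv, inv_inv, smul_smul, Real.norm_of_nonneg hp2.le,
        mul_inv_cancel₀ hp2.ne', one_smul]
    exact ⟨_, by rw [Set.mem_preimage, hψe]; exact hθ, hψe⟩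
  · set Q := ψ ⁻¹' D with hQ
    have hQm : MeasurableSet Q := hψL.continuous.measurable hD
    -- cone
    let S : Set (Eu k × ℝ) := {p | p.2 ∈ Set.Ioc (0:ℝ) 1 ∧ p.2⁻¹ • p.1 ∈ Q}
    have hSm : MeasurableSet S := by
      refine MeasurableSet.inter (measurable_snd measurableSet_Ioc) ?_
      have : Measurable fun p : Eu k × ℝ => p.2⁻¹ • p.1 := measurable_snd.inv.smul measurable_fst
      exact this hQm
    have hSv : volume S = volume Q * ENNReal.ofReal (1 / (k+1)) := by
      rw [Measure.volume_eq_prod, Measure.prod_apply_symm hSm]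
      have : ∀ s : ℝ, volume ((fun x : Eu k => (x, s)) ⁻¹' S) =
          (Set.Ioc (0:ℝ) 1).indicator (fun s => volume Q * ENNReal.ofReal (s^k)) s := by
        intro s
        by_cases hs : s ∈ Set.Ioc (0:ℝ) 1
        · rw [Set.indicator_of_mem hs]
          have e1 : ((fun x : Eu k => (x, s)) ⁻¹' S) = (fun x : Eu k => s⁻¹ • x) ⁻¹' Q := by
            ext x; simp [S, hs.1, hs.2]
          rw [e1, Measure.addHaar_preimage_smul _ (inv_ne_zero hs.1.ne'), finrank_euclideanSpace_fin, mul_comm, inv_pow,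
            inv_inv, abs_of_nonneg (pow_nonneg hs.1.le _)]
        · rw [Set.indicator_of_notMem hs]
          have e1 : ((fun x : Eu k => (x, s)) ⁻¹' S) = ∅ := by
            ext x; simp only [S, Set.mem_preimage, Set.mem_ofPred_eq, Set.mem_empty_iff_false, iff_false]
            exact fun h => hs h.1
          rw [e1, measure_empty]
      simp_rw [this]
      rw [lintegral_indicator measurableSet_Ioc, lintegral_const_mul _ (by fun_prop), lintegral_pow_Ioc _ zero_le_one]
      simp
    set Co : Set (Eu (k+1)) := J.symm ⁻¹' S with hCo
    have hCom : MeasurableSet Co := J.symm.continuous.measurable hSm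
    have hCv : volume Co = volume S := by
      rw [← hJm.measure_preimage hCom.nullMeasurableSet]
      congr 1; ext p; simp [hCo]
    have hpol := lintegral_polar (Co.indicator 1) (measurable_one.indicator hCom)
    rw [lintegral_indicator_one hCom] at hpol
    have hle : ∀ θ : Sp k, (∫⁻ r in Set.Ioi (0:ℝ), ENNReal.ofReal (r^k) * Co.indicator 1 (r • (θ : Eu (k+1)))) ≤
        D.indicator (fun _ => ENNReal.ofReal ((1 - d^2/2)⁻¹^(k+1) / (k+1))) θ := by
      intro θ
      have hmem : ∀ r, 0 < r → r • (θ : Eu (k+1)) ∈ Co → θ ∈ D ∧ r ≤ (1 - d^2/2)⁻¹ := by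
        intro r hr hmem
        obtain ⟨p, hp⟩ : ∃ p, p = J.symm (r • (θ : Eu (k+1))) := ⟨_, rfl⟩
        have hpS : p ∈ S := by rw [hp]; exact hmem
        have hJp : J p = r • (θ : Eu (k+1)) := by rw [hp]; simp
        obtain ⟨⟨hs0, hs1⟩, hq⟩ := hpS
        have e1 : ((p.2⁻¹ • p.1, 1) : Eu k × ℝ) = p.2⁻¹ • p := by
          ext1 <;> simp [hs0.ne']
        have e2 : J (p.2⁻¹ • p.1, 1) = (p.2⁻¹ * r) • (θ : Eu (k+1)) := by
          rw [e1, map_smul, hJp, smul_smul]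
        have e3 : ‖J (p.2⁻¹ • p.1, 1)‖ = p.2⁻¹ * r := by
          rw [e2, norm_smul, hsp, mul_one, Real.norm_of_nonneg (by positivity)]
        have hψe : ψ (p.2⁻¹ • p.1) = θ := by
          apply Subtype.ext
          rw [hψv, e3, e2, inv_smul_smul₀ (by positivity)]
        have hθ : θ ∈ D := by rw [← hψe]; exact hq
        refine ⟨hθ, ?_⟩
        have h3 := hlast θ (r⁻¹ • p) (by rw [map_smul, hJp, inv_smul_smul₀ hr.ne'])
        have h4 := hdist θ hθ
        simp only [Prod.smul_snd, smul_eq_mul] at h3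
        have h5 : 1 - d^2/2 ≤ r⁻¹ := by
          have : r⁻¹ * p.2 ≤ r⁻¹ * 1 := by gcongr
          linarith
        rw [le_inv_comm₀ hr hc0]; exact h5
      by_cases hθ : θ ∈ D
      · rw [Set.indicator_of_mem hθ, ← lintegral_pow_Ioc _ (by positivity),
          ← lintegral_indicator measurableSet_Ioi, ← lintegral_indicator measurableSet_Ioc]
        refine lintegral_mono fun r => ?_
        by_cases hr : r ∈ Set.Ioi (0:ℝ)
        · rw [Set.indicator_of_mem hr]
          by_cases hr2 : r • (θ : Eu (k+1)) ∈ Co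
          · rw [Set.indicator_of_mem hr2, Set.indicator_of_mem (show r ∈ Set.Ioc 0 (1 - d^2/2)⁻¹ from ⟨hr, (hmem r hr hr2).2⟩)]; simp
          · rw [Set.indicator_of_notMem hr2]; simp
        · rw [Set.indicator_of_notMem hr]; simp
      · rw [Set.indicator_of_notMem hθ]
        rw [← lintegral_zero (μ := volume.restrict (Set.Ioi (0:ℝ)))]
        refine setLIntegral_mono' measurableSet_Ioi fun r hr => ?_
        rw [Set.indicator_of_notMem (fun h => hθ (hmem r hr h).1)]; simp
    have := lintegral_mono (μ := sig k) hle
    rw [← hpol, hCv, hSv, lintegral_indicator_const hD] at this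
    have e5 : (1 - d^2/2)⁻¹^(k+1) / (k+1) = (1 - d^2/2)⁻¹^(k+1) * (1 / ((k:ℝ)+1)) := by ring
    rw [e5, ENNReal.ofReal_mul (by positivity), mul_right_comm] at this
    have hk : (0:ℝ) < 1 / (k+1) := by positivity
    have hk' : ENNReal.ofReal (1 / ((k:ℝ)+1)) ≠ 0 := (ENNReal.ofReal_pos.2 hk).ne'
    have h6 := (ENNReal.mul_le_mul_iff_left hk' ENNReal.ofReal_ne_top).1 this
    calc ENNReal.ofReal ((1 - d^2/2)^(k+1)) * volume Q
        ≤ ENNReal.ofReal ((1 - d^2/2)^(k+1)) * (ENNReal.ofReal ((1 - d^2/2)⁻¹^(k+1)) * sig k D) := by gcongr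
      _ = sig k D := by
        rw [← mul_assoc, ← ENNReal.ofReal_mul (by positivity), ← mul_pow, mul_inv_cancel₀ hc0.ne']; simp

lemma graph_piece {k : ℕ} {R : Sp k → ℝ} {τ : NNReal} (hR : LipschitzWith τ R) (hlo : ∀ θ, 1/2 ≤ R θ)
    (e : Sp k) {d : ℝ} (hd0 : 0 < d) (hd : d ≤ 1) {D : Set (Sp k)} (hD : MeasurableSet D)
    (hDb : D ⊆ ball e d) :
    ENNReal.ofReal ((1 - d^2/2)^(k+1)) * ((hc k : ℝ≥0∞) * μH[(k:ℝ)] ((fun θ : Sp k => R θ • (θ : Eu (k+1))) '' D)) ≤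
    ENNReal.ofReal ((1 + 4 * τ * d)^k) * ∫⁻ θ in D, ENNReal.ofReal (√((R θ)^2 + τ^2) ^ k) ∂(sig k) := by
  obtain ⟨Q, ψ, hψ, hsub, hmap, hvol⟩ := cap_piece e hd0 hd hD hDb
  set M := R e + τ * d with hM
  have hRM : ∀ θ ∈ D, R θ ≤ M := fun θ hθ => by
    have h1 := hR.dist_le_mul θ e
    have h2 := (mem_ball.1 (hDb hθ)).le
    rw [Real.dist_eq] at h1
    have h3 : (τ:ℝ) * dist θ e ≤ τ * d := by gcongr
    have := le_abs_self (R θ - R e)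
    linarith
  have hMR : ∀ θ ∈ D, M ≤ R θ + 2 * (τ * d) := fun θ hθ => by
    have h1 := hR.dist_le_mul θ e
    have h2 := (mem_ball.1 (hDb hθ)).le
    rw [Real.dist_eq] at h1
    have h3 : (τ:ℝ) * dist θ e ≤ τ * d := by gcongr
    have := neg_abs_le (R θ - R e)
    linarith
  have hsp : ∀ θ : Sp k, ‖(θ : Eu (k+1))‖ = 1 := fun θ => by simp
  have hM0 : 0 < M := by have := hlo e; have : 0 ≤ τ * d := by positivity
                         linarith
  have hLip : LipschitzOnWith (Real.toNNReal √(M^2 + τ^2)) ((fun θ : Sp k => R θ • (θ : Eu (k+1))) ∘ ψ) Q := by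
    refine LipschitzOnWith.of_dist_le_mul fun q hq q' hq' => ?_
    rw [Real.coe_toNNReal _ (Real.sqrt_nonneg _)]
    simp only [Function.comp]
    have h1 := norm_polar_sq (hsp (ψ q)) (hsp (ψ q')) (R (ψ q)) (R (ψ q'))
    have h2 := hψ.dist_le_mul q q'
    have h3 := hR.dist_le_mul (ψ q) (ψ q')
    simp only [NNReal.coe_one, one_mul] at h2
    have h4 : dist (R (ψ q)) (R (ψ q')) ≤ τ * dist q q' := h3.trans (by gcongr)
    rw [Real.dist_eq] at h4
    rw [Subtype.dist_eq, dist_eq_norm] at h2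
    rw [dist_eq_norm]
    refine le_of_sq_le_sq ?_ (by positivity)
    rw [h1, mul_pow, Real.sq_sqrt (by positivity), add_mul, add_comm]
    have h5 : (R (ψ q) - R (ψ q'))^2 ≤ τ^2 * dist q q' ^ 2 := by
      rw [← mul_pow, ← sq_abs]; gcongr
    have h6 : R (ψ q) * R (ψ q') ≤ M ^ 2 := by
      rw [pow_two]
      exact mul_le_mul (hRM _ (hmap hq)) (hRM _ (hmap hq')) (by linarith [hlo (ψ q')]) hM0.le
    have h7 : ‖(ψ q : Eu (k+1)) - ψ q'‖^2 ≤ dist q q' ^ 2 := by gcongr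
    have h8 : 0 ≤ R (ψ q) * R (ψ q') := mul_nonneg (by linarith [hlo (ψ q)]) (by linarith [hlo (ψ q')])
    gcongr
  have h1 := hLip.hausdorffMeasure_image_le (d := (k:ℝ)) (by positivity)
  have h2 : μH[(k:ℝ)] ((fun θ : Sp k => R θ • (θ : Eu (k+1))) '' D) ≤
      ENNReal.ofReal (√(M^2 + τ^2) ^ k) * μH[(k:ℝ)] Q := by
    refine (measure_mono ?_).trans (h1.trans (le_of_eq ?_))
    · rw [Set.image_comp]; exact Set.image_mono hsub
    · rw [ENNReal.rpow_natCast, ENNReal.ofReal_pow (Real.sqrt_nonneg _)]; rfl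
  calc _ ≤ ENNReal.ofReal ((1 - d^2/2)^(k+1)) * ((hc k : ℝ≥0∞) * (ENNReal.ofReal (√(M^2 + τ^2) ^ k) * μH[(k:ℝ)] Q)) := by gcongr
    _ = ENNReal.ofReal (√(M^2 + τ^2) ^ k) * (ENNReal.ofReal ((1 - d^2/2)^(k+1)) * volume Q) := by
      rw [hc_vol_apply]; ring
    _ ≤ ENNReal.ofReal (√(M^2 + τ^2) ^ k) * sig k D := by gcongr
    _ = ∫⁻ θ in D, ENNReal.ofReal (√(M^2 + τ^2) ^ k) ∂(sig k) := by rw [setLIntegral_const]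
    _ ≤ ∫⁻ θ in D, ENNReal.ofReal ((1 + 4 * τ * d)^k) * ENNReal.ofReal (√((R θ)^2 + τ^2) ^ k) ∂(sig k) := by
      refine setLIntegral_mono' hD fun θ hθ => ?_
      rw [← ENNReal.ofReal_mul (by positivity), ← mul_pow]
      apply ENNReal.ofReal_le_ofReal
      gcongr
      have hx : 0 ≤ τ * d := by positivity
      rw [← Real.sqrt_sq (by positivity : 0 ≤ 1 + 4 * τ * d), ← Real.sqrt_mul (by positivity)]
      apply Real.sqrt_le_sqrt
      have a1 : M ≤ (1 + 4 * τ * d) * R θ := by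
        have := hMR θ hθ; have := hlo θ
        nlinarith
      have a2 : (τ:ℝ)^2 ≤ (1 + 4 * τ * d)^2 * τ^2 := by
        refine le_mul_of_one_le_left (by positivity) (one_le_pow₀ (by nlinarith))
      have a3 : M^2 ≤ ((1 + 4 * τ * d) * R θ)^2 := by gcongr
      nlinarith
    _ = _ := lintegral_const_mul' _ _ (by simp)

lemma graph_meas {k : ℕ} {R : Sp k → ℝ} {τ : NNReal} (hR : LipschitzWith τ R) (hlo : ∀ θ, 1/2 ≤ R θ) :
    (hc k : ℝ≥0∞) * μH[(k:ℝ)] (Set.range (fun θ : Sp k => R θ • (θ : Eu (k+1)))) ≤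
      ∫⁻ θ, ENNReal.ofReal (√((R θ)^2 + τ^2) ^ k) ∂(sig k) := by
  have main : ∀ d : ℝ, 0 < d → d ≤ 1 →
      ENNReal.ofReal ((1 - d^2/2)^(k+1)) * ((hc k : ℝ≥0∞) * μH[(k:ℝ)] (Set.range (fun θ : Sp k => R θ • (θ : Eu (k+1))))) ≤
      ENNReal.ofReal ((1 + 4 * τ * d)^k) * ∫⁻ θ, ENNReal.ofReal (√((R θ)^2 + τ^2) ^ k) ∂(sig k) := by
    intro d hd0 hd
    have : Nonempty (Sp k) := (NormedSpace.sphere_nonempty.2 zero_le_one).to_subtype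
    let c : ℕ → Sp k := TopologicalSpace.denseSeq _
    let D : ℕ → Set (Sp k) := disjointed fun i => ball (c i) d
    have hDm : ∀ i, MeasurableSet (D i) := MeasurableSet.disjointed fun i => measurableSet_ball
    have hDb : ∀ i, D i ⊆ ball (c i) d := disjointed_subset _
    have hDU : ⋃ i, D i = Set.univ := by
      rw [iUnion_disjointed, Set.eq_univ_iff_forall]
      intro x
      obtain ⟨i, hi⟩ := (TopologicalSpace.denseRange_denseSeq (Sp k)).exists_dist_lt x hd0
      exact Set.mem_iUnion.2 ⟨i, hi⟩
    have h1 : μH[(k:ℝ)] (Set.range (fun θ : Sp k => R θ • (θ : Eu (k+1)))) ≤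
        ∑' i, μH[(k:ℝ)] ((fun θ : Sp k => R θ • (θ : Eu (k+1))) '' D i) := by
      rw [← Set.image_univ, ← hDU, Set.image_iUnion]
      exact measure_iUnion_le _
    calc _ ≤ ENNReal.ofReal ((1 - d^2/2)^(k+1)) * ((hc k : ℝ≥0∞) * ∑' i, μH[(k:ℝ)] ((fun θ : Sp k => R θ • (θ : Eu (k+1))) '' D i)) := by gcongr
      _ = ∑' i, ENNReal.ofReal ((1 - d^2/2)^(k+1)) * ((hc k : ℝ≥0∞) * μH[(k:ℝ)] ((fun θ : Sp k => R θ • (θ : Eu (k+1))) '' D i)) := by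
        rw [ENNReal.tsum_mul_left, ENNReal.tsum_mul_left]
      _ ≤ ∑' i, ENNReal.ofReal ((1 + 4 * τ * d)^k) * ∫⁻ θ in D i, ENNReal.ofReal (√((R θ)^2 + τ^2) ^ k) ∂(sig k) :=
        ENNReal.tsum_le_tsum fun i => graph_piece hR hlo (c i) hd0 hd (hDm i) (hDb i)
      _ = _ := by
        rw [ENNReal.tsum_mul_left, ← lintegral_iUnion hDm (disjoint_disjointed _), hDU, Measure.restrict_univ]
  set X := (hc k : ℝ≥0∞) * μH[(k:ℝ)] (Set.range (fun θ : Sp k => R θ • (θ : Eu (k+1))))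
  set Y := ∫⁻ θ, ENNReal.ofReal (√((R θ)^2 + τ^2) ^ k) ∂(sig k)
  have t1 : Tendsto (fun d : ℝ => ENNReal.ofReal ((1 - d^2/2)^(k+1)) * X) (nhdsWithin 0 (Set.Ioi 0)) (nhds (1 * X)) := by
    refine ENNReal.Tendsto.mul_const ?_ (Or.inl one_ne_zero)
    have : Continuous fun d : ℝ => ENNReal.ofReal ((1 - d^2/2)^(k+1)) := ENNReal.continuous_ofReal.comp (by fun_prop)
    have h := (this.tendsto 0).mono_left (nhdsWithin_le_nhds (s := Set.Ioi 0))
    simpa using h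
  have t2 : Tendsto (fun d : ℝ => ENNReal.ofReal ((1 + 4 * τ * d)^k) * Y) (nhdsWithin 0 (Set.Ioi 0)) (nhds (1 * Y)) := by
    refine ENNReal.Tendsto.mul_const ?_ (Or.inl one_ne_zero)
    have : Continuous fun d : ℝ => ENNReal.ofReal ((1 + 4 * τ * d)^k) := ENNReal.continuous_ofReal.comp (by fun_prop)
    have h := (this.tendsto 0).mono_left (nhdsWithin_le_nhds (s := Set.Ioi 0))
    simpa using h
  rw [one_mul] at t1 t2
  refine le_of_tendsto_of_tendsto t1 t2 ?_
  have hev : ∀ᶠ s : ℝ in nhdsWithin 0 (Set.Ioi 0), s ∈ Set.Ioo (0:ℝ) 1 := Ioo_mem_nhdsGT (by positivity)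
  filter_upwards [hev] with d hd
  exact main d hd.1 hd.2.le

lemma essBoundary_subset_frontier {n : ℕ} (E : Set (Eu n)) : essBoundary E ⊆ frontier E := by
  intro x hx
  by_contra h
  have : x ∈ interior E ∨ x ∈ interior Eᶜ := by
    rw [frontier_eq_closure_inter_closure, Set.mem_inter_iff, not_and_or] at h
    rcases h with h | h
    · right; rwa [interior_compl]
    · left; rwa [← compl_compl E, interior_compl]
  rcases this with h | h
  · refine hx.2 ?_
    obtain ⟨ε, hε, hb⟩ := Metric.isOpen_iff.1 isOpen_interior x h
    refine tendsto_const_nhds.congr' ?_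
    filter_upwards [Ioo_mem_nhdsGT hε] with r hr
    have : E ∩ ball x r = ball x r := Set.inter_eq_right.2 (((ball_subset_ball hr.2.le).trans hb).trans interior_subset)
    rw [this, div_self]
    exact (ENNReal.toReal_pos (measure_ball_pos _ _ hr.1).ne' measure_ball_lt_top.ne).ne'
  · refine hx.1 ?_
    obtain ⟨ε, hε, hb⟩ := Metric.isOpen_iff.1 isOpen_interior x h
    refine tendsto_const_nhds.congr' ?_
    filter_upwards [Ioo_mem_nhdsGT hε] with r hr
    have : E ∩ ball x r = ∅ := by
      ext y
      simp only [Set.mem_inter_iff, Set.mem_empty_iff_false, iff_false, not_and]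
      intro h1 h2
      exact (interior_subset (hb (ball_subset_ball hr.2.le h2))) h1
    rw [this]; simp

lemma perimeter_le_graph {k : ℕ} {R : Sp k → ℝ} {τ : NNReal} (hR : LipschitzWith τ R) (hlo : ∀ θ, 1/2 ≤ R θ)
    {E : Set (Eu (k+1))} (hE : frontier E ⊆ Set.range (fun θ : Sp k => R θ • (θ : Eu (k+1)))) :
    (hc k : ℝ≥0∞) * perimeter E ≤ ∫⁻ θ, ENNReal.ofReal (√((R θ)^2 + τ^2) ^ k) ∂(sig k) := by
  refine le_trans ?_ (graph_meas hR hlo)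
  unfold perimeter
  have : (((k+1 : ℕ) : ℝ) - 1) = k := by push_cast; ring
  rw [this]
  gcongr
  exact (essBoundary_subset_frontier E).trans hE

lemma sig_univ' (k : ℕ) : sig k Set.univ = ENNReal.ofReal ((k+1) * om (k+1)) := by
  rw [sig_univ, vol_unit, ENNReal.ofReal_mul (by positivity)]
  congr 1
  rw [← ENNReal.ofReal_natCast]; push_cast; rfl

lemma perimeter_ball (k : ℕ) : (hc k : ℝ≥0∞) * perimeter (ball (0 : Eu (k+1)) 1) = ENNReal.ofReal ((k+1) * om (k+1)) := by
  refine le_antisymm ?_ (isoper measurableSet_ball (vol_unit _))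
  have := perimeter_le_graph (k := k) (R := fun _ => 1) (τ := 0) (LipschitzWith.const 1) (fun _ => by norm_num)
    (E := ball 0 1) (by
      rw [frontier_ball _ one_ne_zero]
      intro x hx
      exact ⟨⟨x, hx⟩, by simp⟩)
  rw [← sig_univ']
  refine this.trans (le_of_eq ?_)
  simp only [one_pow, NNReal.coe_zero, ne_eq, OfNat.ofNat_ne_zero, not_false_eq_true, zero_pow, add_zero, Real.sqrt_one, ENNReal.ofReal_one, lintegral_const, one_mul]

/-- The Riesz kernel. -/
def Kz {n : ℕ} (α : ℝ) (z : Eu n) : ℝ≥0∞ := ENNReal.ofReal (‖z‖ ^ (α - (n:ℝ)))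

lemma Kz_meas {n : ℕ} (α : ℝ) : Measurable (Kz (n := n) α) := by
  unfold Kz; fun_prop

lemma Kz_sub_comm {n : ℕ} (α : ℝ) (x y : Eu n) : Kz α (x - y) = Kz α (y - x) := by
  unfold Kz; rw [norm_sub_rev]

/-- The Riesz potential. -/
def pot {n : ℕ} (α : ℝ) (g : Eu n → ℝ≥0∞) (x : Eu n) : ℝ≥0∞ := ∫⁻ y, g y * Kz α (x - y)

/-- The bilinear Riesz form. -/
def VV {n : ℕ} (α : ℝ) (f g : Eu n → ℝ≥0∞) : ℝ≥0∞ := ∫⁻ x, f x * pot α g x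

lemma pot_meas {n : ℕ} (α : ℝ) {g : Eu n → ℝ≥0∞} (hg : Measurable g) : Measurable (pot α g) := by
  have hm : Measurable fun p : Eu n × Eu n => g p.2 * Kz α (p.1 - p.2) :=
    (hg.comp measurable_snd).mul ((Kz_meas α).comp (measurable_fst.sub measurable_snd))
  exact hm.lintegral_prod_right'

lemma rieszEnergy_eq {n : ℕ} (α : ℝ) {E : Set (Eu n)} (hE : MeasurableSet E) :
    rieszEnergy α E = VV α (E.indicator 1) (E.indicator 1) := by
  unfold rieszEnergy VV pot
  rw [← lintegral_indicator hE]
  refine lintegral_congr fun x => ?_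
  by_cases hx : x ∈ E
  · rw [Set.indicator_of_mem hx, Set.indicator_of_mem hx, ← lintegral_indicator hE, Pi.one_apply, one_mul]
    refine lintegral_congr fun y => ?_
    by_cases hy : y ∈ E
    · rw [Set.indicator_of_mem hy, Set.indicator_of_mem hy, Pi.one_apply, one_mul]; rfl
    · simp [hy]
  · simp [hx]

lemma VV_comm {n : ℕ} (α : ℝ) {f g : Eu n → ℝ≥0∞} (hf : Measurable f) (hg : Measurable g) :
    VV α f g = VV α g f := by
  unfold VV pot
  have hm1 : ∀ x : Eu n, Measurable fun y => g y * Kz α (x - y) := fun x =>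
    hg.mul ((Kz_meas α).comp (measurable_const.sub measurable_id))
  have hm2 : ∀ x : Eu n, Measurable fun y => f y * Kz α (x - y) := fun x =>
    hf.mul ((Kz_meas α).comp (measurable_const.sub measurable_id))
  simp_rw [← lintegral_const_mul _ (hm1 _), ← lintegral_const_mul _ (hm2 _)]
  rw [lintegral_lintegral_swap]
  · refine lintegral_congr fun x => lintegral_congr fun y => ?_
    rw [Kz_sub_comm]; ring
  · have hm : Measurable fun p : Eu n × Eu n => f p.1 * (g p.2 * Kz α (p.1 - p.2)) :=
      (hf.comp measurable_fst).mul ((hg.comp measurable_snd).mul ((Kz_meas α).comp (measurable_fst.sub measurable_snd)))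
    exact hm.aemeasurable

lemma lintegral_Kz_ball {k : ℕ} {α : ℝ} (hα : 0 < α) {b : ℝ} (hb : 0 < b) :
    ∫⁻ z in ball (0 : Eu (k+1)) b, Kz α z = ENNReal.ofReal (b ^ α / α) * sig k Set.univ := by
  rw [← lintegral_indicator measurableSet_ball, lintegral_polar _ ((Kz_meas α).indicator measurableSet_ball)]
  have : ∀ θ : Sp k, (∫⁻ r in Set.Ioi (0:ℝ), ENNReal.ofReal (r^k) * (ball (0 : Eu (k+1)) b).indicator (Kz α) (r • (θ : Eu (k+1))))
      = ENNReal.ofReal (b ^ α / α) := by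
    intro θ
    have hsp : ‖(θ : Eu (k+1))‖ = 1 := by simp
    have h1 : ∀ r ∈ Set.Ioi (0:ℝ), ENNReal.ofReal (r^k) * (ball (0 : Eu (k+1)) b).indicator (Kz α) (r • (θ : Eu (k+1)))
        = (Set.Iio b).indicator (fun r => ENNReal.ofReal (r ^ (α - 1))) r := by
      intro r hr
      have hr : 0 < r := hr
      have hn : ‖r • (θ : Eu (k+1))‖ = r := by rw [norm_smul, hsp, mul_one, Real.norm_of_nonneg hr.le]
      by_cases hrb : r < b
      · rw [Set.indicator_of_mem (by rwa [mem_ball_zero_iff, hn]), Set.indicator_of_mem (show r ∈ Set.Iio b from hrb)]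
        unfold Kz
        rw [hn, ← ENNReal.ofReal_mul (by positivity), ← Real.rpow_natCast, ← Real.rpow_add hr]
        congr 2; push_cast; ring
      · rw [Set.indicator_of_notMem (by rwa [mem_ball_zero_iff, hn]), Set.indicator_of_notMem (show r ∉ Set.Iio b from hrb), mul_zero]
    rw [setLIntegral_congr_fun measurableSet_Ioi h1, lintegral_indicator measurableSet_Iio, Measure.restrict_restrict measurableSet_Iio]
    have hI : Set.Iio b ∩ Set.Ioi 0 = Set.Ioo 0 b := by ext; simp [and_comm]
    rw [hI, ← restrict_Ioo_eq_restrict_Ioc.symm, ← ofReal_integral_eq_lintegral_ofReal]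
    · rw [← intervalIntegral.integral_of_le hb.le, integral_rpow (Or.inl (by linarith)), sub_add_cancel, Real.zero_rpow hα.ne', sub_zero]
    · exact (intervalIntegrable_iff_integrableOn_Ioc_of_le hb.le).1 (intervalIntegral.intervalIntegrable_rpow' (by linarith))
    · exact (ae_restrict_iff' measurableSet_Ioc).2 (Eventually.of_forall fun r hr => Real.rpow_nonneg hr.1.le _)
  simp_rw [this]
  rw [lintegral_const]

/-- bound for potentials. -/
def Lam (k : ℕ) (α M : ℝ) : NNReal := Real.toNNReal (1 / α * ((k+1) * om (k+1))) + Real.toNNReal M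

lemma pot_le {k : ℕ} {α : ℝ} (hα : 0 < α) (hαn : α < (k+1 : ℕ)) {M : ℝ} {g : Eu (k+1) → ℝ≥0∞}
    (hg : Measurable g) (hg1 : ∀ x, g x ≤ 1)
    (hM : ∫⁻ x, g x ≤ ENNReal.ofReal M) (x : Eu (k+1)) : pot α g x ≤ Lam k α M := by
  have h0 : (∫⁻ y, (ball (0 : Eu (k+1)) 1).indicator (Kz α) (x - y)) = ENNReal.ofReal (1 / α * ((k+1) * om (k+1))) := by
    rw [lintegral_sub_left_eq_self (μ := volume) (fun y => (ball (0 : Eu (k+1)) 1).indicator (Kz α) y) x,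
      lintegral_indicator measurableSet_ball, lintegral_Kz_ball hα one_pos, sig_univ', Real.one_rpow,
      ← ENNReal.ofReal_mul (by positivity)]
  calc pot α g x ≤ ∫⁻ y, ((ball (0 : Eu (k+1)) 1).indicator (Kz α) (x - y) + g y) := by
        refine lintegral_mono fun y => ?_
        by_cases h : x - y ∈ ball (0 : Eu (k+1)) 1
        · rw [Set.indicator_of_mem h]
          calc g y * Kz α (x - y) ≤ 1 * Kz α (x - y) := by gcongr; exact hg1 y
            _ ≤ _ := by rw [one_mul]; exact le_self_add
        · have h1 : 1 ≤ ‖x - y‖ := by simpa [mem_ball_zero_iff] using h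
          have h2 : Kz α (x - y) ≤ 1 := by
            unfold Kz
            rw [ENNReal.ofReal_le_one]
            exact Real.rpow_le_one_of_one_le_of_nonpos h1 (by linarith)
          calc g y * Kz α (x - y) ≤ g y * 1 := by gcongr
            _ ≤ _ := by rw [mul_one]; exact le_add_self
    _ = (∫⁻ y, (ball (0 : Eu (k+1)) 1).indicator (Kz α) (x - y)) + ∫⁻ y, g y := lintegral_add_right _ hg
    _ ≤ _ := by
      rw [h0]; unfold Lam; push_cast
      gcongr
      · rfl
      · exact hM

lemma VV_le_Lam {k : ℕ} {α : ℝ} (hα : 0 < α) (hαn : α < (k+1 : ℕ)) {M : ℝ} {g h : Eu (k+1) → ℝ≥0∞}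
    (hg : Measurable g) (hg1 : ∀ x, g x ≤ 1) (hh : Measurable h)
    (hM : ∫⁻ x, g x ≤ ENNReal.ofReal M) : VV α h g ≤ Lam k α M * ∫⁻ x, h x := by
  rw [← lintegral_const_mul _ hh]
  refine lintegral_mono fun x => ?_
  rw [mul_comm]; gcongr; exact pot_le hα hαn hg hg1 hM x

lemma VV_le {k : ℕ} {α : ℝ} (hα : 0 < α) (hαn : α < (k+1 : ℕ)) {M : ℝ} {f g h : Eu (k+1) → ℝ≥0∞}
    (hf : Measurable f) (hg : Measurable g) (hh : Measurable h) (hf1 : ∀ x, f x ≤ 1) (hg1 : ∀ x, g x ≤ 1)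
    (hfM : ∫⁻ x, f x ≤ ENNReal.ofReal M) (hgM : ∫⁻ x, g x ≤ ENNReal.ofReal M) (H : ∀ x, f x ≤ g x + h x) :
    VV α f f ≤ VV α g g + 2 * Lam k α M * ∫⁻ x, h x := by
  have step : ∀ u : Eu (k+1) → ℝ≥0∞, Measurable u → (∀ x, u x ≤ 1) → ∫⁻ x, u x ≤ ENNReal.ofReal M →
      VV α f u ≤ VV α g u + Lam k α M * ∫⁻ x, h x := by
    intro u hu hu1 huM
    have : VV α f u ≤ VV α g u + VV α h u := by
      unfold VV
      have hm : Measurable fun x => g x * pot α u x := hg.mul (pot_meas α hu)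
      rw [← lintegral_add_left hm]
      refine lintegral_mono fun x => ?_
      rw [← add_mul]; gcongr; exact H x
    exact this.trans (by gcongr; exact VV_le_Lam hα hαn hu hu1 hh huM)
  have h1 := step f hf hf1 hfM
  rw [VV_comm α hg hf] at h1
  have h2 := step g hg hg1 hgM
  calc _ ≤ _ := h1
    _ ≤ _ := add_le_add_left h2 _
    _ = _ := by ring

/-- radial measure `r^k dr` on `(0,∞)`. -/
def nu (k : ℕ) : Measure ℝ := (volume.restrict (Set.Ioi (0:ℝ))).withDensity (fun r => ENNReal.ofReal (r^k))

instance (k : ℕ) : SFinite (nu k) := by unfold nu; infer_instance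

lemma lintegral_nu {k : ℕ} (g : ℝ → ℝ≥0∞) (hg : Measurable g) :
    ∫⁻ r, g r ∂(nu k) = ∫⁻ r in Set.Ioi (0:ℝ), ENNReal.ofReal (r^k) * g r := by
  unfold nu
  rw [lintegral_withDensity_eq_lintegral_mul _ (by fun_prop) hg]; rfl

lemma lintegral_pol {k : ℕ} (g : Eu (k+1) → ℝ≥0∞) (hg : Measurable g) :
    ∫⁻ x, g x = ∫⁻ θ : Sp k, ∫⁻ r, g (r • (θ : Eu (k+1))) ∂(nu k) ∂(sig k) := by
  rw [lintegral_polar g hg]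
  refine lintegral_congr fun θ => ?_
  have hm : Measurable fun r : ℝ => g (r • (θ : Eu (k+1))) := hg.comp (by fun_prop)
  rw [lintegral_nu _ hm]

/-- Radialization of a ray. -/
def rad {k : ℕ} (u : ℝ → ℝ≥0∞) (x : Eu (k+1)) : ℝ≥0∞ := u ‖x‖

lemma rad_meas {k : ℕ} {u : ℝ → ℝ≥0∞} (hu : Measurable u) : Measurable (rad (k := k) u) := hu.comp measurable_norm

lemma pot_rad {k : ℕ} (α : ℝ) {u : ℝ → ℝ≥0∞} (hu : Measurable u) (θ φ : Sp k) (r : ℝ) :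
    pot α (rad u) (r • (θ : Eu (k+1))) = pot α (rad u) (r • (φ : Eu (k+1))) := by
  have hn : ‖(θ : Eu (k+1))‖ = ‖(φ : Eu (k+1))‖ := by simp
  have hT := Submodule.reflection_sub hn
  set T := (Submodule.span ℝ {(θ : Eu (k+1)) - φ})ᗮ.reflection
  unfold pot
  have hm : Measurable fun y : Eu (k+1) => rad u y * Kz α (r • (φ : Eu (k+1)) - y) :=
    (rad_meas hu).mul ((Kz_meas α).comp (measurable_const.sub measurable_id))
  rw [← T.measurePreserving.lintegral_comp hm]
  refine lintegral_congr fun y => ?_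
  have h1 : rad u (T y) = rad u y := by unfold rad; rw [LinearIsometryEquiv.norm_map]
  have h2 : Kz α (r • (φ : Eu (k+1)) - T y) = Kz α (r • (θ : Eu (k+1)) - y) := by
    unfold Kz
    rw [← hT, ← map_smul, ← map_sub, LinearIsometryEquiv.norm_map]
  rw [h1, h2]

lemma VV_rad {k : ℕ} (α : ℝ) {u : ℝ → ℝ≥0∞} (hu : Measurable u) (θ : Sp k) :
    VV α (rad (k := k) u) (rad u) = sig k Set.univ * ∫⁻ r, u r * pot α (rad u) (r • (θ : Eu (k+1))) ∂(nu k) := by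
  unfold VV
  have hm : Measurable fun x : Eu (k+1) => rad u x * pot α (rad u) x := (rad_meas hu).mul (pot_meas α (rad_meas hu))
  rw [lintegral_pol _ hm]
  have : ∀ φ : Sp k, ∫⁻ r, rad u (r • (φ : Eu (k+1))) * pot α (rad u) (r • (φ : Eu (k+1))) ∂(nu k) =
      ∫⁻ r, u r * pot α (rad u) (r • (θ : Eu (k+1))) ∂(nu k) := by
    intro φ
    have hm1 : Measurable fun r : ℝ => rad u (r • (φ : Eu (k+1))) * pot α (rad u) (r • (φ : Eu (k+1))) := hm.comp (by fun_prop)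
    have hm2 : Measurable fun r : ℝ => u r * pot α (rad u) (r • (θ : Eu (k+1))) :=
      hu.mul ((pot_meas α (rad_meas hu)).comp (by fun_prop))
    rw [lintegral_nu _ hm1, lintegral_nu _ hm2]
    refine setLIntegral_congr_fun measurableSet_Ioi fun r hr => ?_
    have hr : 0 < r := hr
    rw [pot_rad α hu φ θ]
    have : rad u (r • (φ : Eu (k+1))) = u r := by
      unfold rad; rw [norm_smul, Real.norm_of_nonneg hr.le]; simp
    rw [this]
  simp_rw [this]
  rw [lintegral_const, mul_comm]

lemma pot_rad_pol {k : ℕ} (α : ℝ) {u : ℝ → ℝ≥0∞} (hu : Measurable u) (x : Eu (k+1)) :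
    pot α (rad u) x = ∫⁻ φ : Sp k, ∫⁻ s, u s * Kz α (x - s • (φ : Eu (k+1))) ∂(nu k) ∂(sig k) := by
  unfold pot
  have hm : Measurable fun y : Eu (k+1) => rad u y * Kz α (x - y) :=
    (rad_meas hu).mul ((Kz_meas α).comp (measurable_const.sub measurable_id))
  rw [lintegral_pol _ hm]
  refine lintegral_congr fun φ => ?_
  have hm1 : Measurable fun r : ℝ => rad u (r • (φ : Eu (k+1))) * Kz α (x - r • (φ : Eu (k+1))) := hm.comp (by fun_prop)
  have hm2 : Measurable fun r : ℝ => u r * Kz α (x - r • (φ : Eu (k+1))) :=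
      hu.mul ((Kz_meas α).comp (by fun_prop))
  rw [lintegral_nu _ hm1, lintegral_nu _ hm2]
  refine setLIntegral_congr_fun measurableSet_Ioi fun r hr => ?_
  have hr : 0 < r := hr
  have : rad u (r • (φ : Eu (k+1))) = u r := by
      unfold rad; rw [norm_smul, Real.norm_of_nonneg hr.le]; simp
  rw [this]

lemma Kz_swap {k : ℕ} (α : ℝ) (θ φ : Sp k) (r s : ℝ) :
    Kz α (r • (θ : Eu (k+1)) - s • (φ : Eu (k+1))) = Kz α (r • (φ : Eu (k+1)) - s • (θ : Eu (k+1))) := by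
  unfold Kz
  congr 2
  have h1 := norm_polar_sq (θ := (θ : Eu (k+1))) (φ := (φ : Eu (k+1))) (by simp) (by simp) r s
  have h2 := norm_polar_sq (θ := (φ : Eu (k+1))) (φ := (θ : Eu (k+1))) (by simp) (by simp) r s
  rw [norm_sub_rev (φ : Eu (k+1)), ← h1] at h2
  exact ((sq_eq_sq₀ (norm_nonneg _) (norm_nonneg _)).1 h2).symm

/-- The measure on `S × S × ℝ × ℝ`. -/
def mu4 (k : ℕ) : Measure ((Sp k × Sp k) × (ℝ × ℝ)) := ((sig k).prod (sig k)).prod ((nu k).prod (nu k))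

lemma mu4_iter {k : ℕ} (g : (Sp k × Sp k) × (ℝ × ℝ) → ℝ≥0∞) (hg : Measurable g) :
    ∫⁻ p, g p ∂(mu4 k) = ∫⁻ θ, ∫⁻ φ, ∫⁻ r, ∫⁻ s, g ((θ, φ), (r, s)) ∂(nu k) ∂(nu k) ∂(sig k) ∂(sig k) := by
  unfold mu4
  rw [lintegral_prod _ hg.aemeasurable, lintegral_prod _ (Measurable.lintegral_prod_right' hg).aemeasurable]
  refine lintegral_congr fun θ => lintegral_congr fun φ => ?_
  rw [lintegral_prod]
  exact (hg.comp measurable_prodMk_left).aemeasurable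

lemma mu4_swap {k : ℕ} (g : (Sp k × Sp k) × (ℝ × ℝ) → ℝ≥0∞) (hg : Measurable g) :
    ∫⁻ p, g (p.1.swap, p.2) ∂(mu4 k) = ∫⁻ p, g p ∂(mu4 k) := by
  have : MeasurePreserving (Prod.map Prod.swap id) (mu4 k) (mu4 k) :=
    MeasurePreserving.prod Measure.measurePreserving_swap (MeasurePreserving.id _)
  exact this.lintegral_comp hg

/-- The quadruple error term. -/
def ZZ {k : ℕ} (α : ℝ) (g : Eu (k+1) → ℝ) : ℝ≥0∞ := ∫⁻ p : (Sp k × Sp k) × (ℝ × ℝ),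
  ‖g (p.2.1 • (p.1.1 : Eu (k+1))) - g (p.2.1 • (p.1.2 : Eu (k+1)))‖ₑ *
  ‖g (p.2.2 • (p.1.1 : Eu (k+1))) - g (p.2.2 • (p.1.2 : Eu (k+1)))‖ₑ *
  Kz α (p.2.1 • (p.1.1 : Eu (k+1)) - p.2.2 • (p.1.2 : Eu (k+1))) ∂(mu4 k)

lemma average {k : ℕ} (α : ℝ) {g : Eu (k+1) → ℝ} (hg : Measurable g) (hg0 : ∀ x, 0 ≤ g x) :
    ∫⁻ θ : Sp k, VV α (rad (k := k) fun r => ENNReal.ofReal (g (r • (θ : Eu (k+1)))))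
      (rad fun r => ENNReal.ofReal (g (r • (θ : Eu (k+1))))) ∂(sig k) ≤
    sig k Set.univ * (VV α (fun x => ENNReal.ofReal (g x)) (fun x => ENNReal.ofReal (g x)) + ZZ α g) := by
  have hgo : Measurable fun x => ENNReal.ofReal (g x) := hg.ennreal_ofReal
  -- measurable building blocks
  have m11 : Measurable fun p : (Sp k × Sp k) × (ℝ × ℝ) => p.2.1 • (p.1.1 : Eu (k+1)) := by fun_prop
  have m12 : Measurable fun p : (Sp k × Sp k) × (ℝ × ℝ) => p.2.1 • (p.1.2 : Eu (k+1)) := by fun_prop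
  have m21 : Measurable fun p : (Sp k × Sp k) × (ℝ × ℝ) => p.2.2 • (p.1.1 : Eu (k+1)) := by fun_prop
  have m22 : Measurable fun p : (Sp k × Sp k) × (ℝ × ℝ) => p.2.2 • (p.1.2 : Eu (k+1)) := by fun_prop
  have mK : Measurable fun p : (Sp k × Sp k) × (ℝ × ℝ) => Kz α (p.2.1 • (p.1.1 : Eu (k+1)) - p.2.2 • (p.1.2 : Eu (k+1))) :=
    (Kz_meas α).comp (m11.sub m22)
  let gA : (Sp k × Sp k) × (ℝ × ℝ) → ℝ≥0∞ := fun p =>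
    ENNReal.ofReal (g (p.2.1 • (p.1.1 : Eu (k+1)))) * ENNReal.ofReal (g (p.2.2 • (p.1.1 : Eu (k+1)))) * Kz α (p.2.1 • (p.1.1 : Eu (k+1)) - p.2.2 • (p.1.2 : Eu (k+1)))
  let gV : (Sp k × Sp k) × (ℝ × ℝ) → ℝ≥0∞ := fun p =>
    ENNReal.ofReal (g (p.2.1 • (p.1.1 : Eu (k+1)))) * ENNReal.ofReal (g (p.2.2 • (p.1.2 : Eu (k+1)))) * Kz α (p.2.1 • (p.1.1 : Eu (k+1)) - p.2.2 • (p.1.2 : Eu (k+1)))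
  have hgA : Measurable gA := ((hgo.comp m11).mul (hgo.comp m21)).mul mK
  have hgV : Measurable gV := ((hgo.comp m11).mul (hgo.comp m22)).mul mK
  have hA : ∫⁻ θ : Sp k, VV α (rad (k := k) fun r => ENNReal.ofReal (g (r • (θ : Eu (k+1)))))
      (rad fun r => ENNReal.ofReal (g (r • (θ : Eu (k+1))))) ∂(sig k) = sig k Set.univ * ∫⁻ p, gA p ∂(mu4 k) := by
    rw [mu4_iter _ hgA, ← lintegral_const_mul' _ _ (measure_ne_top _ _)]
    refine lintegral_congr fun θ => ?_
    have hu : Measurable fun r : ℝ => ENNReal.ofReal (g (r • (θ : Eu (k+1)))) := hgo.comp (by fun_prop)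
    rw [VV_rad α hu θ]
    congr 1
    simp_rw [pot_rad_pol α hu]
    have e1 : ∀ r : ℝ, ENNReal.ofReal (g (r • (θ : Eu (k+1)))) * ∫⁻ φ : Sp k, ∫⁻ s, ENNReal.ofReal (g (s • (θ : Eu (k+1)))) * Kz α (r • (θ : Eu (k+1)) - s • (φ : Eu (k+1))) ∂(nu k) ∂(sig k)
       = ∫⁻ φ : Sp k, ∫⁻ s, gA ((θ, φ), (r, s)) ∂(nu k) ∂(sig k) := by
      intro r
      rw [← lintegral_const_mul' _ _ (by simp)]
      refine lintegral_congr fun φ => ?_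
      rw [← lintegral_const_mul' _ _ (by simp)]
      refine lintegral_congr fun s => ?_
      simp only [gA]; ring
    simp_rw [e1]
    rw [lintegral_lintegral_swap]
    have hm : Measurable fun q : (ℝ × Sp k) × ℝ => gA ((θ, q.1.2), (q.1.1, q.2)) := hgA.comp (by fun_prop)
    exact hm.lintegral_prod_right'.aemeasurable
  have hV : VV α (fun x => ENNReal.ofReal (g x)) (fun x => ENNReal.ofReal (g x)) = ∫⁻ p, gV p ∂(mu4 k) := by
    rw [mu4_iter _ hgV]
    unfold VV
    have hm : Measurable fun x => ENNReal.ofReal (g x) * pot α (fun x => ENNReal.ofReal (g x)) x := hgo.mul (pot_meas α hgo)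
    rw [lintegral_pol _ hm]
    refine lintegral_congr fun θ => ?_
    have e1 : ∀ r : ℝ, ENNReal.ofReal (g (r • (θ : Eu (k+1)))) * pot α (fun x => ENNReal.ofReal (g x)) (r • (θ : Eu (k+1)))
       = ∫⁻ φ : Sp k, ∫⁻ s, gV ((θ, φ), (r, s)) ∂(nu k) ∂(sig k) := by
      intro r
      unfold pot
      have hm2 : Measurable fun y => ENNReal.ofReal (g y) * Kz α (r • (θ : Eu (k+1)) - y) :=
        hgo.mul ((Kz_meas α).comp (measurable_const.sub measurable_id))
      rw [lintegral_pol _ hm2, ← lintegral_const_mul' _ _ (by simp)]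
      refine lintegral_congr fun φ => ?_
      rw [← lintegral_const_mul' _ _ (by simp)]
      refine lintegral_congr fun s => ?_
      simp only [gV]; ring
    simp_rw [e1]
    rw [lintegral_lintegral_swap]
    have hm : Measurable fun q : (ℝ × Sp k) × ℝ => gV ((θ, q.1.2), (q.1.1, q.2)) := hgV.comp (by fun_prop)
    exact hm.lintegral_prod_right'.aemeasurable
  rw [hA, hV]
  gcongr
  have hpt : ∀ p : (Sp k × Sp k) × (ℝ × ℝ), gA p + gA (p.1.swap, p.2) ≤ (gV p + gV (p.1.swap, p.2)) +
      ‖g (p.2.1 • (p.1.1 : Eu (k+1))) - g (p.2.1 • (p.1.2 : Eu (k+1)))‖ₑ *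
      ‖g (p.2.2 • (p.1.1 : Eu (k+1))) - g (p.2.2 • (p.1.2 : Eu (k+1)))‖ₑ *
      Kz α (p.2.1 • (p.1.1 : Eu (k+1)) - p.2.2 • (p.1.2 : Eu (k+1))) := by
    rintro ⟨⟨θ, φ⟩, r, s⟩
    simp only [gA, gV, Prod.swap_prod_mk]
    rw [Kz_swap α φ θ r s, ← add_mul, ← add_mul, ← add_mul]
    refine mul_le_mul_left ?_ _
    have a1 := hg0 (r • (θ : Eu (k+1)))
    have a2 := hg0 (r • (φ : Eu (k+1)))
    have a3 := hg0 (s • (θ : Eu (k+1)))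
    have a4 := hg0 (s • (φ : Eu (k+1)))
    rw [Real.enorm_eq_ofReal_abs, Real.enorm_eq_ofReal_abs, ← ENNReal.ofReal_mul a1, ← ENNReal.ofReal_mul a1, ← ENNReal.ofReal_mul a2, ← ENNReal.ofReal_mul a2,
      ← ENNReal.ofReal_mul (abs_nonneg _), ← ENNReal.ofReal_add (by positivity) (by positivity), ← ENNReal.ofReal_add (by positivity) (by positivity),
      ← ENNReal.ofReal_add (by positivity) (by positivity)]
    apply ENNReal.ofReal_le_ofReal
    rw [← abs_mul]
    have := le_abs_self ((g (r • (θ : Eu (k+1))) - g (r • (φ : Eu (k+1)))) * (g (s • (θ : Eu (k+1))) - g (s • (φ : Eu (k+1)))))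
    linarith
  have hI := lintegral_mono (μ := mu4 k) hpt
  have hs : Measurable fun p : (Sp k × Sp k) × (ℝ × ℝ) => ((p.1.swap, p.2) : (Sp k × Sp k) × (ℝ × ℝ)) := by fun_prop
  have hsum : Measurable fun p => gV p + gV (p.1.swap, p.2) := hgV.add (hgV.comp hs)
  rw [lintegral_add_left hgA, lintegral_add_left hsum, lintegral_add_left hgV, mu4_swap _ hgA, mu4_swap _ hgV, ← two_mul, ← two_mul] at hI
  have h3 : 2 * ∫⁻ p, gA p ∂(mu4 k) ≤ 2 * ((∫⁻ p, gV p ∂(mu4 k)) + ZZ α g) := by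
    rw [mul_add]
    refine hI.trans ?_
    gcongr
    rw [two_mul]; exact le_self_add
  exact (ENNReal.mul_le_mul_iff_right (by norm_num) (by norm_num)).1 h3

lemma nu_Iio {k : ℕ} {b : ℝ} (hb : 0 ≤ b) : nu k (Set.Iio b) = ENNReal.ofReal (b ^ (k+1) / (k+1)) := by
  rw [← lintegral_indicator_one measurableSet_Iio, lintegral_nu _ (measurable_one.indicator measurableSet_Iio),
    ← lintegral_pow_Ioc k hb, restrict_Ioo_eq_restrict_Ioc.symm, ← lintegral_indicator measurableSet_Ioi, ← lintegral_indicator measurableSet_Ioo]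
  refine lintegral_congr fun r => ?_
  by_cases h1 : 0 < r <;> by_cases h2 : r < b <;> simp [Set.indicator, h1, h2]

lemma nu_Iic_zero {k : ℕ} : nu k (Set.Iic 0) = 0 := by
  unfold nu
  rw [withDensity_apply _ measurableSet_Iic, Measure.restrict_restrict measurableSet_Iic]
  have : Set.Iic (0:ℝ) ∩ Set.Ioi 0 = ∅ := by ext; simp
  rw [this]; simp

lemma nu_ae_pos {k : ℕ} : ∀ᵐ r ∂(nu k), 0 < r := by
  rw [ae_iff]; convert nu_Iic_zero (k := k) using 2; ext; simp

lemma ray_bound {k : ℕ} {v : ℝ → ℝ≥0∞} (hv : Measurable v) (hv1 : ∀ r, v r ≤ 1) (hlo : ∀ r, 0 < r → r ≤ 1/2 → v r = 1)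
    (hhi : ∀ r, 3/2 ≤ r → v r = 0) {ε : ℝ≥0∞}
    (hε : ∀ r s, 1/2 < r → r < s → s < 3/2 → v s ≤ v r + ε) {R : ℝ} (hR : 0 ≤ R)
    (hw : ∫⁻ r, v r ∂(nu k) = nu k (Set.Iio R)) {l : ℝ} (hl : 0 < l) :
    ∫⁻ r, ((Set.Iio R).indicator 1 r - v r) ∂(nu k) ≤
      ENNReal.ofReal l + ENNReal.ofReal ((3/2)^(k+1)/(k+1)) * ((∫⁻ r, v r * (1 - v r) ∂(nu k)) / ENNReal.ofReal l + ε) := by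
  set C0 := ENNReal.ofReal ((3/2)^(k+1)/((k:ℝ)+1))
  have hC0 : C0 = nu k (Set.Iio (3/2)) := (nu_Iio (by norm_num)).symm
  set T := ∫⁻ r, v r * (1 - v r) ∂(nu k)
  set a := ∫⁻ r, ((Set.Iio R).indicator 1 r - v r) ∂(nu k)
  have hfin : nu k (Set.Iio R) ≠ ⊤ := by rw [nu_Iio hR]; simp
  have ha1 : a = ∫⁻ r in Set.Iio R, (1 - v r) ∂(nu k) := by
    rw [← lintegral_indicator measurableSet_Iio]
    refine lintegral_congr fun r => ?_
    by_cases h : r ∈ Set.Iio R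
    · simp only [Set.indicator_of_mem h, Pi.one_apply]
    · simp only [Set.indicator_of_notMem h]; simp
  have ha2 : a = ∫⁻ r in Set.Ici R, v r ∂(nu k) := by
    have h1 : (∫⁻ r in Set.Iio R, v r ∂(nu k)) + a = nu k (Set.Iio R) := by
      rw [ha1, ← lintegral_add_left hv]
      have : ∀ r, v r + (1 - v r) = 1 := fun r => add_tsub_cancel_of_le (hv1 r)
      simp_rw [this]; simp
    have h2 : (∫⁻ r in Set.Iio R, v r ∂(nu k)) + ∫⁻ r in Set.Ici R, v r ∂(nu k) = nu k (Set.Iio R) := by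
      rw [← hw, ← lintegral_add_compl v measurableSet_Iio (μ := nu k) (A := Set.Iio R), Set.compl_Iio]
    have h3 : (∫⁻ r in Set.Iio R, v r ∂(nu k)) ≠ ⊤ := by
      refine ne_top_of_le_ne_top hfin (h1 ▸ le_self_add)
    exact (ENNReal.add_right_inj h3).1 (h1.trans h2.symm)
  have hafin : a ≠ ⊤ := by
    rw [ha1]
    refine ne_top_of_le_ne_top hfin ?_
    calc _ ≤ ∫⁻ r in Set.Iio R, 1 ∂(nu k) := lintegral_mono fun r => tsub_le_self
      _ = _ := by simp
  have hm1 : Measurable fun r => 1 - v r := measurable_const.sub hv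
  have key : a * a ≤ C0 * (T + ε * a) := by
    calc a * a = ∫⁻ r in Set.Iio R, (1 - v r) * (∫⁻ s in Set.Ici R, v s ∂(nu k)) ∂(nu k) := by
          rw [lintegral_mul_const _ hm1, ← ha1, ← ha2]
      _ ≤ ∫⁻ r in Set.Iio R, (v r * (1 - v r) + ε * (1 - v r)) * C0 ∂(nu k) := by
          refine setLIntegral_mono_ae' measurableSet_Iio ?_
          filter_upwards [nu_ae_pos (k := k)] with r hr0 hr
          have hr : r < R := hr
          rcases le_or_gt r (1/2) with h | h
          · rw [hlo r hr0 h]; simp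
          · have : (∫⁻ s in Set.Ici R, v s ∂(nu k)) ≤ (v r + ε) * C0 := by
              rw [hC0, ← lintegral_indicator measurableSet_Ici, ← lintegral_indicator_const measurableSet_Iio]
              refine lintegral_mono fun s => ?_
              by_cases hs : s ∈ Set.Ici R
              · rw [Set.indicator_of_mem hs]
                by_cases hs2 : s ∈ Set.Iio (3/2:ℝ)
                · rw [Set.indicator_of_mem hs2]
                  exact hε r s h (hr.trans_le hs) hs2
                · rw [hhi s (not_lt.1 hs2)]; simp
              · simp [hs]
            calc _ ≤ (1 - v r) * ((v r + ε) * C0) := by gcongr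
              _ = _ := by ring
      _ ≤ ((∫⁻ r, v r * (1 - v r) ∂(nu k)) + ε * a) * C0 := by
          have hm2 : Measurable fun r => v r * (1 - v r) + ε * (1 - v r) := (hv.mul hm1).add (hm1.const_mul _)
          have hm3 : Measurable fun r => v r * (1 - v r) := hv.mul hm1
          rw [lintegral_mul_const _ hm2, lintegral_add_left hm3, lintegral_const_mul _ hm1, ← ha1]
          gcongr
          exact Measure.restrict_le_self
      _ = _ := mul_comm _ _
  rcases le_or_gt a (ENNReal.ofReal l) with h | h
  · exact h.trans le_self_add
  · refine le_trans ?_ le_add_self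
    have hl0 : ENNReal.ofReal l ≠ 0 := (ENNReal.ofReal_pos.2 hl).ne'
    have ha0 : a ≠ 0 := (lt_of_le_of_lt zero_le h).ne'
    have hT : T ≤ T / ENNReal.ofReal l * a := by
      calc T = T / ENNReal.ofReal l * ENNReal.ofReal l := (ENNReal.div_mul_cancel hl0 (by simp)).symm
        _ ≤ _ := by gcongr
    have h4 : a * a ≤ (C0 * (T / ENNReal.ofReal l + ε)) * a := by
      calc a * a ≤ C0 * (T / ENNReal.ofReal l * a + ε * a) := key.trans (by gcongr)
        _ = _ := by ring
    exact (ENNReal.mul_le_mul_iff_left ha0 hafin).1 h4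

lemma lint_scale {k : ℕ} (g : Eu (k+1) → ℝ≥0∞) (hg : Measurable g) {ρ : ℝ} (hρ : 0 < ρ) :
    ∫⁻ x, g x = ENNReal.ofReal (ρ^(k+1)) * ∫⁻ x, g (ρ • x) := by
  have h := Measure.map_addHaar_smul (volume : Measure (Eu (k+1))) (inv_ne_zero hρ.ne')
  have h2 : ∫⁻ x, g (ρ • x) ∂(Measure.map (ρ⁻¹ • ·) (volume : Measure (Eu (k+1)))) = ∫⁻ x, g x := by
    have hm : Measurable fun x : Eu (k+1) => g (ρ • x) := hg.comp (by fun_prop)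
    have hm2 : Measurable fun x : Eu (k+1) => ρ⁻¹ • x := by fun_prop
    rw [lintegral_map hm hm2]
    refine lintegral_congr fun x => ?_
    rw [smul_smul, mul_inv_cancel₀ hρ.ne', one_smul]
  rw [← h2, h, lintegral_smul_measure]
  simp [hρ.le, abs_of_pos hρ]

section PW
open scoped Pointwise

lemma ind_smul {k : ℕ} (E : Set (Eu (k+1))) {ρ : ℝ} (hρ : 0 < ρ) (x : Eu (k+1)) :
    (ρ • E).indicator (1 : Eu (k+1) → ℝ≥0∞) (ρ • x) = E.indicator 1 x := by
  by_cases h : x ∈ E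
  · rw [Set.indicator_of_mem h, Set.indicator_of_mem (Set.smul_mem_smul_set h)]; rfl
  · rw [Set.indicator_of_notMem h, Set.indicator_of_notMem]
    rwa [Set.smul_mem_smul_set_iff₀ hρ.ne']

lemma riesz_scale {k : ℕ} (α : ℝ) {E : Set (Eu (k+1))} (hE : MeasurableSet E) {ρ : ℝ} (hρ : 0 < ρ) :
    rieszEnergy α (ρ • E) = ENNReal.ofReal (ρ ^ ((k+1:ℕ) + α : ℝ)) * rieszEnergy α E := by
  have hE' : MeasurableSet (ρ • E) := hE.const_smul₀ ρ
  rw [rieszEnergy_eq α hE, rieszEnergy_eq α hE']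
  have i1 : Measurable ((ρ • E).indicator (1 : Eu (k+1) → ℝ≥0∞)) := measurable_one.indicator hE'
  have i2 : Measurable (E.indicator (1 : Eu (k+1) → ℝ≥0∞)) := measurable_one.indicator hE
  have hp : ∀ x : Eu (k+1), pot α ((ρ • E).indicator 1) (ρ • x) = ENNReal.ofReal (ρ ^ α) * pot α (E.indicator 1) x := by
    intro x
    unfold pot
    have hm : Measurable fun y : Eu (k+1) => (ρ • E).indicator (1 : Eu (k+1) → ℝ≥0∞) y * Kz α (ρ • x - y) :=
      i1.mul ((Kz_meas α).comp (measurable_const.sub measurable_id))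
    have hm2 : Measurable fun y : Eu (k+1) => E.indicator (1 : Eu (k+1) → ℝ≥0∞) y * Kz α (x - y) :=
      i2.mul ((Kz_meas α).comp (measurable_const.sub measurable_id))
    rw [lint_scale _ hm hρ, ← lintegral_const_mul' _ _ ofReal_ne_top, ← lintegral_const_mul _ hm2]
    refine lintegral_congr fun y => ?_
    simp only [Function.comp, ind_smul E hρ, ← smul_sub]
    have : ENNReal.ofReal (ρ^(k+1)) * Kz α (ρ • (x - y)) = ENNReal.ofReal (ρ ^ α) * Kz α (x - y) := by
      unfold Kz
      rw [← ENNReal.ofReal_mul (by positivity), ← ENNReal.ofReal_mul (by positivity), norm_smul, Real.norm_of_nonneg hρ.le,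
        Real.mul_rpow hρ.le (norm_nonneg _), ← mul_assoc, ← Real.rpow_natCast, ← Real.rpow_add hρ]
      congr 4; ring
    rw [mul_left_comm, this]; ring
  unfold VV
  have hm : Measurable fun x : Eu (k+1) => (ρ • E).indicator (1 : Eu (k+1) → ℝ≥0∞) x * pot α ((ρ • E).indicator 1) x :=
    i1.mul (pot_meas α i1)
  have hm2 : Measurable fun x : Eu (k+1) => E.indicator (1 : Eu (k+1) → ℝ≥0∞) x * pot α (E.indicator 1) x :=
    i2.mul (pot_meas α i2)
  rw [lint_scale _ hm hρ]
  simp_rw [hp, ind_smul E hρ]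
  rw [Real.rpow_add hρ, Real.rpow_natCast, ENNReal.ofReal_mul (by positivity), mul_assoc, ← lintegral_const_mul _ hm2]
  congr 1
  refine lintegral_congr fun x => ?_
  ring

lemma ball_smul {k : ℕ} {ρ : ℝ} (hρ : 0 < ρ) : ball (0 : Eu (k+1)) ρ = ρ • ball (0 : Eu (k+1)) 1 := by
  rw [_root_.smul_ball hρ.ne']; simp [abs_of_pos hρ]

end PW

lemma riesz_ball_fin {k : ℕ} {α : ℝ} (hα : 0 < α) (hαn : α < (k+1 : ℕ)) : rieszEnergy α (ball (0 : Eu (k+1)) 1) ≠ ⊤ := by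
  rw [rieszEnergy_eq α measurableSet_ball]
  have hm : Measurable ((ball (0 : Eu (k+1)) 1).indicator (1 : Eu (k+1) → ℝ≥0∞)) := measurable_one.indicator measurableSet_ball
  have hI : ∫⁻ x, (ball (0 : Eu (k+1)) 1).indicator (1 : Eu (k+1) → ℝ≥0∞) x = ENNReal.ofReal (om (k+1)) := by
    rw [lintegral_indicator_one measurableSet_ball, vol_unit]
  refine ne_top_of_le_ne_top ?_ (VV_le_Lam hα hαn hm (fun x => ?_) hm hI.le)
  · rw [hI]; finiteness
  · exact Set.indicator_le_self' (by simp) x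

lemma lint_rad {k : ℕ} {u : ℝ → ℝ≥0∞} (hu : Measurable u) :
    ∫⁻ x, rad (k := k) u x = sig k Set.univ * ∫⁻ r, u r ∂(nu k) := by
  rw [lintegral_pol _ (rad_meas hu)]
  have : ∀ θ : Sp k, ∫⁻ r, rad u (r • (θ : Eu (k+1))) ∂(nu k) = ∫⁻ r, u r ∂(nu k) := by
    intro θ
    refine lintegral_congr_ae ?_
    filter_upwards [nu_ae_pos (k := k)] with r hr
    simp [rad, norm_smul, abs_of_pos hr]
  simp_rw [this]
  rw [lintegral_const, mul_comm]

/-- single-ray version -/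
lemma ray_single {k : ℕ} {α : ℝ} (hα : 0 < α) (hαn : α < (k+1 : ℕ)) : ∃ C : NNReal, ∀ (v : ℝ → ℝ≥0∞) (_ : Measurable v)
    (_ : ∀ r, v r ≤ 1) (_ : ∀ r, 0 < r → r ≤ 1/2 → v r = 1)
    (_ : ∀ r, 3/2 ≤ r → v r = 0) (ε : ℝ≥0∞)
    (_ : ∀ r s, 1/2 < r → r < s → s < 3/2 → v s ≤ v r + ε) (l : ℝ) (_ : 0 < l),
    ENNReal.ofReal ((k+1:ℕ)+α) * (∫⁻ r, v r ∂(nu k)) * rieszEnergy α (ball (0 : Eu (k+1)) 1) ≤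
      VV α (rad (k := k) v) (rad v) + C * (ENNReal.ofReal l + ((∫⁻ r, v r * (1 - v r) ∂(nu k)) / ENNReal.ofReal l + ε))
      + ENNReal.ofReal (α / (k+1:ℕ)) * rieszEnergy α (ball (0 : Eu (k+1)) 1) := by
  set M : ℝ := ((k+1) * om (k+1)) * ((3/2)^(k+1)/((k:ℝ)+1)) with hMdef
  have hM : ENNReal.ofReal M = sig k Set.univ * nu k (Set.Iio (3/2)) := by
    have := om_pos (k+1)
    rw [sig_univ', nu_Iio (by norm_num), hMdef, ENNReal.ofReal_mul (by positivity)]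
  refine ⟨2 * Lam k α M * Real.toNNReal ((k+1) * om (k+1)) * (1 + Real.toNNReal ((3/2)^(k+1)/((k:ℝ)+1))), ?_⟩
  intro v hv hv1 hlo hhi ε hε l hl
  set V := rieszEnergy α (ball (0 : Eu (k+1)) 1)
  set w := ∫⁻ r, v r ∂(nu k) with hw
  have hn : (0:ℝ) < (k+1:ℕ) := by positivity
  have hwle : w ≤ nu k (Set.Iio (3/2)) := by
    rw [← lintegral_indicator_one measurableSet_Iio]
    refine lintegral_mono fun r => ?_
    by_cases h : r ∈ Set.Iio (3/2:ℝ)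
    · rw [Set.indicator_of_mem h]; exact hv1 r
    · rw [hhi r (not_lt.1 h)]; exact zero_le
  have hwfin : w ≠ ⊤ := ne_top_of_le_ne_top (by rw [nu_Iio (by norm_num)]; simp) hwle
  have hwpos : 0 < w.toReal := by
    refine ENNReal.toReal_pos ?_ hwfin
    have : nu k (Set.Iio (1/2)) ≤ w := by
      rw [← lintegral_indicator_one measurableSet_Iio]
      refine lintegral_mono_ae ?_
      filter_upwards [nu_ae_pos (k := k)] with r hr
      by_cases h : r ∈ Set.Iio (1/2:ℝ)
      · rw [hlo r hr (le_of_lt h)]; exact Set.indicator_le_self' (by simp) r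
      · rw [Set.indicator_of_notMem h]; exact zero_le
    refine (lt_of_lt_of_le ?_ this).ne'
    rw [nu_Iio (by norm_num)]
    exact ENNReal.ofReal_pos.2 (by positivity)
  set X : ℝ := (k+1:ℕ) * w.toReal with hX
  have hX0 : 0 < X := by positivity
  set R : ℝ := X ^ (1 / ((k+1:ℕ):ℝ)) with hR
  have hR0 : 0 < R := by positivity
  have hRX : R ^ (k+1) = X := by
    rw [hR, ← Real.rpow_natCast, ← Real.rpow_mul hX0.le, one_div_mul_cancel hn.ne', Real.rpow_one]
  have hwR : w = nu k (Set.Iio R) := by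
    rw [nu_Iio hR0.le, hRX, hX]
    push_cast
    rw [mul_div_cancel_left₀ _ (by positivity), ENNReal.ofReal_toReal hwfin]
  have hray := ray_bound hv hv1 hlo hhi hε hR0.le hwR hl
  have mI : Measurable ((Set.Iio R).indicator (1 : ℝ → ℝ≥0∞)) := measurable_one.indicator measurableSet_Iio
  have mh : Measurable fun r => (Set.Iio R).indicator (1 : ℝ → ℝ≥0∞) r - v r := mI.sub hv
  have hwM : sig k Set.univ * w ≤ ENNReal.ofReal M := by rw [hM]; gcongr
  have h1 := VV_le hα hαn (M := M) (rad_meas (k := k) mI) (rad_meas (k := k) hv) (rad_meas (k := k) mh)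
    (fun x => Set.indicator_le_self' (by simp) _) (fun x => hv1 _)
    (by rw [lint_rad mI, lintegral_indicator_one measurableSet_Iio, ← hwR]; exact hwM) (by rw [lint_rad hv]; exact hwM)
    (fun x => by simpa only [rad] using le_add_tsub)
  have h2 : VV α (rad (k := k) ((Set.Iio R).indicator 1)) (rad ((Set.Iio R).indicator 1)) = ENNReal.ofReal (R ^ ((k+1:ℕ)+α)) * V := by
    rw [← riesz_scale α measurableSet_ball hR0, ← ball_smul hR0, rieszEnergy_eq α measurableSet_ball]
    have : rad (k := k) ((Set.Iio R).indicator 1) = (ball 0 R).indicator 1 := by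
      funext x; simp [rad, Set.indicator]
    rw [this]
  rw [h2, lint_rad mh] at h1
  have hB : ENNReal.ofReal ((k+1:ℕ)+α) * w ≤ ENNReal.ofReal (R ^ ((k+1:ℕ)+α)) + ENNReal.ofReal (α / (k+1:ℕ)) := by
    rw [← ENNReal.ofReal_toReal hwfin, ← ENNReal.ofReal_mul (by positivity), ← ENNReal.ofReal_add (by positivity) (by positivity)]
    refine ENNReal.ofReal_le_ofReal ?_
    have hb := one_add_mul_self_le_rpow_one_add (s := X - 1) (by linarith) (p := ((k+1:ℕ)+α)/(k+1:ℕ))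
      (by rw [le_div_iff₀ hn]; linarith)
    have e1 : (1 + (X - 1)) ^ (((k+1:ℕ)+α)/(k+1:ℕ)) = R ^ ((k+1:ℕ)+α) := by
      rw [hR, ← Real.rpow_mul hX0.le]; congr 1; ring; field_simp
    rw [e1] at hb
    have e2 : ((k+1:ℕ)+α) * w.toReal = 1 + ((k+1:ℕ)+α)/(k+1:ℕ) * (X - 1) + α / (k+1:ℕ) := by
      rw [hX]; field_simp; ring
    linarith
  calc ENNReal.ofReal ((k+1:ℕ)+α) * w * V ≤ ENNReal.ofReal (R ^ ((k+1:ℕ)+α)) * V + ENNReal.ofReal (α / (k+1:ℕ)) * V := by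
        rw [← add_mul]; gcongr
    _ ≤ _ := by
        gcongr
        refine h1.trans ?_
        rw [sig_univ']
        have hc : ENNReal.ofReal l + ENNReal.ofReal ((3/2)^(k+1)/(k+1)) * ((∫⁻ r, v r * (1 - v r) ∂(nu k)) / ENNReal.ofReal l + ε) ≤
            (1 + ENNReal.ofReal ((3/2)^(k+1)/(k+1))) * (ENNReal.ofReal l + ((∫⁻ r, v r * (1 - v r) ∂(nu k)) / ENNReal.ofReal l + ε)) := by
          generalize ENNReal.ofReal l = a
          generalize ENNReal.ofReal ((3/2)^(k+1)/((k:ℝ)+1)) = c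
          generalize (∫⁻ r, v r * (1 - v r) ∂(nu k)) / a + ε = b
          rw [show (1 + c) * (a + b) = (a + c * b) + (b + c * a) by ring]
          exact le_self_add
        refine add_le_add_right ?_ _
        push_cast
        rw [mul_assoc (2 * (Lam k α M : ℝ≥0∞)), mul_assoc (2 * (Lam k α M : ℝ≥0∞)), mul_assoc (ENNReal.ofNNReal _)]
        exact mul_le_mul_right (mul_le_mul_right (hray.trans hc) _) _

/-- integrated version -/
lemma ray_main {k : ℕ} {α : ℝ} (hα : 0 < α) (hαn : α < (k+1 : ℕ)) : ∃ C : NNReal, ∀ (g : Eu (k+1) → ℝ) (_ : Measurable g)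
    (_ : ∀ x, 0 ≤ g x) (_ : ∀ x, g x ≤ 1) (_ : ∀ x, ‖x‖ ≤ 1/2 → g x = 1)
    (_ : ∀ x, 3/2 ≤ ‖x‖ → g x = 0) (ε : Sp k → ℝ≥0∞) (_ : Measurable ε)
    (_ : ∀ (θ : Sp k) (r s : ℝ), 1/2 < r → r < s → s < 3/2 →
      ENNReal.ofReal (g (s • (θ : Eu (k+1)))) ≤ ENNReal.ofReal (g (r • (θ : Eu (k+1)))) + ε θ)
    (δ : ℝ≥0∞) (_ : ENNReal.ofReal (om (k+1)) ≤ (∫⁻ x, ENNReal.ofReal (g x)) + δ) (l : ℝ) (_ : 0 < l),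
    rieszEnergy α (ball (0 : Eu (k+1)) 1) ≤
      VV α (fun x => ENNReal.ofReal (g x)) (fun x => ENNReal.ofReal (g x)) + ZZ α g
       + C * (δ + ENNReal.ofReal l + (∫⁻ x, ENNReal.ofReal (g x) * (1 - ENNReal.ofReal (g x))) / ENNReal.ofReal l + ∫⁻ θ, ε θ ∂(sig k)) := by
  obtain ⟨C, hC⟩ := ray_single hα hαn
  have hom := om_pos (k+1)
  set V := rieszEnergy α (ball (0 : Eu (k+1)) 1)
  have hV : V ≠ ⊤ := riesz_ball_fin hα hαn
  set S := sig k Set.univ with hS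
  have hS0 : S ≠ 0 := by rw [hS, sig_univ']; exact (ENNReal.ofReal_pos.2 (by positivity)).ne'
  have hSt : S ≠ ⊤ := by rw [hS, sig_univ']; simp
  set C1 : ℝ≥0∞ := S⁻¹ * (ENNReal.ofReal ((k+1:ℕ)+α) * V + C * (1 + S))
  have hC1 : C1 ≠ ⊤ := by
    have := ENNReal.inv_ne_top.2 hS0
    simp only [C1]; finiteness
  refine ⟨C1.toNNReal, ?_⟩
  rw [ENNReal.coe_toNNReal hC1]
  intro g hg hg0 hg1 hglo hghi ε hεm hε δ hδ l hl
  set G := ∫⁻ x, ENNReal.ofReal (g x)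
  set T := ∫⁻ x, ENNReal.ofReal (g x) * (1 - ENNReal.ofReal (g x))
  have hgo : Measurable fun x => ENNReal.ofReal (g x) := hg.ennreal_ofReal
  have hgo2 : Measurable fun x => ENNReal.ofReal (g x) * (1 - ENNReal.ofReal (g x)) := hgo.mul (measurable_const.sub hgo)
  have msm : Measurable fun p : Sp k × ℝ => p.2 • (p.1 : Eu (k+1)) := by fun_prop
  have mG : Measurable fun θ : Sp k => ∫⁻ r, ENNReal.ofReal (g (r • (θ : Eu (k+1)))) ∂(nu k) :=
    (hgo.comp msm).lintegral_prod_right'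
  have mT : Measurable fun θ : Sp k => ∫⁻ r, ENNReal.ofReal (g (r • (θ : Eu (k+1)))) * (1 - ENNReal.ofReal (g (r • (θ : Eu (k+1))))) ∂(nu k) :=
    (hgo2.comp msm).lintegral_prod_right'
  have hG : ∫⁻ θ : Sp k, ∫⁻ r, ENNReal.ofReal (g (r • (θ : Eu (k+1)))) ∂(nu k) ∂(sig k) = G := (lintegral_pol _ hgo).symm
  have hT : ∫⁻ θ : Sp k, ∫⁻ r, ENNReal.ofReal (g (r • (θ : Eu (k+1)))) * (1 - ENNReal.ofReal (g (r • (θ : Eu (k+1))))) ∂(nu k) ∂(sig k) = T :=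
    (lintegral_pol _ hgo2).symm
  have h1 : ∀ θ : Sp k, _ := fun θ => hC (fun r => ENNReal.ofReal (g (r • (θ : Eu (k+1))))) (hgo.comp (by fun_prop))
    (fun r => by simpa using hg1 _) (fun r h h' => by rw [hglo _ (by simpa [norm_smul, abs_of_pos h] using h')]; simp)
    (fun r h => by rw [hghi _ (by simpa [norm_smul, abs_of_pos (show 0 < r by linarith)] using h)]; simp) (ε θ) (hε θ) l hl
  have h2 := lintegral_mono (μ := sig k) h1
  have mE : Measurable fun θ : Sp k => (∫⁻ r, ENNReal.ofReal (g (r • (θ : Eu (k+1)))) * (1 - ENNReal.ofReal (g (r • (θ : Eu (k+1))))) ∂(nu k)) / ENNReal.ofReal l + ε θ :=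
    (mT.div_const _).add hεm
  have mE1 : Measurable fun θ : Sp k => ENNReal.ofReal l + ((∫⁻ r, ENNReal.ofReal (g (r • (θ : Eu (k+1)))) * (1 - ENNReal.ofReal (g (r • (θ : Eu (k+1))))) ∂(nu k)) / ENNReal.ofReal l + ε θ) :=
    mE.const_add _
  have mE2 : Measurable fun θ : Sp k => C * (ENNReal.ofReal l + ((∫⁻ r, ENNReal.ofReal (g (r • (θ : Eu (k+1)))) * (1 - ENNReal.ofReal (g (r • (θ : Eu (k+1))))) ∂(nu k)) / ENNReal.ofReal l + ε θ)) :=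
    mE1.const_mul _
  have mD : Measurable fun θ : Sp k => (∫⁻ r, ENNReal.ofReal (g (r • (θ : Eu (k+1)))) * (1 - ENNReal.ofReal (g (r • (θ : Eu (k+1))))) ∂(nu k)) / ENNReal.ofReal l :=
    (mT.div_const _)
  have mG2 : Measurable fun θ : Sp k => ENNReal.ofReal ((k+1:ℕ)+α) * ∫⁻ r, ENNReal.ofReal (g (r • (θ : Eu (k+1)))) ∂(nu k) := mG.const_mul _
  rw [lintegral_mul_const _ mG2, lintegral_const_mul _ mG, hG, lintegral_add_right _ measurable_const, lintegral_add_right _ mE2,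
    lintegral_const_mul _ mE1, lintegral_add_left measurable_const, lintegral_add_left mD, lintegral_const, lintegral_const] at h2
  simp_rw [div_eq_mul_inv] at h2 ⊢
  rw [lintegral_mul_const _ mT, hT] at h2
  have h3 := average α hg hg0
  set Av := ∫⁻ θ : Sp k, VV α (rad (k := k) fun r => ENNReal.ofReal (g (r • (θ : Eu (k+1)))))
      (rad fun r => ENNReal.ofReal (g (r • (θ : Eu (k+1))))) ∂(sig k)
  set Q := VV α (fun x => ENNReal.ofReal (g x)) (fun x => ENNReal.ofReal (g x)) + ZZ α g
  set Ti := T * (ENNReal.ofReal l)⁻¹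
  set Ei := ∫⁻ θ, ε θ ∂(sig k)
  have h4 : S * V + ENNReal.ofReal (α * ((k+1:ℕ):ℝ)⁻¹) * V * S = ENNReal.ofReal ((k+1:ℕ)+α) * ENNReal.ofReal (om (k+1)) * V := by
    have : S + ENNReal.ofReal (α * ((k+1:ℕ):ℝ)⁻¹) * S = ENNReal.ofReal ((k+1:ℕ)+α) * ENNReal.ofReal (om (k+1)) := by
      rw [hS, sig_univ', ← ENNReal.ofReal_mul (by positivity), ← ENNReal.ofReal_mul (by positivity), ← ENNReal.ofReal_add (by positivity) (by positivity)]
      congr 1; push_cast; field_simp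
    rw [← this]; ring
  have h5 : S * V + ENNReal.ofReal (α * ((k+1:ℕ):ℝ)⁻¹) * V * S ≤
      (S * Q + (ENNReal.ofReal ((k+1:ℕ)+α) * V * δ + C * (ENNReal.ofReal l * S + (Ti + Ei)))) + ENNReal.ofReal (α * ((k+1:ℕ):ℝ)⁻¹) * V * S := by
    rw [h4]
    calc _ ≤ ENNReal.ofReal ((k+1:ℕ)+α) * (G + δ) * V := by gcongr
      _ = ENNReal.ofReal ((k+1:ℕ)+α) * G * V + ENNReal.ofReal ((k+1:ℕ)+α) * V * δ := by ring
      _ ≤ (Av + C * (ENNReal.ofReal l * S + (Ti + Ei)) + ENNReal.ofReal (α * ((k+1:ℕ):ℝ)⁻¹) * V * S) + ENNReal.ofReal ((k+1:ℕ)+α) * V * δ := by gcongr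
      _ ≤ (S * Q + C * (ENNReal.ofReal l * S + (Ti + Ei)) + ENNReal.ofReal (α * ((k+1:ℕ):ℝ)⁻¹) * V * S) + ENNReal.ofReal ((k+1:ℕ)+α) * V * δ := by gcongr
      _ = _ := by ring
  have h6 := (ENNReal.add_le_add_iff_right (by finiteness)).1 h5
  have h7 : S * V ≤ S * (Q + C1 * (δ + ENNReal.ofReal l + Ti + Ei)) := by
    refine h6.trans ?_
    rw [mul_add S Q, ← mul_assoc S C1, show S * C1 = ENNReal.ofReal ((k+1:ℕ)+α) * V + C * (1 + S) by
      simp only [C1]; rw [← mul_assoc, ENNReal.mul_inv_cancel hS0 hSt, one_mul]]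
    gcongr
    generalize ENNReal.ofReal l = l'
    generalize ENNReal.ofReal ((k+1:ℕ)+α) * V = b
    rw [show (b + C * (1 + S)) * (δ + l' + Ti + Ei) = (b * δ + C * (l' * S + (Ti + Ei))) + (b * (l' + Ti + Ei) + C * (1 + S) * δ + C * l' + C * S * (Ti + Ei)) by ring]
    exact le_self_add
  exact (ENNReal.mul_le_mul_iff_right hS0 hSt).1 h7

/-- The calibrating vector field. -/
def X0 {k : ℕ} (x : Eu (k+1)) : Eu (k+1) := (2 / (1 + ‖x‖^2)) • x

/-- The calibration defect. -/
def ee {k : ℕ} (f : Eu (k+1) → ℝ) (x : Eu (k+1)) : ℝ := ‖fderiv ℝ f x‖ + fderiv ℝ f x (X0 x)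

lemma norm_X0_le {k : ℕ} (x : Eu (k+1)) : ‖X0 x‖ ≤ 1 := by
  unfold X0
  rw [norm_smul, Real.norm_of_nonneg (by positivity), div_mul_eq_mul_div, div_le_one (by positivity)]
  nlinarith [sq_nonneg (‖x‖ - 1)]

lemma ee_nonneg {k : ℕ} (f : Eu (k+1) → ℝ) (x : Eu (k+1)) : 0 ≤ ee f x := by
  unfold ee
  have h1 := (fderiv ℝ f x).le_opNorm (X0 x)
  have h2 : ‖fderiv ℝ f x‖ * ‖X0 x‖ ≤ ‖fderiv ℝ f x‖ * 1 := by gcongr; exact norm_X0_le x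
  rw [Real.norm_eq_abs] at h1
  linarith [neg_abs_le (fderiv ℝ f x (X0 x))]

lemma cont_X0 {k : ℕ} : Continuous (X0 (k := k)) := by
  change Continuous fun x : Eu (k+1) => (2 / (1 + ‖x‖^2)) • x
  have h : Continuous fun x : Eu (k+1) => 2 / (1 + ‖x‖^2) :=
    Continuous.div continuous_const (by fun_prop) (fun x => by positivity)
  exact h.smul continuous_id

lemma cont_ee {k : ℕ} {f : Eu (k+1) → ℝ} (hf : ContDiff ℝ 1 f) : Continuous (ee f) := by
  unfold ee
  have h1 : Continuous (fderiv ℝ f) := hf.continuous_fderiv one_ne_zero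
  exact h1.norm.add (h1.clm_apply cont_X0)

lemma X0_ray {k : ℕ} {u : Eu (k+1)} (hu : ‖u‖ = 1) {r : ℝ} (hr : 0 < r) : X0 (r • u) = (2 * r / (1 + r^2)) • u := by
  unfold X0
  rw [norm_smul, hu, mul_one, Real.norm_of_nonneg hr.le, smul_smul]
  congr 1; ring

lemma tang_le {E : Type*} [NormedAddCommGroup E] [InnerProductSpace ℝ E] (L : E →L[ℝ] ℝ) {u t : E} (hu : ‖u‖ = 1) (ht : inner ℝ u t = 0) :
    (L u)^2 * ‖t‖^2 + (L t)^2 ≤ ‖L‖^2 * ‖t‖^2 := by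
  set Y := (L u)^2 * ‖t‖^2 + (L t)^2 with hY
  have hY0 : 0 ≤ Y := by positivity
  have h1 := L.le_opNorm (((L u) * ‖t‖^2) • u + (L t) • t)
  have h2 : ‖((L u) * ‖t‖^2) • u + (L t) • t‖^2 = ‖t‖^2 * Y := by
    rw [norm_add_sq_real, inner_smul_left, inner_smul_right, ht, norm_smul, norm_smul, hu, Real.norm_eq_abs, Real.norm_eq_abs, mul_pow, mul_pow, sq_abs, sq_abs, hY]
    simp; ring
  have h3 : L (((L u) * ‖t‖^2) • u + (L t) • t) = Y := by
    rw [map_add, map_smul, map_smul, hY]; simp; ring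
  rw [h3, Real.norm_of_nonneg hY0] at h1
  have h4 : Y^2 ≤ ‖L‖^2 * (‖t‖^2 * Y) := by rw [← h2, ← mul_pow]; gcongr
  rcases hY0.eq_or_lt with h | h
  · rw [← h]; positivity
  · nlinarith

lemma ee_two {k : ℕ} {u : Eu (k+1)} (hu : ‖u‖ = 1) {r : ℝ} (hr : 0 < r) {f : Eu (k+1) → ℝ} : fderiv ℝ f (r • u) u ≤ ee f (r • u) ∧ ‖fderiv ℝ f (r • u)‖ ≤ 3 * ee f (r • u) - fderiv ℝ f (r • u) u
   ∧ ‖fderiv ℝ f (r • u)‖ - |fderiv ℝ f (r • u) u| ≤ ee f (r • u) := by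
  have h0 := ee_nonneg f (r • u)
  have hL := (fderiv ℝ f (r • u)).le_opNorm u
  rw [hu, mul_one, Real.norm_eq_abs] at hL
  have he : ee f (r • u) = ‖fderiv ℝ f (r • u)‖ + (2 * r / (1 + r^2)) * fderiv ℝ f (r • u) u := by
    unfold ee; rw [X0_ray hu hr]; simp
  have c0 : 0 ≤ 2 * r / (1 + r^2) := by positivity
  have c1 : 2 * r / (1 + r^2) ≤ 1 := by rw [div_le_one (by positivity)]; nlinarith [sq_nonneg (r-1)]
  rcases le_total 0 (fderiv ℝ f (r • u) u) with h | h
  · rw [abs_of_nonneg h] at *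
    have := mul_nonneg c0 h
    refine ⟨by linarith, by linarith, by linarith⟩
  · rw [abs_of_nonpos h] at *
    have : fderiv ℝ f (r • u) u ≤ (2 * r / (1 + r^2)) * fderiv ℝ f (r • u) u := by nlinarith
    refine ⟨by linarith, by linarith, by linarith⟩

lemma ee_tang {k : ℕ} {u : Eu (k+1)} (hu : ‖u‖ = 1) {r : ℝ} (hr : 0 < r) {f : Eu (k+1) → ℝ} {t : Eu (k+1)} (ht : inner ℝ u t = 0) {l : ℝ} (hl : 0 < l) :
    |fderiv ℝ f (r • u) t| ≤ ‖t‖ * (l * ee f (r • u) + l⁻¹ * ‖fderiv ℝ f (r • u)‖) := by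
  have h0 := ee_nonneg f (r • u)
  have h3 := (ee_two hu hr (f := f)).2.2
  have ht := tang_le (fderiv ℝ f (r • u)) hu ht
  have hL := (fderiv ℝ f (r • u)).le_opNorm u
  rw [hu, mul_one, Real.norm_eq_abs] at hL
  set L := fderiv ℝ f (r • u)
  refine abs_le_of_sq_le_sq ?_ (by positivity)
  rw [mul_pow]
  have h5 : (L t)^2 ≤ ‖t‖^2 * (‖L‖^2 - |L u|^2) := by rw [sq_abs]; linarith
  refine h5.trans ?_
  gcongr
  have h6 : ‖L‖^2 - |L u|^2 ≤ 2 * ee f (r • u) * ‖L‖ := by nlinarith [abs_nonneg (L u)]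
  have h7 : (l * ee f (r • u) + l⁻¹ * ‖L‖)^2 = (l * ee f (r • u) - l⁻¹ * ‖L‖)^2 + 4 * (l * l⁻¹) * (ee f (r • u) * ‖L‖) := by ring
  rw [h7, mul_inv_cancel₀ hl.ne']
  nlinarith [sq_nonneg (l * ee f (r • u) - l⁻¹ * ‖L‖), mul_nonneg h0 (norm_nonneg L)]

lemma ftc_enorm {h h' : ℝ → ℝ} {a b : ℝ} (hab : a ≤ b) (hd : ∀ x ∈ Set.Icc a b, HasDerivAt h (h' x) x) (hc : ContinuousOn h' (Set.Icc a b)) :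
    h b - h a = ∫ x in Set.Ioc a b, h' x := by
  rw [← intervalIntegral.integral_of_le hab, intervalIntegral.integral_eq_sub_of_hasDerivAt]
  · rwa [Set.uIcc_of_le hab]
  · rw [← Set.uIcc_of_le hab] at hc; exact hc.intervalIntegrable

abbrev II : Set ℝ := Set.Ioo (1/2) (3/2)

/-- integral of the defect along a ray -/
def e1 {k : ℕ} (f : Eu (k+1) → ℝ) (u : Eu (k+1)) : ℝ≥0∞ := ∫⁻ r in II, ENNReal.ofReal (ee f (r • u))

lemma e1_meas {k : ℕ} {f : Eu (k+1) → ℝ} (hf : ContDiff ℝ 1 f) : Measurable (e1 f) := by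
  have hm : Measurable fun p : Eu (k+1) × ℝ => ENNReal.ofReal (ee f (p.2 • p.1)) :=
    ((cont_ee hf).comp (by fun_prop : Continuous fun p : Eu (k+1) × ℝ => p.2 • p.1)).measurable.ennreal_ofReal
  exact hm.lintegral_prod_right'

lemma ray_deriv {k : ℕ} {f : Eu (k+1) → ℝ} (hf : ContDiff ℝ 1 f) (u : Eu (k+1)) (r : ℝ) :
    HasDerivAt (fun r : ℝ => f (r • u)) (fderiv ℝ f (r • u) u) r := by
  have h1 : HasDerivAt (fun r : ℝ => r • u) u r := by simpa using (hasDerivAt_id r).smul_const u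
  exact ((hf.differentiable one_ne_zero (r • u)).hasFDerivAt).comp_hasDerivAt r h1

lemma ray_mono {k : ℕ} {f : Eu (k+1) → ℝ} (hf : ContDiff ℝ 1 f) {u : Eu (k+1)} (hu : ‖u‖ = 1) {r s : ℝ} (hr : 1/2 < r)
    (hrs : r < s) (hs : s < 3/2) : ENNReal.ofReal (f (s • u)) ≤ ENNReal.ofReal (f (r • u)) + e1 f u := by
  have hc : Continuous fun r : ℝ => fderiv ℝ f (r • u) u :=
    ((hf.continuous_fderiv one_ne_zero).comp (by fun_prop : Continuous fun r : ℝ => r • u)).clm_apply continuous_const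
  have hce : Continuous fun r : ℝ => ee f (r • u) := (cont_ee hf).comp (by fun_prop)
  have h1 := ftc_enorm hrs.le (fun x _ => ray_deriv hf u x) hc.continuousOn
  have h2 : ∫ x in Set.Ioc r s, fderiv ℝ f (x • u) u ≤ ∫ x in Set.Ioc r s, ee f (x • u) := by
    refine setIntegral_mono_on hc.integrableOn_Ioc hce.integrableOn_Ioc measurableSet_Ioc ?_
    intro x hx; exact (ee_two hu (by linarith [hx.1])).1
  have h3 : f (s • u) ≤ f (r • u) + ∫ x in Set.Ioc r s, ee f (x • u) := by linarith
  refine (ENNReal.ofReal_le_ofReal h3).trans (ENNReal.ofReal_add_le.trans ?_)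
  gcongr
  rw [ofReal_integral_eq_lintegral_ofReal hce.integrableOn_Ioc (ae_of_all _ fun x => ee_nonneg f _)]
  exact lintegral_mono_set fun x hx => ⟨hr.trans hx.1, hx.2.trans_lt hs⟩

lemma ray_grad {k : ℕ} {f : Eu (k+1) → ℝ} (hf : ContDiff ℝ 1 f) (hf0 : ∀ x, 0 ≤ f x) (hf1 : ∀ x, f x ≤ 1) {u : Eu (k+1)} (hu : ‖u‖ = 1) :
    ∫⁻ r in II, ‖fderiv ℝ f (r • u)‖ₑ ≤ 3 * e1 f u + 1 := by
  have hc : Continuous fun r : ℝ => fderiv ℝ f (r • u) u :=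
    ((hf.continuous_fderiv one_ne_zero).comp (by fun_prop : Continuous fun r : ℝ => r • u)).clm_apply continuous_const
  have hcn : Continuous fun r : ℝ => ‖fderiv ℝ f (r • u)‖ :=
    ((hf.continuous_fderiv one_ne_zero).comp (by fun_prop : Continuous fun r : ℝ => r • u)).norm
  have hce : Continuous fun r : ℝ => ee f (r • u) := (cont_ee hf).comp (by fun_prop)
  have h1 := ftc_enorm (by norm_num : (1/2:ℝ) ≤ 3/2) (fun x _ => ray_deriv hf u x) hc.continuousOn
  have i3 : IntegrableOn (fun x : ℝ => 3 * ee f (x • u)) (Set.Ioc (1/2:ℝ) (3/2)) := hce.integrableOn_Ioc.const_mul 3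
  have h2 : ∫ x in Set.Ioc (1/2:ℝ) (3/2), ‖fderiv ℝ f (x • u)‖ ≤ ∫ x in Set.Ioc (1/2:ℝ) (3/2), (3 * ee f (x • u) - fderiv ℝ f (x • u) u) := by
    refine setIntegral_mono_on hcn.integrableOn_Ioc (i3.sub hc.integrableOn_Ioc) measurableSet_Ioc ?_
    intro x hx; exact (ee_two hu (by linarith [hx.1])).2.1
  rw [integral_sub i3 hc.integrableOn_Ioc, ← h1, integral_const_mul] at h2
  have h3 : ∫ x in Set.Ioc (1/2:ℝ) (3/2), ‖fderiv ℝ f (x • u)‖ ≤ 3 * (∫ x in Set.Ioc (1/2:ℝ) (3/2), ee f (x • u)) + 1 := by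
    have := hf0 ((3/2:ℝ) • u); have := hf1 ((1/2:ℝ) • u); linarith
  have h4 : (∫⁻ x in Set.Ioc (1/2:ℝ) (3/2), ‖fderiv ℝ f (x • u)‖ₑ) ≤ 3 * (∫⁻ x in Set.Ioc (1/2:ℝ) (3/2), ENNReal.ofReal (ee f (x • u))) + 1 := by
    have e0 : 0 ≤ ∫ x in Set.Ioc (1/2:ℝ) (3/2), ee f (x • u) := integral_nonneg fun x => ee_nonneg f _
    rw [← ofReal_integral_eq_lintegral_ofReal hce.integrableOn_Ioc (ae_of_all _ fun x => ee_nonneg f _)]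
    simp_rw [← ofReal_norm]
    rw [← ofReal_integral_eq_lintegral_ofReal hcn.integrableOn_Ioc (ae_of_all _ fun x => norm_nonneg _)]
    refine (ENNReal.ofReal_le_ofReal h3).trans (le_of_eq ?_)
    rw [ENNReal.ofReal_add (by positivity) zero_le_one, ENNReal.ofReal_mul (by norm_num)]; simp
  unfold e1 II
  rw [restrict_Ioo_eq_restrict_Ioc]
  exact h4

/-- Normalization. -/
def nz {k : ℕ} (z : Eu (k+1)) : Eu (k+1) := ‖z‖⁻¹ • z

lemma norm_nz {k : ℕ} {z : Eu (k+1)} (hz : z ≠ 0) : ‖nz z‖ = 1 := by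
  unfold nz; rw [norm_smul, norm_inv, norm_norm, inv_mul_cancel₀ (norm_ne_zero_iff.2 hz)]

lemma nz_meas {k : ℕ} : Measurable (nz (k := k)) := by
  change Measurable fun z : Eu (k+1) => ‖z‖⁻¹ • z
  fun_prop

lemma nz_ray {k : ℕ} (θ : Sp k) {r : ℝ} (hr : 0 < r) : nz (r • (θ : Eu (k+1))) = θ := by
  unfold nz
  rw [norm_smul, smul_smul]
  simp [abs_of_pos hr, hr.ne']

/-- derivative of the normalization -/
def dnz {k : ℕ} (z v : Eu (k+1)) : Eu (k+1) := ‖z‖⁻¹ • v - (inner ℝ z v / ‖z‖^3) • z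

lemma hasDeriv_nz {k : ℕ} (x v : Eu (k+1)) (s : ℝ) (h : x + s • v ≠ 0) :
    HasDerivAt (fun s : ℝ => nz (x + s • v)) (dnz (x + s • v) v) s := by
  have hg : HasDerivAt (fun s : ℝ => x + s • v) v s := by simpa using ((hasDerivAt_id s).smul_const v).const_add x
  have hn0 : ‖x + s • v‖ ≠ 0 := norm_ne_zero_iff.2 h
  have hn : HasDerivAt (fun s : ℝ => ‖x + s • v‖) (inner ℝ (x + s • v) v / ‖x + s • v‖) s := by
    have h2 := hg.norm_sq
    have h3 := h2.sqrt (by positivity)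
    simp only [Real.sqrt_sq (norm_nonneg _)] at h3
    convert h3 using 1
    field_simp
  have h4 := (hn.inv hn0).smul hg
  refine h4.congr_deriv ?_
  unfold dnz
  rw [sub_eq_add_neg, ← neg_smul]
  congr 2
  field_simp

lemma dnz_tang {k : ℕ} {z v : Eu (k+1)} (hz : z ≠ 0) : inner ℝ (nz z) (dnz z v) = 0 := by
  have hn0 : ‖z‖ ≠ 0 := norm_ne_zero_iff.2 hz
  unfold nz dnz
  rw [inner_smul_left, inner_sub_right, inner_smul_right, inner_smul_right, real_inner_self_eq_norm_sq]
  field_simp; simp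

lemma dnz_norm {k : ℕ} {z v : Eu (k+1)} (hz : z ≠ 0) : ‖dnz z v‖ ≤ ‖z‖⁻¹ * ‖v‖ := by
  have hn0 : ‖z‖ ≠ 0 := norm_ne_zero_iff.2 hz
  have h1 : ‖dnz z v‖^2 = ‖z‖⁻¹^2 * (‖v‖^2 - (inner ℝ z v / ‖z‖)^2) := by
    unfold dnz
    rw [norm_sub_sq_real, norm_smul, norm_smul, inner_smul_left, inner_smul_right, real_inner_comm v z, mul_pow, mul_pow]
    simp only [Real.norm_eq_abs, sq_abs]
    simp only [conj_trivial]
    field_simp; ring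
  refine (sq_le_sq₀ (norm_nonneg _) (by positivity)).1 ?_
  rw [h1, mul_pow]
  gcongr
  nlinarith [sq_nonneg (inner ℝ z v / ‖z‖)]

/-- Ray oscillation. -/
def DD {k : ℕ} (f : Eu (k+1) → ℝ) (x y : Eu (k+1)) : ℝ≥0∞ := ∫⁻ r in II, ‖f (r • nz x) - f (r • nz y)‖ₑ

lemma DD_le_one {k : ℕ} {f : Eu (k+1) → ℝ} (hf0 : ∀ x, 0 ≤ f x) (hf1 : ∀ x, f x ≤ 1) (x y : Eu (k+1)) : DD f x y ≤ 1 := by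
  unfold DD
  calc _ ≤ ∫⁻ r in II, 1 := by
        refine lintegral_mono fun r => ?_
        rw [Real.enorm_eq_ofReal_abs, ENNReal.ofReal_le_one, abs_le]
        constructor <;> linarith [hf0 (r • nz x), hf1 (r • nz x), hf0 (r • nz y), hf1 (r • nz y)]
    _ = 1 := by simp; norm_num

lemma seg_bound {k : ℕ} {f : Eu (k+1) → ℝ} (hf : ContDiff ℝ 1 f) (hf0 : ∀ x, 0 ≤ f x) (hf1 : ∀ x, f x ≤ 1) {x v : Eu (k+1)}
    (hs : ∀ s : ℝ, 0 ≤ s → s ≤ 1 → 1/2 ≤ ‖x + s • v‖) {l : ℝ} (hl : 0 < l) :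
    DD f (x + v) x ≤ ENNReal.ofReal (3 * ‖v‖) * (ENNReal.ofReal l * (∫⁻ s in Set.Ioc (0:ℝ) 1, e1 f (nz (x + s • v)))
      + ENNReal.ofReal l⁻¹ * (3 * (∫⁻ s in Set.Ioc (0:ℝ) 1, e1 f (nz (x + s • v))) + 1)) := by
  have hne : ∀ s : ℝ, 0 ≤ s → s ≤ 1 → x + s • v ≠ 0 := fun s h0 h1 h => by
    have := hs s h0 h1; rw [h, norm_zero] at this; norm_num at this
  have cf := hf.continuous_fderiv one_ne_zero
  have mγ : Measurable fun p : ℝ × ℝ => p.1 • nz (x + p.2 • v) :=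
    measurable_fst.smul (nz_meas.comp (by fun_prop))
  have mE : Measurable fun p : ℝ × ℝ => ENNReal.ofReal (ee f (p.1 • nz (x + p.2 • v))) :=
    ((cont_ee hf).measurable.comp mγ).ennreal_ofReal
  have mL : Measurable fun p : ℝ × ℝ => ‖fderiv ℝ f (p.1 • nz (x + p.2 • v))‖ₑ := (cf.measurable.comp mγ).enorm
  have mJ : Measurable fun p : ℝ × ℝ => ENNReal.ofReal (3 * ‖v‖) * (ENNReal.ofReal l * ENNReal.ofReal (ee f (p.1 • nz (x + p.2 • v)))
      + ENNReal.ofReal l⁻¹ * ‖fderiv ℝ f (p.1 • nz (x + p.2 • v))‖ₑ) := ((mE.const_mul _).add (mL.const_mul _)).const_mul _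
  have me1 : Measurable fun s : ℝ => e1 f (nz (x + s • v)) := (e1_meas hf).comp (nz_meas.comp (by fun_prop))
  have step : ∀ r ∈ II, ‖f (r • nz (x + v)) - f (r • nz x)‖ₑ ≤ ∫⁻ s in Set.Ioc (0:ℝ) 1, ENNReal.ofReal (3 * ‖v‖) * (ENNReal.ofReal l * ENNReal.ofReal (ee f (r • nz (x + s • v)))
      + ENNReal.ofReal l⁻¹ * ‖fderiv ℝ f (r • nz (x + s • v))‖ₑ) := by
    intro r hr
    have hr0 : 0 < r := by linarith [hr.1]
    have hd : ∀ s ∈ Set.Icc (0:ℝ) 1, HasDerivAt (fun s : ℝ => f (r • nz (x + s • v))) (fderiv ℝ f (r • nz (x + s • v)) (r • dnz (x + s • v) v)) s := by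
      intro s hs
      exact ((hf.differentiable one_ne_zero _).hasFDerivAt).comp_hasDerivAt s ((hasDeriv_nz x v s (hne s hs.1 hs.2)).const_smul r)
    have hc : ContinuousOn (fun s : ℝ => fderiv ℝ f (r • nz (x + s • v)) (r • dnz (x + s • v) v)) (Set.Icc 0 1) := by
      have c0 : ContinuousOn (fun s : ℝ => x + s • v) (Set.Icc 0 1) := by fun_prop
      have cn : ContinuousOn (fun s : ℝ => ‖x + s • v‖) (Set.Icc 0 1) := c0.norm
      have n0 : ∀ s ∈ Set.Icc (0:ℝ) 1, ‖x + s • v‖ ≠ 0 := fun s hs => norm_ne_zero_iff.2 (hne s hs.1 hs.2)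
      have cnz : ContinuousOn (fun s : ℝ => nz (x + s • v)) (Set.Icc 0 1) := (cn.inv₀ n0).smul c0
      have cdnz : ContinuousOn (fun s : ℝ => dnz (x + s • v) v) (Set.Icc 0 1) :=
        ((cn.inv₀ n0).smul continuousOn_const).sub (((c0.inner continuousOn_const).div (cn.pow 3) (fun s hs => pow_ne_zero 3 (n0 s hs))).smul c0)
      exact (cf.comp_continuousOn (cnz.const_smul r)).clm_apply (cdnz.const_smul r)
    have h1 := ftc_enorm zero_le_one hd hc
    simp only [one_smul, zero_smul, add_zero] at h1
    rw [h1]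
    refine (enorm_integral_le_lintegral_enorm _).trans (setLIntegral_mono' measurableSet_Ioc fun s hs' => ?_)
    have hz := hne s hs'.1.le hs'.2
    have hz2 := hs s hs'.1.le hs'.2
    have ht := ee_tang (norm_nz hz) hr0 (f := f) (t := r • dnz (x + s • v) v) (by rw [inner_smul_right, dnz_tang hz, mul_zero]) hl
    rw [Real.enorm_eq_ofReal_abs, ← ofReal_norm, ← ENNReal.ofReal_mul hl.le, ← ENNReal.ofReal_mul (by positivity),
      ← ENNReal.ofReal_add (mul_nonneg hl.le (ee_nonneg f _)) (by positivity), ← ENNReal.ofReal_mul (by positivity)]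
    refine ENNReal.ofReal_le_ofReal (ht.trans ?_)
    have := ee_nonneg f (r • nz (x + s • v))
    gcongr
    rw [norm_smul, Real.norm_of_nonneg hr0.le]
    have h5 := dnz_norm (v := v) hz
    have h6 : ‖x + s • v‖⁻¹ ≤ 2 := by
      rw [inv_le_comm₀ (by linarith) (by norm_num)]; linarith
    calc r * ‖dnz (x + s • v) v‖ ≤ (3/2) * (2 * ‖v‖) := by
          gcongr
          · exact hr.2.le
          · exact h5.trans (by gcongr)
      _ = _ := by ring
  unfold DD
  calc _ ≤ ∫⁻ r in II, ∫⁻ s in Set.Ioc (0:ℝ) 1, ENNReal.ofReal (3 * ‖v‖) * (ENNReal.ofReal l * ENNReal.ofReal (ee f (r • nz (x + s • v)))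
      + ENNReal.ofReal l⁻¹ * ‖fderiv ℝ f (r • nz (x + s • v))‖ₑ) := setLIntegral_mono' measurableSet_Ioo step
    _ = ∫⁻ s in Set.Ioc (0:ℝ) 1, ∫⁻ r in II, ENNReal.ofReal (3 * ‖v‖) * (ENNReal.ofReal l * ENNReal.ofReal (ee f (r • nz (x + s • v)))
      + ENNReal.ofReal l⁻¹ * ‖fderiv ℝ f (r • nz (x + s • v))‖ₑ) := lintegral_lintegral_swap mJ.aemeasurable
    _ ≤ ∫⁻ s in Set.Ioc (0:ℝ) 1, ENNReal.ofReal (3 * ‖v‖) * (ENNReal.ofReal l * e1 f (nz (x + s • v)) + ENNReal.ofReal l⁻¹ * (3 * e1 f (nz (x + s • v)) + 1)) := by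
        refine setLIntegral_mono' measurableSet_Ioc fun s hs' => ?_
        have hz := hne s hs'.1.le hs'.2
        have m1 : Measurable fun r : ℝ => ENNReal.ofReal l * ENNReal.ofReal (ee f (r • nz (x + s • v))) :=
          (mE.comp (by fun_prop : Measurable fun r : ℝ => (r, s))).const_mul _
        rw [lintegral_const_mul' _ _ ofReal_ne_top, lintegral_add_left m1, lintegral_const_mul' _ _ ofReal_ne_top, lintegral_const_mul' _ _ ofReal_ne_top]
        gcongr
        · exact le_rfl
        · exact ray_grad hf hf0 hf1 (norm_nz hz)
    _ = _ := by
        have m1 : Measurable fun s : ℝ => ENNReal.ofReal l * e1 f (nz (x + s • v)) := me1.const_mul _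
        have m2 : Measurable fun s : ℝ => 3 * e1 f (nz (x + s • v)) := me1.const_mul _
        rw [lintegral_const_mul' _ _ ofReal_ne_top, lintegral_add_left m1, lintegral_const_mul' _ _ ofReal_ne_top, lintegral_const_mul' _ _ ofReal_ne_top,
          lintegral_add_left m2, lintegral_const_mul' _ _ (by simp)]
        simp

lemma opt_lemma {D m : ℝ≥0∞} {a : ℝ} (ha : 0 < a) (ha1 : a ≤ 1) (hD : D ≤ 1)
    (H : ∀ l : ℝ, 0 < l → D ≤ ENNReal.ofReal (3 * a) * (ENNReal.ofReal l * m + ENNReal.ofReal l⁻¹ * (3 * m + 1))) :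
    D * D ≤ 225 * (ENNReal.ofReal a * m) := by
  have hDD : D * D ≤ 1 := mul_le_one' hD hD
  rcases eq_or_ne m ⊤ with h | hm
  · rw [h, ENNReal.mul_top (ENNReal.ofReal_pos.2 ha).ne', ENNReal.mul_top (by norm_num)]; exact le_top
  have hDt : D ≠ ⊤ := ne_top_of_le_ne_top one_ne_top hD
  lift m to NNReal using hm
  lift D to NNReal using hDt
  set d := (D : ℝ)
  have hd0 : 0 ≤ d := D.2
  have hd1 : d ≤ 1 := by exact_mod_cast hD
  have hm0 : (0:ℝ) ≤ m := m.2
  have H2 : ∀ l : ℝ, 0 < l → d ≤ 3 * a * (l * m + l⁻¹ * (3 * m + 1)) := by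
    intro l hl
    have := H l hl
    rw [← ENNReal.ofReal_coe_nnreal (p := D), ← ENNReal.ofReal_coe_nnreal (p := m), show (3:ℝ≥0∞) = ENNReal.ofReal 3 by simp, show (1:ℝ≥0∞) = ENNReal.ofReal 1 by simp,
      ← ENNReal.ofReal_mul (by positivity), ← ENNReal.ofReal_mul (by positivity), ← ENNReal.ofReal_add (by positivity) (by positivity),
      ← ENNReal.ofReal_mul (by positivity), ← ENNReal.ofReal_add (by positivity) (by positivity), ← ENNReal.ofReal_mul (by positivity)] at this
    exact (ENNReal.ofReal_le_ofReal_iff (by positivity)).1 this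
  have key : d * d ≤ 225 * (a * m) := by
    rcases hm0.eq_or_lt with h0 | hmp
    · have : d ≤ 0 := by
        refine le_of_forall_pos_le_add fun ε hε => ?_
        have h1 := H2 (3 * a / ε) (by positivity)
        rw [← h0] at h1
        calc d ≤ _ := h1
          _ = _ := by field_simp; ring
      have : d = 0 := le_antisymm this hd0
      rw [this, ← h0]; simp
    · rcases le_or_gt 1 (a * m) with h | h
      · nlinarith
      · set t := √(a * m) with ht
        have ht0 : 0 < t := Real.sqrt_pos.2 (by positivity)
        have ht2 : t * t = a * m := Real.mul_self_sqrt (by positivity)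
        have ht1 : t ≤ 1 := by nlinarith
        have h1 := H2 t⁻¹ (by positivity)
        rw [inv_inv] at h1
        have h2 : 3 * a * (t⁻¹ * m + t * (3 * m + 1)) = 3 * (t⁻¹ * (t * t) + 3 * t * (t * t) + a * t) := by rw [ht2]; ring
        have h3 : t⁻¹ * (t * t) = t := by field_simp
        rw [h2, h3] at h1
        have h4 : d ≤ 15 * t := by
          have : t * (t * t) ≤ t := by nlinarith [mul_nonneg ht0.le ht0.le]
          nlinarith
        rw [← ht2]
        nlinarith
  rw [← ENNReal.ofReal_coe_nnreal (p := D), ← ENNReal.ofReal_coe_nnreal (p := m), show (225:ℝ≥0∞) = ENNReal.ofReal 225 by simp,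
    ← ENNReal.ofReal_mul (by positivity), ← ENNReal.ofReal_mul (by positivity), ← ENNReal.ofReal_mul (by positivity)]
  exact ENNReal.ofReal_le_ofReal key

lemma bathtub_ray {h : ℝ → ℝ≥0∞} (hm : Measurable h) (h1 : ∀ r, h r ≤ 1) :
    (∫⁻ r in II, h r) * (∫⁻ r in II, h r) ≤ 8 * ∫⁻ r in II, h r * ENNReal.ofReal |r - 1| := by
  set b := ∫⁻ r in II, h r
  set w := ∫⁻ r in II, h r * ENNReal.ofReal |r - 1|
  have hb1 : b ≤ 1 := by
    calc b ≤ ∫⁻ r in II, 1 := lintegral_mono fun r => h1 r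
      _ = 1 := by simp; norm_num
  have key : ∀ t : ℝ, 0 < t → b ≤ ENNReal.ofReal (2 * t) + ENNReal.ofReal t⁻¹ * w := by
    intro t ht
    have mw : Measurable fun r : ℝ => h r * ENNReal.ofReal |r - 1| := hm.mul (by fun_prop)
    calc b ≤ ∫⁻ r in II, ((Set.Ioo (1 - t) (1 + t)).indicator 1 r + ENNReal.ofReal t⁻¹ * (h r * ENNReal.ofReal |r - 1|)) := by
          refine lintegral_mono fun r => ?_
          by_cases hr : r ∈ Set.Ioo (1 - t) (1 + t)
          · rw [Set.indicator_of_mem hr]; exact (h1 r).trans le_self_add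
          · refine le_trans ?_ le_add_self
            have : t ≤ |r - 1| := by
              by_contra hc
              rw [not_le, abs_lt] at hc
              exact hr ⟨by linarith [hc.1], by linarith [hc.2]⟩
            rw [mul_left_comm, ← ENNReal.ofReal_mul (by positivity)]
            calc h r = h r * 1 := (mul_one _).symm
              _ ≤ _ := by
                  gcongr
                  rw [ENNReal.one_le_ofReal, ← div_eq_inv_mul, le_div_iff₀ ht]; linarith
      _ ≤ (∫⁻ r, (Set.Ioo (1 - t) (1 + t)).indicator 1 r) + ENNReal.ofReal t⁻¹ * w := by
          rw [lintegral_add_left (measurable_one.indicator measurableSet_Ioo), lintegral_const_mul _ mw]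
          gcongr
          exact Measure.restrict_le_self
      _ = _ := by
          rw [lintegral_indicator_one measurableSet_Ioo, Real.volume_Ioo]; congr 2; ring
  rcases eq_or_ne w ⊤ with hw | hw
  · rw [hw]; simp
  rcases eq_or_ne b 0 with hb | hb
  · rw [hb]; simp
  have hbt : b ≠ ⊤ := ne_top_of_le_ne_top one_ne_top hb1
  have hb0 : 0 < b.toReal := ENNReal.toReal_pos hb hbt
  have h2 := key (b.toReal / 4) (by positivity)
  rw [← ENNReal.ofReal_toReal hbt, ← ENNReal.ofReal_toReal hw] at h2 ⊢
  rw [ENNReal.toReal_ofReal hb0.le, ← ENNReal.ofReal_mul (by positivity), ← ENNReal.ofReal_add (by positivity) (by positivity),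
    ENNReal.ofReal_le_ofReal_iff (by positivity)] at h2
  rw [← ENNReal.ofReal_mul (by positivity), show (8:ℝ≥0∞) = ENNReal.ofReal 8 by simp, ← ENNReal.ofReal_mul (by positivity)]
  refine ENNReal.ofReal_le_ofReal ?_
  have h3 : (b.toReal / 4)⁻¹ * w.toReal = 4 * w.toReal / b.toReal := by field_simp
  rw [h3, ← sub_le_iff_le_add', le_div_iff₀ hb0] at h2
  nlinarith

/-- weighted deviation from the ball on a ray -/
def w1 {k : ℕ} (f : Eu (k+1) → ℝ) (u : Eu (k+1)) : ℝ≥0∞ := ∫⁻ r in II, ‖f (r • u) - (Set.Iio 1).indicator 1 r‖ₑ * ENNReal.ofReal |r - 1|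

lemma w1_meas {k : ℕ} {f : Eu (k+1) → ℝ} (hf : Measurable f) : Measurable (w1 f) := by
  have hi : Measurable ((Set.Iio 1).indicator (1 : ℝ → ℝ)) := measurable_one.indicator measurableSet_Iio
  have hm : Measurable fun p : Eu (k+1) × ℝ => ‖f (p.2 • p.1) - (Set.Iio 1).indicator 1 p.2‖ₑ * ENNReal.ofReal |p.2 - 1| :=
    (((hf.comp (by fun_prop : Measurable fun p : Eu (k+1) × ℝ => p.2 • p.1)).sub (hi.comp measurable_snd)).enorm).mul (by fun_prop)
  exact hm.lintegral_prod_right'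

lemma sq_two_le (b c : ℝ≥0∞) : (b + c) * (b + c) ≤ 2 * (b * b + c * c) := by
  rcases le_total b c with h | h
  · obtain ⟨d, rfl⟩ := le_iff_exists_add.1 h
    rw [show 2 * (b * b + (b + d) * (b + d)) = (b + (b + d)) * (b + (b + d)) + d * d by ring]
    exact le_self_add
  · obtain ⟨d, rfl⟩ := le_iff_exists_add.1 h
    rw [show 2 * ((c + d) * (c + d) + c * c) = ((c + d) + c) * ((c + d) + c) + d * d by ring]
    exact le_self_add

lemma DD_far {k : ℕ} {f : Eu (k+1) → ℝ} (hf : Measurable f) (hf0 : ∀ x, 0 ≤ f x) (hf1 : ∀ x, f x ≤ 1) (x y : Eu (k+1)) :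
    DD f x y * DD f x y ≤ 16 * (w1 f (nz x) + w1 f (nz y)) := by
  have hi : Measurable ((Set.Iio 1).indicator (1 : ℝ → ℝ)) := measurable_one.indicator measurableSet_Iio
  have hm : ∀ u : Eu (k+1), Measurable fun r : ℝ => ‖f (r • u) - (Set.Iio 1).indicator 1 r‖ₑ := fun u =>
    ((hf.comp (by fun_prop : Measurable fun r : ℝ => r • u)).sub hi).enorm
  have hle : ∀ (u : Eu (k+1)) (r : ℝ), ‖f (r • u) - (Set.Iio 1).indicator 1 r‖ₑ ≤ 1 := by
    intro u r
    rw [Real.enorm_eq_ofReal_abs, ENNReal.ofReal_le_one, abs_le]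
    have a1 : 0 ≤ (Set.Iio 1).indicator (1 : ℝ → ℝ) r := Set.indicator_nonneg (by simp) r
    have a2 : (Set.Iio 1).indicator (1 : ℝ → ℝ) r ≤ 1 := Set.indicator_le_self' (by simp) r
    constructor <;> linarith [hf0 (r • u), hf1 (r • u)]
  have hx := bathtub_ray (hm (nz x)) (hle (nz x))
  have hy := bathtub_ray (hm (nz y)) (hle (nz y))
  set b := ∫⁻ r in II, ‖f (r • nz x) - (Set.Iio 1).indicator 1 r‖ₑ
  set b' := ∫⁻ r in II, ‖f (r • nz y) - (Set.Iio 1).indicator 1 r‖ₑ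
  have hD : DD f x y ≤ b + b' := by
    rw [← lintegral_add_left (hm _)]
    refine lintegral_mono fun r => ?_
    have : f (r • nz x) - f (r • nz y) = (f (r • nz x) - (Set.Iio 1).indicator 1 r) - (f (r • nz y) - (Set.Iio 1).indicator 1 r) := by ring
    rw [this]; exact enorm_sub_le
  calc DD f x y * DD f x y ≤ (b + b') * (b + b') := by gcongr
    _ ≤ 2 * (b * b + b' * b') := by
        exact sq_two_le b b'
    _ ≤ 2 * (8 * w1 f (nz x) + 8 * w1 f (nz y)) := by
        refine mul_le_mul_right (add_le_add hx hy) _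
    _ = _ := by ring

lemma lint_nz {k : ℕ} {h : Eu (k+1) → ℝ≥0∞} (hh : Measurable h) {b : ℝ} (hb : 0 ≤ b) :
    ∫⁻ x, (ball (0 : Eu (k+1)) b).indicator (fun x => h (nz x)) x = nu k (Set.Iio b) * ∫⁻ θ : Sp k, h θ ∂(sig k) := by
  have hm : Measurable ((ball (0 : Eu (k+1)) b).indicator (fun x => h (nz x))) := (hh.comp nz_meas).indicator measurableSet_ball
  have hc : Measurable fun θ : Sp k => h θ := hh.comp measurable_subtype_coe
  rw [lintegral_pol _ hm, ← lintegral_const_mul _ hc]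
  refine lintegral_congr fun θ => ?_
  rw [mul_comm, ← lintegral_indicator_const measurableSet_Iio]
  refine lintegral_congr_ae ?_
  filter_upwards [nu_ae_pos (k := k)] with r hr
  by_cases hrb : r ∈ Set.Iio b
  · rw [Set.indicator_of_mem, Set.indicator_of_mem hrb, nz_ray θ hr]
    simpa [norm_smul, abs_of_pos hr] using hrb
  · rw [Set.indicator_of_notMem, Set.indicator_of_notMem hrb]
    simpa [norm_smul, abs_of_pos hr] using hrb

abbrev Ann (k : ℕ) : Set (Eu (k+1)) := {x | 1 < ‖x‖ ∧ ‖x‖ < 2}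

lemma Ann_meas (k : ℕ) : MeasurableSet (Ann k) :=
  (measurableSet_lt measurable_const measurable_norm).inter (measurableSet_lt measurable_norm measurable_const)

/-- Near part of the kernel along a segment. -/
def NNf {k : ℕ} (α : ℝ) (EE : Eu (k+1) → ℝ≥0∞) (x v : Eu (k+1)) : ℝ≥0∞ :=
  (ball (0 : Eu (k+1)) (1/2)).indicator (Kz α) v * ∫⁻ s in Set.Ioc (0:ℝ) 1, EE (x + s • v)

lemma seg_meas0 {k : ℕ} {EE : Eu (k+1) → ℝ≥0∞} (mEE : Measurable EE) :
    Measurable fun p : (Eu (k+1) × Eu (k+1)) × ℝ => EE (p.1.1 + p.2 • p.1.2) := by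
  have : Measurable fun p : (Eu (k+1) × Eu (k+1)) × ℝ => p.1.1 + p.2 • p.1.2 :=
    (measurable_fst.comp measurable_fst).add (measurable_snd.smul (measurable_snd.comp measurable_fst))
  exact mEE.comp this

lemma seg_meas {k : ℕ} {EE : Eu (k+1) → ℝ≥0∞} (mEE : Measurable EE) :
    Measurable fun p : Eu (k+1) × Eu (k+1) => ∫⁻ s in Set.Ioc (0:ℝ) 1, EE (p.1 + s • p.2) :=
  (seg_meas0 mEE).lintegral_prod_right'

lemma KzB_meas {k : ℕ} (α : ℝ) : Measurable ((ball (0 : Eu (k+1)) (1/2)).indicator (Kz α)) :=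
  (Kz_meas α).indicator measurableSet_ball

lemma NNf_meas {k : ℕ} (α : ℝ) {EE : Eu (k+1) → ℝ≥0∞} (mEE : Measurable EE) :
    Measurable fun p : Eu (k+1) × Eu (k+1) => NNf α EE p.1 p.2 := by
  unfold NNf
  exact Measurable.mul ((KzB_meas α).comp measurable_snd) (seg_meas mEE)

lemma NNf_int {k : ℕ} (α : ℝ) {EE : Eu (k+1) → ℝ≥0∞} (mEE : Measurable EE) :
    ∫⁻ x, ∫⁻ y, NNf α EE x (y - x) = (∫⁻ z in ball (0:Eu (k+1)) (1/2), Kz α z) * ∫⁻ x, EE x := by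
  have : ∀ x : Eu (k+1), ∫⁻ y, NNf α EE x (y - x) = ∫⁻ v, NNf α EE x v := fun x => lintegral_sub_right_eq_self (μ := volume) (NNf α EE x) x
  simp_rw [this]
  rw [lintegral_lintegral_swap (NNf_meas α mEE).aemeasurable, ← lintegral_indicator measurableSet_ball, ← lintegral_mul_const _ (KzB_meas α)]
  refine lintegral_congr fun v => ?_
  unfold NNf
  have mx : Measurable fun x : Eu (k+1) => ∫⁻ s in Set.Ioc (0:ℝ) 1, EE (x + s • v) :=
    (seg_meas mEE).comp (measurable_id.prodMk measurable_const : Measurable fun x : Eu (k+1) => (x, v))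
  rw [lintegral_const_mul _ mx, lintegral_lintegral_swap]
  · have : ∀ s : ℝ, ∫⁻ x, EE (x + s • v) = ∫⁻ x, EE x := fun s => lintegral_add_right_eq_self (μ := volume) EE (s • v)
    simp_rw [this]; simp
  · have h3 : Measurable fun p : Eu (k+1) × ℝ => EE (p.1 + p.2 • v) :=
      mEE.comp (measurable_fst.add (measurable_snd.smul_const v))
    exact h3.aemeasurable

/-- cut-off of e1 -/
def EEf {k : ℕ} (f : Eu (k+1) → ℝ) : Eu (k+1) → ℝ≥0∞ := (ball (0 : Eu (k+1)) 3).indicator (fun x => e1 f (nz x))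
/-- cut-off of w1 -/
def WWf {k : ℕ} (f : Eu (k+1) → ℝ) : Eu (k+1) → ℝ≥0∞ := (ball (0 : Eu (k+1)) 2).indicator (fun x => w1 f (nz x))

lemma solid_pw {k : ℕ} {α : ℝ} (hαn : α < (k+1 : ℕ)) {f : Eu (k+1) → ℝ} (hf : ContDiff ℝ 1 f)
    (hf0 : ∀ x, 0 ≤ f x) (hf1 : ∀ x, f x ≤ 1) {x y : Eu (k+1)} (hx : x ∈ Ann k) (hy : y ∈ Ann k) :
    DD f y x * DD f y x * ENNReal.ofReal (‖y - x‖ ^ (α - (k+1:ℕ) - 1)) ≤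
      225 * NNf α (EEf f) x (y - x) + ENNReal.ofReal ((1/2:ℝ) ^ (α - (k+1:ℕ) - 1)) * 16 * (WWf f x + WWf f y) := by
  rcases lt_or_ge ‖y - x‖ (1/2) with h | h
  · refine le_trans ?_ le_self_add
    set v := y - x with hv
    have hyv : y = x + v := by rw [hv]; abel
    rcases eq_or_ne v 0 with hv0 | hv0
    · have : DD f y x = 0 := by rw [hyv, hv0, add_zero]; simp [DD]
      rw [this]; simp
    have hvn : 0 < ‖v‖ := norm_pos_iff.2 hv0
    have hseg : ∀ s : ℝ, 0 ≤ s → s ≤ 1 → 1/2 ≤ ‖x + s • v‖ ∧ ‖x + s • v‖ < 3 := by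
      intro s hs0 hs1
      have hsv : ‖s • v‖ ≤ 1/2 := by
        rw [norm_smul, Real.norm_of_nonneg hs0]; nlinarith
      have h1 := norm_sub_le (x + s • v) (s • v)
      rw [add_sub_cancel_right] at h1
      have h2 := norm_add_le x (s • v)
      constructor <;> linarith [hx.1, hx.2]
    have hopt := opt_lemma (D := DD f (x + v) x) (m := ∫⁻ s in Set.Ioc (0:ℝ) 1, e1 f (nz (x + s • v))) hvn (by linarith) (DD_le_one hf0 hf1 _ _)
      (fun l hl => seg_bound hf hf0 hf1 (fun s h0 h1 => (hseg s h0 h1).1) hl)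
    have hEEs : ∫⁻ s in Set.Ioc (0:ℝ) 1, e1 f (nz (x + s • v)) = ∫⁻ s in Set.Ioc (0:ℝ) 1, EEf f (x + s • v) := by
      refine setLIntegral_congr_fun measurableSet_Ioc fun s hs => ?_
      rw [EEf, Set.indicator_of_mem]
      simpa using (hseg s hs.1.le hs.2).2
    rw [hEEs, ← hyv] at hopt
    have hK : ENNReal.ofReal ‖v‖ * ENNReal.ofReal (‖v‖ ^ (α - (k+1:ℕ) - 1)) = Kz α v := by
      unfold Kz
      rw [← ENNReal.ofReal_mul hvn.le]
      congr 1
      rw [mul_comm, ← Real.rpow_add_one hvn.ne']; congr 1; ring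
    calc _ ≤ 225 * (ENNReal.ofReal ‖v‖ * ∫⁻ s in Set.Ioc (0:ℝ) 1, EEf f (x + s • v)) * ENNReal.ofReal (‖v‖ ^ (α - (k+1:ℕ) - 1)) := by gcongr
      _ = 225 * ((ENNReal.ofReal ‖v‖ * ENNReal.ofReal (‖v‖ ^ (α - (k+1:ℕ) - 1))) * ∫⁻ s in Set.Ioc (0:ℝ) 1, EEf f (x + s • v)) := by ring
      _ = _ := by
        unfold NNf
        rw [hK, Set.indicator_of_mem (by simpa using h)]
  · refine le_trans ?_ le_add_self
    have hfar := DD_far hf.continuous.measurable hf0 hf1 y x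
    have hWx : WWf f x = w1 f (nz x) := by rw [WWf, Set.indicator_of_mem]; simpa using hx.2
    have hWy : WWf f y = w1 f (nz y) := by rw [WWf, Set.indicator_of_mem]; simpa using hy.2
    rw [hWx, hWy]
    have hk : ENNReal.ofReal (‖y - x‖ ^ (α - (k+1:ℕ) - 1)) ≤ ENNReal.ofReal ((1/2:ℝ) ^ (α - (k+1:ℕ) - 1)) := by
      refine ENNReal.ofReal_le_ofReal ?_
      exact Real.rpow_le_rpow_of_nonpos (by norm_num) h (by linarith)
    calc _ ≤ 16 * (w1 f (nz y) + w1 f (nz x)) * ENNReal.ofReal ((1/2:ℝ) ^ (α - (k+1:ℕ) - 1)) := by gcongr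
      _ = _ := by ring
lemma solid_le {k : ℕ} {α : ℝ} (hα : 0 < α) (hαn : α < (k+1 : ℕ)) : ∃ C : NNReal, ∀ (f : Eu (k+1) → ℝ) (_ : ContDiff ℝ 1 f)
    (_ : ∀ x, 0 ≤ f x) (_ : ∀ x, f x ≤ 1),
    ∫⁻ x in Ann k, ∫⁻ y in Ann k, DD f y x * DD f y x * ENNReal.ofReal (‖y - x‖ ^ (α - (k+1:ℕ) - 1)) ≤
      C * ((∫⁻ θ : Sp k, e1 f θ ∂(sig k)) + ∫⁻ θ : Sp k, w1 f θ ∂(sig k)) := by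
  set c2 : ℝ := (1/2:ℝ) ^ (α - (k+1:ℕ) - 1)
  set KB : ℝ≥0∞ := ∫⁻ z in ball (0:Eu (k+1)) (1/2), Kz α z with hKB
  have hKBt : KB ≠ ⊤ := by
    rw [hKB, lintegral_Kz_ball hα (by norm_num), sig_univ']; finiteness
  have hn3 : nu k (Set.Iio 3) ≠ ⊤ := by rw [nu_Iio (by norm_num)]; simp
  have hn2 : nu k (Set.Iio 2) ≠ ⊤ := by rw [nu_Iio (by norm_num)]; simp
  have hv2 : volume (ball (0 : Eu (k+1)) 2) ≠ ⊤ := measure_ball_lt_top.ne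
  set C : ℝ≥0∞ := 225 * KB * nu k (Set.Iio 3) + ENNReal.ofReal c2 * 16 * (2 * (volume (ball (0 : Eu (k+1)) 2) * nu k (Set.Iio 2)))
  have hC : C ≠ ⊤ := by simp only [C]; finiteness
  refine ⟨C.toNNReal, ?_⟩
  rw [ENNReal.coe_toNNReal hC]
  intro f hf hf0 hf1
  have me1 : Measurable fun x : Eu (k+1) => e1 f (nz x) := (e1_meas hf).comp nz_meas
  have mw1 : Measurable fun x : Eu (k+1) => w1 f (nz x) := (w1_meas hf.continuous.measurable).comp nz_meas
  have pw := fun x (hx : x ∈ Ann k) y (hy : y ∈ Ann k) => solid_pw hαn hf hf0 hf1 hx hy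
  have mEE : Measurable (EEf f) := me1.indicator measurableSet_ball
  have mWW : Measurable (WWf f) := mw1.indicator measurableSet_ball
  have iEE : ∫⁻ x, EEf f x = nu k (Set.Iio 3) * ∫⁻ θ : Sp k, e1 f θ ∂(sig k) := lint_nz (e1_meas hf) (by norm_num)
  have iWW : ∫⁻ x, WWf f x = nu k (Set.Iio 2) * ∫⁻ θ : Sp k, w1 f θ ∂(sig k) := lint_nz (w1_meas hf.continuous.measurable) (by norm_num)
  have i1 := NNf_int α mEE
  rw [← hKB] at i1
  have mNN := NNf_meas α mEE
  generalize EEf f = EE at *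
  generalize WWf f = WW at *
  have hAsub : Ann k ⊆ ball 0 2 := fun x hx => by simpa using hx.2
  have hvA : volume (Ann k) ≤ volume (ball (0 : Eu (k+1)) 2) := measure_mono hAsub
  have mP0 : Measurable fun p : Eu (k+1) × Eu (k+1) => NNf α EE p.1 (p.2 - p.1) :=
    Measurable.comp (g := fun p : Eu (k+1) × Eu (k+1) => NNf α EE p.1 p.2) (f := fun p : Eu (k+1) × Eu (k+1) => (p.1, p.2 - p.1))
      mNN (measurable_fst.prodMk (measurable_snd.sub measurable_fst))
  have mP : Measurable fun p : Eu (k+1) × Eu (k+1) => 225 * NNf α EE p.1 (p.2 - p.1) := mP0.const_mul _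
  have mP1 : Measurable fun x : Eu (k+1) => ∫⁻ y in Ann k, 225 * NNf α EE x (y - x) :=
    Measurable.lintegral_prod_right' (f := fun p : Eu (k+1) × Eu (k+1) => 225 * NNf α EE p.1 (p.2 - p.1)) mP
  calc _ ≤ ∫⁻ x in Ann k, ∫⁻ y in Ann k, (225 * NNf α EE x (y - x) + ENNReal.ofReal c2 * 16 * (WW x + WW y)) :=
        setLIntegral_mono' (Ann_meas k) fun x hx => setLIntegral_mono' (Ann_meas k) fun y hy => pw x hx y hy
    _ = (∫⁻ x in Ann k, ∫⁻ y in Ann k, 225 * NNf α EE x (y - x)) + ENNReal.ofReal c2 * 16 * ∫⁻ x in Ann k, ∫⁻ y in Ann k, (WW x + WW y) := by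
        have : ∀ x, ∫⁻ y in Ann k, (225 * NNf α EE x (y - x) + ENNReal.ofReal c2 * 16 * (WW x + WW y)) =
          (∫⁻ y in Ann k, 225 * NNf α EE x (y - x)) + ENNReal.ofReal c2 * 16 * ∫⁻ y in Ann k, (WW x + WW y) := by
          intro x
          have m1 : Measurable fun y : Eu (k+1) => 225 * NNf α EE x (y - x) :=
            Measurable.comp (g := fun p : Eu (k+1) × Eu (k+1) => 225 * NNf α EE p.1 (p.2 - p.1)) (f := Prod.mk x) mP measurable_prodMk_left
          rw [lintegral_add_left m1, lintegral_const_mul' (ENNReal.ofReal c2 * 16) _ (by finiteness)]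
        simp_rw [this]
        rw [lintegral_add_left mP1, lintegral_const_mul' (ENNReal.ofReal c2 * 16) _ (by finiteness)]
    _ ≤ 225 * (KB * ∫⁻ x, EE x) + ENNReal.ofReal c2 * 16 * (2 * (volume (ball (0 : Eu (k+1)) 2) * ∫⁻ x, WW x)) := by
        gcongr
        · rw [← i1]
          calc _ ≤ ∫⁻ x, ∫⁻ y, 225 * NNf α EE x (y - x) :=
                lintegral_mono' Measure.restrict_le_self fun x => lintegral_mono' Measure.restrict_le_self fun y => le_rfl
            _ = _ := by
              simp_rw [lintegral_const_mul' (225:ℝ≥0∞) _ (by norm_num)]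
        · have : ∀ x, ∫⁻ y in Ann k, (WW x + WW y) = WW x * volume (Ann k) + ∫⁻ y in Ann k, WW y := by
            intro x
            rw [lintegral_add_left measurable_const]; simp
          simp_rw [this]
          have m3 : Measurable fun x => WW x * volume (Ann k) := mWW.mul_const _
          rw [lintegral_add_left m3, lintegral_mul_const _ mWW]
          simp only [lintegral_const, Measure.restrict_apply_univ]
          have h5 : ∫⁻ x in Ann k, WW x ≤ ∫⁻ x, WW x := lintegral_mono' Measure.restrict_le_self le_rfl
          calc _ ≤ (∫⁻ x, WW x) * volume (ball (0 : Eu (k+1)) 2) + (∫⁻ x, WW x) * volume (ball (0 : Eu (k+1)) 2) := by gcongr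
            _ = _ := by ring
    _ ≤ _ := by
        rw [iEE, iWW]
        set a := ∫⁻ θ : Sp k, e1 f θ ∂(sig k)
        set b := ∫⁻ θ : Sp k, w1 f θ ∂(sig k)
        simp only [C]
        generalize volume (ball (0 : Eu (k+1)) 2) = V2
        generalize nu k (Set.Iio 2) = n2
        generalize nu k (Set.Iio 3) = n3
        generalize ENNReal.ofReal c2 = c2'
        generalize KB = KB
        rw [show (225 * KB * n3 + c2' * 16 * (2 * (V2 * n2))) * (a + b) = (225 * (KB * (n3 * a)) + c2' * 16 * (2 * (V2 * (n2 * b)))) + (225 * KB * n3 * b + c2' * 16 * (2 * (V2 * n2)) * a) by ring]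
        exact le_self_add

lemma nu_ge {k : ℕ} {a b c : ℝ} (ha : 0 ≤ a) (h : ∀ r ∈ Set.Ioo a b, c ≤ r ^ k) :
    ENNReal.ofReal c • volume.restrict (Set.Ioo a b) ≤ nu k := by
  rw [Measure.le_iff]
  intro s hs
  unfold nu
  rw [withDensity_apply _ hs, Measure.restrict_restrict hs, Measure.smul_apply, Measure.restrict_apply hs, smul_eq_mul,
    ← setLIntegral_const]
  have hsub : s ∩ Set.Ioo a b ⊆ s ∩ Set.Ioi 0 := Set.inter_subset_inter_right s fun r hr => ha.trans_lt hr.1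
  calc _ ≤ ∫⁻ r in s ∩ Set.Ioo a b, ENNReal.ofReal (r^k) :=
        setLIntegral_mono' (hs.inter measurableSet_Ioo) fun r hr => ENNReal.ofReal_le_ofReal (h r hr.2)
    _ ≤ _ := lintegral_mono_set hsub

lemma nu_le {k : ℕ} {a b c : ℝ} (h : ∀ r ∈ Set.Ioo a b, r ^ k ≤ c) :
    (nu k).restrict (Set.Ioo a b) ≤ ENNReal.ofReal c • volume.restrict (Set.Ioo a b) := by
  rw [Measure.le_iff]
  intro s hs
  unfold nu
  rw [Measure.restrict_apply hs, withDensity_apply _ (hs.inter measurableSet_Ioo), Measure.restrict_restrict (hs.inter measurableSet_Ioo),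
    Measure.smul_apply, Measure.restrict_apply hs, smul_eq_mul, ← setLIntegral_const]
  calc _ ≤ ∫⁻ r in (s ∩ Set.Ioo a b), ENNReal.ofReal (r^k) := lintegral_mono_set Set.inter_subset_left
    _ ≤ _ := setLIntegral_mono' (hs.inter measurableSet_Ioo) fun r hr => ENNReal.ofReal_le_ofReal (h r hr.2)

lemma kern_low {k : ℕ} {α : ℝ} (hαn : α < (k+1 : ℕ)) (θ φ : Sp k) :
    ENNReal.ofReal ((3:ℝ) ^ (α - (k+1:ℕ) - 1) / 8 * ‖(θ : Eu (k+1)) - φ‖ ^ (α - (k+1:ℕ))) ≤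
    ∫⁻ r in Set.Ioo (1:ℝ) 2, ∫⁻ s in Set.Ioo (1:ℝ) 2, ENNReal.ofReal (‖r • (θ : Eu (k+1)) - s • (φ : Eu (k+1))‖ ^ (α - (k+1:ℕ) - 1)) := by
  have h1 : ‖(θ : Eu (k+1))‖ = 1 := by simp
  have h2 : ‖(φ : Eu (k+1))‖ = 1 := by simp
  set d := ‖(θ : Eu (k+1)) - φ‖ with hd
  have hd0 : 0 ≤ d := norm_nonneg _
  have hd2 : d ≤ 2 := (norm_sub_le _ _).trans (by rw [h1, h2]; norm_num)
  rcases hd0.eq_or_lt with h0 | hdp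
  · rw [← h0, Real.zero_rpow (by linarith)]; simp
  have key : ∀ r s : ℝ, 1 < r → r < 3/2 → r < s → s < r + d/4 → (3 * d) ^ (α - (k+1:ℕ) - 1) ≤ ‖r • (θ : Eu (k+1)) - s • (φ : Eu (k+1))‖ ^ (α - (k+1:ℕ) - 1) := by
    intro r s hr1 hr2 hs1 hs2
    have hsq := norm_polar_sq h1 h2 r s
    rw [← hd] at hsq
    set N := ‖r • (θ : Eu (k+1)) - s • (φ : Eu (k+1))‖
    have hN0 : 0 ≤ N := norm_nonneg _
    have hrs : 0 < r * s := by nlinarith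
    have hpos : 0 < N := by
      rcases hN0.eq_or_lt with h | h
      · exfalso; rw [← h] at hsq; nlinarith [mul_pos hrs (mul_pos hdp hdp), sq_nonneg (r - s)]
      · exact h
    have hrs3 : r * s ≤ 3 := by nlinarith
    have hle : N ≤ 3 * d := by
      refine abs_le_of_sq_le_sq' ?_ (by positivity) |>.2
      nlinarith [mul_le_mul_of_nonneg_right hrs3 (sq_nonneg d)]
    exact Real.rpow_le_rpow_of_nonpos hpos hle (by linarith)
  calc _ = ∫⁻ r in Set.Ioo (1:ℝ) (3/2), ∫⁻ s in Set.Ioo r (r + d/4), ENNReal.ofReal ((3 * d) ^ (α - (k+1:ℕ) - 1)) := by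
        simp only [lintegral_const, Measure.restrict_apply_univ, Real.volume_Ioo, add_sub_cancel_left]
        rw [← ENNReal.ofReal_mul (by positivity), ← ENNReal.ofReal_mul (by positivity)]
        congr 1
        rw [Real.mul_rpow (by norm_num) hd0, Real.rpow_sub_one hdp.ne']
        field_simp
        norm_num
    _ ≤ ∫⁻ r in Set.Ioo (1:ℝ) (3/2), ∫⁻ s in Set.Ioo (1:ℝ) 2, ENNReal.ofReal (‖r • (θ : Eu (k+1)) - s • (φ : Eu (k+1))‖ ^ (α - (k+1:ℕ) - 1)) := by
        refine setLIntegral_mono' measurableSet_Ioo fun r hr => ?_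
        refine le_trans (setLIntegral_mono' measurableSet_Ioo fun s hs => ENNReal.ofReal_le_ofReal (key r s hr.1 hr.2 hs.1 hs.2)) ?_
        refine lintegral_mono_set fun s hs => ⟨hr.1.trans hs.1, hs.2.trans_le ?_⟩
        linarith [hr.2]
    _ ≤ _ := lintegral_mono_set (Set.Ioo_subset_Ioo_right (by norm_num))

lemma DD_meas {k : ℕ} {f : Eu (k+1) → ℝ} (hf : Measurable f) : Measurable fun p : Eu (k+1) × Eu (k+1) => DD f p.1 p.2 := by
  have h : ∀ g : Eu (k+1) × Eu (k+1) → Eu (k+1), Measurable g → Measurable fun p : (Eu (k+1) × Eu (k+1)) × ℝ => f (p.2 • nz (g p.1)) :=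
    fun g hg => hf.comp (measurable_snd.smul (nz_meas.comp (hg.comp measurable_fst)))
  have hm : Measurable fun p : (Eu (k+1) × Eu (k+1)) × ℝ => ‖f (p.2 • nz p.1.1) - f (p.2 • nz p.1.2)‖ₑ :=
    ((h _ measurable_fst).sub (h _ measurable_snd)).enorm
  exact Measurable.lintegral_prod_right' (f := fun p : (Eu (k+1) × Eu (k+1)) × ℝ => ‖f (p.2 • nz p.1.1) - f (p.2 • nz p.1.2)‖ₑ) hm

lemma DD_ray {k : ℕ} (f : Eu (k+1) → ℝ) (θ φ : Sp k) {r s : ℝ} (hr : 0 < r) (hs : 0 < s) :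
    DD f (s • (φ : Eu (k+1))) (r • (θ : Eu (k+1))) = DD f φ θ := by
  have h1 := nz_ray θ one_pos
  have h2 := nz_ray φ one_pos
  rw [one_smul] at h1 h2
  unfold DD
  rw [nz_ray θ hr, nz_ray φ hs, h1, h2]

/-- one-sided polar bound -/
lemma pol_Ann {k : ℕ} {g : Eu (k+1) → ℝ≥0∞} (hg : Measurable g) :
    ∫⁻ θ : Sp k, (∫⁻ r in Set.Ioo (1:ℝ) 2, g (r • (θ : Eu (k+1)))) ∂(sig k) ≤ ∫⁻ x in Ann k, g x := by
  rw [← lintegral_indicator (Ann_meas k), lintegral_pol _ (hg.indicator (Ann_meas k))]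
  refine lintegral_mono fun θ => ?_
  have hn := nu_ge (k := k) (a := 1) (b := 2) (c := 1) (by norm_num) (fun r hr => one_le_pow₀ hr.1.le)
  rw [ENNReal.ofReal_one, one_smul] at hn
  refine le_trans ?_ (lintegral_mono' hn le_rfl)
  refine setLIntegral_mono' measurableSet_Ioo fun r hr => ?_
  rw [Set.indicator_of_mem]
  have : ‖r • (θ : Eu (k+1))‖ = r := by rw [norm_smul]; simp; linarith [hr.1]
  simp only [Ann, Set.mem_ofPred_eq, this]; exact hr

lemma swap_rφ {k : ℕ} {G : Sp k → ℝ → ℝ → ℝ≥0∞} (mG : Measurable fun q : (ℝ × Sp k) × ℝ => G q.1.2 q.1.1 q.2) :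
    ∫⁻ r in Set.Ioo (1:ℝ) 2, ∫⁻ φ : Sp k, (∫⁻ s in Set.Ioo (1:ℝ) 2, G φ r s) ∂(sig k) =
    ∫⁻ φ : Sp k, (∫⁻ r in Set.Ioo (1:ℝ) 2, ∫⁻ s in Set.Ioo (1:ℝ) 2, G φ r s) ∂(sig k) := by
  have m1 : Measurable fun q : ℝ × Sp k => ∫⁻ s in Set.Ioo (1:ℝ) 2, G q.2 q.1 s :=
    Measurable.lintegral_prod_right' mG
  exact lintegral_lintegral_swap m1.aemeasurable

lemma desolid_fib {k : ℕ} {D κ : Sp k → ℝ≥0∞} (mD : Measurable D) {K : Eu (k+1) → ℝ≥0∞} (mK : Measurable K) (θ : Sp k) {c : ℝ≥0∞} (hc : c ≠ ⊤)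
    (hκ : ∀ φ : Sp k, c * κ φ ≤ ∫⁻ r in Set.Ioo (1:ℝ) 2, ∫⁻ s in Set.Ioo (1:ℝ) 2, K (s • (φ : Eu (k+1)) - r • (θ : Eu (k+1)))) :
    c * ∫⁻ φ : Sp k, D φ * κ φ ∂(sig k) ≤
      ∫⁻ r in Set.Ioo (1:ℝ) 2, ∫⁻ φ : Sp k, (∫⁻ s in Set.Ioo (1:ℝ) 2, D φ * K (s • (φ : Eu (k+1)) - r • (θ : Eu (k+1)))) ∂(sig k) := by
  have m1 : Measurable fun q : (ℝ × Sp k) × ℝ => D q.1.2 := mD.comp (measurable_snd.comp measurable_fst)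
  have m2 : Measurable fun q : (ℝ × Sp k) × ℝ => q.2 • (q.1.2 : Eu (k+1)) - q.1.1 • (θ : Eu (k+1)) := by fun_prop
  rw [swap_rφ (G := fun φ r s => D φ * K (s • (φ : Eu (k+1)) - r • (θ : Eu (k+1)))) (m1.mul (mK.comp m2)), ← lintegral_const_mul' _ _ hc]
  refine lintegral_mono fun φ => ?_
  have m3 : Measurable fun p : ℝ × ℝ => p.2 • (φ : Eu (k+1)) - p.1 • (θ : Eu (k+1)) := by fun_prop
  have mK3 : Measurable fun p : ℝ × ℝ => K (p.2 • (φ : Eu (k+1)) - p.1 • (θ : Eu (k+1))) := mK.comp m3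
  have mK1 : Measurable fun r : ℝ => ∫⁻ s in Set.Ioo (1:ℝ) 2, K (s • (φ : Eu (k+1)) - r • (θ : Eu (k+1))) := Measurable.lintegral_prod_right' mK3
  have e1 : ∀ r : ℝ, ∫⁻ s in Set.Ioo (1:ℝ) 2, D φ * K (s • (φ : Eu (k+1)) - r • (θ : Eu (k+1)))
    = D φ * ∫⁻ s in Set.Ioo (1:ℝ) 2, K (s • (φ : Eu (k+1)) - r • (θ : Eu (k+1))) := fun r =>
      lintegral_const_mul _ (mK3.comp measurable_prodMk_left)
  simp_rw [e1]
  rw [lintegral_const_mul _ mK1]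
  calc _ = D φ * (c * κ φ) := by ring
    _ ≤ _ := mul_le_mul_right (hκ φ) _

lemma desolid0 {k : ℕ} {D : Eu (k+1) × Eu (k+1) → ℝ≥0∞} (mD : Measurable D) (hD : ∀ (θ φ : Sp k) (r s : ℝ), 0 < r → 0 < s → D (r • (θ : Eu (k+1)), s • (φ : Eu (k+1))) = D ((θ : Eu (k+1)), (φ : Eu (k+1)))) {K κ : Eu (k+1) → ℝ≥0∞} (mK : Measurable K) {c : ℝ≥0∞} (hc : c ≠ ⊤)
    (hκ : ∀ θ φ : Sp k, c * κ ((θ : Eu (k+1)) - (φ : Eu (k+1))) ≤ ∫⁻ r in Set.Ioo (1:ℝ) 2, ∫⁻ s in Set.Ioo (1:ℝ) 2, K (s • (φ : Eu (k+1)) - r • (θ : Eu (k+1)))) :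
    c * ∫⁻ θ : Sp k, ∫⁻ φ : Sp k, D ((θ : Eu (k+1)), (φ : Eu (k+1))) * κ ((θ : Eu (k+1)) - (φ : Eu (k+1))) ∂(sig k) ∂(sig k) ≤
    ∫⁻ x in Ann k, ∫⁻ y in Ann k, D (x, y) * K (y - x) := by
  have mG : Measurable fun p : Eu (k+1) × Eu (k+1) => D (p.1, p.2) * K (p.2 - p.1) :=
    (mD.comp (measurable_fst.prodMk measurable_snd)).mul (mK.comp (measurable_snd.sub measurable_fst))
  have mG1 : Measurable fun x : Eu (k+1) => ∫⁻ y in Ann k, D (x, y) * K (y - x) := Measurable.lintegral_prod_right' mG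
  refine le_trans ?_ (pol_Ann mG1)
  rw [← lintegral_const_mul' _ _ hc]
  refine lintegral_mono fun θ => ?_
  have mDs : Measurable fun φ : Sp k => D ((θ : Eu (k+1)), (φ : Eu (k+1))) := mD.comp (measurable_const.prodMk measurable_subtype_coe)
  refine (desolid_fib mDs mK θ hc (hκ θ)).trans ?_
  refine setLIntegral_mono' measurableSet_Ioo fun r hr => ?_
  have mg : Measurable fun y : Eu (k+1) => D (r • (θ : Eu (k+1)), y) * K (y - r • (θ : Eu (k+1))) := mG.comp measurable_prodMk_left
  refine le_trans (lintegral_mono fun φ => ?_) (pol_Ann mg)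
  refine setLIntegral_mono' measurableSet_Ioo fun s hs => ?_
  rw [hD θ φ r s (by linarith [hr.1]) (by linarith [hs.1])]

lemma desolid {k : ℕ} {α : ℝ} (hαn : α < (k+1 : ℕ)) {f : Eu (k+1) → ℝ} (hf : Measurable f) :
    ENNReal.ofReal ((3:ℝ) ^ (α - (k+1:ℕ) - 1) / 8) * ∫⁻ θ : Sp k, ∫⁻ φ : Sp k, DD f φ θ * DD f φ θ * Kz α ((θ : Eu (k+1)) - (φ : Eu (k+1))) ∂(sig k) ∂(sig k) ≤
    ∫⁻ x in Ann k, ∫⁻ y in Ann k, DD f y x * DD f y x * ENNReal.ofReal (‖y - x‖ ^ (α - (k+1:ℕ) - 1)) := by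
  have m0 : Measurable fun p : Eu (k+1) × Eu (k+1) => DD f p.2 p.1 :=
    Measurable.comp (g := fun p : Eu (k+1) × Eu (k+1) => DD f p.1 p.2) (f := Prod.swap) (DD_meas hf) measurable_swap
  refine desolid0 (D := fun p => DD f p.2 p.1 * DD f p.2 p.1) (K := fun z => ENNReal.ofReal (‖z‖ ^ (α - (k+1:ℕ) - 1))) (κ := Kz α)
    (m0.mul m0) ?_ (by fun_prop) (by finiteness) ?_
  · intro θ φ r s hr hs
    simp only [DD_ray f θ φ hr hs]
  · intro θ φ
    have := kern_low hαn θ φ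
    rw [ENNReal.ofReal_mul (by positivity)] at this
    simp_rw [norm_sub_rev _ (_ • (φ : Eu (k+1)))] at this
    exact this

/-- truncation of `f` to the ball/annulus -/
def gt {k : ℕ} (f : Eu (k+1) → ℝ) (x : Eu (k+1)) : ℝ := if ‖x‖ ≤ 1/2 then 1 else if 3/2 ≤ ‖x‖ then 0 else f x

lemma gt_meas {k : ℕ} {f : Eu (k+1) → ℝ} (hf : Measurable f) : Measurable (gt f) := by
  unfold gt
  refine Measurable.ite (measurableSet_le measurable_norm measurable_const) measurable_const ?_
  exact Measurable.ite (measurableSet_le measurable_const measurable_norm) measurable_const hf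

lemma nz_self {k : ℕ} (θ : Sp k) : nz (θ : Eu (k+1)) = θ := by
  have h1 := nz_ray θ one_pos
  rwa [one_smul] at h1

lemma gt_ray {k : ℕ} (f : Eu (k+1) → ℝ) (θ φ : Sp k) {r : ℝ} (hr : 0 < r) :
    ‖gt f (r • (θ : Eu (k+1))) - gt f (r • (φ : Eu (k+1)))‖ₑ = II.indicator (fun r => ‖f (r • (φ : Eu (k+1))) - f (r • (θ : Eu (k+1)))‖ₑ) r := by
  have h : ∀ θ : Sp k, ‖r • (θ : Eu (k+1))‖ = r := fun θ => by rw [norm_smul]; simp [hr.le]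
  unfold gt
  rw [h, h]
  by_cases h1 : r ≤ 1/2
  · have : r ∉ II := fun hh => absurd hh.1 (not_lt.2 h1)
    rw [if_pos h1, if_pos h1, Set.indicator_of_notMem this]; simp
  by_cases h2 : 3/2 ≤ r
  · have : r ∉ II := fun hh => absurd hh.2 (not_lt.2 h2)
    rw [if_neg h1, if_neg h1, if_pos h2, if_pos h2, Set.indicator_of_notMem this]; simp
  · have : r ∈ II := ⟨not_le.1 h1, not_le.1 h2⟩
    rw [if_neg h1, if_neg h1, if_neg h2, if_neg h2, Set.indicator_of_mem this, enorm_sub_rev]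

lemma Kz_ray {k : ℕ} {α : ℝ} (hαn : α < (k+1 : ℕ)) (θ φ : Sp k) (hne : (θ : Eu (k+1)) ≠ φ) {r s : ℝ} (hr : 1/2 < r) (hs : 1/2 < s) :
    Kz α (r • (θ : Eu (k+1)) - s • (φ : Eu (k+1))) ≤ ENNReal.ofReal ((1/2:ℝ) ^ (α - (k+1:ℕ))) * Kz α ((θ : Eu (k+1)) - (φ : Eu (k+1))) := by
  unfold Kz
  rw [← ENNReal.ofReal_mul (by positivity), ← Real.mul_rpow (by norm_num) (norm_nonneg _)]
  refine ENNReal.ofReal_le_ofReal ?_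
  have hd : 0 < ‖(θ : Eu (k+1)) - φ‖ := norm_pos_iff.2 (sub_ne_zero.2 hne)
  refine Real.rpow_le_rpow_of_nonpos (by positivity) ?_ (by linarith)
  have hsq := norm_polar_sq (θ := (θ : Eu (k+1))) (φ := (φ : Eu (k+1))) (by simp) (by simp) r s
  refine abs_le_of_sq_le_sq' ?_ (norm_nonneg _) |>.2
  rw [hsq]
  have : 1/4 ≤ r * s := by nlinarith
  nlinarith [sq_nonneg (r - s), mul_le_mul_of_nonneg_right this (sq_nonneg ‖(θ : Eu (k+1)) - φ‖)]

lemma ZZ_DD {k : ℕ} {α : ℝ} (hαn : α < (k+1 : ℕ)) {f : Eu (k+1) → ℝ} (hf : Measurable f) :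
    ZZ α (gt f) ≤ ENNReal.ofReal ((1/2:ℝ) ^ (α - (k+1:ℕ))) * ENNReal.ofReal ((3/2)^k) * ENNReal.ofReal ((3/2)^k) *
      ∫⁻ θ : Sp k, ∫⁻ φ : Sp k, DD f φ θ * DD f φ θ * Kz α ((θ : Eu (k+1)) - (φ : Eu (k+1))) ∂(sig k) ∂(sig k) := by
  unfold ZZ
  have mg := gt_meas hf
  have ms : ∀ (a : (Sp k × Sp k) × (ℝ × ℝ) → ℝ) (b : (Sp k × Sp k) × (ℝ × ℝ) → Sp k), Measurable a → Measurable b →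
    Measurable fun p => a p • (b p : Eu (k+1)) := fun a b ha hb => ha.smul (measurable_subtype_coe.comp hb)
  have m11 := ms _ _ (measurable_fst.comp measurable_snd) (measurable_fst.comp measurable_fst)
  have m12 := ms _ _ (measurable_fst.comp measurable_snd) (measurable_snd.comp measurable_fst)
  have m21 := ms _ _ (measurable_snd.comp measurable_snd) (measurable_fst.comp measurable_fst)
  have m22 := ms _ _ (measurable_snd.comp measurable_snd) (measurable_snd.comp measurable_fst)
  have hM0 : Measurable fun p : (Sp k × Sp k) × (ℝ × ℝ) => ‖gt f (p.2.1 • (p.1.1 : Eu (k+1))) - gt f (p.2.1 • (p.1.2 : Eu (k+1)))‖ₑ *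
      ‖gt f (p.2.2 • (p.1.1 : Eu (k+1))) - gt f (p.2.2 • (p.1.2 : Eu (k+1)))‖ₑ *
      Kz α (p.2.1 • (p.1.1 : Eu (k+1)) - p.2.2 • (p.1.2 : Eu (k+1))) :=
    ((((mg.comp m11).sub (mg.comp m12)).enorm.mul ((mg.comp m21).sub (mg.comp m22)).enorm).mul ((Kz_meas α).comp (m11.sub m22)))
  rw [mu4_iter _ hM0,
    ← lintegral_const_mul' _ _ (by finiteness)]
  refine lintegral_mono fun θ => ?_
  rw [← lintegral_const_mul' _ _ (by finiteness)]
  refine lintegral_mono fun φ => ?_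
  set A : ℝ → ℝ≥0∞ := II.indicator (fun r => ‖f (r • (φ : Eu (k+1))) - f (r • (θ : Eu (k+1)))‖ₑ) with hA
  have mA : Measurable A := by
    refine Measurable.indicator ?_ measurableSet_Ioo
    exact ((hf.comp (by fun_prop : Measurable fun r : ℝ => r • (φ : Eu (k+1)))).sub (hf.comp (by fun_prop : Measurable fun r : ℝ => r • (θ : Eu (k+1))))).enorm
  set M := ENNReal.ofReal ((1/2:ℝ) ^ (α - (k+1:ℕ))) * Kz α ((θ : Eu (k+1)) - (φ : Eu (k+1))) with hM
  have iA : ∫⁻ r, A r ∂(nu k) ≤ ENNReal.ofReal ((3/2)^k) * DD f φ θ := by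
    rw [hA, lintegral_indicator measurableSet_Ioo]
    have hn := nu_le (k := k) (a := 1/2) (b := 3/2) (c := (3/2)^k) (fun r hr => pow_le_pow_left₀ (by linarith [hr.1]) hr.2.le k)
    refine (lintegral_mono' hn le_rfl).trans ?_
    rw [lintegral_smul_measure, smul_eq_mul]
    unfold DD
    rw [nz_self, nz_self]
  have pw : ∀ r s : ℝ, 0 < r → 0 < s → ‖gt f (r • (θ : Eu (k+1))) - gt f (r • (φ : Eu (k+1)))‖ₑ * ‖gt f (s • (θ : Eu (k+1))) - gt f (s • (φ : Eu (k+1)))‖ₑ *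
      Kz α (r • (θ : Eu (k+1)) - s • (φ : Eu (k+1))) ≤ A r * (A s * M) := by
    intro r s hr hs
    rw [gt_ray f θ φ hr, gt_ray f θ φ hs, mul_assoc]
    by_cases h1 : r ∈ II
    swap
    · rw [Set.indicator_of_notMem h1]; simp
    by_cases h2 : s ∈ II
    swap
    · rw [Set.indicator_of_notMem h2]; simp
    rcases eq_or_ne (θ : Eu (k+1)) φ with h | h
    · rw [h]; simp [Set.indicator]
    · have := Kz_ray hαn θ φ h h1.1 h2.1
      rw [← hM] at this
      exact mul_le_mul_right (mul_le_mul_right this _) _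
  calc _ ≤ ∫⁻ r, ∫⁻ s, A r * (A s * M) ∂(nu k) ∂(nu k) := by
        refine lintegral_mono_ae ?_
        filter_upwards [nu_ae_pos] with r hr
        refine lintegral_mono_ae ?_
        filter_upwards [nu_ae_pos] with s hs using pw r s hr hs
    _ = (∫⁻ r, A r ∂(nu k)) * ((∫⁻ r, A r ∂(nu k)) * M) := by
        have : ∀ r, ∫⁻ s, A r * (A s * M) ∂(nu k) = A r * ((∫⁻ s, A s ∂(nu k)) * M) := fun r => by
          rw [lintegral_const_mul _ (mA.mul_const M), lintegral_mul_const _ mA]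
        simp_rw [this]
        rw [lintegral_mul_const _ mA]
    _ ≤ (ENNReal.ofReal ((3/2)^k) * DD f φ θ) * ((ENNReal.ofReal ((3/2)^k) * DD f φ θ) * M) := by gcongr
    _ = _ := by rw [hM]; ring

lemma ZZ_le {k : ℕ} {α : ℝ} (hα : 0 < α) (hαn : α < (k+1 : ℕ)) : ∃ C : NNReal, ∀ (f : Eu (k+1) → ℝ) (_ : ContDiff ℝ 1 f)
    (_ : ∀ x, 0 ≤ f x) (_ : ∀ x, f x ≤ 1),
    ZZ α (gt f) ≤ C * ((∫⁻ θ : Sp k, e1 f θ ∂(sig k)) + ∫⁻ θ : Sp k, w1 f θ ∂(sig k)) := by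
  obtain ⟨C, hC⟩ := solid_le hα hαn
  set c : ℝ := (3:ℝ) ^ (α - (k+1:ℕ) - 1) / 8
  have hc : 0 < c := by positivity
  set M : ℝ≥0∞ := ENNReal.ofReal ((1/2:ℝ) ^ (α - (k+1:ℕ))) * ENNReal.ofReal ((3/2)^k) * ENNReal.ofReal ((3/2)^k) * (ENNReal.ofReal c)⁻¹ * C with hM
  have hc0 : ENNReal.ofReal c ≠ 0 := (ENNReal.ofReal_pos.2 hc).ne'
  have hMt : M ≠ ⊤ := by
    have : (ENNReal.ofReal c)⁻¹ ≠ ⊤ := ENNReal.inv_ne_top.2 hc0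
    rw [hM]; finiteness
  refine ⟨M.toNNReal, fun f hf hf0 hf1 => ?_⟩
  rw [ENNReal.coe_toNNReal hMt]
  have h1 := ZZ_DD hαn hf.continuous.measurable
  have h2 := (desolid hαn hf.continuous.measurable).trans (hC f hf hf0 hf1)
  generalize (∫⁻ θ : Sp k, ∫⁻ φ : Sp k, DD f φ θ * DD f φ θ * Kz α ((θ : Eu (k+1)) - (φ : Eu (k+1))) ∂(sig k) ∂(sig k)) = Y at h1 h2
  generalize ((∫⁻ θ : Sp k, e1 f θ ∂(sig k)) + ∫⁻ θ : Sp k, w1 f θ ∂(sig k)) = W at h2 ⊢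
  have h3 : Y ≤ (ENNReal.ofReal c)⁻¹ * (C * W) := by
    rw [mul_comm, ← div_eq_mul_inv, ENNReal.le_div_iff_mul_le (Or.inl hc0) (Or.inl (by finiteness)), mul_comm]
    exact h2
  refine h1.trans ((mul_le_mul_right h3 _).trans ?_)
  rw [hM]
  apply le_of_eq; ring

lemma II_to_vol {k : ℕ} {h : Eu (k+1) → ℝ≥0∞} (hh : Measurable h) :
    ∫⁻ θ : Sp k, (∫⁻ r in II, h (r • (θ : Eu (k+1)))) ∂(sig k) ≤ ENNReal.ofReal (2^k) * ∫⁻ x, h x := by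
  rw [lintegral_pol _ hh, ← lintegral_const_mul' _ _ (by finiteness)]
  refine lintegral_mono fun θ => ?_
  have hn := nu_ge (k := k) (a := 1/2) (b := 3/2) (c := (1/2)^k) (by norm_num) (fun r hr => pow_le_pow_left₀ (by norm_num) hr.1.le k)
  have := lintegral_mono' hn (le_refl fun r : ℝ => h (r • (θ : Eu (k+1))))
  rw [lintegral_smul_measure, smul_eq_mul] at this
  calc _ = ENNReal.ofReal (2^k) * (ENNReal.ofReal ((1/2)^k) * ∫⁻ r in II, h (r • (θ : Eu (k+1)))) := by
        rw [← mul_assoc, ← ENNReal.ofReal_mul (by positivity), ← mul_pow]; norm_num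
    _ ≤ _ := mul_le_mul_right this _

lemma e1_int {k : ℕ} {f : Eu (k+1) → ℝ} (hf : ContDiff ℝ 1 f) :
    ∫⁻ θ : Sp k, e1 f θ ∂(sig k) ≤ ENNReal.ofReal (2^k) * ∫⁻ x, ENNReal.ofReal (ee f x) :=
  II_to_vol (cont_ee hf).measurable.ennreal_ofReal

/-- weight -/
def wt {k : ℕ} (x : Eu (k+1)) : ℝ≥0∞ := ENNReal.ofReal (min |‖x‖ - 1| 1)
lemma wt_meas {k : ℕ} : Measurable (wt (k := k)) := by unfold wt; fun_prop

lemma w1_int {k : ℕ} {f : Eu (k+1) → ℝ} (hf : Measurable f) :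
    ∫⁻ θ : Sp k, w1 f θ ∂(sig k) ≤ ENNReal.ofReal (2^k) * ∫⁻ x, ‖f x - (ball (0 : Eu (k+1)) 1).indicator 1 x‖ₑ * wt x := by
  have hi : Measurable ((ball (0 : Eu (k+1)) 1).indicator (1 : Eu (k+1) → ℝ)) := measurable_one.indicator measurableSet_ball
  refine le_trans (lintegral_mono fun θ => ?_) (II_to_vol ((hf.sub hi).enorm.mul wt_meas))
  refine setLIntegral_mono' measurableSet_Ioo fun r hr => ?_
  have hn : ‖r • (θ : Eu (k+1))‖ = r := by rw [norm_smul]; simp; linarith [hr.1]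
  simp only [wt, hn]
  have h1 : |r - 1| ≤ 1 := abs_le.2 ⟨by linarith [hr.1], by linarith [hr.2]⟩
  rw [min_eq_left h1]
  refine le_of_eq ?_
  congr 3
  by_cases h : r < 1
  · rw [Set.indicator_of_mem (by exact h), Set.indicator_of_mem (by simpa [hn] using h)]; rfl
  · rw [Set.indicator_of_notMem (by exact h), Set.indicator_of_notMem (by simpa [hn] using h)]

/-- divergence of `X0` as a function of the radius -/
def Dv (k : ℕ) (r : ℝ) : ℝ := 2 * (k+1) / (1 + r^2) - 4 * r^2 / (1 + r^2)^2

lemma X0_comp_deriv {k : ℕ} (i : Fin (k+1)) (x : Eu (k+1)) :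
    ∃ L : Eu (k+1) →L[ℝ] ℝ, HasFDerivAt (fun x : Eu (k+1) => X0 x i) L x ∧ L (EuclideanSpace.single i 1) = 2 / (1 + ‖x‖^2) - 4 * (x i)^2 / (1 + ‖x‖^2)^2 := by
  have h1 : HasFDerivAt (fun x : Eu (k+1) => ‖x‖^2) (2 • innerSL ℝ x) x := (hasStrictFDerivAt_norm_sq x).hasFDerivAt
  have hp : 1 + ‖x‖^2 ≠ 0 := by positivity
  have h2 : HasDerivAt (fun u : ℝ => 2 / (1 + u)) (-2 / (1 + ‖x‖^2)^2) (‖x‖^2) := by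
    have := ((hasDerivAt_id (‖x‖^2)).const_add 1).inv hp
    have := this.const_mul 2
    refine (this.congr_deriv ?_).congr_of_eventuallyEq (Eventually.of_forall fun u => by simp [div_eq_mul_inv])
    simp only [id_eq]; ring
  have h3 := h2.comp_hasFDerivAt x h1
  have h4 : HasFDerivAt (fun x : Eu (k+1) => x i) (EuclideanSpace.proj i : Eu (k+1) →L[ℝ] ℝ) x := (EuclideanSpace.proj i : Eu (k+1) →L[ℝ] ℝ).hasFDerivAt
  refine ⟨_, h3.mul h4, ?_⟩
  simp [EuclideanSpace.inner_single_right]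
  field_simp
  ring

lemma X0_div {k : ℕ} {f : Eu (k+1) → ℝ} (hf : ContDiff ℝ 1 f) (hs : HasCompactSupport f) :
    ∫ x, fderiv ℝ f x (X0 x) = - ∫ x, f x * Dv k ‖x‖ := by
  have cf := hf.continuous_fderiv one_ne_zero
  have hexp : ∀ x, fderiv ℝ f x (X0 x) = ∑ i, X0 x i * fderiv ℝ f x (EuclideanSpace.single i 1) := by
    intro x
    have : X0 x = ∑ i, X0 x i • (EuclideanSpace.single i (1:ℝ) : Eu (k+1)) := by
      have := (EuclideanSpace.basisFun (Fin (k+1)) ℝ).sum_repr (X0 x)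
      simpa using this.symm
    conv_lhs => rw [this]
    simp [map_sum]
  have cX : ∀ i, Continuous fun x : Eu (k+1) => X0 x i := fun i => (EuclideanSpace.proj i : Eu (k+1) →L[ℝ] ℝ).continuous.comp cont_X0
  have dX : ∀ i (x : Eu (k+1)), fderiv ℝ (fun x : Eu (k+1) => X0 x i) x (EuclideanSpace.single i 1) = 2 / (1 + ‖x‖^2) - 4 * (x i)^2 / (1 + ‖x‖^2)^2 := by
    intro i x
    obtain ⟨L, h1, h2⟩ := X0_comp_deriv i x
    rw [h1.fderiv, h2]
  have cD : ∀ i, Continuous fun x : Eu (k+1) => 2 / (1 + ‖x‖^2) - 4 * (x i)^2 / (1 + ‖x‖^2)^2 := by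
    intro i
    have ci : Continuous fun x : Eu (k+1) => x i := (EuclideanSpace.proj i : Eu (k+1) →L[ℝ] ℝ).continuous
    refine Continuous.sub (Continuous.div (by fun_prop) (by fun_prop) fun x => by positivity) (Continuous.div (by fun_prop) (by fun_prop) fun x => by positivity)
  have int1 : ∀ i, Integrable fun x => X0 x i * fderiv ℝ f x (EuclideanSpace.single i 1) := by
    intro i
    refine Continuous.integrable_of_hasCompactSupport ((cX i).mul (cf.clm_apply continuous_const)) ?_
    exact (hs.fderiv_apply ℝ _).mul_left
  have int2 : ∀ i, Integrable fun x : Eu (k+1) => (2 / (1 + ‖x‖^2) - 4 * (x i)^2 / (1 + ‖x‖^2)^2) * f x := fun i =>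
    Continuous.integrable_of_hasCompactSupport ((cD i).mul hf.continuous) hs.mul_left
  have ibp : ∀ i, ∫ x, X0 x i * fderiv ℝ f x (EuclideanSpace.single i 1) = - ∫ x : Eu (k+1), (2 / (1 + ‖x‖^2) - 4 * (x i)^2 / (1 + ‖x‖^2)^2) * f x := by
    intro i
    have := integral_mul_fderiv_eq_neg_fderiv_mul_of_integrable (μ := (volume : Measure (Eu (k+1)))) (f := fun x => X0 x i) (g := f) (v := EuclideanSpace.single i 1)
      (by simp_rw [dX]; exact int2 i) (int1 i) (Continuous.integrable_of_hasCompactSupport ((cX i).mul hf.continuous) hs.mul_left)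
      (fun x _ => by obtain ⟨L, h1, h2⟩ := X0_comp_deriv i x; exact h1.differentiableAt) (fun x _ => hf.differentiable one_ne_zero x)
    rw [this]; simp_rw [dX]
  simp_rw [hexp]
  rw [integral_finsetSum _ fun i _ => int1 i]
  simp_rw [ibp]
  rw [Finset.sum_neg_distrib, ← integral_finsetSum _ fun i _ => int2 i]
  congr 1
  refine integral_congr_ae (ae_of_all _ fun x => ?_)
  simp only [Dv]
  rw [← Finset.sum_mul, mul_comm, Finset.sum_sub_distrib, ← Finset.sum_div, ← Finset.sum_div, ← Finset.mul_sum, ← EuclideanSpace.real_norm_sq_eq]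
  simp
  left; ring

lemma Dv_cont (k : ℕ) : Continuous (Dv k) := by
  unfold Dv
  refine Continuous.sub (Continuous.div (by fun_prop) (by fun_prop) fun x => by positivity) (Continuous.div (by fun_prop) (by fun_prop) fun x => by positivity)

lemma Dv_ball (k : ℕ) : ∫ x : Eu (k+1), (ball (0 : Eu (k+1)) 1).indicator 1 x * Dv k ‖x‖ = (k+1) * om (k+1) := by
  have h := integral_fun_norm_addHaar (volume : Measure (Eu (k+1))) (fun r => (Set.Iio (1:ℝ)).indicator 1 r * Dv k r)
  have h1 : ∀ x : Eu (k+1), (ball (0 : Eu (k+1)) 1).indicator (1 : Eu (k+1) → ℝ) x = (Set.Iio (1:ℝ)).indicator 1 ‖x‖ := by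
    intro x; by_cases hx : ‖x‖ < 1 <;> simp [Set.indicator, hx]
  simp_rw [h1]
  rw [h]
  have hv : volume.real (ball (0 : Eu (k+1)) 1) = om (k+1) := by
    rw [measureReal_def, vol_unit, ENNReal.toReal_ofReal (om_pos _).le]
  rw [hv]
  simp only [finrank_euclideanSpace, Fintype.card_fin, Nat.add_sub_cancel, nsmul_eq_mul, smul_eq_mul]
  have h2 : ∫ y in Set.Ioi (0:ℝ), y ^ k * ((Set.Iio (1:ℝ)).indicator 1 y * Dv k y) = 1 := by
    have e1 : ∀ y : ℝ, y ^ k * ((Set.Iio (1:ℝ)).indicator 1 y * Dv k y) = (Set.Iio (1:ℝ)).indicator (fun y => y ^ k * Dv k y) y := by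
      intro y; by_cases hy : y < 1 <;> simp [Set.indicator, hy]
    simp_rw [e1]
    rw [setIntegral_indicator measurableSet_Iio, Set.Ioi_inter_Iio, ← integral_Ioc_eq_integral_Ioo, ← intervalIntegral.integral_of_le zero_le_one]
    have hd : ∀ y ∈ Set.uIcc (0:ℝ) 1, HasDerivAt (fun y : ℝ => 2 * y^(k+1) / (1 + y^2)) (y ^ k * Dv k y) y := by
      intro y _
      have hp : (1 + y^2) ≠ 0 := by positivity
      have := ((hasDerivAt_pow (k+1) y).const_mul 2).div ((hasDerivAt_pow 2 y).const_add 1) hp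
      refine this.congr_deriv ?_
      unfold Dv
      push_cast
      field_simp
      ring
    rw [intervalIntegral.integral_eq_sub_of_hasDerivAt hd (Continuous.intervalIntegrable ((continuous_pow k).mul (Dv_cont k)) _ _)]
    norm_num
  rw [h2]; push_cast; ring

lemma Dv_bound (k : ℕ) {r : ℝ} (hr : 0 ≤ r) : |Dv k r - k| ≤ 2 * (k+2) * min |r - 1| 1 := by
  set q := (1 - r^2) / (1 + r^2) with hq
  have hp : 0 < 1 + r^2 := by positivity
  have e : Dv k r - k = (k+1) * q + q^2 := by
    rw [hq]; unfold Dv; field_simp; ring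
  have q1 : |q| ≤ 1 := by
    rw [hq, abs_div, abs_of_pos hp, div_le_one hp, abs_le]; constructor <;> nlinarith
  have q2 : |q| ≤ 2 * |r - 1| := by
    rw [hq, abs_div, abs_of_pos hp, div_le_iff₀ hp, show 1 - r^2 = (r - 1) * (-(1 + r)) by ring, abs_mul, abs_neg, abs_of_nonneg (by linarith : 0 ≤ 1 + r)]
    nlinarith [abs_nonneg (r - 1), mul_nonneg (abs_nonneg (r-1)) (sq_nonneg (r - 1)), mul_nonneg (abs_nonneg (r-1)) (sq_nonneg r)]
  have q3 : |q| ≤ 2 * min |r - 1| 1 := by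
    rcases min_cases |r - 1| 1 with ⟨h, _⟩ | ⟨h, _⟩ <;> rw [h] <;> linarith
  have hk : (0:ℝ) ≤ k := Nat.cast_nonneg k
  rw [e]
  calc |(k+1) * q + q^2| ≤ |(k+1) * q| + |q^2| := abs_add_le _ _
    _ = (k+1) * |q| + |q| * |q| := by rw [abs_mul, abs_of_nonneg (by positivity : (0:ℝ) ≤ k+1), sq, abs_mul]
    _ ≤ (k + 2) * |q| := by nlinarith [abs_nonneg q]
    _ ≤ _ := by nlinarith

lemma ee_int {k : ℕ} {f : Eu (k+1) → ℝ} (hf : ContDiff ℝ 1 f) (hs : HasCompactSupport f) {F : Set (Eu (k+1))} (hF : MeasurableSet F)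
    (hv : volume F = ENNReal.ofReal (om (k+1))) {η : ℝ} (hη : 0 ≤ η) (hfF : ∫⁻ x, ‖f x - F.indicator 1 x‖ₑ ≤ ENNReal.ofReal η) :
    (∫⁻ x, ENNReal.ofReal (ee f x)) + ENNReal.ofReal ((k+1) * om (k+1)) ≤
      (∫⁻ x, ‖fderiv ℝ f x‖ₑ) + ENNReal.ofReal (2 * (k+2)) * (∫⁻ x, ‖f x - (ball (0 : Eu (k+1)) 1).indicator 1 x‖ₑ * wt x) + ENNReal.ofReal (k * η) := by
  have cf := hf.continuous_fderiv one_ne_zero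
  have hk : (0:ℝ) ≤ k := Nat.cast_nonneg k
  have if1 : Integrable f := hf.continuous.integrable_of_hasCompactSupport hs
  have iL : Integrable fun x => ‖fderiv ℝ f x‖ := cf.norm.integrable_of_hasCompactSupport (hs.fderiv ℝ).norm
  have iX : Integrable fun x => fderiv ℝ f x (X0 x) := by
    refine iL.mono (cf.clm_apply cont_X0).aestronglyMeasurable (ae_of_all _ fun x => ?_)
    rw [norm_norm]
    exact ((fderiv ℝ f x).le_opNorm _).trans (mul_le_of_le_one_right (norm_nonneg _) (norm_X0_le x))
  set B : Eu (k+1) → ℝ := (ball (0 : Eu (k+1)) 1).indicator 1 with hB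
  have iB : Integrable B := (integrable_indicator_iff measurableSet_ball).2 (integrableOn_const measure_ball_lt_top.ne)
  have iFi : Integrable (F.indicator (1 : Eu (k+1) → ℝ)) := (integrable_indicator_iff hF).2 (integrableOn_const (by rw [hv]; finiteness))
  have vB : ∫ x, B x = om (k+1) := by
    rw [hB, integral_indicator_one measurableSet_ball, measureReal_def, vol_unit, ENNReal.toReal_ofReal (om_pos _).le]
  have vF : ∫ x, F.indicator (1 : Eu (k+1) → ℝ) x = om (k+1) := by
    rw [integral_indicator_one hF, measureReal_def, hv, ENNReal.toReal_ofReal (om_pos _).le]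
  have hDb : ∀ x : Eu (k+1), ‖Dv k ‖x‖‖ ≤ 3 * k + 4 := by
    intro x
    have h1 := Dv_bound k (norm_nonneg x)
    have h2 : min |‖x‖ - 1| 1 ≤ 1 := min_le_right _ _
    have h3 : |Dv k ‖x‖| ≤ |Dv k ‖x‖ - k| + |(k:ℝ)| := by
      have := abs_add_le (Dv k ‖x‖ - k) k
      rwa [sub_add_cancel] at this
    rw [abs_of_nonneg hk] at h3
    rw [Real.norm_eq_abs]
    nlinarith
  have cD : Continuous fun x : Eu (k+1) => Dv k ‖x‖ := (Dv_cont k).comp continuous_norm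
  have ifD : Integrable fun x => f x * Dv k ‖x‖ := if1.mul_bdd (c := 3*k+4) cD.aestronglyMeasurable (ae_of_all _ hDb)
  have iBD : Integrable fun x => B x * Dv k ‖x‖ := iB.mul_bdd (c := 3*k+4) cD.aestronglyMeasurable (ae_of_all _ hDb)
  have iw : Integrable fun x => |f x - B x| * min |‖x‖ - 1| 1 := by
    refine (if1.sub iB).abs.mul_bdd (c := 1) (by fun_prop) (ae_of_all _ fun x => ?_)
    rw [Real.norm_of_nonneg (by positivity)]; exact min_le_right _ _
  have e1 : ∫ x, ee f x = (∫ x, ‖fderiv ℝ f x‖) - ∫ x, f x * Dv k ‖x‖ := by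
    unfold ee
    rw [integral_add iL iX, X0_div hf hs]; ring
  have e2 : ∫ x, f x * Dv k ‖x‖ = (k+1) * om (k+1) + ∫ x, (f x - B x) * Dv k ‖x‖ := by
    rw [← Dv_ball k, ← integral_add iBD (by simp_rw [sub_mul]; exact ifD.sub iBD)]
    refine integral_congr_ae (ae_of_all _ fun x => ?_)
    simp only [hB]; ring
  have e3 : ∫ x, (f x - B x) * Dv k ‖x‖ = k * (∫ x, (f x - F.indicator 1 x)) + ∫ x, (f x - B x) * (Dv k ‖x‖ - k) := by
    have a1 : ∫ x, (f x - F.indicator 1 x) = ∫ x, (f x - B x) := by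
      rw [integral_sub if1 iFi, integral_sub if1 iB, vB, vF]
    have a2 : Integrable fun x => (k:ℝ) * (f x - B x) := (if1.sub iB).const_mul _
    rw [a1, ← integral_const_mul, ← integral_add a2]
    · refine integral_congr_ae (ae_of_all _ fun x => ?_)
      simp only; ring
    · have : Integrable fun x => (f x * Dv k ‖x‖ - B x * Dv k ‖x‖) - k * (f x - B x) := (ifD.sub iBD).sub ((if1.sub iB).const_mul _)
      refine this.congr (ae_of_all _ fun x => ?_)
      simp only; ring
  have b1 : |∫ x, (f x - F.indicator 1 x)| ≤ η := by
    have h1 : ENNReal.ofReal |∫ x, (f x - F.indicator 1 x)| ≤ ENNReal.ofReal η := by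
      rw [← Real.enorm_eq_ofReal_abs]
      exact (enorm_integral_le_lintegral_enorm _).trans hfF
    exact (ENNReal.ofReal_le_ofReal_iff hη).1 h1
  have b2 : |∫ x, (f x - B x) * (Dv k ‖x‖ - k)| ≤ 2 * (k+2) * ∫ x, |f x - B x| * min |‖x‖ - 1| 1 := by
    rw [← integral_const_mul, ← Real.norm_eq_abs]
    refine norm_integral_le_of_norm_le (iw.const_mul _) (ae_of_all _ fun x => ?_)
    rw [norm_mul, Real.norm_eq_abs, Real.norm_eq_abs]
    have := mul_le_mul_of_nonneg_left (Dv_bound k (norm_nonneg x)) (abs_nonneg (f x - B x))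
    linarith
  have main : (∫ x, ee f x) + (k+1) * om (k+1) ≤ (∫ x, ‖fderiv ℝ f x‖) + 2 * (k+2) * (∫ x, |f x - B x| * min |‖x‖ - 1| 1) + k * η := by
    rw [e1, e2, e3]
    have c1 := (abs_le.1 b1).1
    have c2 := (abs_le.1 b2).1
    nlinarith
  have l1 : ∫⁻ x, ENNReal.ofReal (ee f x) = ENNReal.ofReal (∫ x, ee f x) :=
    (ofReal_integral_eq_lintegral_ofReal (iL.add iX) (ae_of_all _ (ee_nonneg f))).symm
  have l2 : ∫⁻ x, ‖fderiv ℝ f x‖ₑ = ENNReal.ofReal (∫ x, ‖fderiv ℝ f x‖) := by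
    rw [ofReal_integral_eq_lintegral_ofReal iL (ae_of_all _ fun x => norm_nonneg _)]
    simp_rw [ofReal_norm]
  have l3 : ∫⁻ x, ‖f x - B x‖ₑ * wt x = ENNReal.ofReal (∫ x, |f x - B x| * min |‖x‖ - 1| 1) := by
    rw [ofReal_integral_eq_lintegral_ofReal iw (ae_of_all _ fun x => by positivity)]
    refine lintegral_congr fun x => ?_
    rw [ENNReal.ofReal_mul (abs_nonneg _), ← Real.enorm_eq_ofReal_abs]; rfl
  have p0 : 0 ≤ ∫ x, ee f x := integral_nonneg (ee_nonneg f)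
  have p1 : 0 ≤ ∫ x, ‖fderiv ℝ f x‖ := integral_nonneg fun x => norm_nonneg _
  have p2 : 0 ≤ ∫ x, |f x - B x| * min |‖x‖ - 1| 1 := integral_nonneg fun x => by positivity
  have p3 := om_pos (k+1)
  rw [l1, l2, l3, ← ENNReal.ofReal_add p0 (by positivity), ← ENNReal.ofReal_mul (by positivity), ← ENNReal.ofReal_add p1 (by positivity), ← ENNReal.ofReal_add (by positivity) (by positivity)]
  exact ENNReal.ofReal_le_ofReal main

/-- weighted `L¹` distance to the unit ball -/
def Wd {k : ℕ} (f : Eu (k+1) → ℝ) : ℝ≥0∞ := ∫⁻ x, ‖f x - (ball (0 : Eu (k+1)) 1).indicator 1 x‖ₑ * wt x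

lemma asm_arith {VB VF Vg Z H T W WF Ei E1 W1 G P nw : ℝ≥0∞} {C1 C2 L c2 c3 kk : ℝ≥0∞}
    (h1 : VB ≤ Vg + Z + C1 * (H + 2 * W + T + T + E1)) (hE : E1 ≤ c2 * Ei) (hW : W1 ≤ c2 * W)
    (hZ : Z ≤ C2 * (E1 + W1)) (hg : Vg ≤ VF + L * (H + 2 * W)) (he : Ei + nw ≤ G + c3 * W + kk * H)
    (hG : G ≤ P + H) (hWF : W ≤ WF + H) (hH : H ≤ T) :
    VB + ((C1+C2)*c2) * nw ≤ VF + ((C1+C2)*c2) * P + ((C1+C2)*c2*c3 + 2*L + C2*c2 + 2*C1) * WF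
      + ((C1+C2)*c2*(1+kk) + L + 3 * C1 + ((C1+C2)*c2*c3 + 2*L + C2*c2 + 2*C1)) * T := by
  calc VB + ((C1+C2)*c2) * nw ≤ (VF + L * (T + 2 * W)) + C2 * (c2 * Ei + c2 * W) + C1 * (T + 2 * W + T + T + c2 * Ei)
        + ((C1+C2)*c2) * nw := by
        gcongr
        refine h1.trans ?_
        gcongr
        · refine hg.trans ?_
          gcongr
        · refine hZ.trans ?_
          gcongr
    _ = VF + ((C1+C2)*c2) * (Ei + nw) + (2*L + C2*c2 + 2*C1) * W + (L + 3 * C1) * T := by ring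
    _ ≤ VF + ((C1+C2)*c2) * ((P + T) + c3 * (WF + T) + kk * T) + (2*L + C2*c2 + 2*C1) * (WF + T) + (L + 3 * C1) * T := by
        have hWT : W ≤ WF + T := hWF.trans (by gcongr)
        have he' : Ei + nw ≤ (P + T) + c3 * (WF + T) + kk * T := by
          refine he.trans ?_
          gcongr
          exact hG.trans (by gcongr)
        generalize Ei + nw = X at he' ⊢
        generalize (P + T) + c3 * (WF + T) + kk * T = Y at he' ⊢
        gcongr
    _ = _ := by ring

lemma gt_nonneg {k : ℕ} {f : Eu (k+1) → ℝ} (h : ∀ x, 0 ≤ f x) (x) : 0 ≤ gt f x := by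
  unfold gt; split_ifs <;> simp [h]
lemma gt_le_one {k : ℕ} {f : Eu (k+1) → ℝ} (h : ∀ x, f x ≤ 1) (x) : gt f x ≤ 1 := by
  unfold gt; split_ifs <;> simp [h]

lemma gt_diff {k : ℕ} (f : Eu (k+1) → ℝ) (x : Eu (k+1)) :
    ‖f x - gt f x‖ₑ ≤ 2 * (‖f x - (ball (0 : Eu (k+1)) 1).indicator 1 x‖ₑ * wt x) := by
  have key : ∀ h : 1/2 ≤ |‖x‖ - 1|, 1 ≤ 2 * wt x := by
    intro h
    unfold wt
    have : 1/2 ≤ min |‖x‖ - 1| 1 := le_min h (by norm_num)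
    generalize min |‖x‖ - 1| 1 = y at this
    rw [← ENNReal.ofReal_ofNat 2, ← ENNReal.ofReal_mul (by norm_num), ENNReal.one_le_ofReal]
    linarith
  have fin : ∀ h : 1/2 ≤ |‖x‖ - 1|, gt f x = (ball (0 : Eu (k+1)) 1).indicator 1 x →
      ‖f x - gt f x‖ₑ ≤ 2 * (‖f x - (ball (0 : Eu (k+1)) 1).indicator 1 x‖ₑ * wt x) := by
    intro h he
    rw [he]
    calc _ = ‖f x - (ball (0 : Eu (k+1)) 1).indicator 1 x‖ₑ * 1 := (mul_one _).symm
      _ ≤ ‖f x - (ball (0 : Eu (k+1)) 1).indicator 1 x‖ₑ * (2 * wt x) := by gcongr; exact key h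
      _ = _ := by ring
  by_cases h1 : ‖x‖ ≤ 1/2
  · refine fin ?_ ?_
    · rw [abs_of_neg (by linarith)]; linarith
    · rw [Set.indicator_of_mem (by rw [mem_ball_zero_iff]; linarith)]; unfold gt; rw [if_pos h1]; rfl
  by_cases h2 : 3/2 ≤ ‖x‖
  · refine fin ?_ ?_
    · rw [abs_of_pos (by linarith)]; linarith
    · rw [Set.indicator_of_notMem (by rw [mem_ball_zero_iff]; linarith)]; unfold gt; rw [if_neg h1, if_pos h2]
  · unfold gt; rw [if_neg h1, if_neg h2]; simp

lemma ofReal_le_add_enorm (a b : ℝ) : ENNReal.ofReal a ≤ ENNReal.ofReal b + ‖a - b‖ₑ := by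
  rw [Real.enorm_eq_ofReal_abs]
  refine le_trans ?_ ENNReal.ofReal_add_le
  exact ENNReal.ofReal_le_ofReal (by linarith [le_abs_self (a-b)])

lemma ofReal_ind {k : ℕ} (F : Set (Eu k)) (x) : ENNReal.ofReal (F.indicator 1 x) = F.indicator 1 x := by
  by_cases h : x ∈ F <;> simp [h]

lemma g_one_sub {a : ℝ} (h0 : 0 ≤ a) (h1 : a ≤ 1) {k : ℕ} (F : Set (Eu k)) (x) :
    ENNReal.ofReal a * (1 - ENNReal.ofReal a) ≤ ‖a - F.indicator 1 x‖ₑ := by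
  rw [Real.enorm_eq_ofReal_abs, ← ENNReal.ofReal_one, ← ENNReal.ofReal_sub _ h0, ← ENNReal.ofReal_mul h0]
  apply ENNReal.ofReal_le_ofReal
  by_cases h : x ∈ F
  · simp only [h, Set.indicator_of_mem, Pi.one_apply]
    rw [abs_of_nonpos (by linarith)]; nlinarith
  · simp only [h, Set.indicator_of_notMem, not_false_eq_true, sub_zero]
    rw [abs_of_nonneg h0]; nlinarith

lemma gt_one_sub {k : ℕ} {f : Eu (k+1) → ℝ} (h0 : ∀ x, 0 ≤ f x) (h1 : ∀ x, f x ≤ 1) (F : Set (Eu (k+1))) (x) :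
    ENNReal.ofReal (gt f x) * (1 - ENNReal.ofReal (gt f x)) ≤ ‖f x - F.indicator 1 x‖ₑ := by
  unfold gt
  split_ifs
  · simp
  · simp
  · exact g_one_sub (h0 x) (h1 x) F x

lemma Wd_meas {k : ℕ} {f : Eu (k+1) → ℝ} (hf : Measurable f) :
    Measurable fun x => ‖f x - (ball (0 : Eu (k+1)) 1).indicator 1 x‖ₑ * wt x := by
  have hi : Measurable ((ball (0 : Eu (k+1)) 1).indicator (1 : Eu (k+1) → ℝ)) := measurable_one.indicator measurableSet_ball
  exact (hf.sub hi).enorm.mul wt_meas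

lemma wt_le_one {k : ℕ} (x : Eu (k+1)) : wt x ≤ 1 := by
  unfold wt; exact ENNReal.ofReal_le_one.2 (min_le_right _ _)

lemma Wd_le {k : ℕ} {f g : Eu (k+1) → ℝ} (hf : Measurable f) (hg : Measurable g) :
    Wd f ≤ Wd g + ∫⁻ x, ‖f x - g x‖ₑ := by
  unfold Wd
  rw [← lintegral_add_left (Wd_meas hg)]
  refine lintegral_mono fun x => ?_
  calc _ ≤ (‖g x - (ball (0 : Eu (k+1)) 1).indicator 1 x‖ₑ + ‖f x - g x‖ₑ) * wt x := by
        gcongr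
        rw [show f x - (ball (0 : Eu (k+1)) 1).indicator 1 x = (g x - (ball (0 : Eu (k+1)) 1).indicator 1 x) + (f x - g x) by ring]
        exact enorm_add_le _ _
    _ = ‖g x - (ball (0 : Eu (k+1)) 1).indicator 1 x‖ₑ * wt x + ‖f x - g x‖ₑ * wt x := by ring
    _ ≤ _ := by
        gcongr
        calc _ ≤ ‖f x - g x‖ₑ * 1 := by gcongr; exact wt_le_one x
          _ = _ := mul_one _

lemma gt_int {k : ℕ} {f : Eu (k+1) → ℝ} (h1 : ∀ x, f x ≤ 1) :
    ∫⁻ x, ENNReal.ofReal (gt f x) ≤ volume (closedBall (0 : Eu (k+1)) (3/2)) := by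
  rw [← lintegral_indicator_one measurableSet_closedBall]
  refine lintegral_mono fun x => ?_
  by_cases h : ‖x‖ ≤ 3/2
  · rw [Set.indicator_of_mem (by simpa using h)];
    exact ENNReal.ofReal_le_one.2 (gt_le_one h1 x)
  · push Not at h
    simp only [gt]
    rw [if_neg (by linarith), if_pos h.le]; simp

lemma quant_t {k : ℕ} {α : ℝ} (hα : 0 < α) (hαn : α < (k+1 : ℕ)) : ∃ Ca Cd Ce : NNReal, ∀ F : Set (Eu (k+1)), MeasurableSet F →
    volume F = ENNReal.ofReal (om (k+1)) → perimeter F ≠ ⊤ → ∀ t : ℝ, 0 < t → t ≤ 1 →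
    rieszEnergy α (ball (0 : Eu (k+1)) 1) + Ca * ENNReal.ofReal ((k+1) * om (k+1)) ≤
      rieszEnergy α F + Ca * (hc k * perimeter F) + Cd * Wd (F.indicator 1) + Ce * ENNReal.ofReal t := by
  obtain ⟨C1, hC1⟩ := ray_main (k := k) hα hαn
  obtain ⟨C2, hC2⟩ := ZZ_le (k := k) hα hαn
  have hom := om_pos (k+1)
  set M : ℝ := (volume (closedBall (0 : Eu (k+1)) (3/2))).toReal + om (k+1) with hM
  have hM1 : volume (closedBall (0 : Eu (k+1)) (3/2)) ≤ ENNReal.ofReal M := by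
    rw [← ENNReal.ofReal_toReal (measure_closedBall_lt_top (x := (0 : Eu (k+1))) (r := 3/2)).ne]
    exact ENNReal.ofReal_le_ofReal (by rw [hM]; linarith)
  have hM2 : ENNReal.ofReal (om (k+1)) ≤ ENNReal.ofReal M := ENNReal.ofReal_le_ofReal (by
    have := ENNReal.toReal_nonneg (a := volume (closedBall (0 : Eu (k+1)) (3/2)))
    rw [hM]; linarith)
  refine ⟨(C1+C2)*Real.toNNReal (2^k), (C1+C2)*Real.toNNReal (2^k)*Real.toNNReal (2*(k+2)) + 2*(2 * Lam k α M) + C2*Real.toNNReal (2^k) + 2*C1,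
    (C1+C2)*Real.toNNReal (2^k)*(1+(k:NNReal)) + (2 * Lam k α M) + 3 * C1 + ((C1+C2)*Real.toNNReal (2^k)*Real.toNNReal (2*(k+2)) + 2*(2 * Lam k α M) + C2*Real.toNNReal (2^k) + 2*C1), ?_⟩
  intro F hF hv hP t ht ht1
  obtain ⟨f, hf, hs, hf0, hf1, hgr, hfF⟩ := exists_smooth hF hP (by rw [hv]; simp) (by positivity : 0 < t^2)
  have hfm : Measurable f := hf.continuous.measurable
  have hFm : Measurable (F.indicator (1 : Eu (k+1) → ℝ)) := measurable_one.indicator hF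
  have hFm' : Measurable (F.indicator (1 : Eu (k+1) → ℝ≥0∞)) := measurable_one.indicator hF
  have hgm := gt_meas hfm
  have hgm' : Measurable fun x => ENNReal.ofReal (gt f x) := hgm.ennreal_ofReal
  have hhm : Measurable fun x => ‖f x - F.indicator 1 x‖ₑ := (hfm.sub hFm).enorm
  have hhm2 : Measurable fun x => 2 * (‖f x - (ball (0 : Eu (k+1)) 1).indicator 1 x‖ₑ * wt x) := (Wd_meas hfm).const_mul 2
  have hh : ∫⁻ x, (‖f x - F.indicator 1 x‖ₑ + 2 * (‖f x - (ball (0 : Eu (k+1)) 1).indicator 1 x‖ₑ * wt x)) ≤ ENNReal.ofReal (t^2) + 2 * Wd f := by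
    rw [lintegral_add_left hhm, lintegral_const_mul _ (Wd_meas hfm)]
    exact add_le_add_left hfF _
  have hδ : ENNReal.ofReal (om (k+1)) ≤ (∫⁻ x, ENNReal.ofReal (gt f x)) + (ENNReal.ofReal (t^2) + 2 * Wd f) := by
    refine le_trans ?_ (add_le_add_right hh _)
    rw [← lintegral_add_left hgm', ← hv, ← lintegral_indicator_one hF]
    refine lintegral_mono fun x => ?_
    rw [← ofReal_ind]
    calc _ ≤ ENNReal.ofReal (f x) + ‖F.indicator 1 x - f x‖ₑ := ofReal_le_add_enorm _ _
      _ ≤ (ENNReal.ofReal (gt f x) + ‖f x - gt f x‖ₑ) + ‖f x - F.indicator 1 x‖ₑ := by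
          rw [enorm_sub_rev]
          gcongr
          exact ofReal_le_add_enorm _ _
      _ ≤ (ENNReal.ofReal (gt f x) + 2 * (‖f x - (ball (0 : Eu (k+1)) 1).indicator 1 x‖ₑ * wt x)) + ‖f x - F.indicator 1 x‖ₑ := by
          gcongr; exact gt_diff f x
      _ = _ := by ring
  have h1 := hC1 (gt f) hgm (gt_nonneg hf0) (gt_le_one hf1) (fun x hx => by simp only [gt]; rw [if_pos hx])
    (fun x hx => by simp only [gt]; rw [if_neg (by linarith), if_pos hx]) (fun θ => e1 f θ) ((e1_meas hf).comp measurable_subtype_coe)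
    (by
      intro θ r s hr hrs hs
      have hθ : ‖(θ : Eu (k+1))‖ = 1 := by simp
      have e : ∀ r : ℝ, 1/2 < r → r < 3/2 → gt f (r • (θ : Eu (k+1))) = f (r • (θ : Eu (k+1))) := by
        intro r h1 h2
        have : ‖r • (θ : Eu (k+1))‖ = r := by rw [norm_smul, hθ, mul_one, Real.norm_of_nonneg (by linarith)]
        simp only [gt, this]
        rw [if_neg (by linarith), if_neg (by linarith)]
      rw [e r hr (by linarith), e s (by linarith) hs]
      exact ray_mono hf hθ hr hrs hs) _ hδ t ht
  have hT : (∫⁻ x, ENNReal.ofReal (gt f x) * (1 - ENNReal.ofReal (gt f x))) / ENNReal.ofReal t ≤ ENNReal.ofReal t := by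
    refine ENNReal.div_le_of_le_mul ?_
    rw [← ENNReal.ofReal_mul ht.le, ← sq]
    exact (lintegral_mono fun x => gt_one_sub hf0 hf1 F x).trans hfF
  have hVg : VV α (fun x => ENNReal.ofReal (gt f x)) (fun x => ENNReal.ofReal (gt f x)) ≤ rieszEnergy α F + 2 * Lam k α M * (ENNReal.ofReal (t^2) + 2 * Wd f) := by
    rw [rieszEnergy_eq α hF]
    refine (VV_le hα hαn hgm' hFm' (hhm.add hhm2) (fun x => ENNReal.ofReal_le_one.2 (gt_le_one hf1 x))
      (fun x => Set.indicator_le_self' (by simp) x) ((gt_int hf1).trans hM1)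
      (by rw [lintegral_indicator_one hF, hv]; exact hM2) ?_).trans (add_le_add_right (mul_le_mul_right hh _) _)
    intro x
    simp only [Pi.add_apply]
    rw [← ofReal_ind]
    calc _ ≤ ENNReal.ofReal (f x) + ‖gt f x - f x‖ₑ := ofReal_le_add_enorm _ _
      _ ≤ (ENNReal.ofReal (F.indicator 1 x) + ‖f x - F.indicator 1 x‖ₑ) + 2 * (‖f x - (ball (0 : Eu (k+1)) 1).indicator 1 x‖ₑ * wt x) := by
          rw [enorm_sub_rev]
          gcongr
          · exact ofReal_le_add_enorm _ _
          · exact gt_diff f x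
      _ = _ := by ring
  have he := ee_int hf hs hF hv (sq_nonneg t) hfF
  rw [ENNReal.ofReal_mul (by positivity : (0:ℝ) ≤ k)] at he
  have hWF := (Wd_le hfm hFm).trans (add_le_add_right hfF _)
  have hH : ENNReal.ofReal (t^2) ≤ ENNReal.ofReal t := ENNReal.ofReal_le_ofReal (by nlinarith)
  have h1' := h1.trans (add_le_add_right (mul_le_mul_right (add_le_add_left (add_le_add_right hT _) _) _) _)
  have := asm_arith h1' (e1_int hf) (w1_int hfm) (hC2 f hf hf0 hf1) hVg he hgr hWF hH
  have e1 : ((Real.toNNReal (2^k) : NNReal) : ℝ≥0∞) = ENNReal.ofReal (2^k) := rfl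
  have e2 : ((Real.toNNReal (2*(k+2)) : NNReal) : ℝ≥0∞) = ENNReal.ofReal (2*(k+2)) := rfl
  push_cast
  rw [e1, e2]
  rw [ENNReal.ofReal_natCast] at this
  exact this

lemma quant {k : ℕ} {α : ℝ} (hα : 0 < α) (hαn : α < (k+1 : ℕ)) : ∃ Ca Cd : NNReal, ∀ F : Set (Eu (k+1)), MeasurableSet F →
    volume F = ENNReal.ofReal (om (k+1)) → perimeter F ≠ ⊤ →
    rieszEnergy α (ball (0 : Eu (k+1)) 1) + Ca * ENNReal.ofReal ((k+1) * om (k+1)) ≤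
      rieszEnergy α F + Ca * (hc k * perimeter F) + Cd * Wd (F.indicator 1) := by
  obtain ⟨Ca, Cd, Ce, h⟩ := quant_t (k := k) hα hαn
  refine ⟨Ca, Cd, fun F hF hv hP => ?_⟩
  have ht : Tendsto (fun t : ℝ => rieszEnergy α F + Ca * (hc k * perimeter F) + Cd * Wd (F.indicator 1) + Ce * ENNReal.ofReal t)
      (nhdsWithin 0 (Set.Ioi 0)) (nhds (rieszEnergy α F + Ca * (hc k * perimeter F) + Cd * Wd (F.indicator 1) + Ce * ENNReal.ofReal 0)) := by
    refine Tendsto.mono_left ?_ nhdsWithin_le_nhds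
    refine Tendsto.add tendsto_const_nhds ?_
    exact ENNReal.Tendsto.const_mul (ENNReal.tendsto_ofReal tendsto_id) (Or.inr (by simp))
  rw [ENNReal.ofReal_zero, mul_zero, add_zero] at ht
  refine ge_of_tendsto ht ?_
  filter_upwards [Ioo_mem_nhdsGT (zero_lt_one' ℝ)] with t ht
  exact h F hF hv hP t ht.1 ht.2.le

lemma rpow_gap {β : ℝ} (hβ : 0 < β) : ∃ c : ℝ, 0 < c ∧ (∀ r : ℝ, 1 ≤ r → c * min |r - 1| 1 + 1 ≤ r ^ β) ∧
    (∀ r : ℝ, 0 ≤ r → r ≤ 1 → c * min |r - 1| 1 + r ^ β ≤ 1) := by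
  refine ⟨min β 1 / 2, by positivity, fun r hr => ?_, fun r hr hr1 => ?_⟩
  · have h0 : 0 < r := by linarith
    have h1 : β * Real.log r + 1 ≤ r ^ β := by
      rw [Real.rpow_def_of_pos h0, mul_comm β]
      exact Real.add_one_le_exp _
    have h2 : 1 - r⁻¹ ≤ Real.log r := Real.one_sub_inv_le_log_of_pos h0
    have h3 : min |r - 1| 1 / 2 ≤ 1 - r⁻¹ := by
      rw [abs_of_nonneg (by linarith), show 1 - r⁻¹ = (r - 1) / r by field_simp, le_div_iff₀ h0]
      rcases le_total (r - 1) 1 with h | h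
      · rw [min_eq_left h]; nlinarith
      · rw [min_eq_right h]; nlinarith
    have h4 : min β 1 / 2 * min |r - 1| 1 ≤ β * (min |r - 1| 1 / 2) := by
      have : 0 ≤ min |r - 1| 1 := by positivity
      have := min_le_left β 1
      nlinarith
    nlinarith
  · have hm : min |r - 1| 1 = 1 - r := by
      rw [abs_of_nonpos (by linarith), min_eq_left (by linarith)]; ring
    rw [hm]
    rcases le_total β 1 with h | h
    · rw [min_eq_left h]
      have := rpow_one_add_le_one_add_mul_self (s := r - 1) (by linarith) hβ.le h
      rw [show 1 + (r - 1) = r by ring] at this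
      nlinarith
    · rw [min_eq_right h]
      have := Real.rpow_le_rpow_of_exponent_ge' hr hr1 zero_le_one h
      rw [Real.rpow_one] at this
      nlinarith

lemma pot_ind {k : ℕ} (β : ℝ) {F : Set (Eu (k+1))} (hF : MeasurableSet F) :
    potEnergy β 1 F = ∫⁻ x, F.indicator 1 x * ENNReal.ofReal (‖x‖ ^ β) := by
  unfold potEnergy
  rw [← lintegral_indicator hF]
  congr 1; ext x
  by_cases h : x ∈ F <;> simp [h]

lemma potEnergy_ball_fin {k : ℕ} {β : ℝ} (hβ : 0 < β) : potEnergy β 1 (ball (0 : Eu (k+1)) 1) ≠ ⊤ := by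
  rw [pot_ind β measurableSet_ball]
  refine ne_top_of_le_ne_top ?_ (lintegral_mono (g := (ball (0 : Eu (k+1)) 1).indicator 1) fun x => ?_)
  · rw [lintegral_indicator_one measurableSet_ball, vol_unit]; simp
  · by_cases h : x ∈ ball (0 : Eu (k+1)) 1
    · simp only [h, Set.indicator_of_mem, Pi.one_apply, one_mul]
      exact ENNReal.ofReal_le_one.2 (Real.rpow_le_one (norm_nonneg _) (by simpa using (mem_ball_zero_iff.1 h).le) hβ.le)
    · simp [h]

lemma Wd_pot {k : ℕ} {β : ℝ} (hβ : 0 < β) : ∃ c : ℝ, 0 < c ∧ ∀ F : Set (Eu (k+1)), MeasurableSet F →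
    volume F = ENNReal.ofReal (om (k+1)) →
    ENNReal.ofReal c * Wd (F.indicator 1) + potEnergy β 1 (ball (0 : Eu (k+1)) 1) ≤ potEnergy β 1 F := by
  obtain ⟨c, hc, h1, h2⟩ := rpow_gap hβ
  refine ⟨c, hc, fun F hF hv => ?_⟩
  set B := ball (0 : Eu (k+1)) 1 with hB
  have mB : MeasurableSet B := measurableSet_ball
  have hFm : Measurable (F.indicator (1 : Eu (k+1) → ℝ)) := measurable_one.indicator hF
  have mφ : Measurable fun x : Eu (k+1) => ENNReal.ofReal (‖x‖ ^ β) := (measurable_norm.pow_const β).ennreal_ofReal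
  have iF : ∫⁻ x, F.indicator 1 x = ENNReal.ofReal (om (k+1)) := by rw [lintegral_indicator_one hF, hv]
  have iB : ∫⁻ x, B.indicator 1 x = ENNReal.ofReal (om (k+1)) := by rw [lintegral_indicator_one mB, vol_unit]
  rw [← ENNReal.add_le_add_iff_right (ENNReal.ofReal_ne_top (r := om (k+1)))]
  nth_rw 2 [← iB]
  rw [← iF, pot_ind β hF, pot_ind β mB, Wd]
  have m1 : Measurable fun x => ‖F.indicator (1 : Eu (k+1) → ℝ) x - B.indicator 1 x‖ₑ * wt x := Wd_meas hFm
  have mFi : Measurable (F.indicator (1 : Eu (k+1) → ℝ≥0∞)) := measurable_one.indicator hF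
  have mBi : Measurable (B.indicator (1 : Eu (k+1) → ℝ≥0∞)) := measurable_one.indicator mB
  rw [← lintegral_const_mul _ m1, ← lintegral_add_left (m1.const_mul _), ← lintegral_add_right _ mFi, ← lintegral_add_right _ mBi]
  refine lintegral_mono fun x => ?_
  have key1 : x ∉ B → ENNReal.ofReal c * wt x + 1 ≤ ENNReal.ofReal (‖x‖ ^ β) := by
    intro hx
    have hx' : 1 ≤ ‖x‖ := by simpa [hB] using hx
    unfold wt
    rw [← ENNReal.ofReal_mul hc.le, ← ENNReal.ofReal_one, ← ENNReal.ofReal_add (by positivity) (by norm_num)]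
    exact ENNReal.ofReal_le_ofReal (h1 _ hx')
  have key2 : x ∈ B → ENNReal.ofReal c * wt x + ENNReal.ofReal (‖x‖ ^ β) ≤ 1 := by
    intro hx
    have hx' : ‖x‖ < 1 := by simpa [hB] using hx
    unfold wt
    rw [← ENNReal.ofReal_mul hc.le, ← ENNReal.ofReal_one, ← ENNReal.ofReal_add (by positivity) (by positivity)]
    exact ENNReal.ofReal_le_ofReal (h2 _ (norm_nonneg x) hx'.le)
  by_cases hx : x ∈ B <;> by_cases hy : x ∈ F
  · simp [hx, hy]
  · simpa [hx, hy] using key2 hx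
  · simpa [hx, hy] using key1 hx
  · simp [hx, hy]

lemma rpow_lip (γ : ℝ) {l L : ℝ} (hl : 0 < l) : ∃ C : ℝ, 0 ≤ C ∧ ∀ y ∈ Set.Icc l L, ∀ z ∈ Set.Icc l L,
    |y ^ γ - z ^ γ| ≤ C * |y - z| := by
  have hpos : ∀ x ∈ Set.Icc l L, x ≠ 0 := fun x hx => (hl.trans_le hx.1).ne'
  have hc : ContinuousOn (fun x : ℝ => γ * x ^ (γ - 1)) (Set.Icc l L) :=
    continuousOn_const.mul (continuousOn_id.rpow_const fun x hx => Or.inl (hpos x hx))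
  obtain ⟨C, hC⟩ := isCompact_Icc.exists_bound_of_continuousOn hc
  refine ⟨|C|, abs_nonneg _, fun y hy z hz => ?_⟩
  have := Convex.norm_image_sub_le_of_norm_hasDerivWithin_le (f := fun x : ℝ => x ^ γ) (f' := fun x : ℝ => γ * x ^ (γ - 1)) (C := |C|)
    (s := Set.Icc l L) (fun x hx => (Real.hasDerivAt_rpow_const (Or.inl (hpos x hx))).hasDerivWithinAt)
    (fun x hx => (hC x hx).trans (le_abs_self C)) (convex_Icc l L) hz hy
  simpa [Real.norm_eq_abs] using this

lemma taylor2 {γ c l L : ℝ} (hl : 0 < l) (hl1 : l < 1) (hL : 1 < L) (h : ∀ x ∈ Set.Icc l L, γ * (γ - 1) * x ^ (γ - 2) ≤ 2 * c) :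
    ∀ x ∈ Set.Icc l L, x ^ γ ≤ 1 + γ * (x - 1) + c * (x - 1)^2 := by
  have hpos : ∀ x ∈ Set.Icc l L, x ≠ 0 := fun x hx => (hl.trans_le hx.1).ne'
  set g : ℝ → ℝ := fun x => 1 + γ * (x - 1) + c * (x - 1)^2 - x ^ γ with hg
  set g' : ℝ → ℝ := fun x => γ + 2 * c * (x - 1) - γ * x ^ (γ - 1) with hg'
  have d1 : ∀ x ∈ Set.Icc l L, HasDerivAt g (g' x) x := by
    intro x hx
    have h1 := (hasDerivAt_id x).sub_const 1
    refine ((((h1.const_mul γ).const_add 1).add ((h1.pow 2).const_mul c)).sub (Real.hasDerivAt_rpow_const (p := γ) (Or.inl (hpos x hx)))).congr_deriv ?_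
    simp [hg']; ring
  have d2 : ∀ x ∈ Set.Icc l L, HasDerivAt g' (2 * c - γ * ((γ - 1) * x ^ (γ - 2))) x := by
    intro x hx
    have h1 := (hasDerivAt_id x).sub_const 1
    refine (((h1.const_mul (2*c)).const_add γ).sub ((Real.hasDerivAt_rpow_const (p := γ - 1) (Or.inl (hpos x hx))).const_mul γ)).congr_deriv ?_
    rw [show γ - 1 - 1 = γ - 2 by ring]; ring
  have hmono : MonotoneOn g' (Set.Icc l L) := by
    refine monotoneOn_of_deriv_nonneg (convex_Icc l L) (fun x hx => (d2 x hx).continuousAt.continuousWithinAt)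
      (fun x hx => (d2 x (interior_subset hx)).differentiableAt.differentiableWithinAt) fun x hx => ?_
    rw [(d2 x (interior_subset hx)).deriv]
    have := h x (interior_subset hx)
    linarith
  have h1m : (1:ℝ) ∈ Set.Icc l L := ⟨hl1.le, hL.le⟩
  have g1 : g' 1 = 0 := by simp [hg']
  have g0 : g 1 = 0 := by simp [hg]
  have hright : MonotoneOn g (Set.Icc 1 L) := by
    have hs : Set.Icc 1 L ⊆ Set.Icc l L := Set.Icc_subset_Icc_left hl1.le
    refine monotoneOn_of_deriv_nonneg (convex_Icc 1 L) (fun x hx => (d1 x (hs hx)).continuousAt.continuousWithinAt)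
      (fun x hx => (d1 x (hs (interior_subset hx))).differentiableAt.differentiableWithinAt) fun x hx => ?_
    rw [(d1 x (hs (interior_subset hx))).deriv, ← g1]
    exact hmono h1m (hs (interior_subset hx)) (interior_subset hx).1
  have hleft : AntitoneOn g (Set.Icc l 1) := by
    have hs : Set.Icc l 1 ⊆ Set.Icc l L := Set.Icc_subset_Icc_right hL.le
    refine antitoneOn_of_deriv_nonpos (convex_Icc l 1) (fun x hx => (d1 x (hs hx)).continuousAt.continuousWithinAt)
      (fun x hx => (d1 x (hs (interior_subset hx))).differentiableAt.differentiableWithinAt) fun x hx => ?_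
    rw [(d1 x (hs (interior_subset hx))).deriv, ← g1]
    exact hmono (hs (interior_subset hx)) h1m (interior_subset hx).2
  intro x hx
  have : 0 ≤ g x := by
    rcases le_total x 1 with h | h
    · rw [← g0]; exact hleft ⟨hx.1, h⟩ ⟨hl1.le, le_rfl⟩ h
    · rw [← g0]; exact hright ⟨le_rfl, hL.le⟩ ⟨h, hx.2⟩ h
  simp only [hg] at this
  linarith

lemma taylor_up (γ : ℝ) {l L : ℝ} (hl : 0 < l) (hl1 : l < 1) (hL : 1 < L) : ∃ C : ℝ, 0 ≤ C ∧ ∀ x ∈ Set.Icc l L,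
    x ^ γ ≤ 1 + γ * (x - 1) + C * (x - 1)^2 := by
  have hpos : ∀ x ∈ Set.Icc l L, x ≠ 0 := fun x hx => (hl.trans_le hx.1).ne'
  have hc : ContinuousOn (fun x : ℝ => γ * (γ - 1) * x ^ (γ - 2)) (Set.Icc l L) :=
    continuousOn_const.mul (continuousOn_id.rpow_const fun x hx => Or.inl (hpos x hx))
  obtain ⟨C, hC⟩ := isCompact_Icc.exists_bound_of_continuousOn hc
  refine ⟨|C|, abs_nonneg _, taylor2 hl hl1 hL fun x hx => ?_⟩
  have h1 := (le_abs_self _).trans (hC x hx)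
  have := le_abs_self C
  have := abs_nonneg C
  linarith

lemma taylor_conc {p : ℝ} (hp : 0 < p) (hp1 : p < 1) {l L : ℝ} (hl : 0 < l) (hl1 : l < 1) (hL : 1 < L) :
    ∃ c : ℝ, 0 < c ∧ ∀ x ∈ Set.Icc l L, x ^ p ≤ 1 + p * (x - 1) - c * (x - 1)^2 := by
  have h0 : 0 < p * (1 - p) := mul_pos hp (by linarith)
  have hL0 : 0 < L := by linarith
  refine ⟨p * (1 - p) * L ^ (p - 2) / 2, by positivity, fun x hx => ?_⟩
  refine (taylor2 (γ := p) (c := -(p * (1 - p) * L ^ (p - 2) / 2)) hl hl1 hL ?_ x hx).trans (by linarith)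
  intro y hy
  have : L ^ (p - 2) ≤ y ^ (p - 2) := Real.rpow_le_rpow_of_nonpos (hl.trans_le hy.1) hy.2 (by linarith)
  nlinarith

/-- diagonal linear map -/
def TT {n : ℕ} (d : Fin n → ℝ) : Eu n →ₗ[ℝ] Eu n where
  toFun x := WithLp.toLp 2 (fun i => d i * x i)
  map_add' x y := by ext i; simp [mul_add]
  map_smul' c x := by ext i; simp; ring

lemma TT_apply {n : ℕ} (d : Fin n → ℝ) (x : Eu n) (i) : TT d x i = d i * x i := rfl

lemma TT_cont {n : ℕ} (d : Fin n → ℝ) : Continuous (TT d) := LinearMap.continuous_of_finiteDimensional _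

lemma TT_mp {n : ℕ} (d : Fin n → ℝ) (hd : ∏ i, d i = 1) : MeasurePreserving (TT d) := by
  have hdet : Matrix.det (Matrix.diagonal d) = 1 := by rw [Matrix.det_diagonal, hd]
  have h1 : MeasurePreserving (Matrix.toLin' (Matrix.diagonal d)) (volume : Measure (Fin n → ℝ)) volume := by
    refine ⟨(LinearMap.continuous_of_finiteDimensional _).measurable, ?_⟩
    have := Real.smul_map_diagonal_volume_pi (D := d) (by rw [hdet]; norm_num)
    simpa [hdet] using this
  have := (PiLp.volume_preserving_toLp (Fin n)).comp (h1.comp (PiLp.volume_preserving_ofLp (Fin n)))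
  have e : (TT d : Eu n → Eu n) = (WithLp.toLp 2) ∘ (Matrix.toLin' (Matrix.diagonal d)) ∘ (WithLp.ofLp) := by
    funext x
    ext i
    simp [TT_apply, Matrix.mulVec_diagonal]
  rw [e]
  exact this

lemma TT_inv {n : ℕ} {d e : Fin n → ℝ} (h : ∀ i, d i * e i = 1) (x : Eu n) : TT d (TT e x) = x := by
  ext i; rw [TT_apply, TT_apply, ← mul_assoc, h, one_mul]

lemma TT_norm {n : ℕ} (d : Fin n → ℝ) (x : Eu n) : ‖TT d x‖^2 = ∑ i, (d i)^2 * (x i)^2 := by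
  rw [EuclideanSpace.norm_sq_eq]
  refine Finset.sum_congr rfl fun i _ => ?_
  rw [TT_apply, Real.norm_eq_abs, sq_abs, mul_pow]

lemma eu_norm_sq {n : ℕ} (x : Eu n) : ‖x‖^2 = ∑ i, (x i)^2 := by
  rw [EuclideanSpace.norm_sq_eq]; simp

lemma TT_norm_near {n : ℕ} {d : Fin n → ℝ} {s : ℝ} (hd : ∀ i, |(d i)^2 - 1| ≤ s) (x : Eu n) :
    |‖TT d x‖^2 - ‖x‖^2| ≤ s * ‖x‖^2 := by
  rw [TT_norm, eu_norm_sq, ← Finset.sum_sub_distrib, Finset.mul_sum]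
  refine (Finset.abs_sum_le_sum_abs _ _).trans (Finset.sum_le_sum fun i _ => ?_)
  rw [show (d i)^2 * (x i)^2 - (x i)^2 = ((d i)^2 - 1) * (x i)^2 by ring, abs_mul, abs_of_nonneg (sq_nonneg (x i))]
  exact mul_le_mul_of_nonneg_right (hd i) (sq_nonneg _)

lemma TT_norm_lip {n : ℕ} {d : Fin n → ℝ} {s : ℝ} (hs : 0 ≤ s) (hd : ∀ i, |(d i)^2 - 1| ≤ s) {x y : Eu n} (hx : ‖x‖ = 1) (hy : ‖y‖ = 1) :
    |‖TT d x‖^2 - ‖TT d y‖^2| ≤ 2 * s * ‖x - y‖ := by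
  have h1 : ‖TT d x‖^2 - ‖TT d y‖^2 = ∑ i, ((d i)^2 - 1) * ((x i - y i) * (x i + y i)) := by
    have e : ‖x‖^2 - ‖y‖^2 = 0 := by rw [hx, hy]; ring
    rw [eu_norm_sq, eu_norm_sq] at e
    rw [TT_norm, TT_norm, ← sub_zero (_ - _), ← e, ← Finset.sum_sub_distrib, ← Finset.sum_sub_distrib, ← Finset.sum_sub_distrib]
    exact Finset.sum_congr rfl fun i _ => by ring
  have h2 : |‖TT d x‖^2 - ‖TT d y‖^2| ≤ s * ∑ i, |x i - y i| * |x i + y i| := by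
    rw [h1, Finset.mul_sum]
    refine (Finset.abs_sum_le_sum_abs _ _).trans (Finset.sum_le_sum fun i _ => ?_)
    rw [abs_mul, abs_mul]
    exact mul_le_mul_of_nonneg_right (hd i) (by positivity)
  have h3 : ∑ i, |x i - y i| * |x i + y i| ≤ ‖x - y‖ * ‖x + y‖ := by
    refine (Real.sum_mul_le_sqrt_mul_sqrt _ _ _).trans (le_of_eq ?_)
    rw [EuclideanSpace.norm_eq, EuclideanSpace.norm_eq]; simp
  have h4 : ‖x + y‖ ≤ 2 := by
    have := norm_add_le x y
    rw [hx, hy] at this; linarith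
  have := norm_nonneg (x - y)
  calc _ ≤ _ := h2
    _ ≤ s * (‖x - y‖ * 2) := by gcongr; exact h3.trans (by gcongr)
    _ = _ := by ring

/-- the volume preserving stretching weights -/
def dg (k : ℕ) (a : ℝ) : Fin (k+1) → ℝ := fun i => (if i = 0 then a else 1) * (if i = Fin.last k then a⁻¹ else 1)

lemma dg_prod {k : ℕ} {a : ℝ} (ha : a ≠ 0) : ∏ i, dg k a i = 1 := by
  unfold dg
  rw [Finset.prod_mul_distrib]
  simp [ha]

lemma dg_inv {k : ℕ} {a : ℝ} (ha : a ≠ 0) (i) : dg k a i * dg k a⁻¹ i = 1 := by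
  unfold dg
  split_ifs <;> field_simp

lemma dg_inv' {k : ℕ} {a : ℝ} (ha : a ≠ 0) (i) : dg k a⁻¹ i * dg k a i = 1 := by
  rw [mul_comm, dg_inv ha]

lemma sq_near {t : ℝ} (ht : 0 ≤ t) (ht1 : t ≤ 1) : |(1+t)^2 - 1| ≤ 3 * t ∧ |((1+t)⁻¹)^2 - 1| ≤ 3 * t := by
  refine ⟨by rw [abs_of_nonneg (by nlinarith)]; nlinarith, ?_⟩
  have h : ((1+t)⁻¹)^2 - 1 = -((2*t + t^2) / (1+t)^2) := by field_simp; ring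
  rw [h, abs_neg, abs_of_nonneg (by positivity), div_le_iff₀ (by positivity)]
  nlinarith [pow_nonneg ht 2, pow_nonneg ht 3]

lemma dg_near {k : ℕ} (hk : 1 ≤ k) {t : ℝ} (ht : 0 ≤ t) (ht1 : t ≤ 1) (i) :
    |(dg k (1+t) i)^2 - 1| ≤ 3 * t ∧ |(dg k (1+t)⁻¹ i)^2 - 1| ≤ 3 * t := by
  obtain ⟨h1, h2⟩ := sq_near ht ht1
  rw [inv_pow] at h2
  have h0 : (0 : Fin (k+1)) ≠ Fin.last k := by
    intro h; have := congrArg Fin.val h; simp at this; omega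
  unfold dg
  by_cases hi : i = 0
  · subst hi; simpa [h0] using ⟨h1, h2⟩
  · by_cases hl : i = Fin.last k
    · subst hl; simpa [h0.symm] using ⟨h2, h1⟩
    · simp [hi, hl, ht]

lemma dg_cap {k : ℕ} (hk : 1 ≤ k) {t : ℝ} (ht : 0 ≤ t) (ht1 : t ≤ 1) {x : Eu (k+1)} (hx : ‖x‖ = 1) (h34 : 3/4 ≤ (x 0)^2) :
    1 + t ≤ ‖TT (dg k (1+t)) x‖^2 := by
  have h0 : (0 : Fin (k+1)) ≠ Fin.last k := by
    intro h; have := congrArg Fin.val h; simp at this; omega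
  have e1 : ‖TT (dg k (1+t)) x‖^2 - ‖x‖^2 = ((1+t)^2 - 1) * (x 0)^2 + (((1+t)⁻¹)^2 - 1) * (x (Fin.last k))^2 := by
    rw [TT_norm, eu_norm_sq, ← Finset.sum_sub_distrib]
    rw [← Finset.add_sum_erase _ _ (Finset.mem_univ (0 : Fin (k+1)))]
    rw [← Finset.add_sum_erase _ _ (Finset.mem_erase.2 ⟨h0.symm, Finset.mem_univ (Fin.last k)⟩)]
    rw [Finset.sum_eq_zero]
    · simp [dg, h0, h0.symm]; ring
    · intro i hi
      simp only [Finset.mem_erase, Finset.mem_univ, and_true] at hi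
      simp [dg, hi.1, hi.2]
  have e2 : (x 0)^2 + (x (Fin.last k))^2 ≤ 1 := by
    have : ‖x‖^2 = 1 := by rw [hx]; norm_num
    rw [eu_norm_sq] at this
    rw [← this, ← Finset.sum_pair (f := fun i => (x i)^2) h0]
    exact Finset.sum_le_sum_of_subset_of_nonneg (Finset.subset_univ _) fun i _ _ => sq_nonneg _
  have e3 : -(2*t) ≤ ((1+t)⁻¹)^2 - 1 := by
    have h : ((1+t)⁻¹)^2 - 1 = -((2*t + t^2) / (1+t)^2) := by field_simp; ring
    rw [h, neg_le_neg_iff, div_le_iff₀ (by positivity)]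
    nlinarith [pow_nonneg ht 2, pow_nonneg ht 3]
  rw [hx] at e1
  have h5 := sq_nonneg (x (Fin.last k))
  nlinarith [mul_nonneg ht h5, mul_le_mul_of_nonneg_right e3 h5, mul_nonneg (sq_nonneg t) (sq_nonneg (x 0)), mul_le_mul_of_nonneg_left h34 ht]

lemma ray_rpow {k : ℕ} {γ : ℝ} (hγ : 0 ≤ γ) {b : ℝ} (hb : 0 < b) :
    ∫⁻ r, (Set.Iio b).indicator (fun r => ENNReal.ofReal (r ^ γ)) r ∂(nu k) = ENNReal.ofReal (b ^ ((k+1:ℕ)+γ) / ((k+1:ℕ)+γ)) := by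
  have hm : Measurable fun r : ℝ => ENNReal.ofReal (r ^ γ) := (measurable_id.pow_const γ).ennreal_ofReal
  set p : ℝ := (k+1:ℕ)+γ with hp
  have hp0 : 0 < p := by positivity
  rw [lintegral_nu _ (hm.indicator measurableSet_Iio)]
  have h1 : ∀ r ∈ Set.Ioi (0:ℝ), ENNReal.ofReal (r^k) * (Set.Iio b).indicator (fun r => ENNReal.ofReal (r ^ γ)) r
      = (Set.Iio b).indicator (fun r => ENNReal.ofReal (r ^ (p - 1))) r := by
    intro r hr
    have hr : 0 < r := hr
    by_cases hrb : r < b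
    · rw [Set.indicator_of_mem (show r ∈ Set.Iio b from hrb), Set.indicator_of_mem (show r ∈ Set.Iio b from hrb),
        ← ENNReal.ofReal_mul (by positivity), ← Real.rpow_natCast, ← Real.rpow_add hr]
      congr 2; rw [hp]; push_cast; ring
    · rw [Set.indicator_of_notMem (show r ∉ Set.Iio b from hrb), Set.indicator_of_notMem (show r ∉ Set.Iio b from hrb), mul_zero]
  rw [setLIntegral_congr_fun measurableSet_Ioi h1, lintegral_indicator measurableSet_Iio, Measure.restrict_restrict measurableSet_Iio]
  have hI : Set.Iio b ∩ Set.Ioi 0 = Set.Ioo 0 b := by ext; simp [and_comm]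
  rw [hI, ← restrict_Ioo_eq_restrict_Ioc.symm, ← ofReal_integral_eq_lintegral_ofReal]
  · rw [← intervalIntegral.integral_of_le hb.le, integral_rpow (Or.inl (by linarith)), sub_add_cancel, Real.zero_rpow hp0.ne', sub_zero]
  · exact (intervalIntegrable_iff_integrableOn_Ioc_of_le hb.le).1 (intervalIntegral.intervalIntegrable_rpow' (by linarith))
  · exact (ae_restrict_iff' measurableSet_Ioc).2 (Eventually.of_forall fun r hr => Real.rpow_nonneg hr.1.le _)

/-- ellipsoid -/
def El {k : ℕ} (d : Fin (k+1) → ℝ) : Set (Eu (k+1)) := {x | ‖TT d x‖ < 1}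

lemma El_meas {k : ℕ} (d : Fin (k+1) → ℝ) : MeasurableSet (El d) :=
  measurableSet_lt (TT_cont d).measurable.norm measurable_const

lemma El_int {k : ℕ} {d : Fin (k+1) → ℝ} (hd : ∀ θ : Sp k, 0 < ‖TT d θ‖) {γ : ℝ} (hγ : 0 ≤ γ) :
    potEnergy γ 1 (El d) = ∫⁻ θ : Sp k, ENNReal.ofReal ((‖TT d θ‖⁻¹) ^ ((k+1:ℕ)+γ) / ((k+1:ℕ)+γ)) ∂(sig k) := by
  have hm : Measurable fun x : Eu (k+1) => (El d).indicator 1 x * ENNReal.ofReal (‖x‖ ^ γ) :=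
    (measurable_one.indicator (El_meas d)).mul (measurable_norm.pow_const γ).ennreal_ofReal
  rw [pot_ind γ (El_meas d), lintegral_pol _ hm]
  refine lintegral_congr fun θ => ?_
  rw [← ray_rpow hγ (inv_pos.2 (hd θ))]
  refine lintegral_congr_ae ?_
  filter_upwards [nu_ae_pos (k := k)] with r hr
  have hsp : ‖(θ : Eu (k+1))‖ = 1 := by simp
  have e1 : ‖r • (θ : Eu (k+1))‖ = r := by rw [norm_smul, hsp, mul_one, Real.norm_of_nonneg hr.le]
  have e2 : (r • (θ : Eu (k+1)) ∈ El d) ↔ r ∈ Set.Iio (‖TT d θ‖⁻¹) := by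
    simp only [El, Set.mem_ofPred_eq, Set.mem_Iio, map_smul, norm_smul, Real.norm_of_nonneg hr.le]
    rw [lt_inv_comm₀ hr (hd θ), inv_eq_one_div, lt_div_iff₀ hr, mul_comm]
  by_cases h : r • (θ : Eu (k+1)) ∈ El d
  · rw [Set.indicator_of_mem h, Set.indicator_of_mem (e2.1 h), e1]; simp
  · rw [Set.indicator_of_notMem h, Set.indicator_of_notMem (fun h' => h (e2.2 h'))]; simp

lemma El_vol {k : ℕ} {d : Fin (k+1) → ℝ} (hd : ∏ i, d i = 1) : volume (El d) = ENNReal.ofReal (om (k+1)) := by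
  rw [← vol_unit, ← (TT_mp d hd).measure_preimage measurableSet_ball.nullMeasurableSet]
  congr 1; ext x; simp [El]

lemma El_avg {k : ℕ} {d : Fin (k+1) → ℝ} (hd0 : ∀ θ : Sp k, 0 < ‖TT d θ‖) (hd : ∏ i, d i = 1) :
    ∫⁻ θ : Sp k, ENNReal.ofReal ((‖TT d θ‖⁻¹) ^ (k+1)) ∂(sig k) = sig k Set.univ := by
  have h1 := El_int hd0 le_rfl
  have h2 : potEnergy 0 1 (El d) = ENNReal.ofReal (om (k+1)) := by
    rw [← El_vol hd]; simp [potEnergy]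
  rw [h2] at h1
  have hn : (0:ℝ) < (k+1:ℕ) := by positivity
  rw [sig_univ', ENNReal.ofReal_mul (by positivity), h1, ← lintegral_const_mul' _ _ (by simp)]
  refine lintegral_congr fun θ => ?_
  rw [← ENNReal.ofReal_mul (by positivity), add_zero, Real.rpow_natCast]
  congr 1; push_cast; field_simp

/-- autocorrelation of the ball -/
def HH {k : ℕ} (z : Eu (k+1)) : ℝ≥0∞ := ∫⁻ x, (ball (0 : Eu (k+1)) 1).indicator 1 x * (ball (0 : Eu (k+1)) 1).indicator 1 (x - z)

lemma HH_meas {k : ℕ} : Measurable (HH (k := k)) := by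
  have mB : Measurable ((ball (0 : Eu (k+1)) 1).indicator (1 : Eu (k+1) → ℝ≥0∞)) := measurable_one.indicator measurableSet_ball
  have hm : Measurable fun p : Eu (k+1) × Eu (k+1) => (ball (0 : Eu (k+1)) 1).indicator (1 : Eu (k+1) → ℝ≥0∞) p.2 * (ball (0 : Eu (k+1)) 1).indicator 1 (p.2 - p.1) :=
    (mB.comp measurable_snd).mul (mB.comp (measurable_snd.sub measurable_fst))
  exact hm.lintegral_prod_right'

lemma HH_rad {k : ℕ} (θ φ : Sp k) (r : ℝ) : HH (r • (θ : Eu (k+1))) = HH (r • (φ : Eu (k+1))) := by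
  have hn : ‖(θ : Eu (k+1))‖ = ‖(φ : Eu (k+1))‖ := by simp
  have hT := Submodule.reflection_sub hn
  set T := (Submodule.span ℝ {(θ : Eu (k+1)) - φ})ᗮ.reflection
  unfold HH
  have mB : Measurable ((ball (0 : Eu (k+1)) 1).indicator (1 : Eu (k+1) → ℝ≥0∞)) := measurable_one.indicator measurableSet_ball
  have hm : Measurable fun y : Eu (k+1) => (ball (0 : Eu (k+1)) 1).indicator (1 : Eu (k+1) → ℝ≥0∞) y * (ball (0 : Eu (k+1)) 1).indicator 1 (y - r • (φ : Eu (k+1))) :=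
    mB.mul (mB.comp (measurable_id.sub measurable_const))
  rw [← T.measurePreserving.lintegral_comp hm]
  have hB : ∀ y, (ball (0 : Eu (k+1)) 1).indicator (1 : Eu (k+1) → ℝ≥0∞) (T y) = (ball (0 : Eu (k+1)) 1).indicator 1 y := by
    intro y; simp [Set.indicator]
  refine lintegral_congr fun y => ?_
  rw [← hT, ← map_smul, ← map_sub, hB, hB]

lemma El_riesz {k : ℕ} (α : ℝ) : ∃ c0 : ℝ≥0∞, ∀ d e : Fin (k+1) → ℝ, (∀ i, d i * e i = 1) → ∏ i, e i = 1 →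
    rieszEnergy α (El d) = c0 * ∫⁻ θ : Sp k, ENNReal.ofReal (‖TT e θ‖ ^ (α - (k+1:ℕ))) ∂(sig k) := by
  have : Nonempty (Sp k) := ⟨⟨EuclideanSpace.single 0 1, by simp⟩⟩
  obtain ⟨θ0⟩ := this
  refine ⟨∫⁻ r, ENNReal.ofReal (r ^ (α - (k+1:ℕ))) * HH (r • (θ0 : Eu (k+1))) ∂(nu k), fun d e hde he => ?_⟩
  set B := ball (0 : Eu (k+1)) 1 with hB
  have mB : Measurable (B.indicator (1 : Eu (k+1) → ℝ≥0∞)) := measurable_one.indicator measurableSet_ball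
  have mE : Measurable ((El d).indicator (1 : Eu (k+1) → ℝ≥0∞)) := measurable_one.indicator (El_meas d)
  have mK : Measurable fun z => Kz α (TT e z) := (Kz_meas α).comp (TT_cont e).measurable
  have hE : ∀ x, (El d).indicator (1 : Eu (k+1) → ℝ≥0∞) (TT e x) = B.indicator 1 x := by
    intro x; simp [Set.indicator, El, hB, TT_inv hde]
  have h1 : ∀ x, pot α ((El d).indicator 1) (TT e x) = ∫⁻ z, B.indicator 1 (x - z) * Kz α (TT e z) := by
    intro x
    unfold pot
    have hm : Measurable fun y => (El d).indicator 1 y * Kz α (TT e x - y) := mE.mul ((Kz_meas α).comp (measurable_const.sub measurable_id))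
    rw [← (TT_mp e he).lintegral_comp hm]
    rw [← lintegral_sub_left_eq_self (μ := volume) (fun z => B.indicator 1 (x - z) * Kz α (TT e z)) x]
    refine lintegral_congr fun y => ?_
    rw [hE, map_sub, show x - (x - y) = y by abel]
  rw [rieszEnergy_eq α (El_meas d)]
  unfold VV
  have hm : Measurable fun x => (El d).indicator 1 x * pot α ((El d).indicator 1) x := mE.mul (pot_meas α mE)
  rw [← (TT_mp e he).lintegral_comp hm]
  simp only [hE, h1]
  have hm2 : Measurable fun p : Eu (k+1) × Eu (k+1) => B.indicator 1 p.1 * (B.indicator 1 (p.1 - p.2) * Kz α (TT e p.2)) :=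
    (mB.comp measurable_fst).mul ((mB.comp (measurable_fst.sub measurable_snd)).mul (mK.comp measurable_snd))
  calc ∫⁻ x, B.indicator 1 x * ∫⁻ z, B.indicator 1 (x - z) * Kz α (TT e z)
      = ∫⁻ x, ∫⁻ z, B.indicator 1 x * (B.indicator 1 (x - z) * Kz α (TT e z)) := by
        refine lintegral_congr fun x => ?_
        rw [lintegral_const_mul' _ _ (by by_cases h : x ∈ B <;> simp [h])]
    _ = ∫⁻ z, ∫⁻ x, B.indicator 1 x * (B.indicator 1 (x - z) * Kz α (TT e z)) := lintegral_lintegral_swap hm2.aemeasurable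
    _ = ∫⁻ z, HH z * Kz α (TT e z) := by
        refine lintegral_congr fun z => ?_
        unfold HH
        rw [← lintegral_mul_const' _ _ (by unfold Kz; simp)]
        exact lintegral_congr fun x => (mul_assoc _ _ _).symm
    _ = ∫⁻ θ : Sp k, ∫⁻ r, HH (r • (θ : Eu (k+1))) * Kz α (TT e (r • (θ : Eu (k+1)))) ∂(nu k) ∂(sig k) :=
        lintegral_pol _ (HH_meas.mul mK)
    _ = ∫⁻ θ : Sp k, (∫⁻ r, ENNReal.ofReal (r ^ (α - (k+1:ℕ))) * HH (r • (θ0 : Eu (k+1))) ∂(nu k)) * ENNReal.ofReal (‖TT e θ‖ ^ (α - (k+1:ℕ))) ∂(sig k) := by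
        refine lintegral_congr fun θ => ?_
        rw [← lintegral_mul_const' _ _ (by simp)]
        refine lintegral_congr_ae ?_
        filter_upwards [nu_ae_pos (k := k)] with r hr
        rw [HH_rad θ θ0]
        unfold Kz
        rw [map_smul, norm_smul, Real.norm_of_nonneg hr.le, Real.mul_rpow hr.le (norm_nonneg _), ENNReal.ofReal_mul (by positivity)]
        ring
    _ = _ := by
        rw [lintegral_const_mul]
        exact (((TT_cont e).comp continuous_subtype_val).measurable.norm.pow_const _).ennreal_ofReal

/-- The density `|Tθ|^{-n}`. -/
def XX {k : ℕ} (d : Fin (k+1) → ℝ) (θ : Sp k) : ℝ := (‖TT d θ‖⁻¹) ^ (k+1)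

/-- near identity condition -/
structure Near {k : ℕ} (d : Fin (k+1) → ℝ) (s : ℝ) : Prop where
  s0 : 0 ≤ s
  s1 : s ≤ 1/4
  prod : ∏ i, d i = 1
  near : ∀ i, |(d i)^2 - 1| ≤ s

lemma Near.sq {k : ℕ} {d : Fin (k+1) → ℝ} {s : ℝ} (h : Near d s) (θ : Sp k) : |‖TT d θ‖^2 - 1| ≤ s := by
  have := TT_norm_near h.near (θ : Eu (k+1))
  simpa using this

lemma Near.mem {k : ℕ} {d : Fin (k+1) → ℝ} {s : ℝ} (h : Near d s) (θ : Sp k) : ‖TT d θ‖^2 ∈ Set.Icc (3/4 : ℝ) (5/4) := by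
  have := abs_le.1 (h.sq θ)
  have := h.s1
  constructor <;> linarith

lemma Near.pos {k : ℕ} {d : Fin (k+1) → ℝ} {s : ℝ} (h : Near d s) (θ : Sp k) : 0 < ‖TT d θ‖ := by
  have h1 := (h.mem θ).1
  have h2 := norm_nonneg (TT d (θ : Eu (k+1)))
  rcases h2.lt_or_eq with h3 | h3
  · exact h3
  · rw [← h3] at h1; norm_num at h1

lemma inv_rpow_sq {N : ℝ} (hN : 0 < N) (p : ℝ) : (N⁻¹) ^ p = (N^2) ^ (-p/2) := by
  rw [Real.inv_rpow hN.le, ← Real.rpow_neg hN.le, ← Real.rpow_natCast, ← Real.rpow_mul hN.le]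
  congr 1; push_cast; ring

lemma XX_eq {k : ℕ} {d : Fin (k+1) → ℝ} {s : ℝ} (h : Near d s) (θ : Sp k) : XX d θ = (‖TT d θ‖^2) ^ (-((k:ℝ)+1)/2) := by
  unfold XX
  rw [← inv_rpow_sq (h.pos θ), ← Real.rpow_natCast]; push_cast; rfl

lemma XX_rpow {k : ℕ} {d : Fin (k+1) → ℝ} {s : ℝ} (h : Near d s) (θ : Sp k) (p : ℝ) : XX d θ ^ (p / (k+1)) = (‖TT d θ‖⁻¹) ^ p := by
  unfold XX
  have := h.pos θ
  rw [← Real.rpow_natCast, ← Real.rpow_mul (by positivity)]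
  congr 1; push_cast; field_simp

lemma XX_pos {k : ℕ} {d : Fin (k+1) → ℝ} {s : ℝ} (h : Near d s) (θ : Sp k) : 0 < XX d θ := by
  have := h.pos θ
  unfold XX; positivity

lemma XX_bds (k : ℕ) : ∃ l L C : ℝ, 0 < l ∧ l < 1 ∧ 1 < L ∧ 0 ≤ C ∧ ∀ (d : Fin (k+1) → ℝ) (s : ℝ), Near d s → ∀ θ : Sp k,
    XX d θ ∈ Set.Icc l L ∧ |XX d θ - 1| ≤ C * s := by
  have hγ : -((k:ℝ)+1)/2 < 0 := by
    have : (0:ℝ) ≤ k := Nat.cast_nonneg k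
    linarith
  obtain ⟨C, hC0, hC⟩ := rpow_lip (-((k:ℝ)+1)/2) (l := 3/4) (L := 5/4) (by norm_num)
  refine ⟨(5/4) ^ (-((k:ℝ)+1)/2), (3/4) ^ (-((k:ℝ)+1)/2), C, by positivity, Real.rpow_lt_one_of_one_lt_of_neg (by norm_num) hγ,
    Real.one_lt_rpow_of_pos_of_lt_one_of_neg (by norm_num) (by norm_num) hγ, hC0, fun d s h θ => ?_⟩
  have hm := h.mem θ
  rw [XX_eq h]
  refine ⟨⟨Real.rpow_le_rpow_of_nonpos (by linarith [hm.1]) hm.2 hγ.le, Real.rpow_le_rpow_of_nonpos (by norm_num) hm.1 hγ.le⟩, ?_⟩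
  have := hC _ hm 1 ⟨by norm_num, by norm_num⟩
  rw [Real.one_rpow] at this
  exact this.trans (mul_le_mul_of_nonneg_left (h.sq θ) hC0)

lemma XX_cont {k : ℕ} {d : Fin (k+1) → ℝ} {s : ℝ} (h : Near d s) : Continuous (XX d) := by
  unfold XX
  have h1 : Continuous fun θ : Sp k => ‖TT d θ‖ := ((TT_cont d).comp continuous_subtype_val).norm
  exact (h1.inv₀ fun θ => (h.pos θ).ne').pow _

/-- total mass of the sphere -/
def sm (k : ℕ) : ℝ := (k+1) * om (k+1)
lemma sm_pos (k : ℕ) : 0 < sm k := by have := om_pos (k+1); unfold sm; positivity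
lemma sig_real (k : ℕ) : (sig k).real Set.univ = sm k := by
  rw [Measure.real, sig_univ']; exact ENNReal.toReal_ofReal (sm_pos k).le

lemma cont_int {k : ℕ} {f : Sp k → ℝ} (hf : Continuous f) : Integrable f (sig k) :=
  hf.integrable_of_hasCompactSupport (HasCompactSupport.of_compactSpace f)

lemma XX_int {k : ℕ} {d : Fin (k+1) → ℝ} {s : ℝ} (h : Near d s) : ∫ θ, XX d θ ∂(sig k) = sm k := by
  rw [integral_eq_lintegral_of_nonneg_ae (Eventually.of_forall fun θ => (XX_pos h θ).le) (XX_cont h).aestronglyMeasurable]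
  unfold XX
  rw [El_avg h.pos h.prod, ← sig_real]; rfl

lemma avg_le {k : ℕ} {d : Fin (k+1) → ℝ} {s : ℝ} (h : Near d s) {Z W : Sp k → ℝ} (hZ : ∀ θ, 0 ≤ Z θ)
    (hZm : AEStronglyMeasurable Z (sig k)) (hW : Integrable W (sig k)) (a : ℝ)
    (H : ∀ θ, Z θ ≤ 1 + a * (XX d θ - 1) + W θ) :
    ∫⁻ θ, ENNReal.ofReal (Z θ) ∂(sig k) ≤ ENNReal.ofReal (sm k + ∫ θ, W θ ∂(sig k)) := by
  have iX := cont_int (XX_cont h)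
  have i1 : Integrable (fun θ => 1 + a * (XX d θ - 1)) (sig k) := (integrable_const _).add ((iX.sub (integrable_const _)).const_mul a)
  have iR : Integrable (fun θ => 1 + a * (XX d θ - 1) + W θ) (sig k) := i1.add hW
  have iZ : Integrable Z (sig k) := by
    refine iR.mono' hZm (Eventually.of_forall fun θ => ?_)
    rw [Real.norm_of_nonneg (hZ θ)]; exact H θ
  rw [← ofReal_integral_eq_lintegral_ofReal iZ (Eventually.of_forall hZ)]
  apply ENNReal.ofReal_le_ofReal
  refine (integral_mono iZ iR H).trans (le_of_eq ?_)
  have i0 : Integrable (fun θ => a * (XX d θ - 1)) (sig k) := (iX.sub (integrable_const _)).const_mul a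
  have e0 : ∫ θ, a * (XX d θ - 1) ∂(sig k) = 0 := by
    rw [integral_const_mul, integral_sub iX (integrable_const _), XX_int h, integral_const, sig_real, smul_eq_mul]; ring
  rw [integral_add i1 hW, integral_add (integrable_const _) i0, e0, integral_const, sig_real, smul_eq_mul]; ring

lemma norm_TT_meas {k : ℕ} (d : Fin (k+1) → ℝ) : Measurable fun θ : Sp k => ‖TT d θ‖ :=
  ((TT_cont d).comp continuous_subtype_val).norm.measurable

lemma near_one (k : ℕ) : Near (k := k) 1 0 := ⟨le_rfl, by norm_num, by simp, by simp⟩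
lemma TT_one {n : ℕ} (x : Eu n) : TT 1 x = x := by ext i; simp [TT_apply]
lemma El_one {k : ℕ} : El (k := k) 1 = ball 0 1 := by ext x; simp [El, TT_one]

lemma pot_ball {k : ℕ} {β : ℝ} (hβ : 0 < β) : potEnergy β 1 (ball (0 : Eu (k+1)) 1) = ENNReal.ofReal (sm k / ((k+1:ℕ)+β)) := by
  rw [← El_one, El_int (near_one k).pos hβ.le]
  have e : ∀ θ : Sp k, ‖TT 1 (θ : Eu (k+1))‖ = 1 := by intro θ; rw [TT_one]; simp
  simp only [e, inv_one, Real.one_rpow]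
  rw [lintegral_const, sig_univ', ← ENNReal.ofReal_mul (by positivity)]
  congr 1; unfold sm; ring

lemma U_bound (k : ℕ) {β : ℝ} (hβ : 0 < β) : ∃ C : ℝ, 0 ≤ C ∧ ∀ (d : Fin (k+1) → ℝ) (s : ℝ), Near d s →
    potEnergy β 1 (El d) ≤ potEnergy β 1 (ball (0 : Eu (k+1)) 1) + ENNReal.ofReal (C * s^2) := by
  obtain ⟨l, L, C1, hl, hl1, hL, hC1, hX⟩ := XX_bds k
  obtain ⟨C2, hC2, hT⟩ := taylor_up (((k+1:ℕ)+β) / (k+1)) hl hl1 hL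
  have hp : (0:ℝ) < (k+1:ℕ) + β := by positivity
  have hsm := sm_pos k
  refine ⟨C2 * C1^2 * sm k / ((k+1:ℕ)+β), by positivity, fun d s h => ?_⟩
  rw [El_int h.pos hβ.le, pot_ball hβ, ← ENNReal.ofReal_add (by positivity) (by positivity)]
  have e : ∀ θ : Sp k, ENNReal.ofReal ((‖TT d θ‖⁻¹) ^ ((k+1:ℕ)+β) / ((k+1:ℕ)+β)) =
      ENNReal.ofReal ((‖TT d θ‖⁻¹) ^ ((k+1:ℕ)+β)) * ENNReal.ofReal (((k+1:ℕ)+β)⁻¹) := by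
    intro θ; rw [← ENNReal.ofReal_mul (by positivity)]; rfl
  simp_rw [e]
  rw [lintegral_mul_const' _ _ (by simp)]
  have := avg_le h (Z := fun θ => (‖TT d θ‖⁻¹) ^ ((k+1:ℕ)+β)) (W := fun _ => C2 * (C1 * s)^2) (fun θ => by positivity)
    (((norm_TT_meas d).inv.pow_const _).aestronglyMeasurable) (integrable_const _) (((k+1:ℕ)+β) / (k+1)) (by
      intro θ
      rw [← XX_rpow h]
      obtain ⟨h1, h2⟩ := hX d s h θ
      refine (hT _ h1).trans ?_
      have : (XX d θ - 1)^2 ≤ (C1 * s)^2 := by rw [← sq_abs]; exact pow_le_pow_left₀ (abs_nonneg _) h2 2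
      nlinarith)
  refine (mul_le_mul_left this _).trans ?_
  rw [integral_const, sig_real, ← ENNReal.ofReal_mul (by simp; positivity)]
  apply ENNReal.ofReal_le_ofReal
  rw [smul_eq_mul]
  exact le_of_eq (by field_simp)

lemma P_bound (k : ℕ) : ∃ C : ℝ, 0 ≤ C ∧ ∀ (d : Fin (k+1) → ℝ) (s : ℝ), Near d s →
    hc k * perimeter (El d) ≤ ENNReal.ofReal (sm k + C * s^2) := by
  obtain ⟨C1, hC1, hL1⟩ := rpow_lip (-1/2) (l := 3/4) (L := 5/4) (by norm_num)
  obtain ⟨C2, hC2, hL2⟩ := rpow_lip ((k:ℝ)/2) (l := 1/2) (L := 2 + C1^2) (by norm_num)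
  have hsm := sm_pos k
  refine ⟨C2 * (C1 * 2)^2 * sm k, by positivity, fun d s h => ?_⟩
  have hs0 := h.s0
  have hs1 := h.s1
  set R : Sp k → ℝ := fun θ => ‖TT d θ‖⁻¹ with hR
  set τ : NNReal := Real.toNNReal (C1 * (2 * s)) with hτ
  have hτ' : (τ : ℝ) = C1 * (2 * s) := Real.coe_toNNReal _ (by positivity)
  have hRr : ∀ θ, R θ = (‖TT d θ‖^2) ^ (-1/2 : ℝ) := by
    intro θ; rw [← inv_rpow_sq (h.pos θ), Real.rpow_one]
  have hR2 : ∀ θ, 4/5 ≤ R θ ^2 ∧ R θ^2 ≤ 4/3 := by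
    intro θ
    have hm := h.mem θ
    have : R θ^2 = (‖TT d θ‖^2)⁻¹ := by simp [hR]
    rw [this]
    constructor
    · rw [le_inv_comm₀ (by norm_num) (by linarith [hm.1])]; linarith [hm.2]
    · rw [inv_le_comm₀ (by linarith [hm.1]) (by norm_num)]; linarith [hm.1]
  have hlip : LipschitzWith τ R := by
    refine LipschitzWith.of_dist_le_mul fun θ φ => ?_
    rw [Real.dist_eq, hRr, hRr, hτ', Subtype.dist_eq, dist_eq_norm]
    refine (hL1 _ (h.mem θ) _ (h.mem φ)).trans ?_
    have := TT_norm_lip hs0 h.near (x := (θ : Eu (k+1))) (y := φ) (by simp) (by simp)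
    calc _ ≤ C1 * (2 * s * ‖(θ : Eu (k+1)) - φ‖) := by gcongr
      _ = _ := by ring
  have hpos : ∀ θ, 0 < R θ := fun θ => inv_pos.2 (h.pos θ)
  have hlo : ∀ θ, 1/2 ≤ R θ := by
    intro θ
    have := (hR2 θ).1
    have := hpos θ
    nlinarith
  have hfr : frontier (El d) ⊆ Set.range (fun θ : Sp k => R θ • (θ : Eu (k+1))) := by
    intro x hx
    have h1 : ‖TT d x‖ = 1 := frontier_lt_subset_eq (TT_cont d).norm continuous_const hx
    have hx0 : x ≠ 0 := by rintro rfl; simp at h1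
    have hxn : 0 < ‖x‖ := norm_pos_iff.2 hx0
    refine ⟨⟨‖x‖⁻¹ • x, by simp [norm_smul, hxn.ne']⟩, ?_⟩
    simp only [hR, map_smul, norm_smul, h1, smul_smul]
    simp [hxn.ne']
  refine (perimeter_le_graph hlip hlo hfr).trans ?_
  have e : sm k + C2 * (C1 * 2)^2 * sm k * s^2 = sm k + ∫ θ : Sp k, C2 * (C1 * (2 * s))^2 ∂(sig k) := by
    rw [integral_const, sig_real, smul_eq_mul]; ring
  rw [e]
  refine avg_le h (fun θ => by positivity) ?_ (integrable_const _) ((k:ℝ) / (k+1)) ?_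
  · have : Measurable R := (norm_TT_meas d).inv
    exact (((this.pow_const 2).add_const _).sqrt.pow_const k).aestronglyMeasurable
  · intro θ
    have hb := hR2 θ
    have hp := hpos θ
    have hτ2 : (τ:ℝ)^2 ≤ C1^2 := by
      rw [hτ']
      refine pow_le_pow_left₀ (by positivity) ?_ 2
      nlinarith
    have h1 : √(R θ^2 + τ^2)^k = (R θ^2 + τ^2) ^ ((k:ℝ)/2) := by
      rw [Real.sqrt_eq_rpow, ← Real.rpow_natCast, ← Real.rpow_mul (by positivity)]
      congr 1; ring
    have h2 : (R θ^2) ^ ((k:ℝ)/2) = R θ ^ (k:ℝ) := by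
      rw [← Real.rpow_natCast, ← Real.rpow_mul hp.le]
      congr 1; push_cast; ring
    have h3 := hL2 (R θ^2 + τ^2) ⟨by nlinarith [sq_nonneg (τ:ℝ)], by linarith⟩ (R θ^2) ⟨by linarith, by nlinarith⟩
    rw [← h1, h2, add_sub_cancel_left, abs_of_nonneg (sq_nonneg (τ:ℝ)), hτ', ← hτ'] at h3
    have h4 : R θ ^ (k:ℝ) ≤ 1 + (k:ℝ)/(k+1) * (XX d θ - 1) := by
      simp only [hR]
      rw [← XX_rpow h]
      have := rpow_one_add_le_one_add_mul_self (s := XX d θ - 1) (p := (k:ℝ)/(k+1)) (by linarith [XX_pos h θ]) (by positivity)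
        (by rw [div_le_one (by positivity)]; linarith)
      rwa [add_sub_cancel] at this
    have h5 := le_abs_self (√(R θ^2 + τ^2)^k - R θ ^ (k:ℝ))
    rw [← hτ']
    linarith

lemma riesz_ball_pos {k : ℕ} {α : ℝ} (hαn : α < (k+1 : ℕ)) : rieszEnergy α (ball (0 : Eu (k+1)) 1) ≠ 0 := by
  set B := ball (0 : Eu (k+1)) 1 with hB
  have hin : ∀ x ∈ B, ENNReal.ofReal (2 ^ (α - ((k+1:ℕ):ℝ))) * volume B ≤ ∫⁻ y in B, ENNReal.ofReal (‖x - y‖ ^ (α - ((k+1:ℕ):ℝ))) := by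
    intro x hx
    rw [← setLIntegral_const]
    refine lintegral_mono_ae ?_
    have h1 : ∀ᵐ y ∂(volume.restrict B), y ≠ x := by
      refine ae_restrict_of_ae ?_
      rw [ae_iff]; simp
    filter_upwards [h1, ae_restrict_mem measurableSet_ball] with y hy hyB
    apply ENNReal.ofReal_le_ofReal
    refine Real.rpow_le_rpow_of_nonpos (norm_pos_iff.2 (sub_ne_zero.2 hy.symm)) ?_ (by linarith)
    have hx' : ‖x‖ < 1 := by simpa [hB] using hx
    have hy' : ‖y‖ < 1 := by simpa [hB] using hyB
    exact (norm_sub_le x y).trans (by linarith)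
  have h2 : (ENNReal.ofReal (2 ^ (α - ((k+1:ℕ):ℝ))) * volume B) * volume B ≤ rieszEnergy α B := by
    unfold rieszEnergy
    rw [← setLIntegral_const]
    exact setLIntegral_mono' measurableSet_ball hin
  intro h0
  rw [h0, nonpos_iff_eq_zero] at h2
  have hv : volume B ≠ 0 := (measure_ball_pos _ _ one_pos).ne'
  have h3 : ENNReal.ofReal (2 ^ (α - ((k+1:ℕ):ℝ))) ≠ 0 := by
    rw [Ne, ENNReal.ofReal_eq_zero, not_le]; positivity
  exact mul_ne_zero (mul_ne_zero h3 hv) hv h2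

lemma near_dg {k : ℕ} (hk : 1 ≤ k) {t : ℝ} (ht : 0 ≤ t) (ht1 : t ≤ 1/12) :
    Near (dg k (1+t)) (3*t) ∧ Near (dg k (1+t)⁻¹) (3*t) := by
  have h : (1+t) ≠ 0 := by positivity
  exact ⟨⟨by positivity, by linarith, dg_prod h, fun i => (dg_near hk ht (by linarith) i).1⟩,
    ⟨by positivity, by linarith, dg_prod (inv_ne_zero h), fun i => (dg_near hk ht (by linarith) i).2⟩⟩

/-- polar cap -/
def cap (k : ℕ) : Set (Sp k) := {θ | 3/4 < ((θ : Eu (k+1)) 0)^2}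

lemma cap_open (k : ℕ) : IsOpen (cap k) := by
  have : Continuous fun θ : Sp k => ((θ : Eu (k+1)) 0)^2 := by fun_prop
  exact isOpen_lt continuous_const this

lemma cap_pos (k : ℕ) : 0 < (sig k).real (cap k) := by
  have h : sig k (cap k) ≠ 0 :=
    (cap_open k).measure_ne_zero _ ⟨⟨EuclideanSpace.single 0 1, by simp⟩, by simp [cap]; norm_num⟩
  exact ENNReal.toReal_pos h (measure_ne_top _ _)

lemma XX_cap {k : ℕ} (hk : 1 ≤ k) {t : ℝ} (ht : 0 ≤ t) (ht1 : t ≤ 1/12) {θ : Sp k} (hθ : θ ∈ cap k) :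
    t / 2 ≤ 1 - XX (dg k (1+t)) θ := by
  have hN := (near_dg hk ht ht1).1
  have h1 := dg_cap hk ht (by linarith) (x := (θ : Eu (k+1))) (by simp) (le_of_lt hθ)
  rw [XX_eq hN]
  generalize ‖TT (dg k (1+t)) (θ : Eu (k+1))‖^2 = y at h1
  have hk' : (1:ℝ) ≤ k := by exact_mod_cast hk
  have h2 : y ^ (-((k:ℝ)+1)/2) ≤ y ^ (-1:ℝ) := Real.rpow_le_rpow_of_exponent_le (by linarith) (by linarith)
  have h3 : y ^ (-1:ℝ) ≤ (1+t)⁻¹ := by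
    rw [Real.rpow_neg_one]; exact inv_anti₀ (by positivity) h1
  have h4 : (1+t)⁻¹ ≤ 1 - t/2 := by
    rw [inv_le_iff_one_le_mul₀ (by positivity)]; nlinarith
  linarith

lemma V_bound {k : ℕ} (hk : 1 ≤ k) {α : ℝ} (hα : 0 < α) (hαn : α < (k+1 : ℕ)) :
    ∃ c t0 : ℝ, 0 < c ∧ 0 < t0 ∧ ∀ t, 0 < t → t ≤ t0 →
      rieszEnergy α (El (dg k (1+t)⁻¹)) + ENNReal.ofReal (c * t^2) ≤ rieszEnergy α (ball (0 : Eu (k+1)) 1) := by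
  obtain ⟨c0, hc0⟩ := El_riesz (k := k) α
  have hn : (0:ℝ) < k + 1 := by positivity
  have hαn' : α < k + 1 := by exact_mod_cast hαn
  have hsm := sm_pos k
  have hVB : rieszEnergy α (ball (0 : Eu (k+1)) 1) = c0 * ENNReal.ofReal (sm k) := by
    have := hc0 1 1 (by simp) (by simp)
    rw [El_one] at this
    rw [this]
    have e : ∀ θ : Sp k, ‖TT 1 (θ : Eu (k+1))‖ = 1 := by intro θ; rw [TT_one]; simp
    simp only [e, Real.one_rpow]
    rw [lintegral_const, sig_univ', ENNReal.ofReal_one, one_mul]; rfl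
  have hc00 : c0 ≠ 0 := by
    rintro rfl; exact riesz_ball_pos hαn (by rw [hVB, zero_mul])
  have hc0t : c0 ≠ ⊤ := by
    rintro rfl
    refine riesz_ball_fin hα hαn (by rw [hVB, ENNReal.top_mul]; simpa using hsm)
  have hr : 0 < c0.toReal := ENNReal.toReal_pos hc00 hc0t
  obtain ⟨l, L, C1, hl, hl1, hL, hC1, hX⟩ := XX_bds k
  obtain ⟨c, hc, hT⟩ := taylor_conc (p := (k + 1 - α)/(k+1)) (div_pos (by linarith) hn) (by rw [div_lt_one hn]; linarith) hl hl1 hL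
  have hcap := cap_pos k
  set κ : ℝ := c / 4 * (sig k).real (cap k) with hκ
  have hκ0 : 0 < κ := by positivity
  refine ⟨c0.toReal * κ, min (1/12) (sm k / κ), by positivity, by positivity, fun t ht ht0 => ?_⟩
  have ht1 : t ≤ 1/12 := ht0.trans (min_le_left _ _)
  have ht2 : t ≤ sm k / κ := ht0.trans (min_le_right _ _)
  have ht3 : κ * t^2 ≤ sm k := by
    rw [le_div_iff₀ hκ0] at ht2
    nlinarith
  have h1t : (1+t) ≠ 0 := by positivity
  have hN := (near_dg hk ht.le ht1).1
  rw [hc0 (dg k (1+t)⁻¹) (dg k (1+t)) (dg_inv' h1t) (dg_prod h1t), hVB]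
  have hWm : Integrable ((cap k).indicator fun _ => -(c * (t/2)^2)) (sig k) :=
    (integrable_const _).indicator (cap_open k).measurableSet
  have key := avg_le hN (Z := fun θ => ‖TT (dg k (1+t)) (θ : Eu (k+1))‖ ^ (α - ((k+1:ℕ):ℝ))) (fun θ => by positivity)
    (((norm_TT_meas _).pow_const _).aestronglyMeasurable) hWm ((k + 1 - α)/(k+1)) (by
      intro θ
      have e : ‖TT (dg k (1+t)) (θ : Eu (k+1))‖ ^ (α - ((k+1:ℕ):ℝ)) = XX (dg k (1+t)) θ ^ (((k:ℝ) + 1 - α)/(k+1)) := by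
        rw [XX_rpow hN, Real.inv_rpow (norm_nonneg _), ← Real.rpow_neg (norm_nonneg _)]
        congr 1; push_cast; ring
      rw [e]
      have h1 := hT _ (hX _ _ hN θ).1
      by_cases hθ : θ ∈ cap k
      · rw [Set.indicator_of_mem hθ]
        have h2 := XX_cap hk ht.le ht1 hθ
        have h3 : (t/2)^2 ≤ (XX (dg k (1+t)) θ - 1)^2 := by nlinarith
        nlinarith
      · rw [Set.indicator_of_notMem hθ]
        nlinarith [sq_nonneg (XX (dg k (1+t)) θ - 1)])
  rw [integral_indicator (cap_open k).measurableSet, setIntegral_const, smul_eq_mul] at key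
  have e2 : sm k + (sig k).real (cap k) * -(c * (t/2)^2) = sm k - κ * t^2 := by rw [hκ]; ring
  rw [e2] at key
  have e3 : ENNReal.ofReal (c0.toReal * κ * t^2) = c0 * ENNReal.ofReal (κ * t^2) := by
    rw [mul_assoc, ENNReal.ofReal_mul hr.le, ENNReal.ofReal_toReal hc0t]
  rw [e3]
  refine (add_le_add_left (mul_le_mul_right key c0) _).trans ?_
  rw [← mul_add, ← ENNReal.ofReal_add (by linarith) (by positivity), sub_add_cancel]

lemma El_symm {k : ℕ} {d : Fin (k+1) → ℝ} {s : ℝ} (h : Near d s) :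
    volume (symmDiff (ball (0 : Eu (k+1)) 1) (El d)) ≤ ENNReal.ofReal (om (k+1) * ((1+s)^(k+1) - (1-s)^(k+1))) := by
  have hs0 := h.s0
  have hs1 := h.s1
  have hω := om_pos (k+1)
  have hsub : symmDiff (ball (0 : Eu (k+1)) 1) (El d) ⊆ closedBall 0 (1+s) \ ball 0 (1-s) := by
    intro x hx
    have hn := abs_le.1 (TT_norm_near h.near x)
    have hx0 := norm_nonneg x
    have hT0 := norm_nonneg (TT d x)
    have hx1 : (‖x‖ < 1 ∧ 1 ≤ ‖TT d x‖) ∨ (‖TT d x‖ < 1 ∧ 1 ≤ ‖x‖) := by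
      simpa [Set.mem_symmDiff, El] using hx
    simp only [Set.mem_sdiff, mem_closedBall, mem_ball, dist_zero_right, not_lt]
    rcases hx1 with ⟨h1, h2⟩ | ⟨h1, h2⟩
    · refine ⟨by linarith, ?_⟩
      by_contra! hc
      have a1 : 1 ≤ ‖TT d x‖^2 := one_le_pow₀ h2
      have a2 : ‖x‖^2 ≤ (1-s)^2 := pow_le_pow_left₀ hx0 hc.le 2
      have a3 : ‖x‖^2 < 1 - s := by
        have : ‖x‖^2 ≤ ‖x‖ := by nlinarith
        linarith
      nlinarith
    · refine ⟨?_, by linarith⟩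
      by_contra! hc
      have a1 : ‖TT d x‖^2 < 1 := pow_lt_one₀ hT0 h1 (by norm_num)
      have a2 : (1+s)^2 ≤ ‖x‖^2 := pow_le_pow_left₀ (by linarith) hc.le 2
      have a3 : (1-s) * ‖x‖^2 < 1 := by linarith [hn.1]
      have a4 : (1-s) * (1+s)^2 < 1 := (mul_le_mul_of_nonneg_left a2 (by linarith)).trans_lt a3
      have a5 : s^2 ≤ s/4 := by nlinarith
      nlinarith
  refine (measure_mono hsub).trans ?_
  rw [measure_sdiff (fun x hx => ?_) measurableSet_ball.nullMeasurableSet measure_ball_lt_top.ne, vol_closedBall _ _ (by linarith),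
    vol_ball _ _ (by linarith), ← ENNReal.ofReal_sub _ (mul_nonneg hω.le (pow_nonneg (by linarith) _)), mul_sub]
  simp only [mem_closedBall, mem_ball] at hx ⊢
  linarith

lemma competitor {k : ℕ} (hk : 1 ≤ k) {α β : ℝ} (hα : 0 < α) (hαn : α < (k+1 : ℕ)) (hβ : 0 < β) :
    ∃ C c : ℝ, 0 ≤ C ∧ 0 < c ∧ ∀ ε, 0 < ε → ∃ t, 0 < t ∧ ∃ F : Set (Eu (k+1)), MeasurableSet F ∧
      volume F = ENNReal.ofReal (om (k+1)) ∧ volume (symmDiff (ball (0 : Eu (k+1)) 1) F) < ENNReal.ofReal ε ∧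
      hc k * perimeter F ≤ ENNReal.ofReal (sm k + C * t^2) ∧
      potEnergy β 1 F ≤ potEnergy β 1 (ball (0 : Eu (k+1)) 1) + ENNReal.ofReal (C * t^2) ∧
      rieszEnergy α F + ENNReal.ofReal (c * t^2) ≤ rieszEnergy α (ball (0 : Eu (k+1)) 1) := by
  obtain ⟨C1, hC1, h1⟩ := P_bound k
  obtain ⟨C2, hC2, h2⟩ := U_bound k hβ
  obtain ⟨c, t0, hc, ht0, h3⟩ := V_bound hk hα hαn
  refine ⟨(C1 + C2) * 9, c, by positivity, hc, fun ε hε => ?_⟩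
  have hcont : Tendsto (fun t : ℝ => om (k+1) * ((1+3*t)^(k+1) - (1-3*t)^(k+1))) (nhdsWithin 0 (Set.Ioi 0)) (nhds 0) := by
    have : Continuous (fun t : ℝ => om (k+1) * ((1+3*t)^(k+1) - (1-3*t)^(k+1))) := by fun_prop
    have := (this.tendsto 0).mono_left (nhdsWithin_le_nhds (s := Set.Ioi 0))
    simpa using this
  have ev := (hcont.eventually_lt_const hε).and (Ioo_mem_nhdsGT (show (0:ℝ) < min t0 (1/12) by positivity))
  obtain ⟨t, hlt, ht, ht'⟩ := ev.exists
  have ht1 : t ≤ t0 := ht'.le.trans (min_le_left _ _)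
  have ht2 : t ≤ 1/12 := ht'.le.trans (min_le_right _ _)
  have hN := (near_dg hk ht.le ht2).2
  refine ⟨t, ht, El (dg k (1+t)⁻¹), El_meas _, El_vol hN.prod, (El_symm hN).trans_lt ?_, (h1 _ _ hN).trans ?_, (h2 _ _ hN).trans ?_, h3 t ht ht1⟩
  · exact (ENNReal.ofReal_lt_ofReal_iff hε).2 hlt
  · apply ENNReal.ofReal_le_ofReal
    nlinarith [mul_nonneg hC2 (sq_nonneg t)]
  · refine add_le_add_right (ENNReal.ofReal_le_ofReal ?_) _
    nlinarith [mul_nonneg hC1 (sq_nonneg t)]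

section PW2
open scoped Pointwise

lemma vol_smul {k : ℕ} (E : Set (Eu (k+1))) {ρ : ℝ} (hρ : 0 < ρ) : volume (ρ • E) = ENNReal.ofReal (ρ ^ (k+1)) * volume E := by
  rw [Measure.addHaar_smul]
  simp [abs_of_pos hρ]

lemma density_smul {k : ℕ} {E : Set (Eu (k+1))} {x : Eu (k+1)} {d ρ : ℝ} (hρ : 0 < ρ) (h : HasDensity E x d) :
    HasDensity (ρ • E) (ρ • x) d := by
  unfold HasDensity at h ⊢
  have hT : Tendsto (fun r : ℝ => ρ⁻¹ * r) (nhdsWithin 0 (Set.Ioi 0)) (nhdsWithin 0 (Set.Ioi 0)) := by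
    refine tendsto_nhdsWithin_of_tendsto_nhds_of_eventually_within _ ?_ ?_
    · have : Continuous fun r : ℝ => ρ⁻¹ * r := by fun_prop
      have := (this.tendsto 0).mono_left (nhdsWithin_le_nhds (s := Set.Ioi 0))
      simpa using this
    · filter_upwards [self_mem_nhdsWithin] with r hr
      exact mul_pos (inv_pos.2 hρ) hr
  refine (h.comp hT).congr fun r => ?_
  have e : ball (ρ • x) r = ρ • ball x (ρ⁻¹ * r) := by
    rw [_root_.smul_ball hρ.ne']
    congr 1
    rw [Real.norm_of_nonneg hρ.le, ← mul_assoc, mul_inv_cancel₀ hρ.ne', one_mul]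
  simp only [Function.comp]
  rw [e, ← Set.smul_set_inter₀ hρ.ne', vol_smul _ hρ, vol_smul _ hρ, ENNReal.toReal_mul, ENNReal.toReal_mul,
    mul_div_mul_left]
  rw [ENNReal.toReal_ofReal (by positivity)]; positivity

lemma density_smul_iff {k : ℕ} {E : Set (Eu (k+1))} {x : Eu (k+1)} {d ρ : ℝ} (hρ : 0 < ρ) :
    HasDensity (ρ • E) (ρ • x) d ↔ HasDensity E x d := by
  refine ⟨fun h => ?_, density_smul hρ⟩
  have := density_smul (inv_pos.2 hρ) h
  rwa [inv_smul_smul₀ hρ.ne', inv_smul_smul₀ hρ.ne'] at this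

lemma essBoundary_smul {k : ℕ} (E : Set (Eu (k+1))) {ρ : ℝ} (hρ : 0 < ρ) : essBoundary (ρ • E) = ρ • essBoundary E := by
  ext x
  rw [Set.mem_smul_set_iff_inv_smul_mem₀ hρ.ne']
  have hx : x = ρ • (ρ⁻¹ • x) := (smul_inv_smul₀ hρ.ne' x).symm
  generalize ρ⁻¹ • x = y at hx
  subst hx
  simp only [essBoundary, Set.mem_ofPred_eq, density_smul_iff hρ]

lemma perimeter_smul {k : ℕ} (E : Set (Eu (k+1))) {ρ : ℝ} (hρ : 0 < ρ) :
    perimeter (ρ • E) = ENNReal.ofReal (ρ ^ k) * perimeter E := by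
  unfold perimeter
  rw [essBoundary_smul E hρ]
  have e : (((k+1:ℕ):ℝ) - 1) = k := by push_cast; ring
  rw [e, Measure.hausdorffMeasure_smul₀ (Nat.cast_nonneg k) hρ.ne', ENNReal.smul_def, smul_eq_mul]
  congr 1
  rw [ENNReal.ofReal]
  congr 1
  ext
  rw [Real.coe_toNNReal _ (by positivity)]
  simp [abs_of_pos hρ]

lemma pot_smul {k : ℕ} {β A : ℝ} (hA : 0 < A) {E : Set (Eu (k+1))} (hE : MeasurableSet E) {ρ : ℝ} (hρ : 0 < ρ) :
    potEnergy β A (ρ • E) = ENNReal.ofReal (A * ρ ^ ((k+1:ℕ) + β : ℝ)) * potEnergy β 1 E := by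
  have hE' : MeasurableSet (ρ • E) := hE.const_smul₀ ρ
  have h1 : potEnergy β A (ρ • E) = ENNReal.ofReal A * potEnergy β 1 (ρ • E) := by
    unfold potEnergy
    rw [← lintegral_const_mul' _ _ (by finiteness)]
    refine lintegral_congr fun x => ?_
    rw [← ENNReal.ofReal_mul hA.le, one_mul]
  have i1 : Measurable fun x : Eu (k+1) => (ρ • E).indicator (1 : Eu (k+1) → ℝ≥0∞) x * ENNReal.ofReal (‖x‖ ^ β) :=
    (measurable_one.indicator hE').mul (measurable_norm.pow_const β).ennreal_ofReal
  rw [h1, pot_ind β hE, pot_ind β hE', lint_scale _ i1 hρ, ENNReal.ofReal_mul hA.le, mul_assoc]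
  congr 1
  have e : ∀ x : Eu (k+1), (ρ • E).indicator (1 : Eu (k+1) → ℝ≥0∞) (ρ • x) * ENNReal.ofReal (‖ρ • x‖ ^ β) =
      ENNReal.ofReal (ρ ^ β) * (E.indicator 1 x * ENNReal.ofReal (‖x‖ ^ β)) := by
    intro x
    rw [ind_smul E hρ x, norm_smul, Real.norm_of_nonneg hρ.le, Real.mul_rpow hρ.le (norm_nonneg _), ENNReal.ofReal_mul (by positivity)]
    ring
  simp_rw [e]
  rw [lintegral_const_mul' _ _ (by finiteness), ← mul_assoc, ← ENNReal.ofReal_mul (by positivity)]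
  congr 2
  rw [Real.rpow_add hρ, Real.rpow_natCast]

/-- rescaled energy -/
def JJ {k : ℕ} (α β A ρ : ℝ) (F : Set (Eu (k+1))) : ℝ≥0∞ :=
  perimeter F + ENNReal.ofReal (ρ ^ (1 + α)) * rieszEnergy α F + ENNReal.ofReal (A * ρ ^ (1 + β)) * potEnergy β 1 F

lemma total_smul {k : ℕ} {α β A : ℝ} (hA : 0 < A) {E : Set (Eu (k+1))} (hE : MeasurableSet E) {ρ : ℝ} (hρ : 0 < ρ) :
    totalEnergy α β A (ρ • E) = ENNReal.ofReal (ρ ^ k) * JJ α β A ρ E := by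
  unfold totalEnergy JJ
  rw [perimeter_smul E hρ, riesz_scale α hE hρ, pot_smul hA hE hρ, mul_add, mul_add, ← mul_assoc, ← mul_assoc,
    ← ENNReal.ofReal_mul (by positivity), ← ENNReal.ofReal_mul (by positivity)]
  have e : ∀ γ : ℝ, ρ ^ (((k+1:ℕ):ℝ) + γ) = ρ ^ k * ρ ^ (1 + γ) := by
    intro γ
    rw [← Real.rpow_natCast ρ k, ← Real.rpow_add hρ]; congr 1; push_cast; ring
  rw [e, e, mul_left_comm A]

/-- local minimality after rescaling -/
def LM (k : ℕ) (α β A ρ : ℝ) : Prop := ∃ ε : ℝ, 0 < ε ∧ ∀ F : Set (Eu (k+1)), MeasurableSet F →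
  volume F = ENNReal.ofReal (om (k+1)) → volume (symmDiff (ball (0 : Eu (k+1)) 1) F) < ENNReal.ofReal ε →
  JJ α β A ρ (ball (0 : Eu (k+1)) 1) ≤ JJ α β A ρ F

lemma ballOfVolume_eq (k : ℕ) {ρ : ℝ} (hρ : 0 < ρ) : ballOfVolume (k+1) (om (k+1) * ρ^(k+1)) = ρ • ball (0 : Eu (k+1)) 1 := by
  have hω := om_pos (k+1)
  rw [← ball_smul hρ]
  unfold ballOfVolume unitBall
  rw [vol_unit, ENNReal.toReal_ofReal hω.le, mul_div_cancel_left₀ _ hω.ne', one_div, Real.pow_rpow_inv_natCast hρ.le (by omega)]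

lemma locMin_iff (k : ℕ) {α β A : ℝ} (hA : 0 < A) {ρ : ℝ} (hρ : 0 < ρ) :
    IsL1LocalMin α β A (om (k+1) * ρ^(k+1)) (ballOfVolume (k+1) (om (k+1) * ρ^(k+1))) ↔ LM k α β A ρ := by
  have hω := om_pos (k+1)
  have hp : 0 < ρ^(k+1) := by positivity
  have hp0 : ENNReal.ofReal (ρ^(k+1)) ≠ 0 := by simpa using hp
  have hq : 0 < ρ^k := by positivity
  have hq0 : ENNReal.ofReal (ρ^k) ≠ 0 := by simpa using hq
  have hvol : ∀ F : Set (Eu (k+1)), volume (ρ • F) = ENNReal.ofReal (om (k+1) * ρ^(k+1)) ↔ volume F = ENNReal.ofReal (om (k+1)) := by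
    intro F
    rw [vol_smul F hρ, mul_comm (om (k+1)), ENNReal.ofReal_mul hp.le, ENNReal.mul_right_inj hp0 ENNReal.ofReal_ne_top]
  have hsd : ∀ (F : Set (Eu (k+1))) (ε : ℝ), volume (symmDiff (ρ • ball (0 : Eu (k+1)) 1) (ρ • F)) < ENNReal.ofReal (ρ^(k+1) * ε) ↔
      volume (symmDiff (ball (0 : Eu (k+1)) 1) F) < ENNReal.ofReal ε := by
    intro F ε
    rw [← Set.smul_set_symmDiff₀ hρ.ne', vol_smul _ hρ, ENNReal.ofReal_mul hp.le, ENNReal.mul_lt_mul_iff_right hp0 ENNReal.ofReal_ne_top]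
  have hE : ∀ F : Set (Eu (k+1)), MeasurableSet F → (totalEnergy α β A (ρ • ball (0 : Eu (k+1)) 1) ≤ totalEnergy α β A (ρ • F) ↔
      JJ α β A ρ (ball (0 : Eu (k+1)) 1) ≤ JJ α β A ρ F) := by
    intro F hF
    rw [total_smul hA measurableSet_ball hρ, total_smul hA hF hρ, ENNReal.mul_le_mul_iff_right hq0 ENNReal.ofReal_ne_top]
  rw [ballOfVolume_eq k hρ]
  constructor
  · rintro ⟨-, -, ε, hε, h⟩
    refine ⟨(ρ^(k+1))⁻¹ * ε, by positivity, fun F hF hv hs => (hE F hF).1 (h _ (hF.const_smul₀ ρ) ((hvol F).2 hv) ?_)⟩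
    have := (hsd F _).2 hs
    rwa [← mul_assoc, mul_inv_cancel₀ hp.ne', one_mul] at this
  · rintro ⟨ε, hε, h⟩
    refine ⟨measurableSet_ball.const_smul₀ ρ, (hvol _).2 (vol_unit _), ρ^(k+1) * ε, by positivity, fun F hF hv hs => ?_⟩
    have hF' : F = ρ • (ρ⁻¹ • F) := (smul_inv_smul₀ hρ.ne' F).symm
    have hm : MeasurableSet (ρ⁻¹ • F) := hF.const_smul₀ _
    generalize ρ⁻¹ • F = G at hF' hm
    subst hF'
    exact (hE G hm).2 (h G hm ((hvol G).1 hv) ((hsd G ε).1 hs))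

end PW2

lemma perim_ball_fin (k : ℕ) : perimeter (ball (0 : Eu (k+1)) 1) ≠ ⊤ := by
  intro h
  have := perimeter_ball k
  rw [h, ENNReal.mul_top (by simpa using (hc_pos k).ne')] at this
  exact ENNReal.ofReal_ne_top this.symm

lemma perim_ball_le {k : ℕ} {F : Set (Eu (k+1))} (hF : MeasurableSet F) (hv : volume F = ENNReal.ofReal (om (k+1))) :
    perimeter (ball (0 : Eu (k+1)) 1) ≤ perimeter F := by
  have h1 := isoper hF hv
  rw [← perimeter_ball k] at h1
  exact (ENNReal.mul_le_mul_iff_right (by simpa using (hc_pos k).ne') ENNReal.coe_ne_top).1 h1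

lemma pot_ball_le {k : ℕ} {β : ℝ} (hβ : 0 < β) {F : Set (Eu (k+1))} (hF : MeasurableSet F) (hv : volume F = ENNReal.ofReal (om (k+1))) :
    potEnergy β 1 (ball (0 : Eu (k+1)) 1) ≤ potEnergy β 1 F := by
  obtain ⟨c, hc, h⟩ := Wd_pot (k := k) hβ
  exact le_add_self.trans (h F hF hv)

lemma JJ_eq {k : ℕ} {α β A ρ : ℝ} (hA : 0 < A) (hρ : 0 < ρ) {F : Set (Eu (k+1))} (hP : perimeter F ≠ ⊤) (hV : rieszEnergy α F ≠ ⊤)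
    (hU : potEnergy β 1 F ≠ ⊤) : JJ α β A ρ F = ENNReal.ofReal ((perimeter F).toReal + ρ ^ (1+α) * (rieszEnergy α F).toReal +
      A * ρ ^ (1+β) * (potEnergy β 1 F).toReal) := by
  unfold JJ
  rw [ENNReal.ofReal_add (by positivity) (by positivity), ENNReal.ofReal_add (by positivity) (by positivity),
    ENNReal.ofReal_mul (p := ρ ^ (1+α)) (by positivity), ENNReal.ofReal_mul (p := A * ρ ^ (1+β)) (by positivity), ENNReal.ofReal_toReal hP,
    ENNReal.ofReal_toReal hV, ENNReal.ofReal_toReal hU]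

lemma JJ_le_of {k : ℕ} {α β A ρ : ℝ} (hα : 0 < α) (hαn : α < (k+1:ℕ)) (hβ : 0 < β) (hA : 0 < A) (hρ : 0 < ρ) {F : Set (Eu (k+1))}
    (H : perimeter F ≠ ⊤ → rieszEnergy α F ≠ ⊤ → potEnergy β 1 F ≠ ⊤ →
      (perimeter (ball (0 : Eu (k+1)) 1)).toReal + ρ ^ (1+α) * (rieszEnergy α (ball (0 : Eu (k+1)) 1)).toReal +
      A * ρ ^ (1+β) * (potEnergy β 1 (ball (0 : Eu (k+1)) 1)).toReal ≤ (perimeter F).toReal + ρ ^ (1+α) * (rieszEnergy α F).toReal +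
      A * ρ ^ (1+β) * (potEnergy β 1 F).toReal) : JJ α β A ρ (ball (0 : Eu (k+1)) 1) ≤ JJ α β A ρ F := by
  have c1 : ENNReal.ofReal (ρ ^ (1+α)) ≠ 0 := by
    rw [Ne, ENNReal.ofReal_eq_zero, not_le]; positivity
  have c2 : ENNReal.ofReal (A * ρ ^ (1+β)) ≠ 0 := by
    rw [Ne, ENNReal.ofReal_eq_zero, not_le]; positivity
  by_cases hP : perimeter F = ⊤
  · simp [JJ, hP]
  by_cases hV : rieszEnergy α F = ⊤
  · unfold JJ; rw [hV, ENNReal.mul_top c1]; simp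
  by_cases hU : potEnergy β 1 F = ⊤
  · rw [JJ, JJ, hU, ENNReal.mul_top c2]; simp
  rw [JJ_eq hA hρ hP hV hU, JJ_eq hA hρ (perim_ball_fin k) (riesz_ball_fin hα hαn) (potEnergy_ball_fin hβ)]
  exact ENNReal.ofReal_le_ofReal (H hP hV hU)

lemma LM_mono {k : ℕ} {α β A ρ ρ' : ℝ} (hα : 0 < α) (hαn : α < (k+1:ℕ)) (hβ : 0 < β) (hA : 0 < A) (hβα : β < α) (hρ' : 0 < ρ')
    (hle : ρ' ≤ ρ) (h : LM k α β A ρ) : LM k α β A ρ' := by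
  have hρ : 0 < ρ := hρ'.trans_le hle
  obtain ⟨ε, hε, h⟩ := h
  refine ⟨ε, hε, fun F hF hv hs => JJ_le_of hα hαn hβ hA hρ' fun hP hV hU => ?_⟩
  have h1 := h F hF hv hs
  rw [JJ_eq hA hρ hP hV hU, JJ_eq hA hρ (perim_ball_fin k) (riesz_ball_fin hα hαn) (potEnergy_ball_fin hβ),
    ENNReal.ofReal_le_ofReal_iff (by positivity)] at h1
  have h2 := ENNReal.toReal_mono hP (perim_ball_le hF hv)
  have h3 := ENNReal.toReal_mono hU (pot_ball_le hβ hF hv)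
  generalize (perimeter F).toReal = p at *
  generalize (rieszEnergy α F).toReal = v at *
  generalize (potEnergy β 1 F).toReal = u at *
  generalize (perimeter (ball (0 : Eu (k+1)) 1)).toReal = p0 at *
  generalize (rieszEnergy α (ball (0 : Eu (k+1)) 1)).toReal = v0 at *
  generalize (potEnergy β 1 (ball (0 : Eu (k+1)) 1)).toReal = u0 at *
  set q : ℝ := (ρ'/ρ) ^ (1+α) with hq
  have hq0 : 0 ≤ q := by positivity
  have hq1 : q ≤ 1 := Real.rpow_le_one (by positivity) (by rw [div_le_one hρ]; exact hle) (by linarith)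
  have e1 : q * ρ ^ (1+α) = ρ' ^ (1+α) := by
    rw [hq, Real.div_rpow hρ'.le hρ.le, div_mul_cancel₀]; positivity
  have e2 : q * ρ ^ (1+β) ≤ ρ' ^ (1+β) := by
    have a1 : q ≤ (ρ'/ρ) ^ (1+β) :=
      Real.rpow_le_rpow_of_exponent_ge (by positivity) (by rw [div_le_one hρ]; exact hle) (by linarith)
    refine (mul_le_mul_of_nonneg_right a1 (by positivity)).trans (le_of_eq ?_)
    rw [Real.div_rpow hρ'.le hρ.le, div_mul_cancel₀]; positivity
  rw [← e1]
  have h4 := mul_le_mul_of_nonneg_left h1 hq0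
  have h5 : q * (p - p0) ≤ p - p0 := mul_le_of_le_one_left (by linarith) hq1
  have h6 : (q * ρ ^ (1+β)) * (A * (u - u0)) ≤ ρ' ^ (1+β) * (A * (u - u0)) :=
    mul_le_mul_of_nonneg_right e2 (mul_nonneg hA.le (by linarith))
  linarith

lemma LM_small {k : ℕ} {α β A : ℝ} (hα : 0 < α) (hαn : α < (k+1:ℕ)) (hβ : 0 < β) (hA : 0 < A) (hβα : β < α) :
    ∃ ρ, 0 < ρ ∧ LM k α β A ρ := by
  obtain ⟨Ca, Cd, hq⟩ := quant (k := k) hα hαn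
  obtain ⟨c, hc0, hW⟩ := Wd_pot (k := k) hβ
  have t0 : ∀ γ D : ℝ, 0 < γ → Tendsto (fun ρ : ℝ => ρ ^ γ * D) (nhdsWithin 0 (Set.Ioi 0)) (nhds 0) := by
    intro γ D hγ
    have := (((Real.continuous_rpow_const (q := γ) hγ.le).mul_const D).tendsto 0).mono_left (nhdsWithin_le_nhds (s := Set.Ioi 0))
    rwa [Real.zero_rpow hγ.ne', zero_mul] at this
  have ev := (((t0 (1+α) ((Ca:ℝ) * hc k) (by linarith)).eventually_lt_const one_pos).and
    ((t0 (α-β) Cd (by linarith)).eventually_lt_const (show 0 < A * c by positivity))).and self_mem_nhdsWithin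
  obtain ⟨ρ, ⟨hr1, hr2⟩, hρ⟩ := ev.exists
  have hρ : 0 < ρ := hρ
  refine ⟨ρ, hρ, 1, one_pos, fun F hF hv _ => JJ_le_of hα hαn hβ hA hρ fun hP hV hU => ?_⟩
  have h1 := hq F hF hv hP
  have h2 := hW F hF hv
  have hU0 := potEnergy_ball_fin (k := k) hβ
  have hV0 := riesz_ball_fin (k := k) hα hαn
  have hP0 := perim_ball_fin k
  rw [← perimeter_ball k] at h1
  have hw : Wd (F.indicator 1) ≠ ⊤ := by
    intro h
    rw [h, ENNReal.mul_top (by simpa using hc0), top_add, top_le_iff] at h2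
    exact hU h2
  have h1' := ENNReal.toReal_mono (by finiteness) h1
  have h2' := ENNReal.toReal_mono hU h2
  rw [ENNReal.toReal_add (by finiteness) (by finiteness), ENNReal.toReal_add (by finiteness) (by finiteness),
    ENNReal.toReal_add (by finiteness) (by finiteness)] at h1'
  rw [ENNReal.toReal_add (by finiteness) (by finiteness)] at h2'
  simp only [ENNReal.toReal_mul, ENNReal.coe_toReal, ENNReal.toReal_ofReal hc0.le] at h1' h2'
  have hw0 : 0 ≤ (Wd (F.indicator 1)).toReal := ENNReal.toReal_nonneg
  have h3 := ENNReal.toReal_mono hP (perim_ball_le hF hv)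
  generalize (Wd (F.indicator 1)).toReal = w at *
  generalize (perimeter F).toReal = p at *
  generalize (rieszEnergy α F).toReal = v at *
  generalize (potEnergy β 1 F).toReal = u at *
  generalize (perimeter (ball (0 : Eu (k+1)) 1)).toReal = p0 at *
  generalize (rieszEnergy α (ball (0 : Eu (k+1)) 1)).toReal = v0 at *
  generalize (potEnergy β 1 (ball (0 : Eu (k+1)) 1)).toReal = u0 at *
  have eR : ρ ^ (1+α) = ρ ^ (1+β) * ρ ^ (α-β) := by rw [← Real.rpow_add hρ]; congr 1; ring
  have hS : 0 < ρ ^ (1+β) := by positivity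
  have hR : 0 < ρ ^ (1+α) := by positivity
  have h4 : ρ ^ (1+α) * (v0 - v) ≤ ρ ^ (1+α) * (Ca * hc k * (p - p0) + Cd * w) := by
    refine mul_le_mul_of_nonneg_left ?_ hR.le; linarith
  have h5 : (ρ ^ (1+α) * (Ca * hc k)) * (p - p0) ≤ p - p0 := mul_le_of_le_one_left (by linarith) hr1.le
  have h6 : ρ ^ (1+α) * (Cd * w) ≤ A * ρ ^ (1+β) * (u - u0) := by
    calc ρ ^ (1+α) * (Cd * w) = ρ ^ (1+β) * ((ρ ^ (α-β) * Cd) * w) := by rw [eR]; ring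
      _ ≤ ρ ^ (1+β) * ((A * c) * w) := by gcongr
      _ = A * ρ ^ (1+β) * (c * w) := by ring
      _ ≤ A * ρ ^ (1+β) * (u - u0) := mul_le_mul_of_nonneg_left (by linarith) (by positivity)
  linarith

lemma LM_large {k : ℕ} (hk : 1 ≤ k) {α β A : ℝ} (hα : 0 < α) (hαn : α < (k+1:ℕ)) (hβ : 0 < β) (hA : 0 < A) (hβα : β < α) :
    ∃ ρ1, ∀ ρ, ρ1 ≤ ρ → ¬ LM k α β A ρ := by
  obtain ⟨C, c, hC, hc0, hF⟩ := competitor hk hα hαn hβ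
  have hh : (0:ℝ) < hc k := hc_pos k
  have ev := ((tendsto_rpow_atTop (show 0 < α - β by linarith)).eventually_gt_atTop ((C / hc k + A * C) / c)).and (eventually_ge_atTop (1:ℝ))
  obtain ⟨ρ1, h1⟩ := eventually_atTop.1 ev
  refine ⟨ρ1, fun ρ hρ1 hLM => ?_⟩
  obtain ⟨hr, hρ1⟩ := h1 ρ hρ1
  have hρ : 0 < ρ := by linarith
  obtain ⟨ε, hε, hLM⟩ := hLM
  obtain ⟨t, ht, F, hFm, hv, hs, hP, hU, hV⟩ := hF ε hε
  have hJ := hLM F hFm hv hs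
  have hU0 := potEnergy_ball_fin (k := k) hβ
  have hV0 := riesz_ball_fin (k := k) hα hαn
  have hP0 := perim_ball_fin k
  have hPf : perimeter F ≠ ⊤ := by
    intro h
    rw [h, ENNReal.mul_top (by simpa using (hc_pos k).ne'), top_le_iff] at hP
    exact ENNReal.ofReal_ne_top hP
  have hUf : potEnergy β 1 F ≠ ⊤ := ne_top_of_le_ne_top (by finiteness) hU
  have hVf : rieszEnergy α F ≠ ⊤ := ne_top_of_le_ne_top hV0 (le_self_add.trans hV)
  rw [JJ_eq hA hρ hPf hVf hUf, JJ_eq hA hρ hP0 hV0 hU0, ENNReal.ofReal_le_ofReal_iff (by positivity)] at hJ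
  have hsm := sm_pos k
  have hP' := ENNReal.toReal_mono (by finiteness) hP
  have hU' := ENNReal.toReal_mono (by finiteness) hU
  have hV' := ENNReal.toReal_mono hV0 hV
  have hB' := congrArg ENNReal.toReal (perimeter_ball k)
  change _ = (ENNReal.ofReal (sm k)).toReal at hB'
  rw [ENNReal.toReal_mul, ENNReal.coe_toReal, ENNReal.toReal_ofReal (sm_pos k).le] at hB'
  have hB'' : (hc k : ℝ) * (perimeter (ball (0 : Eu (k+1)) 1)).toReal = sm k := hB'
  rw [ENNReal.toReal_mul, ENNReal.coe_toReal, ENNReal.toReal_ofReal (by positivity), ← hB''] at hP'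
  rw [ENNReal.toReal_add (by finiteness) (by finiteness), ENNReal.toReal_ofReal (by positivity)] at hU' hV'
  clear hB' hB'' hP hU hV
  generalize (perimeter F).toReal = p at *
  generalize (rieszEnergy α F).toReal = v at *
  generalize (potEnergy β 1 F).toReal = u at *
  generalize (perimeter (ball (0 : Eu (k+1)) 1)).toReal = p0 at *
  generalize (rieszEnergy α (ball (0 : Eu (k+1)) 1)).toReal = v0 at *
  generalize (potEnergy β 1 (ball (0 : Eu (k+1)) 1)).toReal = u0 at *
  have eR : ρ ^ (1+α) = ρ ^ (1+β) * ρ ^ (α-β) := by rw [← Real.rpow_add hρ]; congr 1; ring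
  have hS : 1 ≤ ρ ^ (1+β) := Real.one_le_rpow hρ1 (by linarith)
  have hR : 0 < ρ ^ (1+α) := by positivity
  have hr' : C / hc k + A * C < ρ ^ (α-β) * c := (div_lt_iff₀ hc0).1 hr
  have hCh : 0 ≤ C / hc k := by positivity
  have a1 : C / hc k + A * ρ ^ (1+β) * C < ρ ^ (1+α) * c := by
    rw [eR]
    have b1 := mul_lt_mul_of_pos_left hr' (show 0 < ρ ^ (1+β) by linarith)
    nlinarith
  have a2 : p - p0 ≤ C / hc k * t^2 := by
    rw [div_mul_eq_mul_div, le_div_iff₀ hh]; linarith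
  have a3 : A * ρ ^ (1+β) * (u - u0) ≤ A * ρ ^ (1+β) * (C * t^2) := mul_le_mul_of_nonneg_left (by linarith) (by positivity)
  have a4 : ρ ^ (1+α) * (c * t^2) ≤ ρ ^ (1+α) * (v0 - v) := mul_le_mul_of_nonneg_left (by linarith) hR.le
  have a5 := mul_lt_mul_of_pos_right a1 (show 0 < t^2 by positivity)
  linarith

lemma main_k {k : ℕ} (hk : 1 ≤ k) {α β A : ℝ} (hα : 0 < α) (hαn : α < (k+1:ℕ)) (hβ : 0 < β) (hA : 0 < A) (hβα : β < α) :
    ∃ mstar : ℝ, 0 < mstar ∧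
      (∀ m, 0 < m → m < mstar → IsL1LocalMin α β A m (ballOfVolume (k+1) m)) ∧
      (∀ m, mstar < m → ¬ IsL1LocalMin α β A m (ballOfVolume (k+1) m)) := by
  have hω := om_pos (k+1)
  obtain ⟨ρ0, hρ0, h0⟩ := LM_small (k := k) hα hαn hβ hA hβα
  obtain ⟨ρ1, h1⟩ := LM_large hk hα hαn hβ hA hβα
  set S : Set ℝ := {ρ | 0 < ρ ∧ LM k α β A ρ} with hS
  have hb : BddAbove S := ⟨ρ1, fun ρ hρ => le_of_not_ge fun h => h1 ρ h hρ.2⟩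
  have hne : S.Nonempty := ⟨ρ0, hρ0, h0⟩
  have hpos : 0 < sSup S := hρ0.trans_le (le_csSup hb ⟨hρ0, h0⟩)
  have hm : ∀ m : ℝ, 0 < m → ∃ ρ, 0 < ρ ∧ m = om (k+1) * ρ^(k+1) := by
    intro m hm
    refine ⟨(m / om (k+1)) ^ (((k+1:ℕ):ℝ)⁻¹), by positivity, ?_⟩
    rw [Real.rpow_inv_natCast_pow (by positivity) (by omega)]
    field_simp
  refine ⟨om (k+1) * (sSup S)^(k+1), by positivity, fun m hm0 hlt => ?_, fun m hlt hL => ?_⟩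
  · obtain ⟨ρ, hρ, rfl⟩ := hm m hm0
    have h2 : ρ < sSup S := lt_of_pow_lt_pow_left₀ (k+1) hpos.le (lt_of_mul_lt_mul_left hlt hω.le)
    obtain ⟨ρ', hρ', h3⟩ := exists_lt_of_lt_csSup hne h2
    exact (locMin_iff k hA hρ).2 (LM_mono hα hαn hβ hA hβα hρ h3.le hρ'.2)
  · obtain ⟨ρ, hρ, rfl⟩ := hm m (lt_trans (by positivity) hlt)
    have h2 : sSup S < ρ := lt_of_pow_lt_pow_left₀ (k+1) hρ.le (lt_of_mul_lt_mul_left hlt hω.le)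
    exact absurd (le_csSup hb ⟨hρ, (locMin_iff k hA hρ).1 hL⟩) (not_le.2 h2)

/-- If `α > β`, there is a critical mass `m⋆ > 0` below which balls are `L¹`-local
minimizers and above which they are not. -/
theorem statement4 (n : ℕ) (hn : 2 ≤ n) (α β A : ℝ)
    (hα0 : 0 < α) (hαn : α < n) (hβ : 0 < β) (hA : 0 < A) (hβα : β < α) :
    ∃ mstar : ℝ, 0 < mstar ∧
      (∀ m, 0 < m → m < mstar → IsL1LocalMin α β A m (ballOfVolume n m)) ∧
      (∀ m, mstar < m → ¬ IsL1LocalMin α β A m (ballOfVolume n m)) := by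
  obtain ⟨k, rfl⟩ : ∃ k, n = k + 1 := ⟨n - 1, by omega⟩
  exact main_k (by omega) hα0 hαn hβ hA hβα
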